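/- Let an angle θ0∈(0,π/2) and constants 0<α<1, c>0 be given. Then for all ρ0>0 sufficiently small, there exists a unique competitive equilibrium (I*, θ*, u*): the pair (θ*,u*) is an optimal solution of problem (OP2) with light intensity I = I*, and I*(y) = exp(−(ρ0/cos θ0)·∫_y^∞ u*(ζ)/sin θ*(ζ) dζ) for all y ≥ 0. -/

import Mathlib

open Real MeasureTheory

/-- `G(θ,u) = (1 − e^{−u/cos(θ−θ0)})·cos(θ−θ0)`. -/
noncomputable def G2 (θ0 θ u : ℝ) : ℝ :=
  (1 - Real.exp (-u / Real.cos (θ - θ0))) * Real.cos (θ - θ0)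

/-- Admissible controls for problem (OP2). -/
def Adm2 (θ0 : ℝ) (θ u : ℝ → ℝ) : Prop :=
  Measurable θ ∧ Measurable u ∧
    (∀ t, θ t ∈ Set.Icc θ0 (π / 2)) ∧ (∀ t, 0 ≤ u t) ∧ IntegrableOn u (Set.Ioi 0)

/-- The payoff of (OP2). -/
noncomputable def Payoff (θ0 α c : ℝ) (I : ℝ → ℝ) (θ u : ℝ → ℝ) : ℝ :=
  ∫ t in Set.Ioi (0 : ℝ),
    (I (∫ s in (0 : ℝ)..t, Real.sin (θ s)) * G2 θ0 (θ t) (u t) -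
      c * (∫ s in Set.Ioi t, u s) ^ α)

/-- Competitive equilibrium for Model 2: `(θ*, u*)` optimally solves (OP2) for the
intensity `I*`, and `I*` is the intensity generated by stems with configuration
`(θ*, u*)` and density `ρ0`. -/
def Equilibrium (θ0 α c ρ0 : ℝ) (Istar θs us : ℝ → ℝ) : Prop :=
  Adm2 θ0 θs us ∧
  (∀ θ u : ℝ → ℝ, Adm2 θ0 θ u →
    Payoff θ0 α c Istar θ u ≤ Payoff θ0 α c Istar θs us) ∧
  (∀ y ≥ (0 : ℝ), Istar y =
    Real.exp (-(ρ0 / Real.cos θ0) * ∫ ζ in Set.Ioi y, us ζ / Real.sin (θs ζ)))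


namespace Model2
open Set Filter Topology

/-- Light captured by a unit of stem at projected height rate `s` with leaf density `u`. -/
noncomputable def gain (s u : ℝ) : ℝ := s * (1 - exp (-(u / s)))

/-- The derivative of `gain` in the direction `s`, as a function of `u / s`. -/
noncomputable def hh (x : ℝ) : ℝ := 1 - (1 + x) * exp (-x)

lemma G2_eq (θ0 θ u : ℝ) : G2 θ0 θ u = gain (cos (θ - θ0)) u := by
  unfold G2 gain; rw [neg_div]; ring

lemma exp_tangent (v x : ℝ) : exp (-x) * (1 - (v - x)) ≤ exp (-v) := by
  have h := add_one_le_exp (x - v)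
  have : exp (-v) = exp (-x) * exp (x - v) := by rw [← exp_add]; ring_nf
  rw [this]
  exact mul_le_mul_of_nonneg_left (by linarith) (exp_pos _).le

lemma exp_tangent_lt {v x : ℝ} (hne : v ≠ x) : exp (-x) * (1 - (v - x)) < exp (-v) := by
  have h := add_one_lt_exp (sub_ne_zero.2 hne.symm)
  have : exp (-v) = exp (-x) * exp (x - v) := by rw [← exp_add]; ring_nf
  rw [this]
  exact mul_lt_mul_of_pos_left (by linarith) (exp_pos _)

lemma gain_le_tangent {s : ℝ} (hs : 0 < s) (u x : ℝ) :
    gain s u ≤ s * hh x + exp (-x) * u := by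
  have h := mul_le_mul_of_nonneg_left (exp_tangent (u / s) x) hs.le
  have e : s * (exp (-x) * (1 - (u / s - x))) = exp (-x) * (s - (u - s * x)) := by
    field_simp
  rw [e] at h
  unfold gain hh
  nlinarith

lemma gain_lt_tangent {s u x : ℝ} (hs : 0 < s) (hne : u ≠ s * x) :
    gain s u < s * hh x + exp (-x) * u := by
  have hne' : u / s ≠ x := fun h => hne (by rw [← h]; field_simp)
  have h := mul_lt_mul_of_pos_left (exp_tangent_lt hne') hs
  have e : s * (exp (-x) * (1 - (u / s - x))) = exp (-x) * (s - (u - s * x)) := by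
    field_simp
  rw [e] at h
  unfold gain hh
  nlinarith

lemma gain_mul {s : ℝ} (hs : 0 < s) (x : ℝ) : gain s (s * x) = s * (1 - exp (-x)) := by
  unfold gain; rw [mul_div_cancel_left₀ _ hs.ne']

lemma gain_mul_tangent {s : ℝ} (hs : 0 < s) (x : ℝ) :
    gain s (s * x) = s * hh x + exp (-x) * (s * x) := by
  rw [gain_mul hs]; unfold hh; ring

lemma gain_nonneg {s u : ℝ} (hs : 0 < s) (hu : 0 ≤ u) : 0 ≤ gain s u := by
  unfold gain
  have : exp (-(u / s)) ≤ 1 := by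
    rw [exp_le_one_iff]; have := div_nonneg hu hs.le; linarith
  exact mul_nonneg hs.le (by linarith)

lemma gain_le_self {s : ℝ} (hs : 0 < s) (u : ℝ) : gain s u ≤ u := by
  have := gain_le_tangent hs u 0
  simpa [hh] using this

lemma gain_le_left {s : ℝ} (hs : 0 < s) (u : ℝ) : gain s u ≤ s := by
  unfold gain
  have := exp_pos (-(u / s))
  nlinarith

lemma gain_zero (s : ℝ) : gain s 0 = 0 := by simp [gain]

lemma hasDerivAt_hh (x : ℝ) : HasDerivAt hh (x * exp (-x)) x := by
  unfold hh
  have h1 : HasDerivAt (fun x : ℝ => exp (-x)) (-exp (-x)) x := by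
    simpa using (hasDerivAt_neg x).exp
  have h2 := (((hasDerivAt_id x).const_add 1).mul h1).const_sub 1
  refine h2.congr_deriv ?_
  simp only [id]; ring

lemma continuous_hh : Continuous hh := by unfold hh; fun_prop

lemma hh_zero : hh 0 = 0 := by simp [hh]

lemma hh_pos {x : ℝ} (hx : 0 < x) : 0 < hh x := by
  unfold hh
  have h := add_one_lt_exp hx.ne'
  have : (1 + x) * exp (-x) < exp x * exp (-x) :=
    mul_lt_mul_of_pos_right (by linarith) (exp_pos _)
  rw [← exp_add] at this
  simp at this
  linarith

lemma hh_nonneg {x : ℝ} (hx : 0 ≤ x) : 0 ≤ hh x := by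
  rcases hx.eq_or_lt with h | h
  · rw [← h, hh_zero]
  · exact (hh_pos h).le

lemma hh_le_one {x : ℝ} (hx : 0 ≤ x) : hh x ≤ 1 := by
  unfold hh
  have : 0 ≤ (1 + x) * exp (-x) := by positivity
  linarith

lemma hasDerivAt_gain_left {s : ℝ} (hs : 0 < s) (u : ℝ) :
    HasDerivAt (fun s => gain s u) (hh (u / s)) s := by
  unfold gain
  have h1 : HasDerivAt (fun s : ℝ => u / s) (-u / s ^ 2) s := by
    refine ((hasDerivAt_const s u).div (hasDerivAt_id s) hs.ne').congr_deriv ?_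
    simp
  have h2 := (hasDerivAt_id s).mul (h1.neg.exp.const_sub 1)
  refine h2.congr_deriv ?_
  simp only [hh, id, Pi.neg_apply]
  field_simp
  ring

lemma gain_mono_left {s s' u : ℝ} (hs : 0 < s) (hss : s ≤ s') (hu : 0 ≤ u) :
    gain s u ≤ gain s' u := by
  have hd : ∀ r ∈ Ioi (0 : ℝ), HasDerivAt (fun s => gain s u) (hh (u / r)) r :=
    fun r hr => hasDerivAt_gain_left hr u
  have : MonotoneOn (fun s => gain s u) (Ioi 0) := by
    apply monotoneOn_of_deriv_nonneg (convex_Ioi 0)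
    · exact fun r hr => (hd r hr).continuousAt.continuousWithinAt
    · intro r hr; rw [interior_Ioi] at hr
      exact (hd r hr).differentiableAt.differentiableWithinAt
    · intro r hr; rw [interior_Ioi] at hr
      rw [(hd r hr).deriv]
      exact hh_nonneg (div_nonneg hu (le_of_lt hr))
  exact this hs (lt_of_lt_of_le hs hss) hss

/-- Fubini on the triangle `0 < t < s ≤ T`. -/
lemma integral_triangle {T : ℝ} (hT : 0 ≤ T) {r v : ℝ → ℝ}
    (hr : IntervalIntegrable r volume 0 T) (hv : IntervalIntegrable v volume 0 T) :
    ∫ t in (0 : ℝ)..T, r t * ∫ s in t..T, v s = ∫ s in (0 : ℝ)..T, v s * ∫ t in (0 : ℝ)..s, r t := by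
  rw [intervalIntegrable_iff_integrableOn_Ioc_of_le hT] at hr hv
  set μ := volume.restrict (Ioc (0 : ℝ) T) with hμ
  have hprod : Integrable (fun p : ℝ × ℝ => r p.1 * v p.2) (μ.prod μ) := hr.mul_prod hv
  have hmeas : MeasurableSet {p : ℝ × ℝ | p.1 < p.2} := measurableSet_lt measurable_fst measurable_snd
  have hind := hprod.indicator hmeas
  have key := integral_integral_swap (f := fun t s => {p : ℝ × ℝ | p.1 < p.2}.indicator
    (fun p : ℝ × ℝ => r p.1 * v p.2) (t, s)) (μ := μ) (ν := μ) hind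
  rw [intervalIntegral.integral_of_le hT, intervalIntegral.integral_of_le hT]
  convert key using 1
  · apply setIntegral_congr_fun measurableSet_Ioc
    intro t ht
    have : Ioc t T = Ioc 0 T ∩ Ioi t := by
      ext z; simp only [mem_Ioc, mem_inter_iff, mem_Ioi]
      constructor
      · rintro ⟨h1, h2⟩; exact ⟨⟨by linarith [ht.1], h2⟩, h1⟩
      · rintro ⟨⟨_, h2⟩, h1⟩; exact ⟨h1, h2⟩
    simp only
    rw [intervalIntegral.integral_of_le ht.2, ← integral_const_mul, this,
      ← setIntegral_indicator measurableSet_Ioi]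
    rfl
  · apply setIntegral_congr_fun measurableSet_Ioc
    intro t ht
    have : Ioo 0 t = Ioc 0 T ∩ Iio t := by
      ext z; simp only [mem_Ioc, mem_Ioo, mem_inter_iff, mem_Iio]
      constructor
      · rintro ⟨h1, h2⟩; exact ⟨⟨h1, by linarith [ht.2]⟩, h2⟩
      · rintro ⟨⟨h1, _⟩, h2⟩; exact ⟨h1, h2⟩
    simp only
    rw [intervalIntegral.integral_of_le ht.1.le, integral_Ioc_eq_integral_Ioo,
      ← integral_const_mul, this, ← setIntegral_indicator measurableSet_Iio]
    simp only [mul_comm (v t)]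
    rfl

end Model2

namespace Model2
open Set Filter Topology

/-- Standing assumptions on the parameters. -/
structure Params (θ0 α c : ℝ) : Prop where
  pos : 0 < θ0
  lt : θ0 < π / 2
  α0 : 0 < α
  α1 : α < 1
  c0 : 0 < c

/-- Assumptions on a light intensity. -/
structure Light (I : ℝ → ℝ) : Prop where
  cont : Continuous I
  mono : Monotone I
  pos : ∀ y, 0 < I y
  le_two : ∀ y, I y ≤ 2

/-- Mass of leaves beyond `t`. -/
noncomputable def zf (u : ℝ → ℝ) (t : ℝ) : ℝ := ∫ s in Ioi t, u s

/-- Height at arc length `t`. -/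
noncomputable def yf (θ : ℝ → ℝ) (t : ℝ) : ℝ := ∫ s in (0 : ℝ)..t, sin (θ s)

/-- The rate of light capture. -/
noncomputable def lt (θ0 : ℝ) (I θ u : ℝ → ℝ) (t : ℝ) : ℝ :=
  I (yf θ t) * gain (cos (θ t - θ0)) (u t)

lemma payoff_eq (θ0 α c : ℝ) (I θ u : ℝ → ℝ) :
    Payoff θ0 α c I θ u = ∫ t in Ioi (0 : ℝ), (lt θ0 I θ u t - c * zf u t ^ α) := by
  simp only [Payoff, G2_eq]; rfl

section
variable {θ0 α c : ℝ}

lemma Params.sin_pos (P : Params θ0 α c) : 0 < sin θ0 :=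
  sin_pos_of_pos_of_lt_pi P.pos (by linarith [P.lt, pi_pos])
lemma Params.cos_pos (P : Params θ0 α c) : 0 < cos θ0 :=
  cos_pos_of_mem_Ioo ⟨by linarith [P.pos, pi_pos], P.lt⟩
lemma Params.sin_lt_one (P : Params θ0 α c) : sin θ0 < 1 := by
  have := sin_lt_sin_of_lt_of_le_pi_div_two (by linarith [P.pos, pi_pos]) le_rfl P.lt
  simpa using this

lemma Params.sin_le (P : Params θ0 α c) {θ : ℝ} (h : θ ∈ Icc θ0 (π / 2)) : sin θ0 ≤ sin θ :=
  sin_le_sin_of_le_of_le_pi_div_two (by linarith [P.pos, pi_pos]) h.2 h.1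

lemma Params.le_cos (P : Params θ0 α c) {θ : ℝ} (h : θ ∈ Icc θ0 (π / 2)) :
    sin θ0 ≤ cos (θ - θ0) := by
  rw [← cos_pi_div_two_sub]
  apply cos_le_cos_of_nonneg_of_le_pi <;> linarith [h.1, h.2, P.pos, pi_pos]

lemma Params.cos_sub_pos (P : Params θ0 α c) {θ : ℝ} (h : θ ∈ Icc θ0 (π / 2)) : 0 < cos (θ - θ0) :=
  P.sin_pos.trans_le (P.le_cos h)

end

section
variable {θ0 α c : ℝ} {I θ u : ℝ → ℝ}

lemma zf_nonneg (hu : ∀ t, 0 ≤ u t) (t : ℝ) : 0 ≤ zf u t :=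
  setIntegral_nonneg measurableSet_Ioi fun s _ => hu s

lemma zf_add (hi : IntegrableOn u (Ioi 0)) {a b : ℝ} (ha : 0 ≤ a) (hab : a ≤ b) :
    zf u a = (∫ s in a..b, u s) + zf u b := by
  unfold zf
  rw [intervalIntegral.integral_of_le hab, ← setIntegral_union (Ioc_disjoint_Ioi le_rfl)
    measurableSet_Ioi, Ioc_union_Ioi_eq_Ioi hab]
  · exact hi.mono_set (Ioc_subset_Ioi_self.trans (Ioi_subset_Ioi ha))
  · exact hi.mono_set (Ioi_subset_Ioi (ha.trans hab))

lemma intervalIntegrable_of_Ioi (hi : IntegrableOn u (Ioi 0)) {a b : ℝ} (ha : 0 ≤ a) (hb : 0 ≤ b) :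
    IntervalIntegrable u volume a b := by
  rw [intervalIntegrable_iff]
  exact hi.mono_set fun x hx => lt_of_le_of_lt (le_min ha hb) hx.1

lemma zf_antitone (hi : IntegrableOn u (Ioi 0)) (hu : ∀ t, 0 ≤ u t) {a b : ℝ} (ha : 0 ≤ a)
    (hab : a ≤ b) : zf u b ≤ zf u a := by
  rw [zf_add hi ha hab]
  have := intervalIntegral.integral_nonneg (μ := volume) hab fun s _ => hu s
  linarith

lemma zf_continuousOn (hi : IntegrableOn u (Ioi 0)) : ContinuousOn (zf u) (Ici 0) := by
  have h1 : ∀ t ∈ Ici (0 : ℝ), zf u t = zf u 0 - ∫ s in (0 : ℝ)..t, (Ioi 0).indicator u s := by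
    intro t ht
    have e : ∫ s in Ioc 0 t, (Ioi 0).indicator u s = ∫ s in Ioc 0 t, u s :=
      setIntegral_congr_fun measurableSet_Ioc fun s hs =>
        indicator_of_mem (show s ∈ Ioi 0 from hs.1) u
    rw [zf_add hi le_rfl ht, intervalIntegral.integral_of_le ht, intervalIntegral.integral_of_le ht,
      e]
    ring
  refine ContinuousOn.congr (Continuous.continuousOn ?_) h1
  exact continuous_const.sub (intervalIntegral.continuous_primitive
    (fun a b => ((integrable_indicator_iff measurableSet_Ioi).2 hi).intervalIntegrable) 0)

lemma zf_tendsto (hi : IntegrableOn u (Ioi 0)) : Tendsto (zf u) atTop (𝓝 0) := by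
  have h := intervalIntegral_tendsto_integral_Ioi 0 hi tendsto_id
  have h2 : Tendsto (fun t => zf u 0 - ∫ s in (0 : ℝ)..t, u s) atTop (𝓝 (zf u 0 - zf u 0)) :=
    tendsto_const_nhds.sub h
  rw [sub_self] at h2
  refine h2.congr' ?_
  filter_upwards [eventually_ge_atTop 0] with t ht
  rw [zf_add hi le_rfl ht]; ring

lemma sin_intervalIntegrable (hθ : Measurable θ) (a b : ℝ) :
    IntervalIntegrable (fun s => sin (θ s)) volume a b := by
  refine (intervalIntegrable_const (c := (1 : ℝ))).mono_fun
    (measurable_sin.comp hθ).aestronglyMeasurable (ae_of_all _ fun s => ?_)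
  simpa using abs_sin_le_one (θ s)

lemma yf_sub (hθ : Measurable θ) (a b : ℝ) : yf θ b - yf θ a = ∫ s in a..b, sin (θ s) :=
  intervalIntegral.integral_interval_sub_left (sin_intervalIntegrable hθ _ _)
    (sin_intervalIntegrable hθ _ _)

lemma yf_continuous (hθ : Measurable θ) : Continuous (yf θ) :=
  intervalIntegral.continuous_primitive (sin_intervalIntegrable hθ) 0

lemma yf_zero : yf θ 0 = 0 := by simp [yf]

lemma yf_sub_le (hθ : Measurable θ) {a b : ℝ} (hab : a ≤ b) : yf θ b - yf θ a ≤ b - a := by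
  rw [yf_sub hθ]
  have := intervalIntegral.integral_mono_on (g := fun _ => (1 : ℝ)) hab
    (sin_intervalIntegrable hθ a b) (by simp) (fun s _ => sin_le_one _)
  simpa using this

lemma le_yf_sub (P : Params θ0 α c) (hθ : Measurable θ) (hm : ∀ t, θ t ∈ Icc θ0 (π / 2)) {a b : ℝ}
    (hab : a ≤ b) : sin θ0 * (b - a) ≤ yf θ b - yf θ a := by
  rw [yf_sub hθ]
  have := intervalIntegral.integral_mono_on (f := fun _ => sin θ0) hab
    (by simp) (sin_intervalIntegrable hθ a b) (fun s _ => P.sin_le (hm s))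
  simpa [mul_comm] using this

lemma yf_le (hθ : Measurable θ) {t : ℝ} (ht : 0 ≤ t) : yf θ t ≤ t := by
  simpa [yf_zero] using yf_sub_le hθ ht

lemma le_yf (P : Params θ0 α c) (hθ : Measurable θ) (hm : ∀ t, θ t ∈ Icc θ0 (π / 2)) {t : ℝ}
    (ht : 0 ≤ t) : sin θ0 * t ≤ yf θ t := by
  simpa [yf_zero] using le_yf_sub P hθ hm ht

lemma yf_mono (P : Params θ0 α c) (hθ : Measurable θ) (hm : ∀ t, θ t ∈ Icc θ0 (π / 2)) :
    StrictMono (yf θ) := by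
  intro a b hab
  have := le_yf_sub P hθ hm hab.le
  nlinarith [P.sin_pos, mul_pos P.sin_pos (sub_pos.2 hab)]

lemma lt_nonneg (P : Params θ0 α c) (hI : Light I) (ha : Adm2 θ0 θ u) (t : ℝ) : 0 ≤ lt θ0 I θ u t :=
  mul_nonneg (hI.pos _).le (gain_nonneg (P.cos_sub_pos (ha.2.2.1 t)) (ha.2.2.2.1 t))

lemma lt_le (P : Params θ0 α c) (hI : Light I) (ha : Adm2 θ0 θ u) (t : ℝ) :
    lt θ0 I θ u t ≤ 2 * u t :=
  mul_le_mul (hI.le_two _) (gain_le_self (P.cos_sub_pos (ha.2.2.1 t)) _)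
    (gain_nonneg (P.cos_sub_pos (ha.2.2.1 t)) (ha.2.2.2.1 t)) zero_le_two

lemma measurable_gain {s u : ℝ → ℝ} (hs : Measurable s) (hu : Measurable u) :
    Measurable fun t => gain (s t) (u t) := by unfold gain; fun_prop

lemma measurable_lt (hI : Light I) (ha : Adm2 θ0 θ u) : Measurable (lt θ0 I θ u) := by
  have h1 : Measurable fun t => I (yf θ t) := (hI.cont.comp (yf_continuous ha.1)).measurable
  exact h1.mul (measurable_gain (measurable_cos.comp (ha.1.sub_const _)) ha.2.1)

lemma lt_integrable (P : Params θ0 α c) (hI : Light I) (ha : Adm2 θ0 θ u) :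
    IntegrableOn (lt θ0 I θ u) (Ioi 0) := by
  refine (ha.2.2.2.2.const_mul 2).mono' (measurable_lt hI ha).aestronglyMeasurable
    (ae_of_all _ fun t => ?_)
  rw [norm_of_nonneg (lt_nonneg P hI ha t)]
  exact lt_le P hI ha t

lemma zfpow_aesm (hi : IntegrableOn u (Ioi 0)) {p : ℝ} (hp : 0 ≤ p) :
    AEStronglyMeasurable (fun t => zf u t ^ p) (volume.restrict (Ioi 0)) :=
  (((zf_continuousOn hi).mono Ioi_subset_Ici_self).rpow_const
    fun _ _ => Or.inr hp).aestronglyMeasurable measurableSet_Ioi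

lemma payoff_of_integrable (P : Params θ0 α c) (hI : Light I) (ha : Adm2 θ0 θ u)
    (hz : IntegrableOn (fun t => zf u t ^ α) (Ioi 0)) :
    Payoff θ0 α c I θ u =
      (∫ t in Ioi (0 : ℝ), lt θ0 I θ u t) - c * ∫ t in Ioi (0 : ℝ), zf u t ^ α := by
  rw [payoff_eq, integral_sub (lt_integrable P hI ha) (hz.const_mul c), integral_const_mul]

lemma payoff_of_not_integrable (P : Params θ0 α c) (hI : Light I) (ha : Adm2 θ0 θ u)
    (hz : ¬ IntegrableOn (fun t => zf u t ^ α) (Ioi 0)) : Payoff θ0 α c I θ u = 0 := by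
  rw [payoff_eq]
  apply integral_undef
  intro h
  apply hz
  have := ((lt_integrable P hI ha).sub h).const_mul c⁻¹
  refine this.congr (ae_of_all _ fun t => ?_)
  have := P.c0.ne'
  simp; field_simp

end
end Model2

namespace Model2
open Set Filter Topology

lemma rpow_tangent {α a b : ℝ} (h0 : 0 ≤ α) (h1 : α ≤ 1) (ha : 0 < a) (hb : 0 ≤ b) :
    b ^ α ≤ a ^ α + α * a ^ (α - 1) * (b - a) := by
  have h := rpow_one_add_le_one_add_mul_self (s := b / a - 1) (p := α)
    (by have := div_nonneg hb ha.le; linarith) h0 h1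
  have e : 1 + (b / a - 1) = b / a := by ring
  rw [e, div_rpow hb ha.le, div_le_iff₀ (rpow_pos_of_pos ha _)] at h
  rw [rpow_sub_one ha.ne']
  calc b ^ α ≤ _ := h
    _ = _ := by field_simp

lemma lintegral_tail {v : ℝ → ENNReal} (hv : Measurable v) :
    ∫⁻ t in Ioi (0 : ℝ), ∫⁻ s in Ioi t, v s = ∫⁻ s in Ioi (0 : ℝ), ENNReal.ofReal s * v s := by
  have hm : Measurable (Function.uncurry fun t s : ℝ =>
      ({p : ℝ × ℝ | p.1 < p.2}.indicator (fun p => v p.2) (t, s))) :=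
    (hv.comp measurable_snd).indicator (measurableSet_lt measurable_fst measurable_snd)
  have key := lintegral_lintegral_swap (μ := volume.restrict (Ioi (0 : ℝ)))
    (ν := volume.restrict (Ioi (0 : ℝ))) hm.aemeasurable
  convert key using 1
  · apply setLIntegral_congr_fun measurableSet_Ioi
    intro t ht
    have : Ioi t = Ioi 0 ∩ Ioi t := (inter_eq_right.2 (Ioi_subset_Ioi (le_of_lt ht))).symm
    simp only
    rw [this, inter_comm, ← setLIntegral_indicator measurableSet_Ioi]
    rfl
  · apply setLIntegral_congr_fun measurableSet_Ioi
    intro t ht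
    have h2 : (fun s : ℝ => {p : ℝ × ℝ | p.1 < p.2}.indicator (fun p => v p.2) (s, t)) =
        (Iio t).indicator fun _ => v t := by ext s; rfl
    simp only
    rw [h2, setLIntegral_indicator measurableSet_Iio, lintegral_const, Measure.restrict_apply_univ,
      Iio_inter_Ioi, Real.volume_Ioo, sub_zero, mul_comm]

lemma integral_tail {w : ℝ → ℝ} (hm : Measurable w) (hw : ∀ t, 0 ≤ w t)
    (hi : IntegrableOn w (Ioi 0)) (hz : IntegrableOn (zf w) (Ioi 0)) :
    IntegrableOn (fun t => t * w t) (Ioi 0) ∧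
      ∫ t in Ioi (0 : ℝ), t * w t = ∫ t in Ioi (0 : ℝ), zf w t := by
  have h := lintegral_tail (v := fun t => ENNReal.ofReal (w t)) hm.ennreal_ofReal
  have e1 : ∫⁻ t in Ioi (0 : ℝ), ∫⁻ s in Ioi t, ENNReal.ofReal (w s) =
      ∫⁻ t in Ioi (0 : ℝ), ENNReal.ofReal (zf w t) := by
    apply setLIntegral_congr_fun measurableSet_Ioi
    intro t ht
    simp only [zf]
    rw [ofReal_integral_eq_lintegral_ofReal (hi.mono_set (Ioi_subset_Ioi (le_of_lt ht)))
      (ae_of_all _ hw)]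
  have e2 : ∫⁻ s in Ioi (0 : ℝ), ENNReal.ofReal s * ENNReal.ofReal (w s) =
      ∫⁻ t in Ioi (0 : ℝ), ENNReal.ofReal (t * w t) := by
    apply setLIntegral_congr_fun measurableSet_Ioi
    intro t ht
    simp only
    rw [ENNReal.ofReal_mul (le_of_lt ht)]
  rw [e1, e2] at h
  have hn : 0 ≤ᵐ[volume.restrict (Ioi (0 : ℝ))] fun t => t * w t := by
    filter_upwards [ae_restrict_mem measurableSet_Ioi] with t ht
    exact mul_nonneg (le_of_lt ht) (hw t)
  have hn2 : 0 ≤ᵐ[volume.restrict (Ioi (0 : ℝ))] fun t => zf w t :=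
    ae_of_all _ fun t => zf_nonneg hw t
  refine ⟨⟨(measurable_id.mul hm).aestronglyMeasurable, ?_⟩, ?_⟩
  · rw [hasFiniteIntegral_iff_ofReal hn, ← h, ← hasFiniteIntegral_iff_ofReal hn2]
    exact hz.2
  · rw [integral_eq_lintegral_of_nonneg_ae hn (measurable_id.mul hm).aestronglyMeasurable,
      integral_eq_lintegral_of_nonneg_ae hn2 hz.1, h]

/-- The logarithmic majorant `log⁺ (A / t)`. -/
noncomputable def Ul (A t : ℝ) : ℝ := max 0 (log (A / t))

lemma Ul_nonneg (A t : ℝ) : 0 ≤ Ul A t := le_max_left _ _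

lemma measurable_Ul (A : ℝ) : Measurable (Ul A) := by unfold Ul; fun_prop

lemma Ul_eq_zero {A t : ℝ} (hA : 0 < A) (ht : A ≤ t) : Ul A t = 0 := by
  unfold Ul
  apply max_eq_left
  apply log_nonpos (div_nonneg hA.le (hA.le.trans ht))
  exact (div_le_one (hA.trans_le ht)).2 ht

lemma Ul_eq_log {A t : ℝ} (ht0 : 0 < t) (ht : t ≤ A) : Ul A t = log A - log t := by
  unfold Ul
  rw [log_div (ht0.trans_le ht).ne' ht0.ne']
  exact max_eq_right (sub_nonneg.2 (log_le_log ht0 ht))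

lemma Ul_integral {A : ℝ} (hA : 0 < A) :
    IntegrableOn (Ul A) (Ioi 0) ∧ ∫ t in Ioi (0 : ℝ), Ul A t = A := by
  have h1 : EqOn (Ul A) (fun t => log A - log t) (Ioc 0 A) := fun t ht => Ul_eq_log ht.1 ht.2
  have h2 : EqOn (Ul A) (fun _ => 0) (Ioi A) := fun t ht => Ul_eq_zero hA (le_of_lt ht)
  have hinteg : IntervalIntegrable (fun t => log A - log t) volume 0 A :=
    intervalIntegrable_const.sub intervalIntegral.intervalIntegrable_log'
  have i1 : IntegrableOn (Ul A) (Ioc 0 A) :=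
    ((intervalIntegrable_iff_integrableOn_Ioc_of_le hA.le).1 hinteg).congr_fun h1.symm measurableSet_Ioc
  have i2 : IntegrableOn (Ul A) (Ioi A) :=
    (integrableOn_zero).congr_fun h2.symm measurableSet_Ioi
  rw [← Ioc_union_Ioi_eq_Ioi hA.le]
  refine ⟨i1.union i2, ?_⟩
  rw [setIntegral_union (Ioc_disjoint_Ioi le_rfl) measurableSet_Ioi i1 i2,
    setIntegral_congr_fun measurableSet_Ioc h1, setIntegral_congr_fun measurableSet_Ioi h2,
    ← intervalIntegral.integral_of_le hA.le, intervalIntegral.integral_sub intervalIntegrable_const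
      intervalIntegral.intervalIntegrable_log', integral_log]
  simp

section
variable {θ0 α c : ℝ} {I θ u : ℝ → ℝ}

lemma zf_sub {u' : ℝ → ℝ} (hi : IntegrableOn u (Ioi 0)) (hi' : IntegrableOn u' (Ioi 0)) {t : ℝ}
    (ht : 0 ≤ t) : zf (fun s => u s - u' s) t = zf u t - zf u' t :=
  integral_sub (hi.mono_set (Ioi_subset_Ioi ht)) (hi'.mono_set (Ioi_subset_Ioi ht))

lemma zf_le_of_le {u' : ℝ → ℝ} (hi : IntegrableOn u (Ioi 0)) (hi' : IntegrableOn u' (Ioi 0))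
    (h : ∀ t > 0, u' t ≤ u t) {t : ℝ} (ht : 0 ≤ t) : zf u' t ≤ zf u t :=
  setIntegral_mono_on (hi'.mono_set (Ioi_subset_Ioi ht)) (hi.mono_set (Ioi_subset_Ioi ht))
    measurableSet_Ioi fun s hs => h s (lt_of_le_of_lt ht hs)

lemma lt_truncate (P : Params θ0 α c) (hI : Light I) (ha : Adm2 θ0 θ u) {m t : ℝ} (hm : 0 < m)
    (ht : 0 < t) :
    lt θ0 I θ u t - lt θ0 I θ (fun t => min (u t) (Ul (2 / m) t)) t ≤
      m * (t * (u t - min (u t) (Ul (2 / m) t))) := by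
  rcases le_total (u t) (Ul (2 / m) t) with h | h
  · simp [lt, min_eq_left h]
  · set v := Ul (2 / m) t with hv
    have hs := P.cos_sub_pos (ha.2.2.1 t)
    set s := cos (θ t - θ0)
    have hs1 : s ≤ 1 := cos_le_one _
    have hv0 : 0 ≤ v := Ul_nonneg _ _
    have hmin : min (u t) v = v := min_eq_right h
    have e : gain s v = s * hh (v / s) + exp (-(v / s)) * v := by
      have := gain_mul_tangent hs (v / s)
      rwa [mul_div_cancel₀ _ hs.ne'] at this
    have h1 := gain_le_tangent hs (u t) (v / s)
    have h2 : exp (-(v / s)) ≤ m * t / 2 := by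
      have hvs : v ≤ v / s := by rw [le_div_iff₀ hs]; nlinarith
      calc exp (-(v / s)) ≤ exp (-log (2 / m / t)) := exp_le_exp.2 (by
            have : log (2 / m / t) ≤ v := le_max_right _ _
            linarith)
        _ = m * t / 2 := by
            rw [exp_neg, exp_log (by positivity)]; field_simp
    have hw : 0 ≤ u t - v := by linarith
    have hIy := hI.le_two (yf θ t)
    have hI0 := hI.pos (yf θ t)
    change I (yf θ t) * gain s (u t) - I (yf θ t) * gain s (min (u t) v) ≤ m * (t * (u t - min (u t) v))
    rw [hmin]
    calc I (yf θ t) * gain s (u t) - I (yf θ t) * gain s v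
        = I (yf θ t) * (gain s (u t) - gain s v) := by ring
      _ ≤ I (yf θ t) * (m * t / 2 * (u t - v)) := by
          apply mul_le_mul_of_nonneg_left _ hI0.le
          nlinarith
      _ ≤ 2 * (m * t / 2 * (u t - v)) := mul_le_mul_of_nonneg_right hIy (by positivity)
      _ = m * (t * (u t - v)) := by ring

lemma truncate (P : Params θ0 α c) (hI : Light I) (ha : Adm2 θ0 θ u)
    (hz : IntegrableOn (fun t => zf u t ^ α) (Ioi 0)) {Z m : ℝ} (hZ : 0 < Z) (h0 : zf u 0 ≤ Z)
    (hm : m = c * α * Z ^ (α - 1)) {u' : ℝ → ℝ} (hu' : u' = fun t => min (u t) (Ul (2 / m) t)) :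
    Adm2 θ0 θ u' ∧ IntegrableOn (fun t => zf u' t ^ α) (Ioi 0) ∧ zf u' 0 ≤ 2 / m ∧
      Payoff θ0 α c I θ u ≤ Payoff θ0 α c I θ u' := by
  have hm0 : 0 < m := by rw [hm]; have := P.c0; have := P.α0; positivity
  have hA : 0 < 2 / m := by positivity
  have hU := Ul_integral hA
  have hle : ∀ t, u' t ≤ u t := fun t => by rw [hu']; exact min_le_left _ _
  have hleU : ∀ t, u' t ≤ Ul (2 / m) t := fun t => by rw [hu']; exact min_le_right _ _
  have hnn : ∀ t, 0 ≤ u' t := fun t => by rw [hu']; exact le_min (ha.2.2.2.1 t) (Ul_nonneg _ _)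
  have hmeas : Measurable u' := by rw [hu']; exact ha.2.1.min (measurable_Ul _)
  have hinteg : IntegrableOn u' (Ioi 0) := ha.2.2.2.2.mono' hmeas.aestronglyMeasurable
    (ae_of_all _ fun t => by rw [norm_of_nonneg (hnn t)]; exact hle t)
  have ha' : Adm2 θ0 θ u' := ⟨ha.1, hmeas, ha.2.2.1, hnn, hinteg⟩
  have hzle : ∀ t, 0 ≤ t → zf u' t ≤ zf u t := fun t ht =>
    zf_le_of_le ha.2.2.2.2 hinteg (fun t _ => hle t) ht
  have hz' : IntegrableOn (fun t => zf u' t ^ α) (Ioi 0) := by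
    refine hz.mono' (zfpow_aesm hinteg P.α0.le) ?_
    filter_upwards [ae_restrict_mem measurableSet_Ioi] with t ht
    rw [norm_of_nonneg (rpow_nonneg (zf_nonneg hnn t) _)]
    exact rpow_le_rpow (zf_nonneg hnn t) (hzle t (le_of_lt ht)) P.α0.le
  refine ⟨ha', hz', ?_, ?_⟩
  · rw [← hU.2]
    exact setIntegral_mono_on hinteg hU.1 measurableSet_Ioi fun t _ => hleU t
  set w : ℝ → ℝ := fun t => u t - u' t with hw
  have hwm : Measurable w := ha.2.1.sub hmeas
  have hw0 : ∀ t, 0 ≤ w t := fun t => sub_nonneg.2 (hle t)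
  have hwi : IntegrableOn w (Ioi 0) := ha.2.2.2.2.sub hinteg
  have hcost : ∀ t, 0 < t → m * zf w t ≤ c * zf u t ^ α - c * zf u' t ^ α := by
    intro t ht
    rw [hw, zf_sub ha.2.2.2.2 hinteg ht.le]
    have hz0 := zf_nonneg ha.2.2.2.1 t
    have hz1 := zf_nonneg hnn t
    have hz2 := hzle t ht.le
    rcases hz0.eq_or_lt with h | h
    · have : zf u' t = 0 := by linarith
      rw [this, ← h]; simp
    · have hta := rpow_tangent P.α0.le P.α1.le h hz1
      have hzZ : zf u t ≤ Z := (zf_antitone ha.2.2.2.2 ha.2.2.2.1 le_rfl ht.le).trans h0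
      have hp : Z ^ (α - 1) ≤ zf u t ^ (α - 1) :=
        rpow_le_rpow_of_nonpos h hzZ (by linarith [P.α1])
      have h3 : Z ^ (α - 1) * (zf u t - zf u' t) ≤ zf u t ^ (α - 1) * (zf u t - zf u' t) :=
        mul_le_mul_of_nonneg_right hp (by linarith)
      have h4 := mul_le_mul_of_nonneg_left h3 (mul_pos P.c0 P.α0).le
      have h5 := mul_le_mul_of_nonneg_left hta P.c0.le
      rw [hm]
      nlinarith
  have hzw : IntegrableOn (zf w) (Ioi 0) := by
    refine Integrable.mono' (((hz.const_mul c).sub (hz'.const_mul c)).const_mul m⁻¹)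
      (((zf_continuousOn hwi).mono Ioi_subset_Ici_self).aestronglyMeasurable measurableSet_Ioi) ?_
    filter_upwards [ae_restrict_mem measurableSet_Ioi] with t ht
    rw [norm_of_nonneg (zf_nonneg hw0 t)]
    have := mul_le_mul_of_nonneg_left (hcost t ht) (inv_pos.2 hm0).le
    rwa [← mul_assoc, inv_mul_cancel₀ hm0.ne', one_mul] at this
  obtain ⟨ht1, ht2⟩ := integral_tail hwm hw0 hwi hzw
  have hl := lt_integrable P hI ha
  have hl' := lt_integrable P hI ha'
  have k1 : (∫ t in Ioi (0 : ℝ), lt θ0 I θ u t) - ∫ t in Ioi (0 : ℝ), lt θ0 I θ u' t ≤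
      m * ∫ t in Ioi (0 : ℝ), t * w t := by
    rw [← integral_sub hl hl', ← integral_const_mul]
    apply setIntegral_mono_on (hl.sub hl') (ht1.const_mul m) measurableSet_Ioi
    intro t ht
    have := lt_truncate P hI ha hm0 ht
    rw [← hu'] at this
    simpa [hw, hu'] using this
  have k2 : m * ∫ t in Ioi (0 : ℝ), zf w t ≤
      c * (∫ t in Ioi (0 : ℝ), zf u t ^ α) - c * ∫ t in Ioi (0 : ℝ), zf u' t ^ α := by
    rw [← integral_const_mul, ← integral_const_mul, ← integral_const_mul,
      ← integral_sub (hz.const_mul c) (hz'.const_mul c)]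
    exact setIntegral_mono_on (hzw.const_mul m) ((hz.const_mul c).sub (hz'.const_mul c))
      measurableSet_Ioi hcost
  rw [payoff_of_integrable P hI ha hz, payoff_of_integrable P hI ha' hz']
  rw [ht2] at k1
  linarith

end
end Model2

namespace Model2
open Set Filter Topology

lemma weak_subseq {A : ℝ} {f : ℕ → ℝ → ℝ} {F : ℝ → ℝ} (hf : ∀ n, Measurable (f n))
    (hF : MemLp F 2 (volume.restrict (Ioc 0 A))) (hfF : ∀ n t, |f n t| ≤ F t) :
    ∃ φ : ℕ → ℕ, StrictMono φ ∧ ∃ g : ℝ → ℝ, Measurable g ∧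
      MemLp g 2 (volume.restrict (Ioc 0 A)) ∧
      ∀ w : ℝ → ℝ, MemLp w 2 (volume.restrict (Ioc 0 A)) →
        Tendsto (fun n => ∫ t in Ioc 0 A, w t * f (φ n) t) atTop
          (𝓝 (∫ t in Ioc 0 A, w t * g t)) := by
  set μ := volume.restrict (Ioc (0 : ℝ) A) with hμ
  have : Fact ((1 : ENNReal) ≤ 2) := ⟨by norm_num⟩
  have : Fact ((2 : ENNReal) ≠ ⊤) := ⟨by norm_num⟩
  have hmem : ∀ n, MemLp (f n) 2 μ := fun n =>
    hF.mono (hf n).aestronglyMeasurable (ae_of_all _ fun t => by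
      rw [norm_eq_abs]; exact (hfF n t).trans (le_abs_self _))
  let E := Lp ℝ 2 μ
  let v : ℕ → E := fun n => (hmem n).toLp (f n)
  have hnorm : ∀ n, ‖v n‖ ≤ ‖hF.toLp F‖ := by
    intro n
    apply Lp.norm_le_norm_of_ae_le
    filter_upwards [(hmem n).coeFn_toLp, hF.coeFn_toLp] with t h1 h2
    rw [h1, h2, norm_eq_abs]; exact (hfF n t).trans (le_abs_self _)
  let d : ℕ → WeakDual ℝ E := fun n => (InnerProductSpace.toDual ℝ E (v n) : StrongDual ℝ E).toWeakDual
  have hd : ∀ n, d n ∈ WeakDual.toStrongDual ⁻¹' Metric.closedBall (0 : StrongDual ℝ E) ‖hF.toLp F‖ := by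
    intro n
    simp only [mem_preimage, mem_closedBall_zero_iff]
    change ‖InnerProductSpace.toDual ℝ E (v n)‖ ≤ _
    rw [LinearIsometryEquiv.norm_map]
    exact hnorm n
  obtain ⟨a, -, φ, hφ, hlim⟩ := WeakDual.isSeqCompact_closedBall ℝ E 0 _ hd
  let g0 : E := (InnerProductSpace.toDual ℝ E).symm (WeakDual.toStrongDual a)
  refine ⟨φ, hφ, g0, (Lp.stronglyMeasurable g0).measurable, Lp.memLp g0, ?_⟩
  intro w hw
  have h1 : Tendsto (fun n => d (φ n) (hw.toLp w)) atTop (𝓝 (a (hw.toLp w))) :=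
    ((WeakDual.eval_continuous (hw.toLp w)).tendsto a).comp hlim
  have e1 : ∀ n, d (φ n) (hw.toLp w) = ∫ t, w t * f (φ n) t ∂μ := by
    intro n
    change InnerProductSpace.toDual ℝ E (v (φ n)) (hw.toLp w) = _
    rw [InnerProductSpace.toDual_apply_apply, L2.inner_def]
    apply integral_congr_ae
    filter_upwards [(hmem (φ n)).coeFn_toLp, hw.coeFn_toLp] with t h1 h2
    rw [h2]
    change inner ℝ (((hmem (φ n)).toLp (f (φ n)) : E) t) _ = _
    rw [h1]; simp
  have e2 : a (hw.toLp w) = ∫ t, w t * g0 t ∂μ := by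
    have : a (hw.toLp w) = inner ℝ g0 (hw.toLp w) := by
      rw [InnerProductSpace.toDual_symm_apply]; rfl
    rw [this, L2.inner_def]
    apply integral_congr_ae
    filter_upwards [hw.coeFn_toLp] with t h2
    rw [h2]; simp
  rw [← e2]
  simpa only [← e1] using h1

end Model2

namespace Model2
open Set Filter Topology

/-- Weak convergence in `L²(0, A)`. -/
def WeakLim (A : ℝ) (f : ℕ → ℝ → ℝ) (g : ℝ → ℝ) : Prop :=
  ∀ w : ℝ → ℝ, MemLp w 2 (volume.restrict (Ioc 0 A)) →
    Tendsto (fun n => ∫ t in Ioc 0 A, w t * f n t) atTop (𝓝 (∫ t in Ioc 0 A, w t * g t))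

lemma memLp_bdd {A C : ℝ} {w : ℝ → ℝ} (hw : Measurable w) (hC : ∀ t, |w t| ≤ C) :
    MemLp w 2 (volume.restrict (Ioc 0 A)) :=
  MemLp.of_bound hw.aestronglyMeasurable C (ae_of_all _ fun t => by
    rw [norm_eq_abs]; exact hC t)

lemma integrable_mul_of_memLp {A : ℝ} {v w : ℝ → ℝ} (hv : MemLp v 2 (volume.restrict (Ioc 0 A)))
    (hw : MemLp w 2 (volume.restrict (Ioc 0 A))) :
    Integrable (fun t => v t * w t) (volume.restrict (Ioc 0 A)) :=
  MemLp.integrable_mul hv hw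

lemma WeakLim.ge {A : ℝ} {f : ℕ → ℝ → ℝ} {g l : ℝ → ℝ} (h : WeakLim A f g) (hg : Measurable g)
    (hg2 : MemLp g 2 (volume.restrict (Ioc 0 A))) (hl : Measurable l)
    (hl2 : MemLp l 2 (volume.restrict (Ioc 0 A)))
    (hf2 : ∀ n, MemLp (f n) 2 (volume.restrict (Ioc 0 A))) (hfl : ∀ n t, l t ≤ f n t) :
    ∀ᵐ t ∂(volume.restrict (Ioc 0 A)), l t ≤ g t := by
  classical
  set w : ℝ → ℝ := fun t => if g t < l t then 1 else 0 with hw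
  have hwm : Measurable w := Measurable.ite (measurableSet_lt hg hl) measurable_const measurable_const
  have hw2 : MemLp w 2 (volume.restrict (Ioc 0 A)) := memLp_bdd hwm (C := 1) fun t => by
    simp only [hw]; split_ifs <;> simp
  have hw0 : ∀ t, 0 ≤ w t := fun t => by simp only [hw]; split_ifs <;> simp
  have hwl := integrable_mul_of_memLp hw2 hl2
  have hwg := integrable_mul_of_memLp hw2 hg2
  have h1 : ∫ t in Ioc 0 A, w t * l t ≤ ∫ t in Ioc 0 A, w t * g t := by
    refine ge_of_tendsto' (h w hw2) fun n => ?_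
    exact integral_mono hwl (integrable_mul_of_memLp hw2 (hf2 n)) fun t =>
      mul_le_mul_of_nonneg_left (hfl n t) (hw0 t)
  have h2 : 0 ≤ fun t => w t * l t - w t * g t := fun t => by
    simp only [hw, Pi.zero_apply]; split_ifs with hlt <;> simp; exact hlt.le
  have h3 : ∫ t in Ioc 0 A, (w t * l t - w t * g t) = 0 :=
    le_antisymm (by rw [integral_sub hwl hwg]; linarith) (integral_nonneg h2)
  rw [integral_eq_zero_iff_of_nonneg h2 (hwl.sub hwg)] at h3
  filter_upwards [h3] with t ht
  by_contra hlt
  push Not at hlt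
  simp only [hw, if_pos hlt, Pi.zero_apply] at ht
  linarith

lemma WeakLim.neg {A : ℝ} {f : ℕ → ℝ → ℝ} {g : ℝ → ℝ} (h : WeakLim A f g) :
    WeakLim A (fun n t => -f n t) (fun t => -g t) := by
  intro w hw
  simpa only [mul_neg, integral_neg] using (h w hw).neg

lemma WeakLim.comp {A : ℝ} {f : ℕ → ℝ → ℝ} {g : ℝ → ℝ} (h : WeakLim A f g) {φ : ℕ → ℕ}
    (hφ : StrictMono φ) : WeakLim A (fun n => f (φ n)) g :=
  fun w hw => (h w hw).comp hφ.tendsto_atTop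

lemma WeakLim.circle {A : ℝ} {f f' : ℕ → ℝ → ℝ} {a b : ℝ → ℝ} (h : WeakLim A f a)
    (h' : WeakLim A f' b) (ha : Measurable a) (hb : Measurable b)
    (ha2 : MemLp a 2 (volume.restrict (Ioc 0 A))) (hb2 : MemLp b 2 (volume.restrict (Ioc 0 A)))
    (hf2 : ∀ n, MemLp (f n) 2 (volume.restrict (Ioc 0 A)))
    (hf2' : ∀ n, MemLp (f' n) 2 (volume.restrict (Ioc 0 A)))
    (hff : ∀ n t, f n t ^ 2 + f' n t ^ 2 = 1) :
    ∀ᵐ t ∂(volume.restrict (Ioc 0 A)), a t ^ 2 + b t ^ 2 ≤ 1 := by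
  classical
  set r : ℝ → ℝ := fun t => √(a t ^ 2 + b t ^ 2) with hr
  have hrm : Measurable r := by fun_prop
  set e : ℝ → ℝ := fun t => if 1 < a t ^ 2 + b t ^ 2 then 1 else 0 with he
  have hem : Measurable e := Measurable.ite (measurableSet_lt measurable_const (by fun_prop))
    measurable_const measurable_const
  have hsq : ∀ t, r t ^ 2 = a t ^ 2 + b t ^ 2 := fun t => sq_sqrt (by positivity)
  have hr0 : ∀ t, 0 ≤ r t := fun t => sqrt_nonneg _
  have he01 : ∀ t, 0 ≤ e t ∧ e t ≤ 1 := fun t => by simp only [he]; split_ifs <;> simp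
  have har : ∀ t, |a t / r t| ≤ 1 := fun t => by
    rw [abs_div, abs_of_nonneg (hr0 t)]
    apply div_le_one_of_le₀ _ (hr0 t)
    exact abs_le_sqrt (by nlinarith [sq_nonneg (b t)])
  have hbr : ∀ t, |b t / r t| ≤ 1 := fun t => by
    rw [abs_div, abs_of_nonneg (hr0 t)]
    apply div_le_one_of_le₀ _ (hr0 t)
    exact abs_le_sqrt (by nlinarith [sq_nonneg (a t)])
  have hw1 : MemLp (fun t => e t * (a t / r t)) 2 (volume.restrict (Ioc 0 A)) :=
    memLp_bdd (by fun_prop) (C := 1) fun t => by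
      rw [abs_mul, abs_of_nonneg (he01 t).1]; exact mul_le_one₀ (he01 t).2 (abs_nonneg _) (har t)
  have hw2 : MemLp (fun t => e t * (b t / r t)) 2 (volume.restrict (Ioc 0 A)) :=
    memLp_bdd (by fun_prop) (C := 1) fun t => by
      rw [abs_mul, abs_of_nonneg (he01 t).1]; exact mul_le_one₀ (he01 t).2 (abs_nonneg _) (hbr t)
  have hei : Integrable e (volume.restrict (Ioc 0 A)) :=
    (memLp_bdd hem (C := 1) fun t => by
      rw [abs_of_nonneg (he01 t).1]; exact (he01 t).2).integrable (by norm_num)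
  have hlim := (h _ hw1).add (h' _ hw2)
  have i1 := integrable_mul_of_memLp hw1 ha2
  have i2 := integrable_mul_of_memLp hw2 hb2
  rw [← integral_add i1 i2] at hlim
  have hle : ∫ t in Ioc 0 A, (e t * (a t / r t) * a t + e t * (b t / r t) * b t) ≤
      ∫ t in Ioc 0 A, e t := by
    refine le_of_tendsto' hlim fun n => ?_
    rw [← integral_add (integrable_mul_of_memLp hw1 (hf2 n)) (integrable_mul_of_memLp hw2 (hf2' n))]
    refine integral_mono ((integrable_mul_of_memLp hw1 (hf2 n)).add
      (integrable_mul_of_memLp hw2 (hf2' n))) hei fun t => ?_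
    have hcs : (a t / r t) * f n t + (b t / r t) * f' n t ≤ 1 := by
      have h1 : (a t / r t) ^ 2 + (b t / r t) ^ 2 ≤ 1 := by
        rw [div_pow, div_pow, ← add_div, hsq]; exact div_self_le_one _
      nlinarith [hff n t, sq_nonneg (a t / r t - f n t), sq_nonneg (b t / r t - f' n t)]
    have := mul_le_mul_of_nonneg_left hcs (he01 t).1
    simp only
    linarith
  have hpt : ∀ t, e t * (a t / r t) * a t + e t * (b t / r t) * b t = e t * r t := by
    intro t
    rcases (hr0 t).eq_or_lt with h0 | h0
    · have : a t ^ 2 + b t ^ 2 = 0 := by rw [← hsq, ← h0]; simp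
      have he0 : e t = 0 := by simp only [he, this]; norm_num
      simp [he0]
    · field_simp
      rw [← hsq]
  have h2 : 0 ≤ fun t => (e t * (a t / r t) * a t + e t * (b t / r t) * b t) - e t := fun t => by
    simp only [Pi.zero_apply]
    rw [hpt]
    simp only [he]
    split_ifs with hlt
    · have : 1 ≤ r t := by rw [hr]; exact one_le_sqrt.2 hlt.le
      linarith
    · simp
  have i12 : Integrable (fun t => e t * (a t / r t) * a t + e t * (b t / r t) * b t)
      (volume.restrict (Ioc 0 A)) := i1.add i2
  have h3 : ∫ t in Ioc 0 A, ((e t * (a t / r t) * a t + e t * (b t / r t) * b t) - e t) = 0 :=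
    le_antisymm (by rw [integral_sub i12 hei]; linarith) (integral_nonneg h2)
  rw [integral_eq_zero_iff_of_nonneg h2 (i12.sub hei)] at h3
  filter_upwards [h3] with t ht
  by_contra hlt
  push Not at hlt
  rw [hpt] at ht
  simp only [he, if_pos hlt, Pi.zero_apply] at ht
  have : r t = 1 := by linarith
  have := hsq t
  nlinarith

lemma Ul_memLp {A : ℝ} (hA : 0 < A) : MemLp (Ul A) 2 (volume.restrict (Ioc 0 A)) := by
  rw [memLp_two_iff_integrable_sq (measurable_Ul A).aestronglyMeasurable]
  have hinteg : IntegrableOn (fun t : ℝ => 16 * A ^ (1 / 2 : ℝ) * t ^ (-(1 / 2) : ℝ)) (Ioc 0 A) := by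
    rw [← intervalIntegrable_iff_integrableOn_Ioc_of_le hA.le]
    exact (intervalIntegral.intervalIntegrable_rpow' (by norm_num)).const_mul _
  refine Integrable.mono' hinteg ((measurable_Ul A).pow_const 2).aestronglyMeasurable ?_
  filter_upwards [ae_restrict_mem measurableSet_Ioc] with t ht
  rw [norm_of_nonneg (sq_nonneg _)]
  have h1 : Ul A t ≤ 4 * (A / t) ^ (1 / 4 : ℝ) := by
    unfold Ul
    have hq : 0 ≤ A / t := div_nonneg hA.le ht.1.le
    refine max_le (by positivity) ?_
    have := log_le_rpow_div hq (ε := 1 / 4) (by norm_num)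
    linarith
  have h2 : (4 * (A / t) ^ (1 / 4 : ℝ)) ^ 2 = 16 * A ^ (1 / 2 : ℝ) * t ^ (-(1 / 2) : ℝ) := by
    rw [mul_pow, ← rpow_natCast, ← rpow_natCast, ← rpow_mul (div_nonneg hA.le ht.1.le),
      div_rpow hA.le ht.1.le, rpow_neg ht.1.le]
    norm_num
    ring
  rw [← h2]
  exact pow_le_pow_left₀ (Ul_nonneg _ _) h1 2

end Model2

namespace Model2
open Set Filter Topology

section
variable {θ0 α c : ℝ} {I θ u : ℝ → ℝ}

/-- The bound on the mass used in the truncation procedure. -/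
noncomputable def ZA (α c : ℝ) : ℝ := (4 / (c * α)) ^ (1 / α)

lemma ZA_pos (P : Params θ0 α c) : 0 < ZA α c := by
  have := P.c0; have := P.α0; unfold ZA; positivity

lemma two_div_le (P : Params θ0 α c) {Z : ℝ} (hZ : ZA α c ≤ Z) :
    2 / (c * α * Z ^ (α - 1)) ≤ Z / 2 := by
  have h0 := ZA_pos P
  have hc := P.c0
  have hα := P.α0
  have hZ0 : 0 < Z := h0.trans_le hZ
  have h1 : 4 / (c * α) ≤ Z ^ α := by
    have := rpow_le_rpow h0.le hZ hα.le
    rwa [ZA, ← rpow_mul (by positivity), one_div_mul_cancel hα.ne', rpow_one] at this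
  rw [rpow_sub_one hZ0.ne', div_le_iff₀ (by positivity)]
  rw [div_le_iff₀ (by positivity)] at h1
  have : Z / 2 * (c * α * (Z ^ α / Z)) = Z ^ α * (c * α) / 2 := by field_simp
  rw [this]; linarith

lemma reduce_aux (P : Params θ0 α c) (hI : Light I) (n : ℕ) : ∀ u : ℝ → ℝ, Adm2 θ0 θ u →
    IntegrableOn (fun t => zf u t ^ α) (Ioi 0) → zf u 0 ≤ ZA α c * 2 ^ n →
    ∃ u', Adm2 θ0 θ u' ∧ (∀ t, u' t ≤ Ul (2 / (c * α * ZA α c ^ (α - 1))) t) ∧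
      Payoff θ0 α c I θ u ≤ Payoff θ0 α c I θ u' := by
  induction n with
  | zero =>
    intro u ha hz h0
    obtain ⟨h1, -, -, h4⟩ := truncate P hI ha hz (ZA_pos P) (by simpa using h0) rfl rfl
    exact ⟨_, h1, fun t => min_le_right _ _, h4⟩
  | succ n ih =>
    intro u ha hz h0
    have hp : ZA α c ≤ ZA α c * 2 ^ (n + 1) :=
      le_mul_of_one_le_right (ZA_pos P).le (one_le_pow₀ (by norm_num))
    obtain ⟨h1, h2, h3, h4⟩ := truncate P hI ha hz ((ZA_pos P).trans_le hp) h0 rfl rfl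
    have h5 := two_div_le P hp
    obtain ⟨u', g1, g2, g3⟩ := ih _ h1 h2 (h3.trans (h5.trans_eq (by rw [pow_succ]; ring)))
    exact ⟨u', g1, g2, h4.trans g3⟩

lemma payoff_zero (P : Params θ0 α c) : Payoff θ0 α c I θ (fun _ => 0) = 0 := by
  rw [payoff_eq]
  simp [lt, gain_zero, zf, zero_rpow P.α0.ne']

lemma reduce (P : Params θ0 α c) (hI : Light I) (ha : Adm2 θ0 θ u) :
    ∃ u', Adm2 θ0 θ u' ∧ (∀ t, u' t ≤ Ul (2 / (c * α * ZA α c ^ (α - 1))) t) ∧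
      Payoff θ0 α c I θ u ≤ Payoff θ0 α c I θ u' := by
  by_cases hz : IntegrableOn (fun t => zf u t ^ α) (Ioi 0)
  · obtain ⟨n, hn⟩ := pow_unbounded_of_one_lt (zf u 0 / ZA α c) one_lt_two
    rw [div_lt_iff₀ (ZA_pos P)] at hn
    exact reduce_aux P hI n u ha hz (by linarith)
  · refine ⟨fun _ => 0, ⟨ha.1, measurable_const, ha.2.2.1, fun _ => le_rfl, by simp⟩,
      fun t => Ul_nonneg _ _, ?_⟩
    rw [payoff_of_not_integrable P hI ha hz, payoff_zero P]

lemma zf_of_le_Ul {A : ℝ} (hA : 0 < A) (hu : ∀ t, 0 ≤ u t) (hUl : ∀ t, u t ≤ Ul A t) {t : ℝ} 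
    (ht : A ≤ t) : zf u t = 0 := by
  have : ∀ s ∈ Ioi t, u s = 0 := fun s hs => le_antisymm
    ((hUl s).trans_eq (Ul_eq_zero hA (ht.trans (le_of_lt hs)))) (hu s)
  rw [zf, setIntegral_congr_fun measurableSet_Ioi this]; simp

lemma payoff_class (P : Params θ0 α c) (hI : Light I) (ha : Adm2 θ0 θ u) {A : ℝ} (hA : 0 < A)
    (hUl : ∀ t, u t ≤ Ul A t) : Payoff θ0 α c I θ u =
      (∫ t in Ioc 0 A, lt θ0 I θ u t) - c * ∫ t in Ioc 0 A, zf u t ^ α := by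
  have hc : ContinuousOn (fun t => zf u t ^ α) (Icc 0 A) :=
    ((zf_continuousOn ha.2.2.2.2).mono Icc_subset_Ici_self).rpow_const fun _ _ => Or.inr P.α0.le
  have h1 : IntegrableOn (fun t => zf u t ^ α) (Ioc 0 A) :=
    hc.integrableOn_Icc.mono_set Ioc_subset_Icc_self
  have h0 : ∀ t ∈ Ioi A, zf u t ^ α = 0 := fun t ht => by
    rw [zf_of_le_Ul hA ha.2.2.2.1 hUl (le_of_lt ht), zero_rpow P.α0.ne']
  have h0' : ∀ t ∈ Ioi A, lt θ0 I θ u t = 0 := fun t ht => by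
    have : u t = 0 := le_antisymm ((hUl t).trans_eq (Ul_eq_zero hA (le_of_lt ht))) (ha.2.2.2.1 t)
    rw [lt, this, gain_zero, mul_zero]
  have h2 : IntegrableOn (fun t => zf u t ^ α) (Ioi A) :=
    integrableOn_zero.congr_fun (fun t ht => (h0 t ht).symm) measurableSet_Ioi
  have h3 := h1.union h2
  rw [Ioc_union_Ioi_eq_Ioi hA.le] at h3
  have h4 := lt_integrable P hI ha
  rw [payoff_of_integrable P hI ha h3, ← Ioc_union_Ioi_eq_Ioi hA.le,
    setIntegral_union (Ioc_disjoint_Ioi le_rfl) measurableSet_Ioi h1 h2,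
    setIntegral_union (Ioc_disjoint_Ioi le_rfl) measurableSet_Ioi (h4.mono_set Ioc_subset_Ioi_self)
      (h4.mono_set (Ioi_subset_Ioi hA.le)), setIntegral_congr_fun measurableSet_Ioi h0,
      setIntegral_congr_fun measurableSet_Ioi h0']
  simp

lemma payoff_class_le (P : Params θ0 α c) (hI : Light I) (ha : Adm2 θ0 θ u) {A : ℝ} (hA : 0 < A)
    (hUl : ∀ t, u t ≤ Ul A t) : Payoff θ0 α c I θ u ≤ 2 * A := by
  rw [payoff_class P hI ha hA hUl]
  have h1 : ∫ t in Ioc 0 A, lt θ0 I θ u t ≤ ∫ t in Ioi 0, 2 * Ul A t := by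
    refine (setIntegral_mono_set (lt_integrable P hI ha) (ae_of_all _ (lt_nonneg P hI ha))
      (LE.le.eventuallyLE Ioc_subset_Ioi_self)).trans ?_
    exact integral_mono (lt_integrable P hI ha) ((Ul_integral hA).1.const_mul 2) fun t =>
      (lt_le P hI ha t).trans (mul_le_mul_of_nonneg_left (hUl t) zero_le_two)
  rw [integral_const_mul, (Ul_integral hA).2] at h1
  have h2 : 0 ≤ ∫ t in Ioc 0 A, zf u t ^ α :=
    setIntegral_nonneg measurableSet_Ioc fun t _ => rpow_nonneg (zf_nonneg ha.2.2.2.1 t) _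
  have := mul_nonneg P.c0.le h2
  linarith

lemma WeakLim.primitive {A : ℝ} {f : ℕ → ℝ → ℝ} {g : ℝ → ℝ} (h : WeakLim A f g) {s t : ℝ}
    (hs : 0 ≤ s) (ht : t ≤ A) :
    Tendsto (fun n => ∫ r in Ioc s t, f n r) atTop (𝓝 (∫ r in Ioc s t, g r)) := by
  classical
  set w : ℝ → ℝ := (Ioc s t).indicator fun _ => 1 with hw
  have hw2 : MemLp w 2 (volume.restrict (Ioc 0 A)) :=
    memLp_bdd (C := 1) (measurable_const.indicator measurableSet_Ioc) fun r => by
      simp only [hw, indicator]; split_ifs <;> simp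
  have e : ∀ f : ℝ → ℝ, ∫ r in Ioc 0 A, w r * f r = ∫ r in Ioc s t, f r := fun f => by
    have : (fun r => w r * f r) = (Ioc s t).indicator f := by
      funext r; simp only [hw, indicator]; split_ifs <;> simp
    rw [this, setIntegral_indicator measurableSet_Ioc,
      inter_eq_right.2 (Ioc_subset_Ioc hs ht)]
  simpa only [e] using h w hw2

end
end Model2

namespace Model2
open Set Filter Topology

section
variable {θ0 α c : ℝ} {I θ u : ℝ → ℝ}

lemma yf_eq_Ioc {t : ℝ} (ht : 0 ≤ t) : yf θ t = ∫ s in Ioc 0 t, sin (θ s) :=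
  intervalIntegral.integral_of_le ht

lemma zf_eq_Ioc {A : ℝ} (hA : 0 < A) (hi : IntegrableOn u (Ioi 0)) (hu : ∀ t, 0 ≤ u t)
    (hUl : ∀ t, u t ≤ Ul A t) {t : ℝ} (ht : t ∈ Icc 0 A) : zf u t = ∫ s in Ioc t A, u s := by
  rw [zf_add hi ht.1 ht.2, zf_of_le_Ul hA hu hUl le_rfl, add_zero,
    intervalIntegral.integral_of_le ht.2]

lemma zpow_limit (P : Params θ0 α c) {A : ℝ} (hA : 0 < A) {v : ℕ → ℝ → ℝ} {u : ℝ → ℝ}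
    (hm : ∀ n, IntegrableOn (v n) (Ioi 0)) (h0 : ∀ n t, 0 ≤ v n t) (hU : ∀ n t, v n t ≤ Ul A t)
    (hlim : ∀ t ∈ Icc 0 A, Tendsto (fun n => zf (v n) t) atTop (𝓝 (zf u t))) :
    Tendsto (fun n => ∫ t in Ioc 0 A, zf (v n) t ^ α) atTop (𝓝 (∫ t in Ioc 0 A, zf u t ^ α)) := by
  refine tendsto_integral_of_dominated_convergence (fun _ => A ^ α) (fun n => ?_) (by simp)
    (fun n => ?_) ?_
  · exact (zfpow_aesm (hm n) P.α0.le).mono_measure (Measure.restrict_mono Ioc_subset_Ioi_self le_rfl)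
  · filter_upwards [ae_restrict_mem measurableSet_Ioc] with t ht
    have hz := zf_nonneg (h0 n) t
    rw [norm_of_nonneg (rpow_nonneg hz _)]
    apply rpow_le_rpow hz _ P.α0.le
    refine (zf_antitone (hm n) (h0 n) le_rfl ht.1.le).trans ?_
    refine (zf_le_of_le (Ul_integral hA).1 (hm n) (fun t _ => hU n t) le_rfl).trans_eq ?_
    exact (Ul_integral hA).2
  · filter_upwards [ae_restrict_mem measurableSet_Ioc] with t ht
    exact (hlim t ⟨ht.1.le, ht.2⟩).rpow_const (Or.inr P.α0.le)

lemma exists_opt_class (P : Params θ0 α c) (hI : Light I) {A : ℝ} (hA : 0 < A) :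
    ∃ θ u, Adm2 θ0 θ u ∧ (∀ t, u t ≤ Ul A t) ∧ ∀ θ' u', Adm2 θ0 θ' u' → (∀ t, u' t ≤ Ul A t) →
      Payoff θ0 α c I θ' u' ≤ Payoff θ0 α c I θ u := by
  set S : Set ℝ := {r | ∃ θ u, Adm2 θ0 θ u ∧ (∀ t, u t ≤ Ul A t) ∧ Payoff θ0 α c I θ u = r} with hS
  have hne : S.Nonempty := ⟨_, fun _ => θ0, fun _ => 0, ⟨measurable_const, measurable_const,
    fun _ => ⟨le_rfl, P.lt.le⟩, fun _ => le_rfl, by simp⟩, fun t => Ul_nonneg _ _, rfl⟩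
  have hbdd : BddAbove S := ⟨2 * A, by
    rintro r ⟨θ, u, ha, hu, rfl⟩; exact payoff_class_le P hI ha hA hu⟩
  obtain ⟨p, -, hp, hpS⟩ := exists_seq_tendsto_sSup hne hbdd
  choose Θ V hadm hVU hpay using hpS
  have hUm := Ul_memLp hA
  have hone : MemLp (fun _ => (1 : ℝ)) 2 (volume.restrict (Ioc 0 A)) :=
    memLp_bdd (C := 1) measurable_const (by simp)
  have hcosm : ∀ n, Measurable fun t => cos (Θ n t) := fun n => measurable_cos.comp (hadm n).1
  have hsinm : ∀ n, Measurable fun t => sin (Θ n t) := fun n => measurable_sin.comp (hadm n).1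
  obtain ⟨φ1, hφ1, a, ham, ha2, hal⟩ := weak_subseq hcosm hone (fun n t => abs_cos_le_one _)
  obtain ⟨φ2, hφ2, b, hbm, hb2, hbl⟩ := weak_subseq (fun n => hsinm (φ1 n)) hone
    (fun n t => abs_sin_le_one _)
  obtain ⟨φ3, hφ3, u0, hu0m, hu02, hu0l⟩ := weak_subseq (fun n => (hadm (φ1 (φ2 n))).2.1) hUm
    (fun n t => by rw [abs_of_nonneg ((hadm _).2.2.2.1 t)]; exact hVU _ t)
  set φ : ℕ → ℕ := fun n => φ1 (φ2 (φ3 n)) with hφ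
  have hφm : StrictMono φ := hφ1.comp (hφ2.comp hφ3)
  have wa : WeakLim A (fun n t => cos (Θ (φ n) t)) a :=
    (show WeakLim A (fun n t => cos (Θ (φ1 n) t)) a from hal).comp (hφ2.comp hφ3)
  have wb : WeakLim A (fun n t => sin (Θ (φ n) t)) b :=
    (show WeakLim A (fun n t => sin (Θ (φ1 (φ2 n)) t)) b from hbl).comp hφ3
  have wu : WeakLim A (fun n => V (φ n)) u0 := hu0l
  have mcos : ∀ n, MemLp (fun t => cos (Θ (φ n) t)) 2 (volume.restrict (Ioc 0 A)) :=
    fun n => memLp_bdd (hcosm _) (fun t => abs_cos_le_one _)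
  have msin : ∀ n, MemLp (fun t => sin (Θ (φ n) t)) 2 (volume.restrict (Ioc 0 A)) :=
    fun n => memLp_bdd (hsinm _) (fun t => abs_sin_le_one _)
  have mV : ∀ n, MemLp (V (φ n)) 2 (volume.restrict (Ioc 0 A)) := fun n =>
    hUm.mono (hadm _).2.1.aestronglyMeasurable (ae_of_all _ fun t => by
      rw [norm_of_nonneg ((hadm _).2.2.2.1 t), norm_of_nonneg (Ul_nonneg _ _)]; exact hVU _ t)
  have hcirc := wa.circle wb ham hbm ha2 hb2 mcos msin (fun n t => cos_sq_add_sin_sq _)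
  have hbσ := wb.ge hbm hb2 (l := fun _ => sin θ0) measurable_const
    (memLp_bdd measurable_const (fun t => abs_sin_le_one _)) msin
    (fun n t => P.sin_le ((hadm _).2.2.1 t))
  have hu00 := wu.ge hu0m hu02 (l := fun _ => 0) measurable_const
    (memLp_bdd (C := 0) measurable_const (by simp)) mV (fun n t => (hadm _).2.2.2.1 t)
  have hu0U := wu.neg.ge hu0m.neg hu02.neg (l := fun t => - Ul A t) (measurable_Ul A).neg hUm.neg
    (fun n => (mV n).neg) (fun n t => neg_le_neg (hVU _ t))
  set θ : ℝ → ℝ := fun t => arcsin (max (sin θ0) (min (b t) 1)) with hθ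
  set u : ℝ → ℝ := fun t => max 0 (min (u0 t) (Ul A t)) with hu
  have huU : ∀ t, u t ≤ Ul A t := fun t => max_le (Ul_nonneg _ _) (min_le_right _ _)
  have hu0 : ∀ t, 0 ≤ u t := fun t => le_max_left _ _
  have hum : Measurable u := measurable_const.max (hu0m.min (measurable_Ul A))
  have hui : IntegrableOn u (Ioi 0) := (Ul_integral hA).1.mono' hum.aestronglyMeasurable
    (ae_of_all _ fun t => by rw [norm_of_nonneg (hu0 t)]; exact huU t)
  have hθm : Measurable θ := measurable_arcsin.comp (measurable_const.max (hbm.min measurable_const))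
  have hadm' : Adm2 θ0 θ u := by
    refine ⟨hθm, hum, fun t => ⟨?_, arcsin_le_pi_div_two _⟩, hu0, hui⟩
    rw [hθ, le_arcsin_iff_sin_le' ⟨by linarith [P.pos, pi_pos], P.lt.le⟩]
    exact le_max_left _ _
  have hsinθ : ∀ᵐ t ∂(volume.restrict (Ioc 0 A)), sin (θ t) = b t := by
    filter_upwards [hcirc, hbσ] with t h1 h2
    have hb1 : b t ≤ 1 := by nlinarith [sq_nonneg (a t)]
    simp only [hθ]
    rw [min_eq_left hb1, max_eq_right h2, sin_arcsin (by linarith [P.sin_pos]) hb1]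
  have hueq : ∀ᵐ t ∂(volume.restrict (Ioc 0 A)), u t = u0 t := by
    filter_upwards [hu00, hu0U] with t h1 h2
    simp only [hu]
    rw [min_eq_left (by linarith), max_eq_right h1]
  have hs : ∀ᵐ t ∂(volume.restrict (Ioc 0 A)),
      cos θ0 * a t + sin θ0 * b t ≤ cos (θ t - θ0) := by
    filter_upwards [hcirc, hsinθ] with t h1 h2
    have hc0 : 0 ≤ cos (θ t) := cos_nonneg_of_mem_Icc ⟨by
      linarith [(hadm'.2.2.1 t).1, P.pos, pi_pos], (hadm'.2.2.1 t).2⟩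
    have h3 : a t ≤ cos (θ t) := by
      apply le_of_sq_le_sq _ hc0
      rw [← h2] at h1
      nlinarith [cos_sq_add_sin_sq (θ t)]
    rw [cos_sub, h2]
    nlinarith [mul_le_mul_of_nonneg_left h3 P.cos_pos.le]
  have hylim : ∀ t ∈ Icc 0 A, Tendsto (fun n => yf (Θ (φ n)) t) atTop (𝓝 (yf θ t)) := by
    intro t ht
    have := wb.primitive le_rfl ht.2
    simp only [yf_eq_Ioc ht.1]
    have e : ∫ s in Ioc 0 t, sin (θ s) = ∫ s in Ioc 0 t, b s :=
      integral_congr_ae (ae_restrict_of_ae_restrict_of_subset (Ioc_subset_Ioc le_rfl ht.2) hsinθ)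
    rw [e]; exact this
  have hzlim : ∀ t ∈ Icc 0 A, Tendsto (fun n => zf (V (φ n)) t) atTop (𝓝 (zf u t)) := by
    intro t ht
    have := wu.primitive ht.1 le_rfl
    have e : ∫ s in Ioc t A, u s = ∫ s in Ioc t A, u0 s :=
      integral_congr_ae (ae_restrict_of_ae_restrict_of_subset (Ioc_subset_Ioc ht.1 le_rfl) hueq)
    rw [zf_eq_Ioc hA hui hu0 huU ht, e]
    refine this.congr fun n => ?_
    rw [zf_eq_Ioc hA (hadm _).2.2.2.2 (hadm _).2.2.2.1 (hVU _) ht]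
  have hzpow := zpow_limit P hA (fun n => (hadm (φ n)).2.2.2.2) (fun n => (hadm (φ n)).2.2.2.1)
    (fun n => hVU (φ n)) hzlim
  refine ⟨θ, u, hadm', huU, fun θ' u' h1 h2 => (le_csSup hbdd ⟨θ', u', h1, h2, rfl⟩).trans ?_⟩
  set x : ℝ → ℝ := fun t => u t / cos (θ t - θ0) with hx
  have hspos : ∀ t, 0 < cos (θ t - θ0) := fun t => P.cos_sub_pos (hadm'.2.2.1 t)
  have hx0 : ∀ t, 0 ≤ x t := fun t => div_nonneg (hu0 t) (hspos t).le
  have hsm : Measurable fun t => cos (θ t - θ0) := measurable_cos.comp (hθm.sub_const _)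
  have hxm : Measurable x := hum.div hsm
  have hhm : Measurable fun t => hh (x t) := continuous_hh.measurable.comp hxm
  set W : ℝ → ℝ := fun t => I (yf θ t) with hW
  have hWm : Measurable W := (hI.cont.comp (yf_continuous hθm)).measurable
  have hW0 : ∀ t, 0 ≤ W t := fun t => (hI.pos _).le
  have hex : ∀ t, exp (-x t) ≤ 1 := fun t => exp_le_one_iff.2 (by linarith [hx0 t])
  have m1 : MemLp (fun t => W t * hh (x t) * cos θ0) 2 (volume.restrict (Ioc 0 A)) :=
    memLp_bdd (C := 2) ((hWm.mul hhm).mul_const _) fun t => by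
      have h := mul_le_mul (hI.le_two (yf θ t)) (hh_le_one (hx0 t)) (hh_nonneg (hx0 t)) zero_le_two
      have h' := mul_nonneg (hW0 t) (hh_nonneg (hx0 t))
      rw [abs_of_nonneg (mul_nonneg h' P.cos_pos.le)]
      have := mul_le_mul h (cos_le_one θ0) P.cos_pos.le (by norm_num)
      simpa using this
  have m2 : MemLp (fun t => W t * hh (x t) * sin θ0) 2 (volume.restrict (Ioc 0 A)) :=
    memLp_bdd (C := 2) ((hWm.mul hhm).mul_const _) fun t => by
      have h := mul_le_mul (hI.le_two (yf θ t)) (hh_le_one (hx0 t)) (hh_nonneg (hx0 t)) zero_le_two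
      have h' := mul_nonneg (hW0 t) (hh_nonneg (hx0 t))
      rw [abs_of_nonneg (mul_nonneg h' P.sin_pos.le)]
      have := mul_le_mul h (sin_le_one θ0) P.sin_pos.le (by norm_num)
      simpa using this
  have m3 : MemLp (fun t => W t * exp (-x t)) 2 (volume.restrict (Ioc 0 A)) :=
    memLp_bdd (C := 2) (hWm.mul (hxm.neg.exp)) fun t => by
      rw [abs_of_nonneg (mul_nonneg (hW0 t) (exp_pos _).le)]
      have := mul_le_mul (hI.le_two (yf θ t)) (hex t) (exp_pos _).le zero_le_two
      simpa using this
  have i1 := fun n => integrable_mul_of_memLp m1 (mcos n)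
  have i2 := fun n => integrable_mul_of_memLp m2 (msin n)
  have i3 := fun n => integrable_mul_of_memLp m3 (mV n)
  have lim1 := ((wa _ m1).add (wb _ m2)).add (wu _ m3)
  set E : ℕ → ℝ → ℝ := fun n t => (I (yf (Θ (φ n)) t) - W t) *
    (cos (Θ (φ n) t - θ0) * hh (x t) + exp (-x t) * V (φ n) t) with hE
  have hbr : ∀ n t, 0 ≤ cos (Θ (φ n) t - θ0) * hh (x t) + exp (-x t) * V (φ n) t ∧
      cos (Θ (φ n) t - θ0) * hh (x t) + exp (-x t) * V (φ n) t ≤ 1 + Ul A t := by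
    intro n t
    have c0 := (P.cos_sub_pos ((hadm (φ n)).2.2.1 t)).le
    have v0 := (hadm (φ n)).2.2.2.1 t
    have h0 := hh_nonneg (hx0 t)
    refine ⟨by positivity, add_le_add ?_ ?_⟩
    · exact mul_le_one₀ (cos_le_one _) h0 (hh_le_one (hx0 t))
    · calc _ ≤ 1 * V (φ n) t := mul_le_mul_of_nonneg_right (hex t) v0
        _ ≤ _ := by rw [one_mul]; exact hVU _ t
  have hEm : ∀ n, Measurable (E n) := fun n => by
    have q1 : Measurable fun t => I (yf (Θ (φ n)) t) :=
      (hI.cont.comp (yf_continuous (hadm _).1)).measurable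
    have q2 : Measurable fun t => cos (Θ (φ n) t - θ0) := measurable_cos.comp ((hadm _).1.sub_const _)
    exact (q1.sub hWm).mul ((q2.mul hhm).add (hxm.neg.exp.mul (hadm _).2.1))
  have hUi : IntegrableOn (fun t => 1 + Ul A t) (Ioc 0 A) :=
    Integrable.add (by simp) ((Ul_integral hA).1.mono_set Ioc_subset_Ioi_self)
  have hEb : ∀ n t, ‖E n t‖ ≤ 2 * (1 + Ul A t) := fun n t => by
    rw [norm_eq_abs, abs_mul, abs_of_nonneg (hbr n t).1]
    refine mul_le_mul ?_ (hbr n t).2 (hbr n t).1 zero_le_two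
    have := hI.le_two (yf (Θ (φ n)) t)
    have := hI.le_two (yf θ t)
    have := hI.pos (yf (Θ (φ n)) t)
    have := hI.pos (yf θ t)
    rw [abs_le]; constructor <;> simp only [hW] <;> linarith
  have hEi : ∀ n, IntegrableOn (E n) (Ioc 0 A) := fun n =>
    (hUi.const_mul 2).mono' (hEm n).aestronglyMeasurable (ae_of_all _ (hEb n))
  have lim2 : Tendsto (fun n => ∫ t in Ioc 0 A, E n t) atTop (𝓝 (∫ t in Ioc 0 A, (0 : ℝ))) := by
    refine tendsto_integral_of_dominated_convergence (fun t => 2 * (1 + Ul A t))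
      (fun n => (hEm n).aestronglyMeasurable) (hUi.const_mul 2) (fun n => ae_of_all _ (hEb n)) ?_
    filter_upwards [ae_restrict_mem measurableSet_Ioc] with t ht
    have h1 : Tendsto (fun n => I (yf (Θ (φ n)) t) - W t) atTop (𝓝 0) := by
      rw [← sub_self (W t)]
      exact ((hI.cont.tendsto _).comp (hylim t ⟨ht.1.le, ht.2⟩)).sub_const _
    rw [tendsto_zero_iff_norm_tendsto_zero]
    have h2 := (h1.norm).mul_const (1 + Ul A t)
    rw [norm_zero, zero_mul] at h2
    refine squeeze_zero (fun n => norm_nonneg _) (fun n => ?_) h2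
    rw [norm_mul]
    refine mul_le_mul_of_nonneg_left ?_ (norm_nonneg _)
    rw [norm_of_nonneg (hbr n t).1]; exact (hbr n t).2
  have hlt : ∀ n, ∫ t in Ioc 0 A, lt θ0 I (Θ (φ n)) (V (φ n)) t ≤
      (∫ t in Ioc 0 A, W t * hh (x t) * cos θ0 * cos (Θ (φ n) t)) +
      (∫ t in Ioc 0 A, W t * hh (x t) * sin θ0 * sin (Θ (φ n) t)) +
      (∫ t in Ioc 0 A, W t * exp (-x t) * V (φ n) t) + ∫ t in Ioc 0 A, E n t := by
    intro n
    have i12 := (i1 n).fun_add (i2 n)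
    have i123 := i12.fun_add (i3 n)
    rw [← integral_add (i1 n) (i2 n), ← integral_add i12 (i3 n), ← integral_add i123 (hEi n)]
    refine integral_mono ((lt_integrable P hI (hadm _)).mono_set Ioc_subset_Ioi_self)
      (i123.add (hEi n)) fun t => ?_
    have h := mul_le_mul_of_nonneg_left
      (gain_le_tangent (P.cos_sub_pos ((hadm (φ n)).2.2.1 t)) (V (φ n) t) (x t))
      (hI.pos (yf (Θ (φ n)) t)).le
    have e : cos (Θ (φ n) t - θ0) = cos (Θ (φ n) t) * cos θ0 + sin (Θ (φ n) t) * sin θ0 :=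
      cos_sub _ _
    simp only [lt, hE] at h ⊢
    refine h.trans (le_of_eq ?_)
    rw [e]; ring
  have hlim0 : Tendsto (fun n => p (φ n)) atTop (𝓝 (sSup S)) := hp.comp hφm.tendsto_atTop
  have hlim3 := (lim1.add lim2).sub (hzpow.const_mul c)
  have hsup := le_of_tendsto_of_tendsto' hlim0 hlim3 fun n => by
    rw [← hpay, payoff_class P hI (hadm _) hA (hVU _)]
    exact sub_le_sub_right (hlt n) _
  refine hsup.trans ?_
  rw [payoff_class P hI hadm' hA huU]
  refine sub_le_sub_right ?_ _
  rw [integral_zero, add_zero]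
  have i1' := integrable_mul_of_memLp m1 ha2
  have i2' := integrable_mul_of_memLp m2 hb2
  have i3' := integrable_mul_of_memLp m3 hu02
  have i12' := i1'.fun_add i2'
  rw [← integral_add i1' i2', ← integral_add i12' i3']
  refine integral_mono_ae (i12'.add i3')
    ((lt_integrable P hI hadm').mono_set Ioc_subset_Ioi_self) ?_
  filter_upwards [hs, hueq] with t h1 h2
  have e : u t = cos (θ t - θ0) * x t := by simp only [hx]; field_simp [(hspos t).ne']
  have h3 := gain_mul_tangent (hspos t) (x t)
  rw [← e] at h3
  have h4 := mul_le_mul_of_nonneg_left h1 (mul_nonneg (hW0 t) (hh_nonneg (hx0 t)))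
  simp only [lt, h3, ← h2]
  change _ ≤ W t * _
  linarith

/-- Problem (OP2) has an optimal solution. -/
theorem exists_opt (P : Params θ0 α c) (hI : Light I) :
    ∃ θ u, Adm2 θ0 θ u ∧ ∀ θ' u', Adm2 θ0 θ' u' → Payoff θ0 α c I θ' u' ≤ Payoff θ0 α c I θ u := by
  have hA : 0 < 2 / (c * α * ZA α c ^ (α - 1)) := by
    have := ZA_pos P; have := P.c0; have := P.α0; positivity
  obtain ⟨θ, u, h1, -, h3⟩ := exists_opt_class P hI hA
  refine ⟨θ, u, h1, fun θ' u' h => ?_⟩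
  obtain ⟨v, g1, g2, g3⟩ := reduce P hI h
  exact g3.trans (h3 _ _ g1 g2)

end
end Model2

namespace Model2
open Set Filter Topology

/-- Optimality in (OP2). -/
def Opt (θ0 α c : ℝ) (I θ u : ℝ → ℝ) : Prop :=
  Adm2 θ0 θ u ∧ ∀ θ' u', Adm2 θ0 θ' u' → Payoff θ0 α c I θ' u' ≤ Payoff θ0 α c I θ u

/-- The marginal cost of placing leaves at arc length `t`. -/
noncomputable def Rf (α c : ℝ) (u : ℝ → ℝ) (t : ℝ) : ℝ :=
  ∫ s in (0 : ℝ)..t, c * α * zf u s ^ (α - 1)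

/-- An a priori bound on the mass and the length of optimal stems. -/
noncomputable def Zb (α c : ℝ) : ℝ := (2 / (c * α)) ^ (1 / α)

section
variable {θ0 α c : ℝ} {I θ u : ℝ → ℝ}

lemma Zb_pos (P : Params θ0 α c) : 0 < Zb α c := by
  have := P.c0; have := P.α0; unfold Zb; positivity

lemma Zb_rpow (P : Params θ0 α c) : Zb α c ^ α = 2 / (c * α) := by
  have hc := P.c0
  have hα := P.α0
  rw [Zb, ← rpow_mul (by positivity), one_div_mul_cancel hα.ne', rpow_one]

lemma zf_indicator {δ : ℝ} {t : ℝ} (ht : t ∈ Icc 0 δ) :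
    zf ((Ioc 0 δ).indicator fun _ => 1) t = δ - t := by
  rw [zf, setIntegral_indicator measurableSet_Ioc]
  have : Ioi t ∩ Ioc 0 δ = Ioc t δ := by
    ext s; simp only [mem_inter_iff, mem_Ioi, mem_Ioc]
    constructor
    · rintro ⟨h1, h2, h3⟩; exact ⟨h1, h3⟩
    · rintro ⟨h1, h2⟩; exact ⟨h1, ht.1.trans_lt h1, h2⟩
  rw [this]; simp [ht.2]

lemma zf_indicator_zero {δ : ℝ} {t : ℝ} (ht : δ < t) :
    zf ((Ioc 0 δ).indicator fun _ => 1) t = 0 := by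
  rw [zf, setIntegral_indicator measurableSet_Ioc]
  have : Ioi t ∩ Ioc 0 δ = ∅ := by
    ext s; simp only [mem_inter_iff, mem_Ioi, mem_Ioc, mem_empty_iff_false, iff_false]
    rintro ⟨h1, h2, h3⟩; linarith
  rw [this]; simp

lemma exists_payoff_pos (P : Params θ0 α c) (hI : Light I) :
    ∃ θ' u', Adm2 θ0 θ' u' ∧ 0 < Payoff θ0 α c I θ' u' := by
  set g := I 0 * gain 1 1 with hg
  have hg1 : 0 < gain 1 1 := by
    simp [gain]
  have hg0 : 0 < g := mul_pos (hI.pos 0) hg1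
  have hc := P.c0
  set δ := (g / (2 * c)) ^ (1 / α) with hδ
  have hδ0 : 0 < δ := by positivity
  have hδα : c * δ ^ α = g / 2 := by
    rw [hδ, ← rpow_mul (by positivity), one_div_mul_cancel P.α0.ne', rpow_one]; field_simp
  set v : ℝ → ℝ := (Ioc 0 δ).indicator fun _ => 1 with hv
  have hvm : Measurable v := measurable_const.indicator measurableSet_Ioc
  have ha : Adm2 θ0 (fun _ => θ0) v := ⟨measurable_const, hvm, fun _ => ⟨le_rfl, P.lt.le⟩,
    fun t => indicator_nonneg (fun _ _ => zero_le_one) t, by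
      rw [hv]; exact ((integrable_indicator_iff measurableSet_Ioc).2 (by simp)).integrableOn⟩
  have hzle : ∀ t > 0, zf v t ^ α ≤ (Ioc 0 δ).indicator (fun _ => δ ^ α) t := by
    intro t ht
    by_cases h : t ≤ δ
    · rw [zf_indicator ⟨ht.le, h⟩, indicator_of_mem (show t ∈ Ioc 0 δ from ⟨ht, h⟩)]
      exact rpow_le_rpow (by linarith) (by linarith) P.α0.le
    · rw [zf_indicator_zero (not_le.1 h), zero_rpow P.α0.ne']
      exact indicator_nonneg (fun _ _ => by positivity) _
  have hib : IntegrableOn ((Ioc 0 δ).indicator fun _ : ℝ => δ ^ α) (Ioi 0) :=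
    ((integrable_indicator_iff measurableSet_Ioc).2 (by simp)).integrableOn
  have hz : IntegrableOn (fun t => zf v t ^ α) (Ioi 0) := by
    refine hib.mono' (zfpow_aesm ha.2.2.2.2 P.α0.le) ?_
    filter_upwards [ae_restrict_mem measurableSet_Ioi] with t ht
    rw [norm_of_nonneg (rpow_nonneg (zf_nonneg ha.2.2.2.1 t) _)]
    exact hzle t ht
  refine ⟨_, v, ha, ?_⟩
  rw [payoff_of_integrable P hI ha hz]
  have h1 : ∫ t in Ioi (0 : ℝ), zf v t ^ α ≤ δ * δ ^ α := by
    refine (setIntegral_mono_on hz hib measurableSet_Ioi hzle).trans_eq ?_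
    rw [setIntegral_indicator measurableSet_Ioc, inter_eq_right.2 Ioc_subset_Ioi_self]
    simp [hδ0.le]
  have hib' : IntegrableOn ((Ioc 0 δ).indicator fun _ : ℝ => g) (Ioi 0) :=
    ((integrable_indicator_iff measurableSet_Ioc).2 (by simp)).integrableOn
  have h2 : δ * g ≤ ∫ t in Ioi (0 : ℝ), lt θ0 I (fun _ => θ0) v t := by
    refine le_trans (le_of_eq ?_) (setIntegral_mono_on hib' (lt_integrable P hI ha) measurableSet_Ioi
      fun t ht => ?_)
    · rw [setIntegral_indicator measurableSet_Ioc, inter_eq_right.2 Ioc_subset_Ioi_self]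
      simp [hδ0.le]
    · by_cases h : t ≤ δ
      · rw [lt, hv, indicator_of_mem (show t ∈ Ioc 0 δ from ⟨ht, h⟩), indicator_of_mem (show t ∈ Ioc 0 δ from ⟨ht, h⟩), sub_self, cos_zero]
        refine mul_le_mul_of_nonneg_right (hI.mono ?_) hg1.le
        have := le_yf P ha.1 ha.2.2.1 (le_of_lt ht)
        exact (mul_nonneg P.sin_pos.le (le_of_lt ht)).trans this
      · rw [indicator_of_notMem (fun h' => h h'.2)]; exact lt_nonneg P hI ha t
  have h3 := mul_le_mul_of_nonneg_left h1 hc.le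
  have : c * (δ * δ ^ α) = δ * (g / 2) := by rw [← hδα]; ring
  rw [this] at h3
  nlinarith [mul_pos hδ0 hg0]

lemma Opt.payoff_pos (P : Params θ0 α c) (hI : Light I) (ho : Opt θ0 α c I θ u) :
    0 < Payoff θ0 α c I θ u := by
  obtain ⟨θ', u', h1, h2⟩ := exists_payoff_pos P hI
  exact h2.trans_le (ho.2 _ _ h1)

lemma Opt.integrable (P : Params θ0 α c) (hI : Light I) (ho : Opt θ0 α c I θ u) :
    IntegrableOn (fun t => zf u t ^ α) (Ioi 0) := by
  by_contra h
  have := ho.payoff_pos P hI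
  rw [payoff_of_not_integrable P hI ho.1 h] at this
  exact lt_irrefl _ this

lemma Opt.zf_pos (P : Params θ0 α c) (hI : Light I) (ho : Opt θ0 α c I θ u) : 0 < zf u 0 := by
  refine (zf_nonneg ho.1.2.2.2.1 0).lt_of_ne' fun h => ?_
  have h1 := (ho.1.2.2.2.2).const_mul 2
  have h2 := integral_mono (lt_integrable P hI ho.1) h1 (lt_le P hI ho.1)
  rw [integral_const_mul] at h2
  change _ ≤ 2 * zf u 0 at h2
  have h3 := ho.payoff_pos P hI
  rw [payoff_of_integrable P hI ho.1 (ho.integrable P hI)] at h3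
  have h4 : 0 ≤ ∫ t in Ioi (0 : ℝ), zf u t ^ α :=
    setIntegral_nonneg measurableSet_Ioi fun t _ => rpow_nonneg (zf_nonneg ho.1.2.2.2.1 t) _
  nlinarith [mul_nonneg P.c0.le h4]

lemma gain_best {s W R v u : ℝ} (hs : 0 < s) (hW : 0 < W) (hR : 0 < R) (hu : 0 ≤ u)
    (hv : v = s * max 0 (log (W / R))) :
    W * gain s u - R * u ≤ W * gain s v - R * v ∧
      (W * gain s u - R * u = W * gain s v - R * v → u = v) := by
  rcases le_total W R with h | h
  · have hl : log (W / R) ≤ 0 := log_nonpos (by positivity) ((div_le_one hR).2 h)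
    rw [max_eq_left hl, mul_zero] at hv
    rw [hv, gain_zero, mul_zero, mul_zero, sub_zero]
    have h1 := gain_le_self hs u
    have h2 := mul_le_mul_of_nonneg_left h1 hW.le
    have h3 := mul_le_mul_of_nonneg_right h hu
    refine ⟨by linarith, fun he => ?_⟩
    by_contra hne
    have h4 := gain_lt_tangent (x := 0) hs (u := u) (by simpa using hne)
    simp [hh_zero] at h4
    have := mul_lt_mul_of_pos_left h4 hW
    linarith
  · have hl : 0 ≤ log (W / R) := log_nonneg ((one_le_div hR).2 h)
    rw [max_eq_right hl] at hv
    have hex : W * exp (-log (W / R)) = R := by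
      rw [exp_neg, exp_log (by positivity)]; field_simp
    have h0 := gain_mul_tangent hs (log (W / R))
    rw [← hv] at h0
    have h1 := mul_le_mul_of_nonneg_left (gain_le_tangent hs u (log (W / R))) hW.le
    have e : ∀ r, W * (s * hh (log (W / R)) + exp (-log (W / R)) * r) =
        W * (s * hh (log (W / R))) + R * r := fun r => by
      rw [mul_add, ← mul_assoc, ← mul_assoc, hex, mul_assoc]
    rw [e] at h1
    have h2 : W * gain s v = W * (s * hh (log (W / R))) + R * v := by rw [h0, e]
    refine ⟨by linarith, fun he => ?_⟩
    by_contra hne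
    rw [hv] at hne
    have h4 := mul_lt_mul_of_pos_left (gain_lt_tangent hs hne) hW
    rw [e] at h4
    linarith

end
end Model2

namespace Model2
open Set Filter Topology

section
variable {θ0 α c : ℝ} {I θ u : ℝ → ℝ}

lemma mcost_continuousOn (ha : Adm2 θ0 θ u) {T : ℝ} (hT : 0 < zf u T) :
    ContinuousOn (fun t => c * α * zf u t ^ (α - 1)) (Icc 0 T) := by
  refine continuousOn_const.mul (((zf_continuousOn ha.2.2.2.2).mono Icc_subset_Ici_self).rpow_const
    fun t ht => Or.inl ?_)
  exact (hT.trans_le (zf_antitone ha.2.2.2.2 ha.2.2.2.1 ht.1 ht.2)).ne'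

lemma mcost_ge (P : Params θ0 α c) (ha : Adm2 θ0 θ u) {t : ℝ} (ht0 : 0 ≤ t) (ht : 0 < zf u t) :
    c * α * zf u 0 ^ (α - 1) ≤ c * α * zf u t ^ (α - 1) :=
  mul_le_mul_of_nonneg_left (rpow_le_rpow_of_nonpos ht (zf_antitone ha.2.2.2.2 ha.2.2.2.1 le_rfl ht0)
    (by linarith [P.α1])) (mul_pos P.c0 P.α0).le

lemma le_Rf (P : Params θ0 α c) (ha : Adm2 θ0 θ u) {t : ℝ} (ht0 : 0 ≤ t) (ht : 0 < zf u t) :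
    c * α * zf u 0 ^ (α - 1) * t ≤ Rf α c u t := by
  have h := intervalIntegral.integral_mono_on (μ := volume) (f := fun _ => c * α * zf u 0 ^ (α - 1))
    ht0 (by simp) ((mcost_continuousOn (c := c) (α := α) ha ht).intervalIntegrable_of_Icc ht0)
    fun s hs => mcost_ge P ha hs.1 (ht.trans_le (zf_antitone ha.2.2.2.2 ha.2.2.2.1 hs.1 hs.2))
  simp only [intervalIntegral.integral_const, smul_eq_mul, sub_zero] at h
  unfold Rf; linarith

lemma Rf_continuousOn (ha : Adm2 θ0 θ u) {T : ℝ} (hT0 : 0 ≤ T) (hT : 0 < zf u T) :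
    ContinuousOn (Rf α c u) (Icc 0 T) := by
  have := intervalIntegral.continuousOn_primitive_interval (μ := volume) (a := 0) (b := T)
    (f := fun t => c * α * zf u t ^ (α - 1))
    (by rw [uIcc_of_le hT0]; exact (mcost_continuousOn ha hT).integrableOn_Icc)
  rwa [uIcc_of_le hT0] at this

lemma zf_const_tail {u v : ℝ → ℝ} {T : ℝ} (h : ∀ t, T < t → v t = u t) {t : ℝ} (ht : T ≤ t) :
    zf v t = zf u t :=
  setIntegral_congr_fun measurableSet_Ioi fun s hs => h s (lt_of_le_of_lt ht hs)

lemma Ul_log_le {A W R t : ℝ} (ht : 0 < t) (hW : 0 < W) (h : W * t ≤ A * R) (hR : 0 < R) :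
    max 0 (log (W / R)) ≤ Ul A t := by
  refine max_le_max le_rfl (log_le_log (by positivity) ?_)
  rw [div_le_div_iff₀ hR ht]; exact h

lemma Opt.u_eq_aux (P : Params θ0 α c) (hI : Light I) (ho : Opt θ0 α c I θ u) {T : ℝ}
    (hT0 : 0 < T) (hT : 0 < zf u T) : ∀ᵐ t ∂(volume.restrict (Ioc 0 T)),
      u t = cos (θ t - θ0) * max 0 (log (I (yf θ t) / Rf α c u t)) := by
  have ha := ho.1
  obtain ⟨hθm, hum, hθ, hu0, hui⟩ := ho.1
  set r0 := c * α * zf u 0 ^ (α - 1) with hr0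
  have hr0p : 0 < r0 := mul_pos (mul_pos P.c0 P.α0) (rpow_pos_of_pos (ho.zf_pos P hI) _)
  set R := Rf α c u with hR
  have hzp : ∀ t ∈ Icc 0 T, 0 < zf u t := fun t ht => hT.trans_le (zf_antitone hui hu0 ht.1 ht.2)
  have hRge : ∀ t ∈ Icc 0 T, r0 * t ≤ R t := fun t ht => le_Rf P ha ht.1 (hzp t ht)
  have hRpos : ∀ t ∈ Ioc 0 T, 0 < R t := fun t ht =>
    (mul_pos hr0p ht.1).trans_le (hRge t ⟨ht.1.le, ht.2⟩)
  have hRc : ContinuousOn R (Icc 0 T) := Rf_continuousOn ha hT0.le hT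
  set W : ℝ → ℝ := fun t => I (yf θ t) with hW
  have hWc : Continuous W := hI.cont.comp (yf_continuous hθm)
  have hW0 : ∀ t, 0 < W t := fun t => hI.pos _
  have hs : ∀ t, 0 < cos (θ t - θ0) := fun t => P.cos_sub_pos (hθ t)
  have hsm : Measurable fun t => cos (θ t - θ0) := measurable_cos.comp (hθm.sub_const _)
  set R' : ℝ → ℝ := (Ioc 0 T).indicator R with hR'
  have hR'm : Measurable R' := by
    have : R' = (Ioc 0 T).indicator ((Icc 0 T).indicator R) := by
      rw [indicator_indicator, inter_eq_left.2 Ioc_subset_Icc_self]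
    rw [this]
    refine Measurable.indicator ?_ measurableSet_Ioc
    have h := hRc.measurable_piecewise (g := (0 : ℝ → ℝ)) continuousOn_const measurableSet_Icc
    rwa [piecewise_eq_indicator] at h
  set v : ℝ → ℝ := (Ioc 0 T).piecewise (fun t => cos (θ t - θ0) * max 0 (log (W t / R' t))) u with hv
  have hvm : Measurable v := Measurable.piecewise measurableSet_Ioc
    (hsm.mul (measurable_const.max (hWc.measurable.div hR'm).log)) hum
  have hv1 : ∀ t ∈ Ioc 0 T, v t = cos (θ t - θ0) * max 0 (log (W t / R t)) := fun t ht => by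
    rw [hv, piecewise_eq_of_mem _ _ _ ht, hR', indicator_of_mem ht]
  have hv2 : ∀ t, T < t → v t = u t := fun t ht =>
    piecewise_eq_of_notMem _ _ _ fun h => not_lt.2 h.2 ht
  have hv0 : ∀ t, 0 ≤ v t := fun t => by
    by_cases h : t ∈ Ioc 0 T
    · rw [hv, piecewise_eq_of_mem _ _ _ h]; exact mul_nonneg (hs t).le (le_max_left _ _)
    · rw [hv, piecewise_eq_of_notMem _ _ _ h]; exact hu0 t
  have hA : 0 < 2 / r0 := by positivity
  have hvU : ∀ t ∈ Ioc 0 T, v t ≤ Ul (2 / r0) t := fun t ht => by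
    rw [hv1 t ht]
    have h1 : max 0 (log (W t / R t)) ≤ Ul (2 / r0) t := by
      refine Ul_log_le ht.1 (hW0 t) ?_ (hRpos t ht)
      have h2 := hRge t ⟨ht.1.le, ht.2⟩
      have h3 := hI.le_two (yf θ t)
      calc W t * t ≤ 2 * t := mul_le_mul_of_nonneg_right h3 ht.1.le
        _ = 2 / r0 * (r0 * t) := by field_simp
        _ ≤ _ := mul_le_mul_of_nonneg_left h2 hA.le
    calc _ ≤ 1 * max 0 (log (W t / R t)) :=
          mul_le_mul_of_nonneg_right (cos_le_one _) (le_max_left _ _)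
      _ ≤ _ := by rw [one_mul]; exact h1
  have hvi1 : IntegrableOn v (Ioc 0 T) := by
    refine ((Ul_integral hA).1.mono_set Ioc_subset_Ioi_self).mono' hvm.aestronglyMeasurable ?_
    filter_upwards [ae_restrict_mem measurableSet_Ioc] with t ht
    rw [norm_of_nonneg (hv0 t)]; exact hvU t ht
  have hvi : IntegrableOn v (Ioi 0) := by
    rw [← Ioc_union_Ioi_eq_Ioi hT0.le]
    exact hvi1.union ((hui.mono_set (Ioi_subset_Ioi hT0.le)).congr_fun
      (fun t ht => (hv2 t ht).symm) measurableSet_Ioi)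
  have hav : Adm2 θ0 θ v := ⟨hθm, hvm, hθ, hv0, hvi⟩
  have hzv : ∀ t, T ≤ t → zf v t = zf u t := fun t ht => zf_const_tail hv2 ht
  have hzui := ho.integrable P hI
  have hc1 : ∀ w : ℝ → ℝ, IntegrableOn w (Ioi 0) → IntegrableOn (fun t => zf w t ^ α) (Ioc 0 T) :=
    fun w hw => (((zf_continuousOn hw).mono Icc_subset_Ici_self).rpow_const
      fun _ _ => Or.inr P.α0.le).integrableOn_Icc.mono_set Ioc_subset_Icc_self
  have hzu2 : IntegrableOn (fun t => zf u t ^ α) (Ioi T) := hzui.mono_set (Ioi_subset_Ioi hT0.le)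
  have hzv2 : IntegrableOn (fun t => zf v t ^ α) (Ioi T) :=
    hzu2.congr_fun (fun t ht => by simp only; rw [hzv t (le_of_lt ht)]) measurableSet_Ioi
  have hzvi : IntegrableOn (fun t => zf v t ^ α) (Ioi 0) := by
    rw [← Ioc_union_Ioi_eq_Ioi hT0.le]; exact (hc1 v hvi).union hzv2
  have hpay := ho.2 θ v hav
  rw [payoff_of_integrable P hI ha hzui, payoff_of_integrable P hI hav hzvi] at hpay
  have split : ∀ f : ℝ → ℝ, IntegrableOn f (Ioi 0) →
      ∫ t in Ioi 0, f t = (∫ t in Ioc 0 T, f t) + ∫ t in Ioi T, f t := fun f hf => by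
    rw [← setIntegral_union (Ioc_disjoint_Ioi le_rfl) measurableSet_Ioi
      (hf.mono_set Ioc_subset_Ioi_self) (hf.mono_set (Ioi_subset_Ioi hT0.le)),
      Ioc_union_Ioi_eq_Ioi hT0.le]
  have hLu := lt_integrable P hI ha
  have hLv := lt_integrable P hI hav
  rw [split _ hLu, split _ hLv, split _ hzui, split _ hzvi,
    setIntegral_congr_fun measurableSet_Ioi (f := lt θ0 I θ v) (g := lt θ0 I θ u)
      (fun t ht => by simp only [lt]; rw [hv2 t ht]),
    setIntegral_congr_fun measurableSet_Ioi (f := fun t => zf v t ^ α) (g := fun t => zf u t ^ α)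
      (fun t ht => by simp only; rw [hzv t (le_of_lt ht)])] at hpay
  set r : ℝ → ℝ := fun t => c * α * zf u t ^ (α - 1) with hr
  have hrc : ContinuousOn r (Icc 0 T) := mcost_continuousOn ha hT
  have hvui : IntervalIntegrable (fun t => v t - u t) volume 0 T :=
    (intervalIntegrable_of_Ioi hvi le_rfl hT0.le).sub (intervalIntegrable_of_Ioi hui le_rfl hT0.le)
  have htri := integral_triangle hT0.le (hrc.intervalIntegrable_of_Icc hT0.le) hvui
  have hzdiff : ∀ t ∈ Icc 0 T, ∫ s in t..T, (v s - u s) = zf v t - zf u t := fun t ht => by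
    rw [zf_add hvi ht.1 ht.2, zf_add hui ht.1 ht.2, hzv T le_rfl,
      intervalIntegral.integral_sub (intervalIntegrable_of_Ioi hvi ht.1 hT0.le)
        (intervalIntegrable_of_Ioi hui ht.1 hT0.le)]
    ring
  have hdc : ContinuousOn (fun t => r t * (zf v t - zf u t)) (Icc 0 T) :=
    hrc.mul (((zf_continuousOn hvi).mono Icc_subset_Ici_self).sub
      ((zf_continuousOn hui).mono Icc_subset_Ici_self))
  have hconc : c * (∫ t in Ioc 0 T, zf v t ^ α) ≤ c * (∫ t in Ioc 0 T, zf u t ^ α) +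
      ∫ t in (0 : ℝ)..T, (v t - u t) * R t := by
    have e : ∫ t in (0 : ℝ)..T, (v t - u t) * R t = ∫ t in Ioc 0 T, r t * (zf v t - zf u t) := by
      rw [← intervalIntegral.integral_of_le hT0.le]
      refine htri.symm.trans (intervalIntegral.integral_congr fun t ht => ?_)
      rw [uIcc_of_le hT0.le] at ht
      rw [hzdiff t ht]
    have hdi := (hdc.integrableOn_Icc (μ := volume)).mono_set (Ioc_subset_Icc_self (α := ℝ))
    rw [e, ← integral_const_mul, ← integral_const_mul, ← integral_add ((hc1 u hui).const_mul c) hdi]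
    refine setIntegral_mono_on ((hc1 v hvi).const_mul c) (((hc1 u hui).const_mul c).fun_add hdi)
      measurableSet_Ioc fun t ht => ?_
    have := mul_le_mul_of_nonneg_left (rpow_tangent P.α0.le P.α1.le (hzp t ⟨ht.1.le, ht.2⟩)
      (zf_nonneg hv0 t)) P.c0.le
    simp only [hr]; linarith
  obtain ⟨C, hC⟩ := isCompact_Icc.exists_bound_of_continuousOn hRc
  have hRi : ∀ w : ℝ → ℝ, Measurable w → IntegrableOn w (Ioi 0) →
      IntegrableOn (fun t => R t * w t) (Ioc 0 T) := fun w _ hw =>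
    (hw.mono_set Ioc_subset_Ioi_self).bdd_mul (c := C)
      ((hRc.mono Ioc_subset_Icc_self).aestronglyMeasurable measurableSet_Ioc)
      (by filter_upwards [ae_restrict_mem measurableSet_Ioc] with t ht
          exact hC t ⟨ht.1.le, ht.2⟩)
  have hL' : ∀ w : ℝ → ℝ, IntegrableOn (lt θ0 I θ w) (Ioi 0) →
    IntegrableOn (lt θ0 I θ w) (Ioc 0 T) := fun w h => h.mono_set Ioc_subset_Ioi_self
  have key : ∫ t in Ioc 0 T, ((lt θ0 I θ v t - R t * v t) - (lt θ0 I θ u t - R t * u t)) ≤ 0 := by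
    rw [integral_sub ((hL' v hLv).fun_sub (hRi v hvm hvi)) ((hL' u hLu).fun_sub (hRi u hum hui)),
      integral_sub (hL' v hLv) (hRi v hvm hvi), integral_sub (hL' u hLu) (hRi u hum hui)]
    have e : ∫ t in (0 : ℝ)..T, (v t - u t) * R t =
        (∫ t in Ioc 0 T, R t * v t) - ∫ t in Ioc 0 T, R t * u t := by
      rw [intervalIntegral.integral_of_le hT0.le, ← integral_sub (hRi v hvm hvi) (hRi u hum hui)]
      congr 1; funext t; ring
    rw [e] at hconc
    linarith
  have hbest : ∀ t ∈ Ioc 0 T, W t * gain (cos (θ t - θ0)) (u t) - R t * u t ≤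
      W t * gain (cos (θ t - θ0)) (v t) - R t * v t ∧ _ := fun t ht =>
    gain_best (hs t) (hW0 t) (hRpos t ht) (hu0 t) (hv1 t ht)
  have hnn : 0 ≤ᵐ[volume.restrict (Ioc 0 T)] fun t =>
      (lt θ0 I θ v t - R t * v t) - (lt θ0 I θ u t - R t * u t) := by
    filter_upwards [ae_restrict_mem measurableSet_Ioc] with t ht
    exact sub_nonneg.2 (hbest t ht).1
  have hz := (integral_eq_zero_iff_of_nonneg_ae hnn (((hL' v hLv).fun_sub (hRi v hvm hvi)).fun_sub
    ((hL' u hLu).fun_sub (hRi u hum hui)))).1 (le_antisymm key (integral_nonneg_of_ae hnn))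
  filter_upwards [hz, ae_restrict_mem measurableSet_Ioc] with t h1 ht
  rw [(hbest t ht).2 (sub_eq_zero.1 h1).symm, hv1 t ht]

end
end Model2

namespace Model2
open Set Filter Topology

/-- `T` is the length of the leafy part of the stem, where the leaf density is determined by
the first order condition. -/
structure Len (θ0 α c : ℝ) (I θ u : ℝ → ℝ) (T : ℝ) : Prop where
  pos : 0 < T
  le : T ≤ Zb α c
  z_pos : ∀ t, 0 ≤ t → t < T → 0 < zf u t
  z_zero : ∀ t, T ≤ t → zf u t = 0
  z_le : zf u 0 ≤ Zb α c
  u_eq : ∀ᵐ t ∂(volume.restrict (Ioo 0 T)),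
      u t = cos (θ t - θ0) * max 0 (log (I (yf θ t) / Rf α c u t))
  u_zero : ∀ᵐ t ∂(volume.restrict (Ioi T)), u t = 0

section
variable {θ0 α c : ℝ} {I θ u : ℝ → ℝ}

lemma Opt.u_le_Ul (P : Params θ0 α c) (hI : Light I) (ho : Opt θ0 α c I θ u) {T : ℝ}
    (hT0 : 0 < T) (hT : 0 < zf u T) : ∀ᵐ t ∂(volume.restrict (Ioc 0 T)),
      u t ≤ Ul (2 / (c * α * zf u 0 ^ (α - 1))) t := by
  set r0 := c * α * zf u 0 ^ (α - 1) with hr0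
  have hr0p : 0 < r0 := mul_pos (mul_pos P.c0 P.α0) (rpow_pos_of_pos (ho.zf_pos P hI) _)
  filter_upwards [ho.u_eq_aux P hI hT0 hT, ae_restrict_mem measurableSet_Ioc] with t h1 ht
  have hz := hT.trans_le (zf_antitone ho.1.2.2.2.2 ho.1.2.2.2.1 ht.1.le ht.2)
  have h2 := le_Rf P ho.1 ht.1.le hz
  rw [h1]
  have h3 : max 0 (log (I (yf θ t) / Rf α c u t)) ≤ Ul (2 / r0) t := by
    refine Ul_log_le ht.1 (hI.pos _) ?_ ((mul_pos hr0p ht.1).trans_le h2)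
    calc I (yf θ t) * t ≤ 2 * t := mul_le_mul_of_nonneg_right (hI.le_two _) ht.1.le
        _ = 2 / r0 * (r0 * t) := by field_simp
        _ ≤ _ := mul_le_mul_of_nonneg_left h2 (by positivity)
  calc _ ≤ 1 * max 0 (log (I (yf θ t) / Rf α c u t)) :=
          mul_le_mul_of_nonneg_right (cos_le_one _) (le_max_left _ _)
      _ ≤ _ := by rw [one_mul]; exact h3

lemma zf_exists (hi : IntegrableOn u (Ioi 0)) {t0 e : ℝ} (ht0 : 0 ≤ t0)
    (he : 0 < e) (hez : e < zf u t0) : ∃ t, t0 < t ∧ zf u t = e := by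
  have h1 := (zf_tendsto hi).eventually (gt_mem_nhds he)
  obtain ⟨b, hb1, hb2⟩ := (h1.and (eventually_ge_atTop t0)).exists
  have := intermediate_value_Icc' hb2 ((zf_continuousOn hi).mono
    ((Icc_subset_Ici_self).trans (Ici_subset_Ici.2 ht0)))
  obtain ⟨t, ht, hte⟩ := this ⟨hb1.le, hez.le⟩
  refine ⟨t, ht.1.lt_of_ne fun h => ?_, hte⟩
  rw [← h] at hte; exact hez.ne' hte

lemma Opt.z0_le_aux (P : Params θ0 α c) (hI : Light I) (ho : Opt θ0 α c I θ u) :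
    zf u 0 ≤ 2 / (c * α * zf u 0 ^ (α - 1)) ∧ zf u (2 / (c * α * zf u 0 ^ (α - 1))) = 0 := by
  set r0 := c * α * zf u 0 ^ (α - 1) with hr0
  have hz0 := ho.zf_pos P hI
  have hr0p : 0 < r0 := mul_pos (mul_pos P.c0 P.α0) (rpow_pos_of_pos hz0 _)
  have hA : 0 < 2 / r0 := by positivity
  obtain ⟨-, hum, -, hu0, hui⟩ := ho.1
  constructor
  · refine le_of_forall_pos_lt_add fun e he => ?_
    have he' : 0 < min (e / 2) (zf u 0 / 2) := by positivity
    obtain ⟨t, ht, hte⟩ := zf_exists hui le_rfl he'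
      ((min_le_right _ _).trans_lt (by linarith))
    have h1 : ∫ s in Ioc 0 t, u s ≤ ∫ s in Ioi 0, Ul (2 / r0) s := by
      have hUi := (Ul_integral hA).1
      refine (integral_mono_ae (hui.mono_set Ioc_subset_Ioi_self)
        (hUi.mono_set Ioc_subset_Ioi_self) (ho.u_le_Ul P hI ht (hte ▸ he'))).trans ?_
      exact setIntegral_mono_set hUi (ae_of_all _ (Ul_nonneg _)) 
        (LE.le.eventuallyLE Ioc_subset_Ioi_self)
    rw [(Ul_integral hA).2] at h1
    rw [zf_add hui le_rfl ht.le, hte, intervalIntegral.integral_of_le ht.le]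
    have := min_le_left (e / 2) (zf u 0 / 2)
    linarith
  · by_contra hne
    have hzA : 0 < zf u (2 / r0) := (zf_nonneg hu0 _).lt_of_ne' hne
    obtain ⟨t, ht, hte⟩ := zf_exists hui hA.le (half_pos hzA) (half_lt_self hzA)
    have h0 : ∫ s in (2 / r0)..t, u s = 0 := by
      rw [intervalIntegral.integral_of_le ht.le]
      have : ∀ᵐ s ∂(volume.restrict (Ioc (2 / r0) t)), u s = 0 := by
        have h := ae_restrict_of_ae_restrict_of_subset (Ioc_subset_Ioc hA.le le_rfl)
          (ho.u_le_Ul P hI (hA.trans ht) (hte ▸ half_pos hzA))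
        filter_upwards [h, ae_restrict_mem measurableSet_Ioc] with s h1 hs
        exact le_antisymm (h1.trans_eq (Ul_eq_zero hA hs.1.le)) (hu0 s)
      rw [integral_congr_ae this]; simp
    have := zf_add hui hA.le ht.le
    rw [h0, hte] at this
    linarith

lemma Opt.exists_len (P : Params θ0 α c) (hI : Light I) (ho : Opt θ0 α c I θ u) :
    ∃ T, Len θ0 α c I θ u T := by
  obtain ⟨h1, h2⟩ := ho.z0_le_aux P hI
  have hz0 := ho.zf_pos P hI
  have hc := P.c0
  have hα := P.α0
  obtain ⟨-, hum, -, hu0, hui⟩ := ho.1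
  have hZ : zf u 0 ≤ Zb α c := by
    rw [rpow_sub_one hz0.ne', le_div_iff₀ (by positivity)] at h1
    have h3 : zf u 0 ^ α ≤ Zb α c ^ α := by
      rw [Zb_rpow P, le_div_iff₀ (by positivity)]
      have : zf u 0 * (c * α * (zf u 0 ^ α / zf u 0)) = zf u 0 ^ α * (c * α) := by field_simp
      rwa [← this]
    exact (rpow_le_rpow_iff hz0.le (Zb_pos P).le hα).1 h3
  have hAZ : 2 / (c * α * zf u 0 ^ (α - 1)) ≤ Zb α c := by
    have h3 := Zb_rpow P
    have hZp := Zb_pos P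
    have h4 := rpow_le_rpow_of_nonpos hz0 hZ (show α - 1 ≤ 0 by linarith [P.α1])
    rw [rpow_sub_one hZp.ne', h3] at h4
    rw [div_le_iff₀ (by positivity)]
    calc (2 : ℝ) = Zb α c * (c * α * (2 / (c * α) / Zb α c)) := by field_simp
      _ ≤ _ := by gcongr
  set S : Set ℝ := {t | 0 ≤ t ∧ zf u t = 0} with hS
  have hAS : 2 / (c * α * zf u 0 ^ (α - 1)) ∈ S := ⟨by positivity, h2⟩
  have hbd : BddBelow S := ⟨0, fun t ht => ht.1⟩
  set T := sInf S with hT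
  have hclosed : IsClosed S := by
    have : S = Ici 0 ∩ zf u ⁻¹' {0} := by ext t; simp [hS]
    rw [this]
    exact (zf_continuousOn hui).preimage_isClosed_of_isClosed isClosed_Ici isClosed_singleton
  have hTS : T ∈ S := hclosed.csInf_mem ⟨_, hAS⟩ hbd
  have hTpos : 0 < T := hTS.1.lt_of_ne fun h => by
    have := hTS.2; rw [← h] at this; exact hz0.ne' this
  have hzT : ∀ t, T ≤ t → zf u t = 0 := fun t ht =>
    le_antisymm ((zf_antitone hui hu0 hTS.1 ht).trans_eq hTS.2) (zf_nonneg hu0 t)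
  have hzp : ∀ t, 0 ≤ t → t < T → 0 < zf u t := fun t ht0 ht =>
    (zf_nonneg hu0 t).lt_of_ne' fun h => not_le.2 ht (csInf_le hbd ⟨ht0, h⟩)
  refine ⟨T, hTpos, (csInf_le hbd hAS).trans hAZ, hzp, hzT, hZ, ?_, ?_⟩
  · have hU : Ioo 0 T = ⋃ n : ℕ, Ioc 0 (T - T / (n + 2)) := by
      ext t
      simp only [mem_Ioo, mem_iUnion, mem_Ioc]
      constructor
      · rintro ⟨h1, h2⟩
        obtain ⟨n, hn⟩ := exists_nat_gt (T / (T - t))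
        refine ⟨n, h1, ?_⟩
        rw [div_lt_iff₀ (by linarith)] at hn
        have : T / (n + 2) ≤ T - t := by
          rw [div_le_iff₀ (by positivity)]; nlinarith
        linarith
      · rintro ⟨n, h1, h2⟩
        have : 0 < T / ((n : ℝ) + 2) := by positivity
        exact ⟨h1, by linarith⟩
    rw [hU, ae_restrict_iUnion_iff]
    intro n
    have h3 : 0 < T / ((n : ℝ) + 2) := by positivity
    have h4 : T / ((n : ℝ) + 2) < T := div_lt_self hTpos (by
      have : (0 : ℝ) ≤ n := n.cast_nonneg
      linarith)
    exact ho.u_eq_aux P hI (by linarith) (hzp _ (by linarith) (by linarith))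
  · have h5 : ∫ t in Ioi T, u t = 0 := hTS.2
    rw [integral_eq_zero_iff_of_nonneg hu0 (hui.mono_set (Ioi_subset_Ioi hTS.1))] at h5
    exact h5

end
end Model2

namespace Model2
open Set Filter Topology

section
variable {θ0 α c : ℝ} {I θ u : ℝ → ℝ}

lemma zpow_intervalIntegrable (P : Params θ0 α c) (hi : IntegrableOn u (Ioi 0)) {a b : ℝ}
    (ha : 0 ≤ a) (hb : 0 ≤ b) : IntervalIntegrable (fun t => zf u t ^ α) volume a b :=
  ContinuousOn.intervalIntegrable (((zf_continuousOn hi).mono fun _ ht =>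
    (le_min ha hb).trans ht.1).rpow_const fun _ _ => Or.inr P.α0.le)

lemma lt_intervalIntegrable (P : Params θ0 α c) (hI : Light I) (ha : Adm2 θ0 θ u) {a b : ℝ}
    (h0 : 0 ≤ a) (hb : 0 ≤ b) : IntervalIntegrable (lt θ0 I θ u) volume a b :=
  intervalIntegrable_of_Ioi (lt_integrable P hI ha) h0 hb

lemma payoff_support (P : Params θ0 α c) (hI : Light I) (ha : Adm2 θ0 θ u) {B : ℝ} (hB : 0 ≤ B)
    (hz : zf u B = 0) : Payoff θ0 α c I θ u =
      (∫ t in (0 : ℝ)..B, lt θ0 I θ u t) - c * ∫ t in (0 : ℝ)..B, zf u t ^ α := by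
  have h0 : ∀ t ∈ Ioi B, zf u t ^ α = 0 := fun t ht => by
    rw [le_antisymm ((zf_antitone ha.2.2.2.2 ha.2.2.2.1 hB (le_of_lt ht)).trans_eq hz)
      (zf_nonneg ha.2.2.2.1 t), zero_rpow P.α0.ne']
  have hu : ∀ᵐ t ∂(volume.restrict (Ioi B)), u t = 0 := by
    rw [zf, integral_eq_zero_iff_of_nonneg ha.2.2.2.1 (ha.2.2.2.2.mono_set (Ioi_subset_Ioi hB))] at hz
    exact hz
  have h0' : ∀ᵐ t ∂(volume.restrict (Ioi B)), lt θ0 I θ u t = 0 := by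
    filter_upwards [hu] with t ht
    rw [lt, ht, gain_zero, mul_zero]
  have h1 : IntegrableOn (fun t => zf u t ^ α) (Ioc 0 B) := by
    rw [← intervalIntegrable_iff_integrableOn_Ioc_of_le hB]
    exact zpow_intervalIntegrable P ha.2.2.2.2 le_rfl hB
  have h2 : IntegrableOn (fun t => zf u t ^ α) (Ioi B) :=
    integrableOn_zero.congr_fun (fun t ht => (h0 t ht).symm) measurableSet_Ioi
  have h3 := h1.union h2
  rw [Ioc_union_Ioi_eq_Ioi hB] at h3
  have h4 := lt_integrable P hI ha
  rw [payoff_of_integrable P hI ha h3, ← Ioc_union_Ioi_eq_Ioi hB,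
    setIntegral_union (Ioc_disjoint_Ioi le_rfl) measurableSet_Ioi h1 h2,
    setIntegral_union (Ioc_disjoint_Ioi le_rfl) measurableSet_Ioi (h4.mono_set Ioc_subset_Ioi_self)
      (h4.mono_set (Ioi_subset_Ioi hB)), setIntegral_congr_fun measurableSet_Ioi h0,
      integral_congr_ae h0', intervalIntegral.integral_of_le hB, intervalIntegral.integral_of_le hB]
  simp

lemma double_gain {s x : ℝ} (hs : 0 < s) :
    2 * gain s (s * x / 2) - gain s (s * x) = s * (1 - exp (-(x / 2))) ^ 2 := by
  rw [show s * x / 2 = s * (x / 2) by ring, gain_mul hs, gain_mul hs,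
    show -x = -(x / 2) + -(x / 2) by ring, exp_add]
  ring

lemma no_jump_aux (P : Params θ0 α c) (hI : Light I) (ho : Opt θ0 α c I θ u) {T : ℝ}
    (hL : Len θ0 α c I θ u T) {l : ℝ} (hl : 0 < l)
    (h : ∀ t ∈ Ioo 0 T, l ≤ log (I (yf θ t) / Rf α c u t)) {δ : ℝ} (hδ : 0 < δ) (hδT : δ < T) :
    I 0 * (sin θ0 * (1 - exp (-(l / 2))) ^ 2) * δ ≤ c * (2 * δ * zf u (T - δ) ^ α) := by
  classical
  obtain ⟨hθm, hum, hθ, hu0, hui⟩ := ho.1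
  set u' : ℝ → ℝ := fun t => if t ≤ T - δ then u t else if t ≤ T then u t / 2 else
    if t ≤ T + δ then u (t - δ) / 2 else 0 with hu'
  set θ' : ℝ → ℝ := fun t => if t ≤ T then θ t else θ (t - δ) with hθ'
  have hu'm : Measurable u' := Measurable.ite measurableSet_Iic hum (Measurable.ite measurableSet_Iic
    (hum.div_const _) (Measurable.ite measurableSet_Iic
      ((hum.comp (measurable_id.sub_const δ)).div_const _) measurable_const))
  have hθ'm : Measurable θ' :=
    Measurable.ite measurableSet_Iic hθm (hθm.comp (measurable_id.sub_const δ))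
  have hu'0 : ∀ t, 0 ≤ u' t := fun t => by
    have h1 := hu0 t
    have h2 := hu0 (t - δ)
    simp only [hu']; split_ifs <;> linarith
  have a1 : ∀ t, t ≤ T - δ → u' t = u t := fun t ht => by simp only [hu', if_pos ht]
  have a2 : ∀ t, T - δ < t → t ≤ T → u' t = u t / 2 := fun t ht ht' => by
    simp only [hu', if_neg (not_le.2 ht), if_pos ht']
  have a3 : ∀ t, T < t → t ≤ T + δ → u' t = u (t - δ) / 2 := fun t ht ht' => by
    simp only [hu', if_neg (not_le.2 ht), if_neg (show ¬ t ≤ T - δ by linarith), if_pos ht']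
  have a4 : ∀ t, T + δ < t → u' t = 0 := fun t ht => by
    simp only [hu', if_neg (not_le.2 ht), if_neg (show ¬ t ≤ T - δ by linarith),
      if_neg (show ¬ t ≤ T by linarith)]
  have hii : ∀ a b : ℝ, 0 ≤ a → 0 ≤ b → IntervalIntegrable u volume a b :=
    fun a b ha hb => intervalIntegrable_of_Ioi hui ha hb
  have ii2 : IntervalIntegrable u' volume (T - δ) T := by
    refine ((hii (T - δ) T (by linarith) hL.pos.le).div_const 2).congr fun t ht => ?_
    rw [uIoc_of_le (by linarith)] at ht
    exact (a2 t ht.1 ht.2).symm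
  have ii3 : IntervalIntegrable u' volume T (T + δ) := by
    have := ((hii (T - δ) T (by linarith) hL.pos.le).comp_sub_right δ).div_const 2
    rw [sub_add_cancel] at this
    refine this.congr fun t ht => ?_
    rw [uIoc_of_le (by linarith)] at ht
    exact (a3 t ht.1 ht.2).symm
  have hu'i : IntegrableOn u' (Ioi 0) := by
    have e : Ioi (0 : ℝ) = ((Ioc 0 (T - δ) ∪ Ioc (T - δ) T) ∪ Ioc T (T + δ)) ∪ Ioi (T + δ) := by
      rw [Ioc_union_Ioc_eq_Ioc (by linarith) (by linarith), Ioc_union_Ioc_eq_Ioc hL.pos.le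
        (by linarith), Ioc_union_Ioi_eq_Ioi (by linarith [hL.pos])]
    rw [e]
    refine ((IntegrableOn.union ?_ ?_).union ?_).union ?_
    · exact (hui.mono_set Ioc_subset_Ioi_self).congr_fun (fun t ht => (a1 t ht.2).symm)
        measurableSet_Ioc
    · exact (intervalIntegrable_iff_integrableOn_Ioc_of_le (by linarith)).1 ii2
    · exact (intervalIntegrable_iff_integrableOn_Ioc_of_le (by linarith)).1 ii3
    · exact integrableOn_zero.congr_fun (fun t ht => (a4 t ht).symm) measurableSet_Ioi
  have ha' : Adm2 θ0 θ' u' := ⟨hθ'm, hu'm, fun t => by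
    simp only [hθ']; split_ifs; exacts [hθ t, hθ _], hu'0, hu'i⟩
  have zend : zf u' (T + δ) = 0 := by
    rw [zf, setIntegral_congr_fun measurableSet_Ioi (fun t ht => a4 t ht)]; simp
  have half2 : ∫ t in (T - δ)..T, u' t = (∫ t in (T - δ)..T, u t) / 2 := by
    rw [← intervalIntegral.integral_div]
    refine intervalIntegral.integral_congr_ae (ae_of_all _ fun t ht => ?_)
    rw [uIoc_of_le (by linarith)] at ht
    exact a2 t ht.1 ht.2
  have half3 : ∫ t in T..(T + δ), u' t = (∫ t in (T - δ)..T, u t) / 2 := by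
    have e : ∫ t in T..(T + δ), u' t = ∫ t in T..(T + δ), u (t - δ) / 2 := by
      refine intervalIntegral.integral_congr_ae (ae_of_all _ fun t ht => ?_)
      rw [uIoc_of_le (by linarith)] at ht
      exact a3 t ht.1 ht.2
    rw [e, intervalIntegral.integral_div, intervalIntegral.integral_comp_sub_right (fun t => u t),
      add_sub_cancel_right]
  have zmid : zf u' (T - δ) = zf u (T - δ) := by
    rw [zf_add hu'i (by linarith) (show T - δ ≤ T by linarith),
      zf_add hu'i hL.pos.le (show T ≤ T + δ by linarith), zend, half2, half3,
      zf_add hui (by linarith) (show T - δ ≤ T by linarith), hL.z_zero T le_rfl]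
    ring
  have zlow : ∀ t ∈ Icc 0 (T - δ), zf u' t = zf u t := fun t ht => by
    rw [zf_add hu'i ht.1 ht.2, zf_add hui ht.1 ht.2, zmid]
    congr 1
    refine intervalIntegral.integral_congr_ae (ae_of_all _ fun s hs => ?_)
    rw [uIoc_of_le ht.2] at hs
    exact a1 s hs.2
  have hpay := ho.2 θ' u' ha'
  have q0 : (0 : ℝ) ≤ T - δ := by linarith
  have q1 : (0 : ℝ) ≤ T + δ := by linarith
  rw [payoff_support P hI ho.1 hL.pos.le (hL.z_zero T le_rfl),
    payoff_support P hI ha' (by linarith) zend,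
    ← intervalIntegral.integral_add_adjacent_intervals (b := T - δ)
      (lt_intervalIntegrable P hI ho.1 le_rfl q0) (lt_intervalIntegrable P hI ho.1 q0 hL.pos.le),
    ← intervalIntegral.integral_add_adjacent_intervals (b := T - δ)
      (zpow_intervalIntegrable P hui le_rfl q0) (zpow_intervalIntegrable P hui q0 hL.pos.le),
    ← intervalIntegral.integral_add_adjacent_intervals (b := T - δ) (c := T + δ)
      (zpow_intervalIntegrable P hu'i le_rfl q0) (zpow_intervalIntegrable P hu'i q0 q1),
    ← intervalIntegral.integral_add_adjacent_intervals (b := T - δ) (c := T + δ)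
      (lt_intervalIntegrable P hI ha' le_rfl q0) (lt_intervalIntegrable P hI ha' q0 q1),
    ← intervalIntegral.integral_add_adjacent_intervals (b := T) (c := T + δ)
      (lt_intervalIntegrable P hI ha' q0 hL.pos.le) (lt_intervalIntegrable P hI ha' hL.pos.le q1)]
    at hpay
  have b1 : ∀ t, t ≤ T → θ' t = θ t := fun t ht => by simp only [hθ', if_pos ht]
  have b2 : ∀ t, T < t → θ' t = θ (t - δ) := fun t ht => by
    simp only [hθ', if_neg (not_le.2 ht)]
  have hylow : ∀ t, t ≤ T → yf θ' t = yf θ t := fun t ht => by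
    refine intervalIntegral.integral_congr_ae (ae_of_all _ fun s hs => ?_)
    have : s ≤ T := hs.2.trans (max_le hL.pos.le ht)
    simp only [hθ', if_pos this]
  have e1 : ∫ t in (0 : ℝ)..(T - δ), lt θ0 I θ' u' t = ∫ t in (0 : ℝ)..(T - δ), lt θ0 I θ u t := by
    refine intervalIntegral.integral_congr_ae (ae_of_all _ fun s hs => ?_)
    rw [uIoc_of_le q0] at hs
    have : s ≤ T := by linarith [hs.2]
    simp only [lt, a1 s hs.2, hylow s this, b1 s this]
  have e2 : ∫ t in (0 : ℝ)..(T - δ), zf u' t ^ α = ∫ t in (0 : ℝ)..(T - δ), zf u t ^ α := by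
    refine intervalIntegral.integral_congr fun s hs => ?_
    rw [uIcc_of_le q0] at hs
    simp only [zlow s hs]
  have e3 : ∫ t in (T - δ)..(T + δ), zf u' t ^ α ≤ 2 * δ * zf u (T - δ) ^ α := by
    have := intervalIntegral.integral_mono_on (show T - δ ≤ T + δ by linarith)
      (zpow_intervalIntegrable P hu'i q0 q1)
      (intervalIntegrable_const (c := zf u (T - δ) ^ α)) fun t ht =>
        rpow_le_rpow (zf_nonneg hu'0 t) ((zf_antitone hu'i hu'0 q0 ht.1).trans_eq zmid) P.α0.le
    rw [intervalIntegral.integral_const, smul_eq_mul] at this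
    linarith
  have e4 : 0 ≤ ∫ t in (T - δ)..T, zf u t ^ α :=
    intervalIntegral.integral_nonneg (by linarith) fun t _ => rpow_nonneg (zf_nonneg hu0 t) _
  set g : ℝ → ℝ := fun t => I (yf θ t) * gain (cos (θ t - θ0)) (u t / 2) with hg
  have hs : ∀ t, 0 < cos (θ t - θ0) := fun t => P.cos_sub_pos (hθ t)
  have hau : Adm2 θ0 θ (fun t => u t / 2) := ⟨hθm, hum.div_const _, hθ, fun t => by
    have := hu0 t; positivity, hui.div_const 2⟩
  have hgi : IntervalIntegrable g volume (T - δ) T := lt_intervalIntegrable P hI hau q0 hL.pos.le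
  have e5 : ∫ t in (T - δ)..T, lt θ0 I θ' u' t = ∫ t in (T - δ)..T, g t := by
    refine intervalIntegral.integral_congr_ae (ae_of_all _ fun s hs => ?_)
    rw [uIoc_of_le (by linarith)] at hs
    simp only [lt, hg, a2 s hs.1 hs.2, hylow s hs.2, b1 s hs.2]
  have e6 : ∫ t in (T - δ)..T, g t ≤ ∫ t in T..(T + δ), lt θ0 I θ' u' t := by
    have e : ∫ t in T..(T + δ), g (t - δ) = ∫ t in (T - δ)..T, g t := by
      rw [intervalIntegral.integral_comp_sub_right (fun t => g t), add_sub_cancel_right]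
    rw [← e]
    have hgi' := hgi.comp_sub_right δ
    rw [sub_add_cancel] at hgi'
    refine intervalIntegral.integral_mono_on_of_le_Ioo (by linarith) hgi'
      (lt_intervalIntegrable P hI ha' hL.pos.le q1) fun t ht => ?_
    simp only [lt, hg, a3 t ht.1 ht.2.le, b2 t ht.1]
    refine mul_le_mul_of_nonneg_right (hI.mono ?_) (gain_nonneg (hs _) (by have := hu0 (t - δ); positivity))
    have h1 : yf θ (t - δ) ≤ yf θ T := (yf_mono P hθm hθ).monotone (by linarith [ht.2])
    have h2 : yf θ' T ≤ yf θ' t := (yf_mono P hθ'm ha'.2.2.1).monotone ht.1.le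
    rw [hylow T le_rfl] at h2
    exact h1.trans h2
  have e7 : I 0 * (sin θ0 * (1 - exp (-(l / 2))) ^ 2) * δ ≤
      2 * (∫ t in (T - δ)..T, g t) - ∫ t in (T - δ)..T, lt θ0 I θ u t := by
    have hli := lt_intervalIntegrable P hI ho.1 q0 hL.pos.le
    rw [← intervalIntegral.integral_const_mul, ← intervalIntegral.integral_sub (hgi.const_mul 2) hli]
    have hc : I 0 * (sin θ0 * (1 - exp (-(l / 2))) ^ 2) * δ =
        ∫ t in (T - δ)..T, I 0 * (sin θ0 * (1 - exp (-(l / 2))) ^ 2) := by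
      rw [intervalIntegral.integral_const, smul_eq_mul]; ring
    rw [hc]
    have hlt : T - δ ≤ T := by linarith
    refine intervalIntegral.integral_mono_ae_restrict hlt intervalIntegrable_const
      ((hgi.const_mul 2).sub hli) ?_
    rw [← restrict_Ioo_eq_restrict_Icc]
    have hue := ae_restrict_of_ae_restrict_of_subset (Ioo_subset_Ioo q0 le_rfl) hL.u_eq
    filter_upwards [hue, ae_restrict_mem measurableSet_Ioo] with t hut ht
    have hlx := h t ⟨by linarith [ht.1], ht.2⟩
    rw [max_eq_right (hl.le.trans hlx)] at hut
    set x := log (I (yf θ t) / Rf α c u t) with hx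
    have : 2 * g t - lt θ0 I θ u t = I (yf θ t) * (cos (θ t - θ0) * (1 - exp (-(x / 2))) ^ 2) := by
      rw [← double_gain (hs t), ← hut]; simp only [hg, lt]; ring
    rw [this]
    have hy0 : 0 ≤ yf θ t := by
      have := (yf_mono P hθm hθ).monotone (show (0 : ℝ) ≤ t by linarith [ht.1])
      rwa [yf_zero] at this
    have hexp : exp (-(x / 2)) ≤ exp (-(l / 2)) := exp_le_exp.2 (by linarith)
    have hexp1 : exp (-(l / 2)) ≤ 1 := by rw [exp_le_one_iff]; linarith
    refine mul_le_mul (hI.mono hy0) (mul_le_mul (P.le_cos (hθ t)) ?_ (sq_nonneg _) (hs t).le)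
      (mul_nonneg P.sin_pos.le (sq_nonneg _)) (hI.pos _).le
    exact pow_le_pow_left₀ (by linarith) (by linarith) 2
  rw [e1, e2, e5] at hpay
  have h8 := mul_le_mul_of_nonneg_left e3 P.c0.le
  have h9 := mul_nonneg P.c0.le e4
  linarith

lemma no_jump (P : Params θ0 α c) (hI : Light I) (ho : Opt θ0 α c I θ u) {T : ℝ}
    (hL : Len θ0 α c I θ u T) {l : ℝ} (hl : 0 < l) :
    ∃ t ∈ Ioo 0 T, log (I (yf θ t) / Rf α c u t) < l := by
  by_contra! h
  have hd : 0 < I 0 * (sin θ0 * (1 - exp (-(l / 2))) ^ 2) := by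
    have : exp (-(l / 2)) < 1 := by rw [← exp_zero]; exact exp_lt_exp.2 (by linarith)
    exact mul_pos (hI.pos 0) (mul_pos P.sin_pos (pow_pos (by linarith) 2))
  set d := I 0 * (sin θ0 * (1 - exp (-(l / 2))) ^ 2)
  have hcont : Tendsto (fun t => c * (2 * zf u t ^ α)) (𝓝[<] T) (𝓝 (c * (2 * zf u T ^ α))) := by
    have h1 : ContinuousWithinAt (fun t => c * (2 * zf u t ^ α)) (Ici 0) T :=
      ((((zf_continuousOn ho.1.2.2.2.2).rpow_const fun _ _ => Or.inr P.α0.le) T hL.pos.le).const_mul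
        2).const_mul c
    exact (h1.continuousAt (Ici_mem_nhds hL.pos)).continuousWithinAt
  rw [hL.z_zero T le_rfl, zero_rpow P.α0.ne', mul_zero, mul_zero] at hcont
  have hev := (hcont.eventually (gt_mem_nhds hd)).and (Ioo_mem_nhdsLT hL.pos)
  obtain ⟨t, h1, h2⟩ := hev.exists
  have h3 := no_jump_aux P hI ho hL hl h (δ := T - t) (by linarith [h2.2]) (by linarith [h2.1])
  rw [sub_sub_cancel] at h3
  nlinarith [h2.2, mul_lt_mul_of_pos_right h1 (show 0 < T - t by linarith [h2.2])]

end
end Model2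

namespace Model2
open Set Filter Topology

/-- A priori constant for leaf densities `ζ ↦ f ζ / √ζ`. -/
noncomputable def Kc (θ0 α c : ℝ) : ℝ := 2 * √(Zb α c) / sin θ0

/-- A priori constant for the total leaf density. -/
noncomputable def C2 (θ0 α c : ℝ) : ℝ := 2 * Kc θ0 α c * √(Zb α c)

/-- The leaf density `f ζ / √ζ` accumulated up to height `y`, cut off at `Zb`. -/
noncomputable def Jf (α c : ℝ) (f : ℝ → ℝ) (y : ℝ) : ℝ :=
  ∫ ζ in (0 : ℝ)..max 0 (min y (Zb α c)), f ζ / √ζ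

/-- The light intensity generated by the leaf density `f ζ / √ζ`. -/
noncomputable def If (α c κ : ℝ) (f : ℝ → ℝ) (b y : ℝ) : ℝ := exp (b + κ * Jf α c f y)

/-- Smallness of the density parameter. -/
structure Small (θ0 α c κ : ℝ) : Prop where
  pos : 0 ≤ κ
  le_quarter : κ * C2 θ0 α c ≤ 1 / 4
  le_sin : κ * C2 θ0 α c ≤ sin θ0

/-- A priori bounds for leaf densities. -/
structure Wk (θ0 α c κ : ℝ) (f : ℝ → ℝ) (b : ℝ) : Prop where
  meas : Measurable f
  nonneg : ∀ ζ, 0 ≤ f ζ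
  le : ∀ ζ, f ζ ≤ Kc θ0 α c
  b_le : |b| ≤ κ * C2 θ0 α c

section
variable {θ0 α c κ : ℝ} {f : ℝ → ℝ} {b : ℝ}

lemma Kc_pos (P : Params θ0 α c) : 0 < Kc θ0 α c := by
  have := P.sin_pos; have := Zb_pos P; unfold Kc; positivity

lemma C2_pos (P : Params θ0 α c) : 0 < C2 θ0 α c := by
  have := Kc_pos P; have := Zb_pos P; unfold C2; positivity

lemma inv_sqrt_intervalIntegrable (a b : ℝ) : IntervalIntegrable (fun ζ : ℝ => 1 / √ζ) volume a b := by
  have h : ∀ a, IntervalIntegrable (fun ζ : ℝ => 1 / √ζ) volume 0 a := fun a => by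
    have h1 : ∀ b : ℝ, 0 ≤ b → IntervalIntegrable (fun ζ : ℝ => 1 / √ζ) volume 0 b := fun b hb => by
      refine (intervalIntegral.intervalIntegrable_rpow' (r := -(1 / 2)) (by norm_num)).congr
        fun t ht => ?_
      rw [uIoc_of_le hb] at ht
      rw [rpow_neg ht.1.le, sqrt_eq_rpow, one_div, one_div]
    rcases le_total 0 a with ha | ha
    · exact h1 a ha
    · refine (intervalIntegrable_const (c := (0 : ℝ))).congr fun t ht => ?_
      rw [uIoc_of_ge ha] at ht
      simp [sqrt_eq_zero_of_nonpos ht.2]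
  exact (h a).symm.trans (h b)

lemma integral_inv_sqrt {y1 y2 : ℝ} (h1 : 0 ≤ y1) (h : y1 ≤ y2) :
    ∫ ζ in y1..y2, 1 / √ζ = 2 * (√y2 - √y1) := by
  have := intervalIntegral.integral_eq_sub_of_hasDerivAt_of_le h (f := fun ζ => 2 * √ζ)
    (f' := fun ζ => 1 / √ζ) (by fun_prop) (fun x hx => by
      have hx0 : x ≠ 0 := (h1.trans_lt hx.1).ne'
      exact ((hasDerivAt_sqrt hx0).const_mul 2).congr_deriv (by ring)) (inv_sqrt_intervalIntegrable _ _)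
  rw [this]; ring

lemma bdd_div_sqrt {M : ℝ} (hf : Measurable f) (hM : ∀ ζ, |f ζ| ≤ M) (a b : ℝ) :
    IntervalIntegrable (fun ζ => f ζ / √ζ) volume a b := by
  refine ((inv_sqrt_intervalIntegrable a b).const_mul M).mono_fun
    (hf.div (by fun_prop)).aestronglyMeasurable (ae_of_all _ fun ζ => ?_)
  have hM0 : 0 ≤ M := (abs_nonneg _).trans (hM 0)
  simp only [norm_eq_abs, abs_div, abs_mul, abs_of_nonneg (sqrt_nonneg ζ), abs_one, abs_of_nonneg hM0]
  rw [mul_one_div]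
  gcongr
  exact hM ζ

lemma Wk.intervalIntegrable (hw : Wk θ0 α c κ f b) (y1 y2 : ℝ) :
    IntervalIntegrable (fun ζ => f ζ / √ζ) volume y1 y2 :=
  bdd_div_sqrt hw.meas (fun ζ => (abs_of_nonneg (hw.nonneg ζ)).trans_le (hw.le ζ)) y1 y2

lemma Wk.integral_le_sqrt (hw : Wk θ0 α c κ f b) {y1 y2 : ℝ} (h1 : 0 ≤ y1) (h : y1 ≤ y2) :
    ∫ ζ in y1..y2, f ζ / √ζ ≤ 2 * Kc θ0 α c * (√y2 - √y1) := by
  have := intervalIntegral.integral_mono_on h (hw.intervalIntegrable y1 y2)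
    ((inv_sqrt_intervalIntegrable y1 y2).const_mul (Kc θ0 α c)) fun ζ _ => by
      rw [mul_one_div]; have := hw.le ζ; gcongr
  rw [intervalIntegral.integral_const_mul, integral_inv_sqrt h1 h] at this
  linarith

lemma Wk.integral_le_log (P : Params θ0 α c) (hw : Wk θ0 α c κ f b) {y1 y2 : ℝ} (h1 : 0 < y1)
    (h : y1 ≤ y2) (h2 : y2 ≤ Zb α c) :
    ∫ ζ in y1..y2, f ζ / √ζ ≤ Kc θ0 α c * √(Zb α c) * (log y2 - log y1) := by
  have hi : IntervalIntegrable (fun ζ : ℝ => 1 / ζ) volume y1 y2 :=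
    intervalIntegral.intervalIntegrable_one_div (fun x hx => by
      rw [uIcc_of_le h] at hx; exact (h1.trans_le hx.1).ne') continuousOn_id
  have := intervalIntegral.integral_mono_on h (hw.intervalIntegrable y1 y2)
    (hi.const_mul (Kc θ0 α c * √(Zb α c))) fun ζ hζ => by
      have hζ0 := h1.trans_le hζ.1
      have h3 := Kc_pos P
      have h4 : √ζ ≤ √(Zb α c) := sqrt_le_sqrt (hζ.2.trans h2)
      have h5 : √ζ * √ζ = ζ := mul_self_sqrt hζ0.le
      have h6 := sqrt_pos.2 hζ0
      rw [mul_one_div, div_le_div_iff₀ h6 hζ0]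
      calc f ζ * ζ ≤ Kc θ0 α c * ζ := by have := hw.le ζ; gcongr
        _ = Kc θ0 α c * √ζ * √ζ := by rw [mul_assoc, h5]
        _ ≤ _ := by gcongr
  rw [intervalIntegral.integral_const_mul, integral_one_div_of_pos h1 (h1.trans_le h),
    log_div (h1.trans_le h).ne' h1.ne'] at this
  exact this

lemma Wk.Jf_sub (hw : Wk θ0 α c κ f b) (y1 y2 : ℝ) :
    Jf α c f y2 - Jf α c f y1 =
      ∫ ζ in (max 0 (min y1 (Zb α c)))..max 0 (min y2 (Zb α c)), f ζ / √ζ :=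
  intervalIntegral.integral_interval_sub_left (hw.intervalIntegrable _ _) (hw.intervalIntegrable _ _)

lemma clamp_eq {y : ℝ} (h0 : 0 ≤ y) (h1 : y ≤ Zb α c) : max 0 (min y (Zb α c)) = y := by
  rw [min_eq_left h1, max_eq_right h0]

lemma Jf_eq {y : ℝ} (h0 : 0 ≤ y) (h1 : y ≤ Zb α c) :
    Jf α c f y = ∫ ζ in (0 : ℝ)..y, f ζ / √ζ := by
  rw [Jf, clamp_eq h0 h1]

lemma Wk.Jf_mono (hw : Wk θ0 α c κ f b) : Monotone (Jf α c f) := fun y1 y2 h => by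
  rw [← sub_nonneg, hw.Jf_sub]
  refine intervalIntegral.integral_nonneg (by gcongr) fun ζ _ => ?_
  exact div_nonneg (hw.nonneg ζ) (sqrt_nonneg _)

lemma Wk.Jf_nonneg (hw : Wk θ0 α c κ f b) (y : ℝ) : 0 ≤ Jf α c f y :=
  intervalIntegral.integral_nonneg (le_max_left _ _) fun ζ _ =>
    div_nonneg (hw.nonneg ζ) (sqrt_nonneg _)

lemma Wk.Jf_le (P : Params θ0 α c) (hw : Wk θ0 α c κ f b) (y : ℝ) : Jf α c f y ≤ C2 θ0 α c := by
  refine (hw.integral_le_sqrt le_rfl (le_max_left _ _)).trans ?_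
  rw [sqrt_zero, sub_zero, C2]
  have := Kc_pos P
  gcongr
  exact max_le (Zb_pos P).le (min_le_right _ _)

lemma Wk.Jf_continuous (hw : Wk θ0 α c κ f b) : Continuous (Jf α c f) :=
  (intervalIntegral.continuous_primitive (fun a b => hw.intervalIntegrable a b) 0).comp
    (by fun_prop : Continuous fun y => max 0 (min y (Zb α c)))

lemma Wk.If_le (P : Params θ0 α c) (hs : Small θ0 α c κ) (hw : Wk θ0 α c κ f b) (y : ℝ) :
    If α c κ f b y ≤ 2 := by
  have h1 : b + κ * Jf α c f y ≤ 1 / 2 := by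
    have h2 := mul_le_mul_of_nonneg_left (hw.Jf_le P y) hs.pos
    linarith [hs.le_quarter, hw.b_le, le_abs_self b]
  have h3 : (1 : ℝ) / 2 ≤ log 2 := by linarith [log_two_gt_d9]
  calc If α c κ f b y ≤ exp (log 2) := exp_le_exp.2 (h1.trans h3)
    _ = 2 := exp_log two_pos

lemma Wk.le_If (hs : Small θ0 α c κ) (hw : Wk θ0 α c κ f b) (y : ℝ) :
    1 / 2 ≤ If α c κ f b y := by
  have h2 := mul_nonneg hs.pos (hw.Jf_nonneg y)
  have h1 : -(1 / 2) ≤ b + κ * Jf α c f y := by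
    linarith [hs.le_quarter, hw.b_le, neg_abs_le b]
  have := add_one_le_exp (b + κ * Jf α c f y)
  rw [If]; linarith

lemma Wk.light (P : Params θ0 α c) (hs : Small θ0 α c κ) (hw : Wk θ0 α c κ f b) :
    Light (If α c κ f b) where
  cont := by
    have := hw.Jf_continuous
    unfold If; fun_prop
  mono := fun y1 y2 h => by
    have h1 := hw.Jf_mono h
    have h2 := hs.pos
    unfold If; gcongr
  pos := fun y => exp_pos _
  le_two := hw.If_le P hs

lemma If_pos (y : ℝ) : 0 < If α c κ f b y := exp_pos _

lemma log_If (y : ℝ) : log (If α c κ f b y) = b + κ * Jf α c f y := log_exp _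

end
end Model2

namespace Model2
open Set Filter Topology

/-- The optimal leaf density per unit of `cos (θ - θ0)`. -/
noncomputable def Xf (α c : ℝ) (I θ u : ℝ → ℝ) (t : ℝ) : ℝ := log (I (yf θ t) / Rf α c u t)

/-- An optimal stem of length `T` for the intensity generated by `f` and `b`. -/
structure Tr (θ0 α c κ : ℝ) (f : ℝ → ℝ) (b : ℝ) (θ u : ℝ → ℝ) (T : ℝ) : Prop where
  P : Params θ0 α c
  hs : Small θ0 α c κ
  hw : Wk θ0 α c κ f b
  ho : Opt θ0 α c (If α c κ f b) θ u
  hL : Len θ0 α c (If α c κ f b) θ u T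

section
variable {θ0 α c κ : ℝ} {f : ℝ → ℝ} {b : ℝ} {θ u : ℝ → ℝ} {T : ℝ}

lemma Tr.light (h : Tr θ0 α c κ f b θ u T) : Light (If α c κ f b) := h.hw.light h.P h.hs

lemma Tr.y_pos (h : Tr θ0 α c κ f b θ u T) {t : ℝ} (ht : 0 < t) : 0 < yf θ t :=
  (mul_pos h.P.sin_pos ht).trans_le (le_yf h.P h.ho.1.1 h.ho.1.2.2.1 ht.le)

lemma Tr.y_le (h : Tr θ0 α c κ f b θ u T) {t : ℝ} (ht : 0 ≤ t) (htT : t ≤ T) : yf θ t ≤ Zb α c :=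
  (yf_le h.ho.1.1 ht).trans (htT.trans h.hL.le)

lemma Tr.R_pos (h : Tr θ0 α c κ f b θ u T) {t : ℝ} (ht : t ∈ Ioo 0 T) : 0 < Rf α c u t := by
  refine lt_of_lt_of_le ?_ (le_Rf h.P h.ho.1 ht.1.le (h.hL.z_pos t ht.1.le ht.2))
  have := rpow_pos_of_pos (h.ho.zf_pos h.P h.light) (α - 1)
  have := h.P.c0; have := h.P.α0; have := ht.1
  positivity

lemma Tr.R_continuousOn (h : Tr θ0 α c κ f b θ u T) : ContinuousOn (Rf α c u) (Ioo 0 T) := by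
  intro t ht
  have hm : (t + T) / 2 < T := by linarith [ht.2]
  have := Rf_continuousOn (α := α) (c := c) h.ho.1 (T := (t + T) / 2) (by linarith [ht.1, ht.2])
    (h.hL.z_pos _ (by linarith [ht.1, ht.2]) hm)
  exact (this.continuousAt (Icc_mem_nhds ht.1 (by linarith [ht.2]))).continuousWithinAt

lemma Tr.X_continuousOn (h : Tr θ0 α c κ f b θ u T) :
    ContinuousOn (Xf α c (If α c κ f b) θ u) (Ioo 0 T) := by
  refine ContinuousOn.log (ContinuousOn.div ?_ h.R_continuousOn fun t ht => (h.R_pos ht).ne')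
    fun t ht => (div_pos (If_pos _) (h.R_pos ht)).ne'
  exact (h.light.cont.comp (yf_continuous h.ho.1.1)).continuousOn

lemma Tr.mcost_mono (h : Tr θ0 α c κ f b θ u T) {s t : ℝ} (hs : 0 ≤ s) (hst : s ≤ t) (ht : t < T) :
    c * α * zf u s ^ (α - 1) ≤ c * α * zf u t ^ (α - 1) :=
  mul_le_mul_of_nonneg_left (rpow_le_rpow_of_nonpos (h.hL.z_pos t (hs.trans hst) ht)
    (zf_antitone h.ho.1.2.2.2.2 h.ho.1.2.2.2.1 hs hst) (by linarith [h.P.α1]))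
    (mul_pos h.P.c0 h.P.α0).le

lemma Tr.mcost_intervalIntegrable (h : Tr θ0 α c κ f b θ u T) {s t : ℝ} (hs : 0 ≤ s) (hst : s ≤ t)
    (ht : t < T) : IntervalIntegrable (fun r => c * α * zf u r ^ (α - 1)) volume s t :=
  ((mcost_continuousOn (c := c) (α := α) h.ho.1 (h.hL.z_pos t (hs.trans hst) ht)).mono
    (Icc_subset_Icc_left hs)).intervalIntegrable_of_Icc hst

lemma Tr.R_le (h : Tr θ0 α c κ f b θ u T) {t : ℝ} (ht : t ∈ Ioo 0 T) :
    Rf α c u t ≤ t * (c * α * zf u t ^ (α - 1)) := by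
  have := intervalIntegral.integral_mono_on ht.1.le (h.mcost_intervalIntegrable le_rfl ht.1.le ht.2)
    (intervalIntegrable_const (c := c * α * zf u t ^ (α - 1))) fun s hs => h.mcost_mono hs.1 hs.2 ht.2
  rw [intervalIntegral.integral_const, smul_eq_mul, sub_zero] at this
  exact this

lemma Tr.R_ratio (h : Tr θ0 α c κ f b θ u T) {s t : ℝ} (hs : 0 < s) (hst : s ≤ t) (ht : t < T) :
    Rf α c u s * (t / s) ≤ Rf α c u t := by
  have hsT : s ∈ Ioo 0 T := ⟨hs, hst.trans_lt ht⟩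
  have h1 := intervalIntegral.integral_mono_on hst
    (intervalIntegrable_const (c := c * α * zf u s ^ (α - 1)))
    (h.mcost_intervalIntegrable hs.le hst ht) fun r hr => h.mcost_mono hs.le hr.1 (hr.2.trans_lt ht)
  have h2 := intervalIntegral.integral_add_adjacent_intervals
    (h.mcost_intervalIntegrable le_rfl hs.le hsT.2) (h.mcost_intervalIntegrable hs.le hst ht)
  have h3 := h.R_le hsT
  rw [intervalIntegral.integral_const, smul_eq_mul] at h1
  change Rf α c u s + _ = Rf α c u t at h2
  have h4 : Rf α c u s / s ≤ c * α * zf u s ^ (α - 1) := by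
    rw [div_le_iff₀ hs]; linarith
  have h5 : Rf α c u s * (t / s) = Rf α c u s + (t - s) * (Rf α c u s / s) := by
    field_simp; ring
  rw [h5]
  have := mul_le_mul_of_nonneg_left h4 (sub_nonneg.2 hst)
  linarith

/-- Heights grow at most polynomially in arc length. -/
lemma Tr.log_y_le (h : Tr θ0 α c κ f b θ u T) {s t : ℝ} (hs : 0 < s) (hst : s ≤ t) :
    log (yf θ t) - log (yf θ s) ≤ (log t - log s) / sin θ0 := by
  have hσ := h.P.sin_pos
  have hy := h.y_pos hs
  have ht := hs.trans_le hst
  have h1 : yf θ t ≤ yf θ s * (t / s) ^ (1 / sin θ0) := by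
    have hb := one_add_mul_self_le_rpow_one_add (s := t / s - 1) (p := 1 / sin θ0)
      (by have := div_pos ht hs; linarith) (by rw [le_div_iff₀ hσ]; linarith [h.P.sin_lt_one])
    rw [add_sub_cancel] at hb
    have h2 := yf_sub_le h.ho.1.1 hst
    have h3 := le_yf h.P h.ho.1.1 h.ho.1.2.2.1 hs.le
    have h4 : t - s ≤ yf θ s * (1 / sin θ0 * (t / s - 1)) := by
      have : t - s = sin θ0 * s * (1 / sin θ0 * (t / s - 1)) := by field_simp
      rw [this]
      refine mul_le_mul_of_nonneg_right h3 (mul_nonneg (by positivity) ?_)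
      rw [sub_nonneg, le_div_iff₀ hs]; linarith
    calc yf θ t ≤ yf θ s * (1 + 1 / sin θ0 * (t / s - 1)) := by linarith
      _ ≤ _ := by gcongr
  have h2 := log_le_log (h.y_pos ht) h1
  rw [log_mul hy.ne' (by positivity), log_rpow (by positivity), log_div ht.ne' hs.ne'] at h2
  rw [div_eq_inv_mul, ← one_div]; linarith

lemma Tr.X_le (h : Tr θ0 α c κ f b θ u T) {s t : ℝ} (hs : 0 < s) (hst : s ≤ t) (ht : t < T) :
    Xf α c (If α c κ f b) θ u t + (log t - log s) / 2 ≤ Xf α c (If α c κ f b) θ u s := by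
  have hsT : s ∈ Ioo 0 T := ⟨hs, hst.trans_lt ht⟩
  have ht0 := hs.trans_le hst
  have htT : t ∈ Ioo 0 T := ⟨ht0, ht⟩
  have hRs := h.R_pos hsT
  have hRt := h.R_pos htT
  have h1 := log_le_log (by positivity) (h.R_ratio hs hst ht)
  rw [log_mul hRs.ne' (by positivity), log_div ht0.ne' hs.ne'] at h1
  have hys := h.y_pos hs
  have hyt := h.y_pos ht0
  have hyst : yf θ s ≤ yf θ t := (yf_mono h.P h.ho.1.1 h.ho.1.2.2.1).monotone hst
  have hytZ := h.y_le ht0.le ht.le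
  have h2 := h.hw.integral_le_log h.P hys hyst hytZ
  have h3 := h.hw.Jf_sub (yf θ s) (yf θ t)
  rw [clamp_eq hys.le (hyst.trans hytZ), clamp_eq hyt.le hytZ] at h3
  have h4 := h.log_y_le hs hst
  have hlog : 0 ≤ log t - log s := sub_nonneg.2 (log_le_log hs hst)
  have hσ := h.P.sin_pos
  have h5 : κ * (Jf α c f (yf θ t) - Jf α c f (yf θ s)) ≤ (log t - log s) / 2 := by
    calc κ * (Jf α c f (yf θ t) - Jf α c f (yf θ s))
        ≤ κ * (Kc θ0 α c * √(Zb α c) * ((log t - log s) / sin θ0)) := by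
          have := Kc_pos h.P
          refine mul_le_mul_of_nonneg_left ?_ h.hs.pos
          rw [h3]
          exact h2.trans (by gcongr)
      _ = (κ * C2 θ0 α c) * ((log t - log s) / sin θ0) / 2 := by unfold C2; ring
      _ ≤ sin θ0 * ((log t - log s) / sin θ0) / 2 := by have := h.hs.le_sin; gcongr
      _ = (log t - log s) / 2 := by field_simp
  rw [Xf, Xf, log_div (If_pos _).ne' hRs.ne', log_div (If_pos _).ne' hRt.ne', log_If, log_If]
  linarith

lemma Tr.X_strictAnti (h : Tr θ0 α c κ f b θ u T) :
    StrictAntiOn (Xf α c (If α c κ f b) θ u) (Ioo 0 T) := fun s hs t ht hst => by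
  have := h.X_le hs.1 hst.le ht.2
  have := log_lt_log hs.1 hst
  linarith

lemma Tr.X_pos (h : Tr θ0 α c κ f b θ u T) {t : ℝ} (ht : t ∈ Ioo 0 T) :
    0 < Xf α c (If α c κ f b) θ u t := by
  by_contra! hx
  have hz : zf u t = 0 := by
    rw [zf_add h.ho.1.2.2.2.2 ht.1.le ht.2.le, h.hL.z_zero T le_rfl, add_zero,
      intervalIntegral.integral_of_le ht.2.le, integral_Ioc_eq_integral_Ioo]
    refine integral_eq_zero_of_ae ?_
    filter_upwards [ae_restrict_of_ae_restrict_of_subset (Ioo_subset_Ioo_left ht.1.le) h.hL.u_eq,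
      ae_restrict_mem measurableSet_Ioo] with s hsu hs
    have hxs := h.X_strictAnti ht ⟨ht.1.trans hs.1, hs.2⟩ hs.1
    have hxs0 : log (If α c κ f b (yf θ s) / Rf α c u s) ≤ 0 := hxs.le.trans hx
    rw [hsu, max_eq_left hxs0, mul_zero]
    rfl
  exact (h.hL.z_pos t ht.1.le ht.2).ne' hz

lemma Tr.X_tendsto_zero (h : Tr θ0 α c κ f b θ u T) {l : ℝ} (hl : 0 < l) :
    ∃ t ∈ Ioo 0 T, Xf α c (If α c κ f b) θ u t < l := no_jump h.P h.light h.ho h.hL hl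

lemma Tr.X_unbounded (h : Tr θ0 α c κ f b θ u T) (l : ℝ) :
    ∃ t ∈ Ioo 0 T, l < Xf α c (If α c κ f b) θ u t := by
  have hT := h.hL.pos
  have hT2 : T / 2 < T := by linarith
  set x2 := Xf α c (If α c κ f b) θ u (T / 2)
  refine ⟨T / 2 * exp (-2 * (|l - x2| + 1)), ?_, ?_⟩
  · have : exp (-2 * (|l - x2| + 1)) ≤ 1 := by
      rw [exp_le_one_iff]; have := abs_nonneg (l - x2); linarith
    exact ⟨by positivity, by nlinarith⟩
  · have hle : T / 2 * exp (-2 * (|l - x2| + 1)) ≤ T / 2 := by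
      have : exp (-2 * (|l - x2| + 1)) ≤ 1 := by
        rw [exp_le_one_iff]; have := abs_nonneg (l - x2); linarith
      nlinarith
    have := h.X_le (by positivity) hle hT2
    rw [log_mul (by positivity) (exp_pos _).ne', log_exp] at this
    have := le_abs_self (l - x2)
    linarith

end
end Model2

namespace Model2
open Set Filter Topology

/-- Normalization of the optimal direction. -/
noncomputable def Ds (θ0 ρ : ℝ) : ℝ := √(1 + 2 * ρ * sin θ0 + ρ ^ 2)

/-- Sine of the optimal angle if `ρ` is the ratio of the adjoint variables. -/
noncomputable def Sn (θ0 ρ : ℝ) : ℝ := (sin θ0 + ρ) / Ds θ0 ρ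

/-- Cosine of the difference of the optimal angle and `θ0`. -/
noncomputable def Cs (θ0 ρ : ℝ) : ℝ := (1 + ρ * sin θ0) / Ds θ0 ρ

section
variable {θ0 α c : ℝ} {ρ : ℝ}

lemma Ds_sq (P : Params θ0 α c) (hρ : 0 ≤ ρ) : Ds θ0 ρ ^ 2 = 1 + 2 * ρ * sin θ0 + ρ ^ 2 := by
  have := P.sin_pos
  exact sq_sqrt (by positivity)

lemma one_le_Ds (P : Params θ0 α c) (hρ : 0 ≤ ρ) : 1 ≤ Ds θ0 ρ := by
  have := P.sin_pos
  exact one_le_sqrt.2 (by nlinarith [mul_nonneg hρ this.le])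

lemma Sn_sq (P : Params θ0 α c) (hρ : 0 ≤ ρ) : Sn θ0 ρ ^ 2 + (cos θ0 / Ds θ0 ρ) ^ 2 = 1 := by
  have h1 := one_le_Ds P hρ
  have h2 := Ds_sq P hρ
  have h3 := sin_sq_add_cos_sq θ0
  rw [Sn, div_pow, div_pow, ← add_div, div_eq_one_iff_eq (by positivity), h2]
  linear_combination h3

lemma Cs_eq (P : Params θ0 α c) (hρ : 0 ≤ ρ) :
    Cs θ0 ρ = cos θ0 / Ds θ0 ρ * cos θ0 + Sn θ0 ρ * sin θ0 := by
  have h1 := one_le_Ds P hρ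
  have h3 := sin_sq_add_cos_sq θ0
  unfold Cs Sn
  field_simp
  linear_combination h3.symm

lemma Sn_le_one (P : Params θ0 α c) (hρ : 0 ≤ ρ) : Sn θ0 ρ ≤ 1 := by
  nlinarith [Sn_sq P hρ, sq_nonneg (cos θ0 / Ds θ0 ρ)]

lemma le_Sn (P : Params θ0 α c) (hρ : 0 ≤ ρ) : sin θ0 ≤ Sn θ0 ρ := by
  have hσ := P.sin_pos
  have hσ1 := P.sin_lt_one
  have h1 := one_le_Ds P hρ
  have h2 := Ds_sq P hρ
  rw [Sn, le_div_iff₀ (by positivity)]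
  refine le_of_sq_le_sq ?_ (by positivity)
  rw [mul_pow, h2]
  have : sin θ0 ^ 2 ≤ 1 := by nlinarith
  nlinarith [mul_nonneg hρ hσ.le, mul_nonneg (mul_nonneg hρ hσ.le) (sub_nonneg.2 this),
    mul_nonneg (sq_nonneg ρ) (sub_nonneg.2 this)]

lemma Cs_le_one (P : Params θ0 α c) (hρ : 0 ≤ ρ) : Cs θ0 ρ ≤ 1 := by
  have hσ := P.sin_pos
  have hσ1 := P.sin_lt_one
  have h1 := one_le_Ds P hρ
  have h2 := Ds_sq P hρ
  rw [Cs, div_le_one (by positivity)]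
  refine le_of_sq_le_sq ?_ (by positivity)
  rw [h2]
  have : sin θ0 ^ 2 ≤ 1 := by nlinarith
  nlinarith [mul_nonneg (sq_nonneg ρ) (sub_nonneg.2 this)]

lemma le_Cs (P : Params θ0 α c) (hρ : 0 ≤ ρ) : sin θ0 ≤ Cs θ0 ρ := by
  have hσ := P.sin_pos
  have hσ1 := P.sin_lt_one
  have h1 := one_le_Ds P hρ
  have h2 := Ds_sq P hρ
  rw [Cs, le_div_iff₀ (by positivity)]
  refine le_of_sq_le_sq ?_ (by positivity)
  rw [mul_pow, h2]
  have : sin θ0 ^ 2 ≤ 1 := by nlinarith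
  nlinarith [mul_nonneg hρ hσ.le, mul_nonneg (mul_nonneg hρ hσ.le) (sub_nonneg.2 this)]

/-- The optimal direction maximizes `ρ sin θ + cos (θ - θ0)`, with a quadratic gap. -/
lemma direction_gap (P : Params θ0 α c) (hρ : 0 ≤ ρ) (θ : ℝ) :
    2 * (cos θ0 ^ 2) * ((ρ * Sn θ0 ρ + Cs θ0 ρ) - (ρ * sin θ + cos (θ - θ0))) = Ds θ0 ρ *
      ((sin θ - Sn θ0 ρ) ^ 2 + (cos (θ - θ0) - Cs θ0 ρ) ^ 2 -
        2 * sin θ0 * (sin θ - Sn θ0 ρ) * (cos (θ - θ0) - Cs θ0 ρ)) := by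
  have h1 := one_le_Ds P hρ
  have h2 := Ds_sq P hρ
  have h3 := sin_sq_add_cos_sq θ0
  have h4 := sin_sq_add_cos_sq θ
  have h5 : sin θ ^ 2 + cos (θ - θ0) ^ 2 - 2 * sin θ0 * sin θ * cos (θ - θ0) = cos θ0 ^ 2 := by
    rw [cos_sub]; linear_combination (cos θ0 ^ 2) * h4 - sin θ ^ 2 * h3
  have e1 : Ds θ0 ρ * Sn θ0 ρ = sin θ0 + ρ := by unfold Sn; field_simp
  have e2 : Ds θ0 ρ * Cs θ0 ρ = 1 + ρ * sin θ0 := by unfold Cs; field_simp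
  have e3 : ρ * Sn θ0 ρ + Cs θ0 ρ = Ds θ0 ρ := by
    have : Ds θ0 ρ * (ρ * Sn θ0 ρ + Cs θ0 ρ) = Ds θ0 ρ * Ds θ0 ρ := by
      linear_combination ρ * e1 + e2 - h2
    exact mul_left_cancel₀ (by positivity) this
  have e4 : Sn θ0 ρ ^ 2 + Cs θ0 ρ ^ 2 - 2 * sin θ0 * Sn θ0 ρ * Cs θ0 ρ = cos θ0 ^ 2 := by
    have h6 := Sn_sq P hρ
    rw [Cs_eq P hρ]
    linear_combination (cos θ0 ^ 2) * h6 - Sn θ0 ρ ^ 2 * h3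
  rw [e3]
  set a := sin θ
  set s := cos (θ - θ0)
  set S := Sn θ0 ρ
  set C := Cs θ0 ρ
  set D := Ds θ0 ρ
  set σ := sin θ0
  have hc : cos θ0 ^ 2 = 1 - σ ^ 2 := by linear_combination h3
  rw [hc] at h5 e4 ⊢
  linear_combination (-D) * h5 - D * e4 + 2 * a * e1 + 2 * s * e2 - 2 * σ * a * e2 - 2 * σ * s * e1

lemma direction_le (P : Params θ0 α c) (hρ : 0 ≤ ρ) (θ : ℝ) :
    ρ * sin θ + cos (θ - θ0) ≤ ρ * Sn θ0 ρ + Cs θ0 ρ := by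
  have hσ := P.sin_pos
  have hσ1 := P.sin_lt_one
  have h1 := one_le_Ds P hρ
  have h := direction_gap P hρ θ
  have hc := pow_pos P.cos_pos 2
  set d1 := sin θ - Sn θ0 ρ
  set d2 := cos (θ - θ0) - Cs θ0 ρ
  have hQ : 0 ≤ d1 ^ 2 + d2 ^ 2 - 2 * sin θ0 * d1 * d2 := by
    nlinarith [sq_nonneg (d1 - sin θ0 * d2), mul_nonneg hc.le (sq_nonneg d2), sin_sq_add_cos_sq θ0]
  have := mul_nonneg (zero_le_one.trans h1) hQ
  nlinarith

lemma direction_eq (P : Params θ0 α c) (hρ : 0 ≤ ρ) {θ : ℝ}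
    (he : ρ * sin θ + cos (θ - θ0) = ρ * Sn θ0 ρ + Cs θ0 ρ) :
    sin θ = Sn θ0 ρ ∧ cos (θ - θ0) = Cs θ0 ρ := by
  have h1 := one_le_Ds P hρ
  have h := direction_gap P hρ θ
  have hc := pow_pos P.cos_pos 2
  rw [he, sub_self, mul_zero] at h
  set d1 := sin θ - Sn θ0 ρ with hd1
  set d2 := cos (θ - θ0) - Cs θ0 ρ with hd2
  have hQ : d1 ^ 2 + d2 ^ 2 - 2 * sin θ0 * d1 * d2 = 0 :=
    (mul_eq_zero.1 h.symm).resolve_left (by positivity)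
  have e : (d1 - sin θ0 * d2) ^ 2 + cos θ0 ^ 2 * d2 ^ 2 = 0 := by
    linear_combination hQ + d2 ^ 2 * sin_sq_add_cos_sq θ0
  have h2 : d2 = 0 := by
    have : cos θ0 ^ 2 * d2 ^ 2 = 0 := by nlinarith [sq_nonneg (d1 - sin θ0 * d2), sq_nonneg d2]
    exact pow_eq_zero_iff two_ne_zero |>.1 ((mul_eq_zero.1 this).resolve_left hc.ne')
  have h3 : d1 = 0 := by
    rw [h2] at e
    nlinarith
  exact ⟨sub_eq_zero.1 h3, sub_eq_zero.1 h2⟩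

lemma arcsin_mem (P : Params θ0 α c) {b : ℝ} (hb : sin θ0 ≤ b) :
    arcsin b ∈ Icc θ0 (π / 2) := by
  refine ⟨?_, arcsin_le_pi_div_two b⟩
  rw [← arcsin_sin (x := θ0) (by linarith [P.pos, pi_pos]) P.lt.le]
  exact monotone_arcsin hb

/-- Moving the sine of an angle linearly towards `Sn` increases the cosine at least linearly. -/
lemma cos_arcsin_ge (P : Params θ0 α c) (hρ : 0 ≤ ρ) {θ ε : ℝ} (hθ : θ ∈ Icc θ0 (π / 2))
    (hε : 0 ≤ ε) (hε1 : ε ≤ 1) :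
    cos (θ - θ0) + ε * (Cs θ0 ρ - cos (θ - θ0)) ≤
      cos (arcsin (sin θ + ε * (Sn θ0 ρ - sin θ)) - θ0) := by
  have hσ := P.sin_pos
  have hc := P.cos_pos
  have h1 := Sn_le_one P hρ
  have h2 := le_Sn P hρ
  have h3 := sin_le_one θ
  have h4 := P.sin_le hθ
  have hb1 : sin θ + ε * (Sn θ0 ρ - sin θ) ≤ 1 := by nlinarith
  have hb0 : -1 ≤ sin θ + ε * (Sn θ0 ρ - sin θ) := by nlinarith
  rw [cos_sub, cos_sub, cos_arcsin, sin_arcsin hb0 hb1, Cs_eq P hρ]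
  set Cn := cos θ0 / Ds θ0 ρ
  have h5 := Sn_sq P hρ
  have h6 := sin_sq_add_cos_sq θ
  have h7 : (1 - ε) * cos θ + ε * Cn ≤ √(1 - (sin θ + ε * (Sn θ0 ρ - sin θ)) ^ 2) := by
    refine le_sqrt_of_sq_le ?_
    nlinarith [mul_nonneg (mul_nonneg hε (sub_nonneg.2 hε1)) (sq_nonneg (sin θ - Sn θ0 ρ)),
      mul_nonneg (mul_nonneg hε (sub_nonneg.2 hε1)) (sq_nonneg (cos θ - Cn))]
  nlinarith [mul_le_mul_of_nonneg_right h7 hc.le]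

end
end Model2

namespace Model2
open Set Filter Topology

section
variable {θ0 α c κ : ℝ} {f : ℝ → ℝ} {b : ℝ} {θ u : ℝ → ℝ} {T : ℝ}

lemma Wk.ae_hasDerivAt (P : Params θ0 α c) (hw : Wk θ0 α c κ f b) :
    ∀ᵐ y, y ∈ Ioo 0 (Zb α c) → HasDerivAt (Jf α c f) (f y / √y) y := by
  filter_upwards [(hw.intervalIntegrable 0 (Zb α c)).ae_hasDerivAt_integral] with y hy hyZ
  have hZ := (Zb_pos P).le
  rw [uIcc_of_le hZ] at hy
  refine (hy (Ioo_subset_Icc_self hyZ) 0 (left_mem_Icc.2 hZ)).congr_of_eventuallyEq ?_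
  filter_upwards [Ioo_mem_nhds hyZ.1 hyZ.2] with x hx
  exact Jf_eq hx.1.le hx.2.le

/-- Null sets of heights correspond to null sets of arc lengths. -/
lemma ae_comp_yf (P : Params θ0 α c) (hθ : Measurable θ) (hm : ∀ t, θ t ∈ Icc θ0 (π / 2))
    {p : ℝ → Prop} (hp : ∀ᵐ y, p y) : ∀ᵐ t, p (yf θ t) := by
  have hσ := P.sin_pos
  have ha : AntilipschitzWith (1 / sin θ0).toNNReal (yf θ) := by
    refine AntilipschitzWith.of_le_mul_dist fun s t => ?_
    rw [coe_toNNReal _ (by positivity), one_div, ← div_eq_inv_mul, le_div_iff₀ hσ]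
    wlog hst : s ≤ t generalizing s t
    · rw [dist_comm, dist_comm (yf θ s)]; exact this t s (not_le.1 hst).le
    have h1 := le_yf_sub P hθ hm hst
    rw [dist_comm, dist_comm (yf θ s), dist_eq, dist_eq, abs_of_nonneg (sub_nonneg.2 hst)]
    exact (mul_comm _ _).trans_le (h1.trans (le_abs_self _))
  have h := ha.hausdorffMeasure_preimage_le zero_le_one {y | ¬ p y}
  rw [hausdorffMeasure_real, (ae_iff.1 hp : volume {y | ¬ p y} = 0), mul_zero] at h
  exact ae_iff.2 (le_antisymm h zero_le)

/-- Marginal value of height per unit of arc length. -/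
noncomputable def qg (θ0 α c κ : ℝ) (f : ℝ → ℝ) (b : ℝ) (θ u : ℝ → ℝ) (s : ℝ) : ℝ :=
  κ * If α c κ f b (yf θ s) * (f (yf θ s) / √(yf θ s)) * gain (cos (θ s - θ0)) (u s)

/-- Marginal value of height for the part of the stem beyond `t`. -/
noncomputable def qf (θ0 α c κ : ℝ) (f : ℝ → ℝ) (b : ℝ) (θ u : ℝ → ℝ) (T t : ℝ) : ℝ :=
  ∫ s in t..T, qg θ0 α c κ f b θ u s

/-- The ratio of the marginal values of height and exposure. -/
noncomputable def rf (θ0 α c κ : ℝ) (f : ℝ → ℝ) (b : ℝ) (θ u : ℝ → ℝ) (T t : ℝ) : ℝ :=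
  qf θ0 α c κ f b θ u T t /
    (If α c κ f b (yf θ t) * hh (Xf α c (If α c κ f b) θ u t))

lemma Tr.gain_mem (h : Tr θ0 α c κ f b θ u T) (t : ℝ) : gain (cos (θ t - θ0)) (u t) ∈ Icc 0 1 :=
  ⟨gain_nonneg (h.P.cos_sub_pos (h.ho.1.2.2.1 t)) (h.ho.1.2.2.2.1 t),
    (gain_le_left (h.P.cos_sub_pos (h.ho.1.2.2.1 t)) _).trans (cos_le_one _)⟩

lemma Tr.qg_nonneg (h : Tr θ0 α c κ f b θ u T) (t : ℝ) : 0 ≤ qg θ0 α c κ f b θ u t := by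
  have h1 := (h.gain_mem t).1
  have h2 := h.hw.nonneg (yf θ t)
  have h3 := If_pos (α := α) (c := c) (κ := κ) (f := f) (b := b) (yf θ t)
  have h4 := h.hs.pos
  unfold qg; positivity

lemma Tr.measurable_qg (h : Tr θ0 α c κ f b θ u T) : Measurable (qg θ0 α c κ f b θ u) := by
  have hy := (yf_continuous h.ho.1.1).measurable
  have h1 := h.light.cont.measurable.comp hy
  have h2 := h.hw.meas.comp hy
  have h3 := measurable_gain (measurable_cos.comp (h.ho.1.1.sub_const θ0)) h.ho.1.2.1
  exact ((h1.const_mul κ).mul (h2.div hy.sqrt)).mul h3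

lemma Tr.div_sqrt_le (h : Tr θ0 α c κ f b θ u T) {t : ℝ} (ht : 0 < t) :
    f (yf θ t) / √(yf θ t) ≤ Kc θ0 α c / √(sin θ0) * (1 / √t) := by
  have hσ := h.P.sin_pos
  have hK := Kc_pos h.P
  have hy := le_yf h.P h.ho.1.1 h.ho.1.2.2.1 ht.le
  rw [div_mul_div_comm, mul_one, ← sqrt_mul hσ.le]
  have := h.hw.le (yf θ t)
  gcongr

lemma Tr.qg_le (h : Tr θ0 α c κ f b θ u T) {t : ℝ} (ht : 0 < t) :
    qg θ0 α c κ f b θ u t ≤ κ * 2 * (Kc θ0 α c / √(sin θ0)) * (1 / √t) := by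
  have hK := Kc_pos h.P
  have h1 := h.div_sqrt_le ht
  have h2 := h.hw.If_le h.P h.hs (yf θ t)
  have h3 := h.hs.pos
  have h4 := h.hw.nonneg (yf θ t)
  have h5 := h.gain_mem t
  calc qg θ0 α c κ f b θ u t ≤ κ * 2 * (Kc θ0 α c / √(sin θ0) * (1 / √t)) * 1 := by
        unfold qg
        have := h5.1
        gcongr
        exact h5.2
    _ = _ := by ring

lemma Tr.qg_intervalIntegrable (h : Tr θ0 α c κ f b θ u T) {s t : ℝ} (hs : 0 ≤ s) (ht : 0 ≤ t) :
    IntervalIntegrable (qg θ0 α c κ f b θ u) volume s t := by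
  refine ((inv_sqrt_intervalIntegrable s t).const_mul
    (κ * 2 * (Kc θ0 α c / √(sin θ0)))).mono_fun' h.measurable_qg.aestronglyMeasurable ?_
  filter_upwards [ae_restrict_mem measurableSet_uIoc] with r hr
  rw [norm_of_nonneg (h.qg_nonneg r)]
  exact h.qg_le ((le_min hs ht).trans_lt hr.1)

lemma Tr.qf_nonneg (h : Tr θ0 α c κ f b θ u T) {t : ℝ} (ht : t ≤ T) :
    0 ≤ qf θ0 α c κ f b θ u T t :=
  intervalIntegral.integral_nonneg ht fun s _ => h.qg_nonneg s

lemma Tr.qf_continuousOn (h : Tr θ0 α c κ f b θ u T) :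
    ContinuousOn (qf θ0 α c κ f b θ u T) (Icc 0 T) := by
  have h1 := intervalIntegral.continuousOn_primitive_interval_left (a := 0) (b := T)
    (f := qg θ0 α c κ f b θ u) (μ := volume) (by
      rw [uIcc_of_le h.hL.pos.le, integrableOn_Icc_iff_integrableOn_Ioc,
        ← intervalIntegrable_iff_integrableOn_Ioc_of_le h.hL.pos.le]
      exact h.qg_intervalIntegrable le_rfl h.hL.pos.le)
  rwa [uIcc_of_le h.hL.pos.le] at h1

lemma Tr.hh_pos (h : Tr θ0 α c κ f b θ u T) {t : ℝ} (ht : t ∈ Ioo 0 T) :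
    0 < hh (Xf α c (If α c κ f b) θ u t) := Model2.hh_pos (h.X_pos ht)

lemma Tr.rf_nonneg (h : Tr θ0 α c κ f b θ u T) {t : ℝ} (ht : t ∈ Ioo 0 T) :
    0 ≤ rf θ0 α c κ f b θ u T t :=
  div_nonneg (h.qf_nonneg ht.2.le) (mul_pos (If_pos _) (h.hh_pos ht)).le

lemma Tr.rf_continuousOn (h : Tr θ0 α c κ f b θ u T) :
    ContinuousOn (rf θ0 α c κ f b θ u T) (Ioo 0 T) := by
  refine (h.qf_continuousOn.mono Ioo_subset_Icc_self).div ?_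
    fun t ht => (mul_pos (If_pos _) (h.hh_pos ht)).ne'
  exact (h.light.cont.comp (yf_continuous h.ho.1.1)).continuousOn.mul
    (continuous_hh.comp_continuousOn h.X_continuousOn)

lemma Ds_pos (P : Params θ0 α c) {ρ : ℝ} (hρ : 0 ≤ ρ) : 0 < Ds θ0 ρ :=
  zero_lt_one.trans_le (one_le_Ds P hρ)

lemma Sn_continuousOn (P : Params θ0 α c) : ContinuousOn (Sn θ0) (Ici 0) := by
  unfold Sn
  refine ContinuousOn.div (by fun_prop) ?_ fun ρ hρ => (Ds_pos P hρ).ne'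
  unfold Ds; fun_prop

lemma Cs_continuousOn (P : Params θ0 α c) : ContinuousOn (Cs θ0) (Ici 0) := by
  unfold Cs
  refine ContinuousOn.div (by fun_prop) ?_ fun ρ hρ => (Ds_pos P hρ).ne'
  unfold Ds; fun_prop

lemma Tr.Sn_continuousOn (h : Tr θ0 α c κ f b θ u T) :
    ContinuousOn (fun t => Sn θ0 (rf θ0 α c κ f b θ u T t)) (Ioo 0 T) :=
  (Model2.Sn_continuousOn h.P).comp h.rf_continuousOn fun _ ht => h.rf_nonneg ht

lemma Tr.Cs_continuousOn (h : Tr θ0 α c κ f b θ u T) :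
    ContinuousOn (fun t => Cs θ0 (rf θ0 α c κ f b θ u T t)) (Ioo 0 T) :=
  (Model2.Cs_continuousOn h.P).comp h.rf_continuousOn fun _ ht => h.rf_nonneg ht

end
end Model2

namespace Model2
open Set Filter Topology

lemma gain_lipschitz {s s' u : ℝ} (hs : 0 < s) (hs' : 0 < s') (hu : 0 ≤ u) :
    |gain s' u - gain s u| ≤ |s' - s| := by
  have := Convex.norm_image_sub_le_of_norm_hasDerivWithin_le (f := fun s => gain s u)
    (f' := fun s => hh (u / s)) (s := Ioi 0) (C := 1) (x := s) (y := s')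
    (fun r hr => (hasDerivAt_gain_left hr u).hasDerivWithinAt) (fun r hr => by
      have : 0 ≤ u / r := div_nonneg hu (le_of_lt hr)
      rw [norm_of_nonneg (hh_nonneg this)]; exact hh_le_one this) (convex_Ioi 0) hs hs'
  simpa using this

lemma abs_exp_sub_le {p q : ℝ} (hp : exp p ≤ 2) (hq : exp q ≤ 2) :
    |exp p - exp q| ≤ 2 * |p - q| := by
  wlog hpq : q ≤ p generalizing p q
  · rw [abs_sub_comm, abs_sub_comm p]; exact this hq hp (not_le.1 hpq).le
  have h1 := add_one_le_exp (q - p)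
  have h2 : exp q = exp p * exp (q - p) := by rw [← exp_add]; ring_nf
  rw [abs_of_nonneg (sub_nonneg.2 (exp_le_exp.2 hpq)), abs_of_nonneg (sub_nonneg.2 hpq), h2]
  nlinarith [exp_pos p]

section
variable {θ0 α c κ : ℝ} {f : ℝ → ℝ} {b : ℝ} {θ u : ℝ → ℝ} {T : ℝ}

lemma Wk.abs_Jf_sub_le (P : Params θ0 α c) (hw : Wk θ0 α c κ f b) {m y1 y2 : ℝ} (hm : 0 < m)
    (h1 : m ≤ y1) (h2 : m ≤ y2) :
    |Jf α c f y2 - Jf α c f y1| ≤ 2 * Kc θ0 α c / √m * |y2 - y1| := by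
  wlog hy : y1 ≤ y2 generalizing y1 y2
  · rw [abs_sub_comm, abs_sub_comm y2]; exact this h2 h1 (not_le.1 hy).le
  have hK := Kc_pos P
  have hmono := hw.Jf_mono hy
  rw [abs_of_nonneg (sub_nonneg.2 hmono), abs_of_nonneg (sub_nonneg.2 hy), hw.Jf_sub]
  have hpos : 0 ≤ 2 * Kc θ0 α c / √m * (y2 - y1) := mul_nonneg (by positivity) (sub_nonneg.2 hy)
  rcases le_total (Zb α c) y1 with hZ | hZ
  · rw [min_eq_right hZ, min_eq_right (hZ.trans hy), intervalIntegral.integral_same]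
    exact hpos
  rw [clamp_eq (hm.le.trans h1) hZ]
  set w := max 0 (min y2 (Zb α c)) with hwd
  have hw1 : y1 ≤ w := le_max_of_le_right (le_min hy hZ)
  have hw2 : w ≤ y2 := max_le (hm.le.trans h2) (min_le_left _ _)
  refine (hw.integral_le_sqrt (hm.le.trans h1) hw1).trans ?_
  have h3 : √w - √y1 ≤ (w - y1) / √m := by
    rw [le_div_iff₀ (sqrt_pos.2 hm)]
    have e1 := sq_sqrt (hm.le.trans (h1.trans hw1))
    have e2 := sq_sqrt (hm.le.trans h1)
    have e3 := sqrt_le_sqrt h1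
    have e4 := sqrt_le_sqrt hw1
    have e5 := sqrt_pos.2 hm
    nlinarith
  calc 2 * Kc θ0 α c * (√w - √y1) ≤ 2 * Kc θ0 α c * ((w - y1) / √m) := by gcongr
    _ ≤ 2 * Kc θ0 α c * ((y2 - y1) / √m) := by gcongr
    _ = _ := by ring

lemma Wk.abs_If_sub_le (P : Params θ0 α c) (hs : Small θ0 α c κ) (hw : Wk θ0 α c κ f b)
    {m y1 y2 : ℝ} (hm : 0 < m) (h1 : m ≤ y1) (h2 : m ≤ y2) :
    |If α c κ f b y2 - If α c κ f b y1| ≤ 4 * κ * Kc θ0 α c / √m * |y2 - y1| := by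
  refine (abs_exp_sub_le (hw.If_le P hs y2) (hw.If_le P hs y1)).trans ?_
  have h3 := hw.abs_Jf_sub_le P hm h1 h2
  rw [add_sub_add_left_eq_sub, ← mul_sub, abs_mul, abs_of_nonneg hs.pos]
  calc 2 * (κ * |Jf α c f y2 - Jf α c f y1|)
      ≤ 2 * (κ * (2 * Kc θ0 α c / √m * |y2 - y1|)) := by have := hs.pos; gcongr
    _ = _ := by ring

/-- The change of the sine towards the optimal direction. -/
noncomputable def dS (θ0 α c κ : ℝ) (f : ℝ → ℝ) (b : ℝ) (θ u : ℝ → ℝ) (T : ℝ) : ℝ → ℝ :=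
  (Ioo 0 T).indicator fun t => Sn θ0 (rf θ0 α c κ f b θ u T t) - sin (θ t)

/-- The change of the exposure towards the optimal direction. -/
noncomputable def dC (θ0 α c κ : ℝ) (f : ℝ → ℝ) (b : ℝ) (θ u : ℝ → ℝ) (T : ℝ) : ℝ → ℝ :=
  (Ioo 0 T).indicator fun t => Cs θ0 (rf θ0 α c κ f b θ u T t) - cos (θ t - θ0)

lemma measurable_indicator_of_continuousOn {g : ℝ → ℝ} {s : Set ℝ} (hs : MeasurableSet s)
    (hg : ContinuousOn g s) : Measurable (s.indicator g) := by
  classical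
  rw [← piecewise_eq_indicator]
  exact hg.measurable_piecewise continuousOn_const hs

lemma Tr.measurable_dS (h : Tr θ0 α c κ f b θ u T) : Measurable (dS θ0 α c κ f b θ u T) := by
  have := (measurable_indicator_of_continuousOn measurableSet_Ioo h.Sn_continuousOn).sub
    ((measurable_sin.comp h.ho.1.1).indicator (measurableSet_Ioo (a := 0) (b := T)))
  rwa [← indicator_sub'] at this

lemma Tr.measurable_dC (h : Tr θ0 α c κ f b θ u T) : Measurable (dC θ0 α c κ f b θ u T) := by
  have := (measurable_indicator_of_continuousOn measurableSet_Ioo h.Cs_continuousOn).sub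
    ((measurable_cos.comp (h.ho.1.1.sub_const θ0)).indicator (measurableSet_Ioo (a := 0) (b := T)))
  rwa [← indicator_sub'] at this

lemma Tr.sin_nonneg (h : Tr θ0 α c κ f b θ u T) (t : ℝ) : sin θ0 ≤ sin (θ t) :=
  h.P.sin_le (h.ho.1.2.2.1 t)

lemma Tr.abs_dS_le (h : Tr θ0 α c κ f b θ u T) (t : ℝ) : |dS θ0 α c κ f b θ u T t| ≤ 1 := by
  unfold dS indicator
  split_ifs with ht
  · have h1 := le_Sn h.P (h.rf_nonneg ht)
    have h2 := Sn_le_one h.P (h.rf_nonneg ht)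
    have h3 := h.sin_nonneg t
    have h4 := sin_le_one (θ t)
    have h5 := h.P.sin_pos
    rw [abs_le]; constructor <;> linarith
  · simp

lemma Tr.abs_dC_le (h : Tr θ0 α c κ f b θ u T) (t : ℝ) : |dC θ0 α c κ f b θ u T t| ≤ 1 := by
  unfold dC indicator
  split_ifs with ht
  · have h1 := le_Cs h.P (h.rf_nonneg ht)
    have h2 := Cs_le_one h.P (h.rf_nonneg ht)
    have h3 := h.P.le_cos (h.ho.1.2.2.1 t)
    have h4 := cos_le_one (θ t - θ0)
    have h5 := h.P.sin_pos
    rw [abs_le]; constructor <;> linarith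
  · simp

/-- The perturbed angle. -/
noncomputable def pert (θ0 α c κ : ℝ) (f : ℝ → ℝ) (b : ℝ) (θ u : ℝ → ℝ) (T ε t : ℝ) : ℝ :=
  arcsin (sin (θ t) + ε * dS θ0 α c κ f b θ u T t)

lemma Tr.sin_add_mem (h : Tr θ0 α c κ f b θ u T) {ε : ℝ} (h0 : 0 ≤ ε) (h1 : ε ≤ 1) (t : ℝ) :
    sin (θ t) + ε * dS θ0 α c κ f b θ u T t ∈ Icc (sin θ0) 1 := by
  unfold dS indicator
  have h3 := h.sin_nonneg t
  have h4 := sin_le_one (θ t)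
  split_ifs with ht
  · have h1 := le_Sn h.P (h.rf_nonneg ht)
    have h2 := Sn_le_one h.P (h.rf_nonneg ht)
    constructor <;> nlinarith
  · simpa using ⟨h3, h4⟩

lemma Tr.sin_pert (h : Tr θ0 α c κ f b θ u T) {ε : ℝ} (h0 : 0 ≤ ε) (h1 : ε ≤ 1) (t : ℝ) :
    sin (pert θ0 α c κ f b θ u T ε t) = sin (θ t) + ε * dS θ0 α c κ f b θ u T t := by
  have := h.sin_add_mem h0 h1 t
  exact sin_arcsin (by linarith [this.1, h.P.sin_pos]) this.2

lemma Tr.adm_pert (h : Tr θ0 α c κ f b θ u T) {ε : ℝ} (h0 : 0 ≤ ε) (h1 : ε ≤ 1) :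
    Adm2 θ0 (pert θ0 α c κ f b θ u T ε) u := by
  refine ⟨?_, h.ho.1.2.1, fun t => arcsin_mem h.P (h.sin_add_mem h0 h1 t).1, h.ho.1.2.2.2.1,
    h.ho.1.2.2.2.2⟩
  exact measurable_arcsin.comp ((measurable_sin.comp h.ho.1.1).add (h.measurable_dS.const_mul ε))

lemma Tr.dS_intervalIntegrable (h : Tr θ0 α c κ f b θ u T) (s t : ℝ) :
    IntervalIntegrable (dS θ0 α c κ f b θ u T) volume s t :=
  (intervalIntegrable_const (c := (1 : ℝ))).mono_fun h.measurable_dS.aestronglyMeasurable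
    (ae_of_all _ fun r => by simpa using h.abs_dS_le r)

/-- The change of height. -/
noncomputable def eta (θ0 α c κ : ℝ) (f : ℝ → ℝ) (b : ℝ) (θ u : ℝ → ℝ) (T t : ℝ) : ℝ :=
  ∫ s in (0 : ℝ)..t, dS θ0 α c κ f b θ u T s

lemma Tr.yf_pert (h : Tr θ0 α c κ f b θ u T) {ε : ℝ} (h0 : 0 ≤ ε) (h1 : ε ≤ 1) (t : ℝ) :
    yf (pert θ0 α c κ f b θ u T ε) t = yf θ t + ε * eta θ0 α c κ f b θ u T t := by
  simp only [yf, h.sin_pert h0 h1]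
  rw [intervalIntegral.integral_add (sin_intervalIntegrable h.ho.1.1 _ _)
    ((h.dS_intervalIntegrable _ _).const_mul ε), intervalIntegral.integral_const_mul, eta]

lemma Tr.abs_eta_le (h : Tr θ0 α c κ f b θ u T) {t : ℝ} (ht : 0 ≤ t) :
    |eta θ0 α c κ f b θ u T t| ≤ t := by
  have := intervalIntegral.norm_integral_le_of_norm_le_const (a := 0) (b := t) (C := 1)
    (f := dS θ0 α c κ f b θ u T) fun s _ => h.abs_dS_le s
  rwa [one_mul, sub_zero, abs_of_nonneg ht] at this

lemma Tr.eta_continuous (h : Tr θ0 α c κ f b θ u T) : Continuous (eta θ0 α c κ f b θ u T) :=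
  intervalIntegral.continuous_primitive h.dS_intervalIntegrable 0

lemma Tr.cos_add_le (h : Tr θ0 α c κ f b θ u T) {ε : ℝ} (h0 : 0 ≤ ε) (h1 : ε ≤ 1) {t : ℝ}
    (ht : t ∈ Ioo 0 T) :
    cos (θ t - θ0) + ε * dC θ0 α c κ f b θ u T t ≤ cos (pert θ0 α c κ f b θ u T ε t - θ0) := by
  unfold pert dC dS
  rw [indicator_of_mem ht, indicator_of_mem ht]
  exact cos_arcsin_ge h.P (h.rf_nonneg ht) (h.ho.1.2.2.1 t) h0 h1

lemma Tr.le_cos_add (h : Tr θ0 α c κ f b θ u T) {ε : ℝ} (h0 : 0 ≤ ε) (h1 : ε ≤ 1) {t : ℝ}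
    (ht : t ∈ Ioo 0 T) : sin θ0 ≤ cos (θ t - θ0) + ε * dC θ0 α c κ f b θ u T t := by
  unfold dC
  rw [indicator_of_mem ht]
  have := le_Cs h.P (h.rf_nonneg ht)
  have := h.P.le_cos (h.ho.1.2.2.1 t)
  nlinarith

end
end Model2

namespace Model2
open Set Filter Topology

section
variable {θ0 α c κ : ℝ} {f : ℝ → ℝ} {b : ℝ} {θ u : ℝ → ℝ} {T : ℝ}

/-- A lower bound for the light capture of the perturbed stem. -/
noncomputable def lp (θ0 α c κ : ℝ) (f : ℝ → ℝ) (b : ℝ) (θ u : ℝ → ℝ) (T ε t : ℝ) : ℝ :=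
  If α c κ f b (yf θ t + ε * eta θ0 α c κ f b θ u T t) *
    gain (cos (θ t - θ0) + ε * dC θ0 α c κ f b θ u T t) (u t)

lemma Tr.measurable_lp (h : Tr θ0 α c κ f b θ u T) (ε : ℝ) :
    Measurable (lp θ0 α c κ f b θ u T ε) := by
  have h1 := h.light.cont.comp ((yf_continuous h.ho.1.1).add (h.eta_continuous.const_mul ε))
  have h2 := measurable_gain ((measurable_cos.comp (h.ho.1.1.sub_const θ0)).add
    (h.measurable_dC.const_mul ε)) h.ho.1.2.1
  exact h1.measurable.mul h2

lemma Tr.lp_le (h : Tr θ0 α c κ f b θ u T) {ε : ℝ} (h0 : 0 ≤ ε) (h1 : ε ≤ 1) {t : ℝ}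
    (ht : t ∈ Ioo 0 T) : lp θ0 α c κ f b θ u T ε t ≤
      lt θ0 (If α c κ f b) (pert θ0 α c κ f b θ u T ε) u t := by
  unfold lp lt
  rw [h.yf_pert h0 h1]
  exact mul_le_mul_of_nonneg_left (gain_mono_left (h.P.sin_pos.trans_le (h.le_cos_add h0 h1 ht))
    (h.cos_add_le h0 h1 ht) (h.ho.1.2.2.2.1 t)) (If_pos _).le

lemma Tr.abs_lp_sub_le (h : Tr θ0 α c κ f b θ u T) {ε : ℝ} (h0 : 0 ≤ ε) (h1 : ε ≤ 1) {t : ℝ}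
    (ht : t ∈ Ioo 0 T) : |lp θ0 α c κ f b θ u T ε t - lt θ0 (If α c κ f b) θ u t| ≤
      ε * (4 * κ * Kc θ0 α c / √(sin θ0) * T * (1 / √t) + 2) := by
  have hσ := h.P.sin_pos
  have hK := Kc_pos h.P
  have hκ := h.hs.pos
  have hy1 := le_yf h.P h.ho.1.1 h.ho.1.2.2.1 ht.1.le
  have hp := h.adm_pert h0 h1
  have hy2 := le_yf h.P hp.1 hp.2.2.1 ht.1.le
  rw [h.yf_pert h0 h1] at hy2
  have hI := h.hw.abs_If_sub_le h.P h.hs (mul_pos hσ ht.1) hy1 hy2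
  have hs' := hσ.trans_le (h.le_cos_add h0 h1 ht)
  have hg := gain_lipschitz (h.P.cos_sub_pos (h.ho.1.2.2.1 t)) hs' (h.ho.1.2.2.2.1 t)
  have hg0 := gain_nonneg hs' (h.ho.1.2.2.2.1 t)
  have hg1 := (gain_le_left hs' (u t)).trans ((h.cos_add_le h0 h1 ht).trans (cos_le_one _))
  have he := (h.abs_eta_le ht.1.le).trans ht.2.le
  have hd := h.abs_dC_le t
  rw [add_sub_cancel_left, abs_mul, abs_of_nonneg h0] at hI hg
  have hL := h.hw.If_le h.P h.hs (yf θ t)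
  have hL0 := (If_pos (α := α) (c := c) (κ := κ) (f := f) (b := b) (yf θ t)).le
  unfold lp lt
  set I1 := If α c κ f b (yf θ t + ε * eta θ0 α c κ f b θ u T t)
  set I0 := If α c κ f b (yf θ t)
  set g1 := gain (cos (θ t - θ0) + ε * dC θ0 α c κ f b θ u T t) (u t)
  set g0 := gain (cos (θ t - θ0)) (u t)
  have e : I1 * g1 - I0 * g0 = (I1 - I0) * g1 + I0 * (g1 - g0) := by ring
  have hA : |I1 - I0| * |g1| ≤ ε * (4 * κ * Kc θ0 α c / √(sin θ0) * T * (1 / √t)) := by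
    rw [abs_of_nonneg hg0]
    calc |I1 - I0| * g1 ≤ |I1 - I0| * 1 := by gcongr
      _ ≤ 4 * κ * Kc θ0 α c / √(sin θ0 * t) * (ε * T) := by
        rw [mul_one]; refine hI.trans ?_; gcongr
      _ = _ := by rw [sqrt_mul hσ.le]; field_simp
  have hB : |I0| * |g1 - g0| ≤ ε * 2 := by
    rw [abs_of_nonneg hL0]
    calc I0 * |g1 - g0| ≤ 2 * (ε * 1) := by
          refine mul_le_mul hL (hg.trans ?_) (abs_nonneg _) zero_le_two
          gcongr
      _ = _ := by ring
  rw [e, mul_add]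
  refine (abs_add_le _ _).trans ?_
  rw [abs_mul, abs_mul]
  exact add_le_add hA hB

lemma Tr.lp_intervalIntegrable (h : Tr θ0 α c κ f b θ u T) {ε : ℝ} (h0 : 0 ≤ ε) (h1 : ε ≤ 1) :
    IntervalIntegrable (lp θ0 α c κ f b θ u T ε) volume 0 T := by
  rw [intervalIntegrable_iff_integrableOn_Ioo_of_le h.hL.pos.le]
  refine Measure.integrableOn_of_bounded (M := 2) (by simp)
    (h.measurable_lp ε).aestronglyMeasurable ?_
  filter_upwards [ae_restrict_mem measurableSet_Ioo] with t ht
  have hs' := h.P.sin_pos.trans_le (h.le_cos_add h0 h1 ht)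
  have hg0 := gain_nonneg hs' (h.ho.1.2.2.2.1 t)
  have hg1 := (gain_le_left hs' (u t)).trans ((h.cos_add_le h0 h1 ht).trans (cos_le_one _))
  rw [lp, norm_of_nonneg (mul_nonneg (If_pos _).le hg0)]
  calc _ ≤ 2 * (1 : ℝ) := mul_le_mul (h.hw.If_le h.P h.hs _) hg1 hg0 zero_le_two
    _ = 2 := by ring

lemma Tr.integral_slope_le (h : Tr θ0 α c κ f b θ u T) {ε : ℝ} (h0 : 0 ≤ ε) (h1 : ε ≤ 1) :
    ∫ t in (0 : ℝ)..T, ε⁻¹ * (lp θ0 α c κ f b θ u T ε t - lt θ0 (If α c κ f b) θ u t) ≤ 0 := by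
  have hT := h.hL.pos.le
  have hp := h.adm_pert h0 h1
  have hz := h.hL.z_zero T le_rfl
  have := h.ho.2 _ _ hp
  rw [payoff_support h.P h.light hp hT hz, payoff_support h.P h.light h.ho.1 hT hz] at this
  have h2 := intervalIntegral.integral_mono_on_of_le_Ioo hT (h.lp_intervalIntegrable h0 h1)
    (lt_intervalIntegrable h.P h.light hp le_rfl hT) fun t ht => h.lp_le h0 h1 ht
  rw [intervalIntegral.integral_const_mul, intervalIntegral.integral_sub
    (h.lp_intervalIntegrable h0 h1) (lt_intervalIntegrable h.P h.light h.ho.1 le_rfl hT)]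
  exact mul_nonpos_of_nonneg_of_nonpos (inv_nonneg.2 h0) (by linarith)

lemma Tr.u_eq (h : Tr θ0 α c κ f b θ u T) : ∀ᵐ t ∂(volume.restrict (Ioo 0 T)),
    u t = cos (θ t - θ0) * Xf α c (If α c κ f b) θ u t := by
  filter_upwards [h.hL.u_eq, ae_restrict_mem measurableSet_Ioo] with t ht htT
  rw [ht]
  congr 1
  exact max_eq_right (h.X_pos htT).le

lemma Tr.If_hasDerivAt (h : Tr θ0 α c κ f b θ u T) : ∀ᵐ t ∂(volume.restrict (Ioo 0 T)),
    HasDerivAt (If α c κ f b) (If α c κ f b (yf θ t) * (κ * (f (yf θ t) / √(yf θ t)))) (yf θ t) := by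
  filter_upwards [ae_restrict_of_ae
    (ae_comp_yf h.P h.ho.1.1 h.ho.1.2.2.1 (h.hw.ae_hasDerivAt h.P)),
    ae_restrict_mem measurableSet_Ioo] with t ht htT
  have hyZ : yf θ t < Zb α c := (yf_le h.ho.1.1 htT.1.le).trans_lt (htT.2.trans_le h.hL.le)
  exact (((ht ⟨h.y_pos htT.1, hyZ⟩).const_mul κ).const_add b).exp

/-- The variation of the payoff in the direction of the optimal angle. -/
noncomputable def var (θ0 α c κ : ℝ) (f : ℝ → ℝ) (b : ℝ) (θ u : ℝ → ℝ) (T t : ℝ) : ℝ :=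
  qg θ0 α c κ f b θ u t * eta θ0 α c κ f b θ u T t +
    If α c κ f b (yf θ t) * hh (Xf α c (If α c κ f b) θ u t) * dC θ0 α c κ f b θ u T t

lemma Tr.slope_tendsto (h : Tr θ0 α c κ f b θ u T) : ∀ᵐ t ∂(volume.restrict (Ioo 0 T)),
    Tendsto (fun ε => ε⁻¹ * (lp θ0 α c κ f b θ u T ε t - lt θ0 (If α c κ f b) θ u t)) (𝓝[>] 0)
      (𝓝 (var θ0 α c κ f b θ u T t)) := by
  filter_upwards [h.u_eq, h.If_hasDerivAt] with t hu hI
  have hs := h.P.cos_sub_pos (h.ho.1.2.2.1 t)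
  have hux : u t / cos (θ t - θ0) = Xf α c (If α c κ f b) θ u t := by
    rw [div_eq_iff hs.ne', hu, mul_comm]
  have h1 : HasDerivAt (fun ε => yf θ t + ε * eta θ0 α c κ f b θ u T t)
      (eta θ0 α c κ f b θ u T t) 0 := by
    simpa using ((hasDerivAt_id (0 : ℝ)).mul_const (eta θ0 α c κ f b θ u T t)).const_add (yf θ t)
  have h2 : HasDerivAt (fun ε => cos (θ t - θ0) + ε * dC θ0 α c κ f b θ u T t)
      (dC θ0 α c κ f b θ u T t) 0 := by
    simpa using ((hasDerivAt_id (0 : ℝ)).mul_const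
      (dC θ0 α c κ f b θ u T t)).const_add (cos (θ t - θ0))
  have h3 := HasDerivAt.comp_of_eq (0 : ℝ) hI h1 (by simp)
  have h4 := HasDerivAt.comp_of_eq (0 : ℝ) (hasDerivAt_gain_left hs (u t)) h2 (by simp)
  have h5 := (h3.mul h4).tendsto_slope_zero_right
  simp only [zero_add, smul_eq_mul, Function.comp_def, Pi.mul_apply, zero_mul, add_zero, hux] at h5
  refine h5.trans_eq (congrArg 𝓝 ?_)
  unfold var qg
  ring

lemma Tr.integral_var_le (h : Tr θ0 α c κ f b θ u T) :
    ∫ t in (0 : ℝ)..T, var θ0 α c κ f b θ u T t ≤ 0 := by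
  have hT := h.hL.pos.le
  have hlim := intervalIntegral.tendsto_integral_filter_of_dominated_convergence
    (μ := volume) (a := 0) (b := T) (l := 𝓝[>] (0 : ℝ))
    (F := fun ε t => ε⁻¹ * (lp θ0 α c κ f b θ u T ε t - lt θ0 (If α c κ f b) θ u t))
    (f := var θ0 α c κ f b θ u T)
    (fun t => 4 * κ * Kc θ0 α c / √(sin θ0) * T * (1 / √t) + 2)
    (Eventually.of_forall fun ε => (((h.measurable_lp ε).sub
      (measurable_lt h.light h.ho.1)).const_mul ε⁻¹).aestronglyMeasurable) ?_
    (((inv_sqrt_intervalIntegrable 0 T).const_mul _).add intervalIntegrable_const) ?_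
  · refine le_of_tendsto hlim ?_
    filter_upwards [Ioo_mem_nhdsGT zero_lt_one] with ε hε
    exact h.integral_slope_le hε.1.le hε.2.le
  · filter_upwards [Ioo_mem_nhdsGT zero_lt_one] with ε hε
    rw [uIoc_of_le hT, ← ae_restrict_iff' measurableSet_Ioc, ← restrict_Ioo_eq_restrict_Ioc]
    filter_upwards [ae_restrict_mem measurableSet_Ioo] with t ht
    rw [norm_mul, norm_inv, norm_of_nonneg hε.1.le, inv_mul_le_iff₀ hε.1]
    exact h.abs_lp_sub_le hε.1.le hε.2.le ht
  · rw [uIoc_of_le hT, ← ae_restrict_iff' measurableSet_Ioc, ← restrict_Ioo_eq_restrict_Ioc]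
    exact h.slope_tendsto

lemma hh_abs_le_one {x : ℝ} (hx : 0 ≤ x) : |hh x| ≤ 1 := by
  rw [abs_of_nonneg (hh_nonneg hx)]; exact hh_le_one hx

lemma Tr.direct_intervalIntegrable (h : Tr θ0 α c κ f b θ u T) : IntervalIntegrable (fun t =>
    If α c κ f b (yf θ t) * hh (Xf α c (If α c κ f b) θ u t) * dC θ0 α c κ f b θ u T t)
    volume 0 T := by
  have h1 : ContinuousOn (fun t => If α c κ f b (yf θ t) * hh (Xf α c (If α c κ f b) θ u t))
      (Ioo 0 T) := (h.light.cont.comp (yf_continuous h.ho.1.1)).continuousOn.mul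
    (continuous_hh.comp_continuousOn h.X_continuousOn)
  rw [intervalIntegrable_iff_integrableOn_Ioo_of_le h.hL.pos.le]
  refine Integrable.of_bound ((h1.aestronglyMeasurable measurableSet_Ioo).mul
    h.measurable_dC.aestronglyMeasurable) 2 ?_
  filter_upwards [ae_restrict_mem measurableSet_Ioo] with t ht
  rw [norm_mul, norm_mul, norm_of_nonneg (If_pos _).le]
  calc _ ≤ 2 * (1 : ℝ) * 1 := mul_le_mul (mul_le_mul (h.hw.If_le h.P h.hs _)
        (hh_abs_le_one (h.X_pos ht).le) (abs_nonneg _) zero_le_two) (h.abs_dC_le t)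
        (abs_nonneg _) (by norm_num)
    _ = 2 := by ring

/-- The optimal angle. -/
lemma Tr.angle (h : Tr θ0 α c κ f b θ u T) : ∀ᵐ t ∂(volume.restrict (Ioo 0 T)),
    sin (θ t) = Sn θ0 (rf θ0 α c κ f b θ u T t) ∧
      cos (θ t - θ0) = Cs θ0 (rf θ0 α c κ f b θ u T t) := by
  have hT := h.hL.pos.le
  have hq := h.qg_intervalIntegrable le_rfl hT
  have hd := h.direct_intervalIntegrable
  have hi1 : IntervalIntegrable (fun t => qg θ0 α c κ f b θ u t * eta θ0 α c κ f b θ u T t)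
      volume 0 T := hq.mul_continuousOn h.eta_continuous.continuousOn
  have hi2 : IntervalIntegrable (fun t => dS θ0 α c κ f b θ u T t * qf θ0 α c κ f b θ u T t)
      volume 0 T := (h.dS_intervalIntegrable 0 T).mul_continuousOn
    (by rw [uIcc_of_le hT]; exact h.qf_continuousOn)
  have h1 := h.integral_var_le
  simp only [var] at h1
  rw [intervalIntegral.integral_add hi1 hd] at h1
  have h2 := integral_triangle hT (h.dS_intervalIntegrable 0 T) hq
  change ∫ t in (0 : ℝ)..T, dS θ0 α c κ f b θ u T t * qf θ0 α c κ f b θ u T t =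
    ∫ t in (0 : ℝ)..T, qg θ0 α c κ f b θ u t * eta θ0 α c κ f b θ u T t at h2
  rw [← h2, ← intervalIntegral.integral_add hi2 hd, intervalIntegral.integral_of_le hT,
    integral_Ioc_eq_integral_Ioo] at h1
  have hi := (hi2.add hd)
  rw [intervalIntegrable_iff_integrableOn_Ioo_of_le hT] at hi
  have key : ∀ t ∈ Ioo 0 T, dS θ0 α c κ f b θ u T t * qf θ0 α c κ f b θ u T t +
      If α c κ f b (yf θ t) * hh (Xf α c (If α c κ f b) θ u t) * dC θ0 α c κ f b θ u T t =
      If α c κ f b (yf θ t) * hh (Xf α c (If α c κ f b) θ u t) *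
        ((rf θ0 α c κ f b θ u T t * Sn θ0 (rf θ0 α c κ f b θ u T t) +
            Cs θ0 (rf θ0 α c κ f b θ u T t)) -
          (rf θ0 α c κ f b θ u T t * sin (θ t) + cos (θ t - θ0))) := fun t ht => by
    have hp := mul_pos (If_pos (α := α) (c := c) (κ := κ) (f := f) (b := b) (yf θ t)) (h.hh_pos ht)
    have hq : qf θ0 α c κ f b θ u T t = rf θ0 α c κ f b θ u T t *
        (If α c κ f b (yf θ t) * hh (Xf α c (If α c κ f b) θ u t)) := by
      rw [rf, div_mul_cancel₀ _ hp.ne']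
    unfold dS dC
    rw [indicator_of_mem ht, indicator_of_mem ht, hq]
    ring
  have hnn : 0 ≤ᵐ[volume.restrict (Ioo 0 T)] fun t =>
      dS θ0 α c κ f b θ u T t * qf θ0 α c κ f b θ u T t +
      If α c κ f b (yf θ t) * hh (Xf α c (If α c κ f b) θ u t) * dC θ0 α c κ f b θ u T t := by
    filter_upwards [ae_restrict_mem measurableSet_Ioo] with t ht
    rw [key t ht]
    exact mul_nonneg (mul_pos (If_pos _) (h.hh_pos ht)).le
      (sub_nonneg.2 (direction_le h.P (h.rf_nonneg ht) _))
  have h0 := (integral_eq_zero_iff_of_nonneg_ae hnn hi).1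
    (le_antisymm h1 (integral_nonneg_of_ae hnn))
  filter_upwards [h0, ae_restrict_mem measurableSet_Ioo] with t h0 ht
  have h0' := (key t ht).symm.trans h0
  have := (mul_eq_zero.1 h0').resolve_left (mul_pos (If_pos _) (h.hh_pos ht)).ne'
  exact direction_eq h.P (h.rf_nonneg ht) (sub_eq_zero.1 this).symm

end
end Model2

namespace Model2
open Set Filter Topology

/-- The leaf density per unit of height along a stem, multiplied by `√ζ`, as a function of the
arc length `ζ`. -/
noncomputable def fn (θ0 α c κ : ℝ) (f : ℝ → ℝ) (b : ℝ) (θ u : ℝ → ℝ) (T : ℝ) : ℝ → ℝ :=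
  (Ioo 0 T).indicator fun ζ => √ζ * (Cs θ0 (rf θ0 α c κ f b θ u T ζ) /
    Sn θ0 (rf θ0 α c κ f b θ u T ζ)) * Xf α c (If α c κ f b) θ u ζ

section
variable {θ0 α c κ : ℝ} {f : ℝ → ℝ} {b : ℝ} {θ u : ℝ → ℝ} {T : ℝ}

lemma Sn_pos (P : Params θ0 α c) {ρ : ℝ} (hρ : 0 ≤ ρ) : 0 < Sn θ0 ρ :=
  P.sin_pos.trans_le (le_Sn P hρ)

lemma Cs_pos (P : Params θ0 α c) {ρ : ℝ} (hρ : 0 ≤ ρ) : 0 < Cs θ0 ρ :=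
  P.sin_pos.trans_le (le_Cs P hρ)

lemma Cs_div_Sn_le (P : Params θ0 α c) {ρ : ℝ} (hρ : 0 ≤ ρ) :
    Cs θ0 ρ / Sn θ0 ρ ≤ 1 / sin θ0 := by
  have := P.sin_pos
  have := le_Sn P hρ
  have := Cs_le_one P hρ
  gcongr

lemma Len.log_le_sqrt {I : ℝ → ℝ} (P : Params θ0 α c) (hI : Light I) (ho : Opt θ0 α c I θ u)
    (hL : Len θ0 α c I θ u T) {t : ℝ} (ht : t ∈ Ioo 0 T) :
    log (I (yf θ t) / Rf α c u t) ≤ 2 * √(Zb α c) / √t := by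
  have hZ := Zb_pos P
  have hα := P.α0
  have hc := P.c0
  have hz0 := ho.zf_pos P hI
  have ht0 := ht.1
  have h1 := le_Rf P ho.1 ht.1.le (hL.z_pos t ht.1.le ht.2)
  have h2 : c * α * Zb α c ^ (α - 1) * t ≤ Rf α c u t := by
    refine le_trans ?_ h1
    have := rpow_le_rpow_of_nonpos hz0 hL.z_le (by linarith [P.α1] : α - 1 ≤ 0)
    gcongr
  have h3 : c * α * Zb α c ^ (α - 1) = 2 / Zb α c := by
    rw [rpow_sub hZ, Zb_rpow P, rpow_one]; field_simp
  rw [h3] at h2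
  have hR : 0 < Rf α c u t := lt_of_lt_of_le (by positivity) h2
  have h4 : I (yf θ t) / Rf α c u t ≤ (√(Zb α c) / √t) ^ 2 := by
    rw [div_pow, sq_sqrt hZ.le, sq_sqrt ht0.le]
    calc I (yf θ t) / Rf α c u t ≤ 2 / (2 / Zb α c * t) := by
          gcongr; exact hI.le_two _
      _ = _ := by field_simp
  have h5 := log_le_log (div_pos (hI.pos _) hR) h4
  rw [log_pow] at h5
  have h6 : 0 < √(Zb α c) / √t := by positivity
  have h7 := log_le_sub_one_of_pos h6
  push_cast at h5
  rw [mul_div_assoc]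
  linarith

lemma Tr.X_le_sqrt (h : Tr θ0 α c κ f b θ u T) {t : ℝ} (ht : t ∈ Ioo 0 T) :
    Xf α c (If α c κ f b) θ u t ≤ 2 * √(Zb α c) / √t :=
  h.hL.log_le_sqrt h.P h.light h.ho ht

lemma Tr.fn_meas (h : Tr θ0 α c κ f b θ u T) : Measurable (fn θ0 α c κ f b θ u T) := by
  refine measurable_indicator_of_continuousOn measurableSet_Ioo ?_
  exact (continuous_sqrt.continuousOn.mul (h.Cs_continuousOn.div h.Sn_continuousOn
    fun t ht => (Sn_pos h.P (h.rf_nonneg ht)).ne')).mul h.X_continuousOn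

lemma Tr.fn_nonneg (h : Tr θ0 α c κ f b θ u T) (ζ : ℝ) : 0 ≤ fn θ0 α c κ f b θ u T ζ :=
  indicator_nonneg (fun _ ht => mul_nonneg (mul_nonneg (sqrt_nonneg _) (div_pos
    (Cs_pos h.P (h.rf_nonneg ht)) (Sn_pos h.P (h.rf_nonneg ht))).le) (h.X_pos ht).le) ζ

lemma Tr.fn_le_X (h : Tr θ0 α c κ f b θ u T) {t : ℝ} (ht : t ∈ Ioo 0 T) :
    fn θ0 α c κ f b θ u T t ≤ √t / sin θ0 * Xf α c (If α c κ f b) θ u t := by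
  rw [fn, indicator_of_mem ht, div_eq_mul_one_div (√t)]
  have := Cs_div_Sn_le h.P (h.rf_nonneg ht)
  have := h.X_pos ht
  gcongr

lemma Tr.fn_le (h : Tr θ0 α c κ f b θ u T) (ζ : ℝ) : fn θ0 α c κ f b θ u T ζ ≤ Kc θ0 α c := by
  by_cases ht : ζ ∈ Ioo 0 T
  · refine (h.fn_le_X ht).trans ?_
    have := h.P.sin_pos
    have := sqrt_pos.2 ht.1
    calc √ζ / sin θ0 * Xf α c (If α c κ f b) θ u ζ ≤ √ζ / sin θ0 * (2 * √(Zb α c) / √ζ) := by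
          gcongr; exact h.X_le_sqrt ht
      _ = _ := by unfold Kc; field_simp
  · rw [fn, indicator_of_notMem ht]; exact (Kc_pos h.P).le

lemma Tr.fn_continuousOn (h : Tr θ0 α c κ f b θ u T) :
    ContinuousOn (fn θ0 α c κ f b θ u T) (Ioi 0) := by
  intro ζ hζ
  refine ContinuousAt.continuousWithinAt ?_
  rcases lt_trichotomy ζ T with hT | rfl | hT
  · have h1 : ContinuousOn (fun ζ => √ζ * (Cs θ0 (rf θ0 α c κ f b θ u T ζ) /
      Sn θ0 (rf θ0 α c κ f b θ u T ζ)) * Xf α c (If α c κ f b) θ u ζ) (Ioo 0 T) :=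
      (continuous_sqrt.continuousOn.mul (h.Cs_continuousOn.div h.Sn_continuousOn
        fun t ht => (Sn_pos h.P (h.rf_nonneg ht)).ne')).mul h.X_continuousOn
    refine (h1.continuousAt (Ioo_mem_nhds hζ hT)).congr ?_
    filter_upwards [Ioo_mem_nhds hζ hT] with t ht
    rw [fn, indicator_of_mem ht]
  · have hσ := h.P.sin_pos
    have h0 : fn θ0 α c κ f b θ u ζ ζ = 0 := indicator_of_notMem (fun h => lt_irrefl _ h.2) _
    rw [ContinuousAt, h0, Metric.tendsto_nhds]
    intro ε hε
    have hζ0 : 0 < √ζ := sqrt_pos.2 hζ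
    obtain ⟨t0, ht0, hx⟩ := h.X_tendsto_zero (l := ε * sin θ0 / √ζ) (by positivity)
    filter_upwards [Ioi_mem_nhds ht0.2] with t ht
    rw [dist_zero_right, norm_of_nonneg (h.fn_nonneg t)]
    by_cases htT : t ∈ Ioo 0 ζ
    · refine (h.fn_le_X htT).trans_lt ?_
      have hX := (h.X_strictAnti ht0 htT ht).trans hx
      calc √t / sin θ0 * Xf α c (If α c κ f b) θ u t
          ≤ √ζ / sin θ0 * Xf α c (If α c κ f b) θ u t := by
            have := h.X_pos htT
            have := htT.2.le
            gcongr
        _ < √ζ / sin θ0 * (ε * sin θ0 / √ζ) := by gcongr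
        _ = ε := by field_simp
    · rw [fn, indicator_of_notMem htT]; exact hε
  · refine (continuousAt_const (y := (0 : ℝ))).congr ?_
    filter_upwards [Ioi_mem_nhds hT] with t ht
    rw [fn, indicator_of_notMem fun h => lt_asymm h.2 ht]

lemma Tr.fn_eq (h : Tr θ0 α c κ f b θ u T) : ∀ᵐ ζ ∂(volume.restrict (Ioi 0)),
    u ζ / sin (θ ζ) = fn θ0 α c κ f b θ u T ζ / √ζ := by
  have hT := h.hL.pos
  rw [← Ioc_union_Ioi_eq_Ioi hT.le, ae_restrict_union_iff]
  constructor
  · rw [← restrict_Ioo_eq_restrict_Ioc]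
    filter_upwards [h.u_eq, h.angle, ae_restrict_mem measurableSet_Ioo] with t hu hs ht
    have := sqrt_pos.2 ht.1
    have := Sn_pos h.P (h.rf_nonneg ht)
    rw [fn, indicator_of_mem ht, hu, hs.1, hs.2]
    field_simp
  · filter_upwards [h.hL.u_zero, ae_restrict_mem measurableSet_Ioi] with t hu ht
    rw [hu, fn, indicator_of_notMem fun h => lt_asymm h.2 ht, zero_div, zero_div]

/-- The total leaf density, multiplied by `-κ`. -/
noncomputable def bn (θ0 α c κ : ℝ) (f : ℝ → ℝ) (b : ℝ) (θ u : ℝ → ℝ) (T : ℝ) : ℝ :=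
  -(κ * Jf α c (fn θ0 α c κ f b θ u T) (Zb α c))

lemma Wk.total (P : Params θ0 α c) (hκ : 0 ≤ κ) (hw : Wk θ0 α c κ f b) :
    Wk θ0 α c κ f (-(κ * Jf α c f (Zb α c))) := by
  refine ⟨hw.meas, hw.nonneg, hw.le, ?_⟩
  rw [abs_neg, abs_mul, abs_of_nonneg hκ, abs_of_nonneg (hw.Jf_nonneg _)]
  exact mul_le_mul_of_nonneg_left (hw.Jf_le P _) hκ

lemma wk_of_le (P : Params θ0 α c) (hκ : 0 ≤ κ) (hm : Measurable f) (h0 : ∀ ζ, 0 ≤ f ζ)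
    (hK : ∀ ζ, f ζ ≤ Kc θ0 α c) : Wk θ0 α c κ f (-(κ * Jf α c f (Zb α c))) :=
  Wk.total (b := 0) P hκ ⟨hm, h0, hK, by
    rw [abs_zero]; exact mul_nonneg hκ (C2_pos P).le⟩

lemma Tr.next (h : Tr θ0 α c κ f b θ u T) :
    Wk θ0 α c κ (fn θ0 α c κ f b θ u T) (bn θ0 α c κ f b θ u T) :=
  wk_of_le h.P h.hs.pos h.fn_meas h.fn_nonneg h.fn_le

end
end Model2

namespace Model2
open Set Filter Topology

lemma hasDerivAt_integral_ae {v g : ℝ → ℝ} {T t : ℝ} (hv : IntervalIntegrable v volume 0 T)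
    (hg : ContinuousOn g (Ioo 0 T)) (he : ∀ᵐ t ∂(volume.restrict (Ioo 0 T)), v t = g t)
    (ht : t ∈ Ioo 0 T) : HasDerivAt (fun t => ∫ s in (0 : ℝ)..t, v s) (g t) t := by
  have hm0 : 0 < t / 2 := by linarith [ht.1]
  have hmt : t / 2 < t := by linarith [ht.1]
  have hT : 0 ≤ T := (ht.1.trans ht.2).le
  have hgi : IntervalIntegrable g volume (t / 2) t :=
    (hg.mono (Icc_subset_Ioo hm0 ht.2)).intervalIntegrable_of_Icc hmt.le
  have h1 := intervalIntegral.integral_hasDerivAt_right hgi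
    (hg.stronglyMeasurableAtFilter isOpen_Ioo t ht) (hg.continuousAt (Ioo_mem_nhds ht.1 ht.2))
  refine (h1.const_add (∫ s in (0 : ℝ)..(t / 2), v s)).congr_of_eventuallyEq ?_
  filter_upwards [Ioo_mem_nhds hmt ht.2] with x hx
  have hs1 : uIcc 0 (t / 2) ⊆ uIcc 0 T := by
    rw [uIcc_of_le hm0.le, uIcc_of_le hT]; exact Icc_subset_Icc le_rfl (by linarith [ht.2])
  have hs2 : uIcc (t / 2) x ⊆ uIcc 0 T := by
    rw [uIcc_of_le hx.1.le, uIcc_of_le hT]; exact Icc_subset_Icc hm0.le hx.2.le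
  have h2 := intervalIntegral.integral_add_adjacent_intervals (hv.mono_set hs1) (hv.mono_set hs2)
  rw [← h2, intervalIntegral.integral_of_le hx.1.le, intervalIntegral.integral_of_le hx.1.le]
  congr 1
  refine integral_congr_ae (ae_restrict_of_ae_restrict_of_subset ?_ he)
  exact fun s hs => ⟨hm0.trans hs.1, hs.2.trans_lt hx.2⟩

section
variable {θ0 α c κ : ℝ} {f : ℝ → ℝ} {b : ℝ} {θ u : ℝ → ℝ} {T : ℝ}

lemma Tr.hasDerivAt_y (h : Tr θ0 α c κ f b θ u T) {t : ℝ} (ht : t ∈ Ioo 0 T) :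
    HasDerivAt (yf θ) (Sn θ0 (rf θ0 α c κ f b θ u T t)) t :=
  hasDerivAt_integral_ae (sin_intervalIntegrable h.ho.1.1 0 T) h.Sn_continuousOn
    (h.angle.mono fun _ h => h.1) ht

lemma Tr.hasDerivAt_z (h : Tr θ0 α c κ f b θ u T) {t : ℝ} (ht : t ∈ Ioo 0 T) :
    HasDerivAt (zf u) (-(Cs θ0 (rf θ0 α c κ f b θ u T t) * Xf α c (If α c κ f b) θ u t)) t := by
  have h1 := hasDerivAt_integral_ae (v := u) (T := T)
    (intervalIntegrable_of_Ioi h.ho.1.2.2.2.2 le_rfl h.hL.pos.le)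
    (h.Cs_continuousOn.mul h.X_continuousOn) (by
      filter_upwards [h.u_eq, h.angle] with t h1 h2
      rw [h1, h2.2]; rfl) ht
  refine (h1.const_sub (zf u 0)).congr_of_eventuallyEq ?_
  filter_upwards [Ioi_mem_nhds ht.1] with s hs
  have := zf_add h.ho.1.2.2.2.2 le_rfl (le_of_lt hs)
  linarith

lemma Tr.hasDerivAt_R (h : Tr θ0 α c κ f b θ u T) {t : ℝ} (ht : t ∈ Ioo 0 T) :
    HasDerivAt (Rf α c u) (c * α * zf u t ^ (α - 1)) t := by
  have hm : (t + T) / 2 < T := by linarith [ht.2]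
  have hm1 : t < (t + T) / 2 := by linarith [ht.2]
  have hm0 : 0 ≤ (t + T) / 2 := (ht.1.trans hm1).le
  exact hasDerivAt_integral_ae (T := (t + T) / 2) (h.mcost_intervalIntegrable le_rfl hm0 hm)
    ((mcost_continuousOn (c := c) (α := α) h.ho.1 (h.hL.z_pos _ hm0 hm)).mono Ioo_subset_Icc_self)
    (ae_of_all _ fun _ => rfl) ⟨ht.1, hm1⟩

lemma Tr.y_lt (h : Tr θ0 α c κ f b θ u T) {t : ℝ} (ht : t ∈ Ioo 0 T) : yf θ t < Zb α c :=
  (yf_le h.ho.1.1 ht.1.le).trans_lt (ht.2.trans_le h.hL.le)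

lemma Wk.hasDerivAt_Jf (hw : Wk θ0 α c κ f b) (hf : ContinuousOn f (Ioi 0)) {y : ℝ}
    (hy : y ∈ Ioo 0 (Zb α c)) : HasDerivAt (Jf α c f) (f y / √y) y := by
  have h1 := hasDerivAt_integral_ae (hw.intervalIntegrable 0 (Zb α c))
    (g := fun y => f y / √y) ((hf.mono Ioo_subset_Ioi_self).div continuous_sqrt.continuousOn
      fun x hx => (sqrt_pos.2 hx.1).ne') (ae_of_all _ fun _ => rfl) hy
  refine h1.congr_of_eventuallyEq ?_
  filter_upwards [Ioo_mem_nhds hy.1 hy.2] with x hx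
  exact Jf_eq hx.1.le hx.2.le

lemma Tr.hasDerivAt_log_I (h : Tr θ0 α c κ f b θ u T) (hf : ContinuousOn f (Ioi 0)) {t : ℝ}
    (ht : t ∈ Ioo 0 T) : HasDerivAt (fun t => log (If α c κ f b (yf θ t)))
      (κ * (f (yf θ t) / √(yf θ t)) * Sn θ0 (rf θ0 α c κ f b θ u T t)) t := by
  have h1 := ((h.hw.hasDerivAt_Jf hf ⟨h.y_pos ht.1, h.y_lt ht⟩).comp t
    (h.hasDerivAt_y ht)).const_mul κ |>.const_add b
  simp only [log_If]
  exact h1.congr_deriv (by ring)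

lemma Tr.hasDerivAt_q (h : Tr θ0 α c κ f b θ u T) (hf : ContinuousOn f (Ioi 0)) {t : ℝ}
    (ht : t ∈ Ioo 0 T) : HasDerivAt (qf θ0 α c κ f b θ u T)
      (-(κ * If α c κ f b (yf θ t) * (f (yf θ t) / √(yf θ t)) *
        (Cs θ0 (rf θ0 α c κ f b θ u T t) * (1 - exp (-Xf α c (If α c κ f b) θ u t))))) t := by
  have hy := (yf_continuous h.ho.1.1).continuousOn (s := Ioo 0 T)
  have hT := h.hL.pos.le
  have hm : MapsTo (yf θ) (Ioo 0 T) (Ioi 0) := fun t ht => h.y_pos ht.1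
  have hg : ContinuousOn (fun t => κ * If α c κ f b (yf θ t) * (f (yf θ t) / √(yf θ t)) *
      (Cs θ0 (rf θ0 α c κ f b θ u T t) * (1 - exp (-Xf α c (If α c κ f b) θ u t)))) (Ioo 0 T) :=
    ((continuousOn_const.mul (h.light.cont.comp_continuousOn hy)).mul
      ((hf.comp hy hm).div (continuous_sqrt.comp_continuousOn hy)
        fun t ht => (sqrt_pos.2 (h.y_pos ht.1)).ne')).mul
      (h.Cs_continuousOn.mul (continuousOn_const.sub
        (continuous_exp.comp_continuousOn h.X_continuousOn.neg)))
  have h1 := hasDerivAt_integral_ae (h.qg_intervalIntegrable le_rfl hT) hg (by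
    filter_upwards [h.u_eq, h.angle, ae_restrict_mem measurableSet_Ioo] with t h1 h2 ht
    rw [qg, h1, gain_mul (h.P.cos_sub_pos (h.ho.1.2.2.1 t)), h2.2]) ht
  refine (h1.const_sub (∫ s in (0 : ℝ)..T, qg θ0 α c κ f b θ u s)).congr_of_eventuallyEq ?_
  filter_upwards [Ioi_mem_nhds ht.1] with s hs
  exact eq_sub_of_add_eq' (intervalIntegral.integral_add_adjacent_intervals
    (h.qg_intervalIntegrable le_rfl (le_of_lt hs)) (h.qg_intervalIntegrable (le_of_lt hs) hT))

lemma Tr.hasDerivAt_X (h : Tr θ0 α c κ f b θ u T) (hf : ContinuousOn f (Ioi 0)) {t : ℝ}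
    (ht : t ∈ Ioo 0 T) : HasDerivAt (Xf α c (If α c κ f b) θ u)
      (κ * (f (yf θ t) / √(yf θ t)) * Sn θ0 (rf θ0 α c κ f b θ u T t) -
        c * α * zf u t ^ (α - 1) / Rf α c u t) t := by
  refine ((h.hasDerivAt_log_I hf ht).sub ((h.hasDerivAt_R ht).log
    (h.R_pos ht).ne')).congr_of_eventuallyEq ?_
  filter_upwards [Ioo_mem_nhds ht.1 ht.2] with s hs
  exact log_div (If_pos _).ne' (h.R_pos hs).ne'

end
end Model2

namespace Model2
open Set Filter Topology

/-- An optimal configuration described as a function of the optical depth `x` of the leaves. -/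
structure Path where
  t : ℝ → ℝ
  y : ℝ → ℝ
  w : ℝ → ℝ
  q : ℝ → ℝ
  L : ℝ → ℝ
  ρ : ℝ → ℝ
  P : ℝ → ℝ
  ν : ℝ → ℝ
  B : ℝ → ℝ
  T : ℝ

/-- The speed with which the length decreases along a path. -/
noncomputable def Path.τ (s : Path) (x : ℝ) : ℝ := s.P x / (1 - s.ν x)

/-- The differential equations solved by an optimal configuration for the light intensity
given by `(f, b)`; the resulting leaf density is given by `(g, b')`. -/
structure Sol (θ0 α c κ : ℝ) (f : ℝ → ℝ) (b : ℝ) (g : ℝ → ℝ) (b' : ℝ) (s : Path) : Prop where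
  P : Params θ0 α c
  hs : Small θ0 α c κ
  hw : Wk θ0 α c κ f b
  hg : Wk θ0 α c κ g b'
  t_pos : ∀ x > 0, 0 < s.t x
  t_lt : ∀ x > 0, s.t x < s.T
  T_le : s.T ≤ Zb α c
  le_y : ∀ x > 0, sin θ0 * s.t x ≤ s.y x
  y_le : ∀ x > 0, s.y x ≤ s.t x
  w_pos : ∀ x > 0, 0 < s.w x
  q_nonneg : ∀ x > 0, 0 ≤ s.q x
  P_le : ∀ x > 0, s.P x ≤ s.t x
  L_eq : ∀ x > 0, s.L x = If α c κ f b (s.y x)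
  ρ_eq : ∀ x > 0, s.ρ x = s.q x / (s.L x * hh x)
  P_eq : ∀ x > 0, s.P x = s.L x * exp (-x) * s.w x ^ ((1 - α) / α) / (c * α)
  ν_eq : ∀ x > 0, s.ν x = κ * (f (s.y x) / √(s.y x)) * Sn θ0 (s.ρ x) * s.P x
  t_deriv : ∀ x > 0, HasDerivAt s.t (-s.τ x) x
  y_deriv : ∀ x > 0, HasDerivAt s.y (-(s.τ x * Sn θ0 (s.ρ x))) x
  w_deriv : ∀ x > 0, HasDerivAt s.w
    (s.L x * Cs θ0 (s.ρ x) * (x * exp (-x)) / (c * (1 - s.ν x))) x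
  q_deriv : ∀ x > 0, HasDerivAt s.q
    (κ * s.L x * (f (s.y x) / √(s.y x)) * (Cs θ0 (s.ρ x) * (1 - exp (-x))) * s.τ x) x
  B_deriv : ∀ x > 0, HasDerivAt s.B (Cs θ0 (s.ρ x) / Sn θ0 (s.ρ x) * x * s.τ x) x
  t_top : Tendsto s.t atTop (𝓝 0)
  t_zero : Tendsto s.t (𝓝[>] 0) (𝓝 s.T)
  w_zero : Tendsto s.w (𝓝[>] 0) (𝓝 0)
  q_zero : Tendsto s.q (𝓝[>] 0) (𝓝 0)
  B_zero : Tendsto s.B (𝓝[>] 0) (𝓝 0)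
  B_top : ∃ β, Tendsto s.B atTop (𝓝 β) ∧ b' = -(κ * β)
  g_eq : ∀ x > 0, g (s.t x) = √(s.t x) * (Cs θ0 (s.ρ x) / Sn θ0 (s.ρ x)) * x
  g_zero : ∀ ζ, s.T ≤ ζ → g ζ = 0
  surj : ∀ ζ ∈ Ioo 0 s.T, ∃ x > 0, s.t x = ζ

section
variable {θ0 α c κ : ℝ} {f : ℝ → ℝ} {b : ℝ} {θ u : ℝ → ℝ} {T : ℝ}

lemma div_sqrt_le (P : Params θ0 α c) (hw : Wk θ0 α c κ f b) {y t : ℝ} (ht : 0 < t)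
    (hy : sin θ0 * t ≤ y) : f y / √y ≤ Kc θ0 α c / √(sin θ0) * (1 / √t) := by
  have hσ := P.sin_pos
  rw [div_mul_div_comm, mul_one, ← sqrt_mul hσ.le]
  have : 0 < √(sin θ0 * t) := sqrt_pos.2 (by positivity)
  exact div_le_div₀ (Kc_pos P).le (hw.le _) this (sqrt_le_sqrt hy)

lemma nu_le (P : Params θ0 α c) (hs : Small θ0 α c κ) (hw : Wk θ0 α c κ f b) {y t p S : ℝ}
    (ht : 0 < t) (hy : sin θ0 * t ≤ y) (htZ : t ≤ Zb α c) (hS : S ≤ 1) (hp : 0 ≤ p) (hpt : p ≤ t) :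
    κ * (f y / √y) * S * p ≤ 1 / 2 := by
  have hσ := P.sin_pos
  have hK := Kc_pos P
  have h1 := div_sqrt_le P hw ht hy
  have h0 : 0 ≤ f y / √y := div_nonneg (hw.nonneg _) (sqrt_nonneg _)
  have hst : 0 < √t := sqrt_pos.2 ht
  have hss : 0 < √(sin θ0) := sqrt_pos.2 hσ
  have hss1 : √(sin θ0) ≤ 1 := sqrt_le_one.2 P.sin_lt_one.le
  have hκ := hs.pos
  have h2 : κ * (Kc θ0 α c * √t) ≤ sin θ0 / 2 := by
    have := hs.le_sin
    have h3 : κ * (Kc θ0 α c * √t) ≤ κ * (Kc θ0 α c * √(Zb α c)) := by gcongr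
    rw [C2] at this; linarith
  calc κ * (f y / √y) * S * p ≤ κ * (f y / √y) * 1 * t := by gcongr
    _ ≤ κ * (Kc θ0 α c / √(sin θ0) * (1 / √t)) * 1 * t := by gcongr
    _ = κ * (Kc θ0 α c * √t) / √(sin θ0) := by
      field_simp
      rw [sq_sqrt ht.le]
    _ ≤ sin θ0 / 2 / √(sin θ0) := by gcongr
    _ = √(sin θ0) / 2 := by
      have : sin θ0 = √(sin θ0) * √(sin θ0) := (mul_self_sqrt hσ.le).symm
      field_simp
      linarith
    _ ≤ 1 / 2 := by linarith

lemma Tr.exists_X_eq (h : Tr θ0 α c κ f b θ u T) {x : ℝ} (hx : 0 < x) :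
    ∃ t ∈ Ioo 0 T, Xf α c (If α c κ f b) θ u t = x := by
  obtain ⟨t1, ht1, h1⟩ := h.X_tendsto_zero hx
  obtain ⟨t2, ht2, h2⟩ := h.X_unbounded x
  exact isPreconnected_Ioo.intermediate_value ht1 ht2 h.X_continuousOn ⟨h1.le, h2.le⟩

lemma Tr.exists_sol (h : Tr θ0 α c κ f b θ u T) (hf : ContinuousOn f (Ioi 0)) :
    ∃ s : Path, Sol θ0 α c κ f b (fn θ0 α c κ f b θ u T) (bn θ0 α c κ f b θ u T) s ∧ s.T = T ∧
      ∀ ζ ∈ Ioo 0 T, ∃ x > 0, s.t x = ζ ∧ s.ρ x = rf θ0 α c κ f b θ u T ζ ∧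
        x = Xf α c (If α c κ f b) θ u ζ ∧ s.y x = yf θ ζ := by
  set X := Xf α c (If α c κ f b) θ u with hX
  set r := rf θ0 α c κ f b θ u T with hr
  have hP := h.P
  have hα0 := h.P.α0
  have hc0 := h.P.c0
  choose! t ht hXt using (fun x hx => h.exists_X_eq hx : ∀ x > 0, ∃ t ∈ Ioo 0 T, X t = x)
  have htX : ∀ ζ ∈ Ioo 0 T, t (X ζ) = ζ := fun ζ hζ =>
    h.X_strictAnti.injOn (ht _ (h.X_pos hζ)) hζ (hXt _ (h.X_pos hζ))
  have hanti : StrictAntiOn t (Ioi 0) := fun x hx x' hx' hlt => by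
    by_contra! hle
    have := h.X_strictAnti.antitoneOn (ht x hx) (ht x' hx') hle
    rw [hXt x hx, hXt x' hx'] at this
    linarith
  have hcont : ∀ x > 0, ContinuousAt t x := fun x hx => by
    have h1 : ContinuousAt (fun x => -t x) x := by
      refine continuousAt_of_monotoneOn_of_image_mem_nhds (s := Ioi 0)
        (fun x hx x' hx' hle => neg_le_neg (hanti.antitoneOn hx hx' hle)) (Ioi_mem_nhds hx) ?_
      refine mem_of_superset (Ioo_mem_nhds (neg_lt_neg (ht x hx).2) (neg_lt_zero.2 (ht x hx).1))
        fun ζ hζ => ?_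
      have hζ' : -ζ ∈ Ioo 0 T := ⟨by linarith [hζ.2], by linarith [hζ.1]⟩
      exact ⟨X (-ζ), h.X_pos hζ', by simp only [htX _ hζ', neg_neg]⟩
    exact h1.neg.congr (Eventually.of_forall fun x => neg_neg _)
  have hLp : ∀ x, 0 < If α c κ f b (yf θ (t x)) := fun x => If_pos _
  have hzp : ∀ x > 0, 0 < zf u (t x) := fun x hx => h.hL.z_pos _ (ht x hx).1.le (ht x hx).2
  have hm : ∀ x > 0, 0 < c * α * zf u (t x) ^ (α - 1) := fun x hx =>
    mul_pos (mul_pos hc0 hα0) (rpow_pos_of_pos (hzp x hx) _)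
  have hR : ∀ x > 0, Rf α c u (t x) = If α c κ f b (yf θ (t x)) * exp (-x) := fun x hx => by
    have h1 : exp x = If α c κ f b (yf θ (t x)) / Rf α c u (t x) := by
      conv_lhs => rw [← hXt x hx]
      exact exp_log (div_pos (hLp x) (h.R_pos (ht x hx)))
    have := h.R_pos (ht x hx)
    have := hLp x
    rw [exp_neg, h1]; field_simp
  set p : ℝ → ℝ := fun x => Rf α c u (t x) / (c * α * zf u (t x) ^ (α - 1)) with hp
  have hp0 : ∀ x > 0, 0 < p x := fun x hx => div_pos (h.R_pos (ht x hx)) (hm x hx)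
  have hpt : ∀ x > 0, p x ≤ t x := fun x hx => (div_le_iff₀ (hm x hx)).2 (h.R_le (ht x hx))
  have hr0 : ∀ x > 0, 0 ≤ r (t x) := fun x hx => h.rf_nonneg (ht x hx)
  have hyl : ∀ x > 0, sin θ0 * t x ≤ yf θ (t x) := fun x hx =>
    le_yf h.P h.ho.1.1 h.ho.1.2.2.1 (ht x hx).1.le
  set v : ℝ → ℝ := fun x => κ * (f (yf θ (t x)) / √(yf θ (t x))) * Sn θ0 (r (t x)) * p x with hv
  have hv2 : ∀ x > 0, v x ≤ 1 / 2 := fun x hx =>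
    nu_le h.P h.hs h.hw (ht x hx).1 (hyl x hx) ((ht x hx).2.le.trans h.hL.le)
      (Sn_le_one h.P (hr0 x hx)) (hp0 x hx).le (hpt x hx)
  have hv1 : ∀ x > 0, 0 < 1 - v x := fun x hx => by linarith [hv2 x hx]
  have hdt : ∀ x > 0, HasDerivAt t (-(p x / (1 - v x))) x := fun x hx => by
    have h1 := h.hasDerivAt_X hf (ht x hx)
    have h2 : κ * (f (yf θ (t x)) / √(yf θ (t x))) * Sn θ0 (rf θ0 α c κ f b θ u T (t x)) -
        c * α * zf u (t x) ^ (α - 1) / Rf α c u (t x) = -((1 - v x) / p x) := by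
      rw [sub_div, one_div_div, hv, mul_div_cancel_right₀ _ (hp0 x hx).ne']; ring
    rw [h2] at h1
    refine (h1.of_local_left_inverse (hcont x hx) (neg_ne_zero.2
      (div_pos (hv1 x hx) (hp0 x hx)).ne') ?_).congr_deriv ?_
    · filter_upwards [Ioi_mem_nhds hx] with x' hx' using hXt x' hx'
    · rw [inv_neg, inv_div]
  have htop : Tendsto t atTop (𝓝 0) := by
    refine tendsto_order.2 ⟨fun a ha => ?_, fun a ha => ?_⟩
    · filter_upwards [eventually_gt_atTop 0] with x hx using ha.trans (ht x hx).1
    · have hζ : min (a / 2) (T / 2) ∈ Ioo 0 T := ⟨lt_min (half_pos ha) (half_pos h.hL.pos),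
        (min_le_right _ _).trans_lt (half_lt_self h.hL.pos)⟩
      filter_upwards [eventually_gt_atTop (X (min (a / 2) (T / 2)))] with x hx
      have := hanti (h.X_pos hζ) ((h.X_pos hζ).trans hx) hx
      rw [htX _ hζ] at this
      exact this.trans_le ((min_le_left _ _).trans (half_lt_self ha).le)
  have hzero : Tendsto t (𝓝[>] 0) (𝓝 T) := by
    refine tendsto_order.2 ⟨fun a ha => ?_, fun a ha => ?_⟩
    · have hζ : max ((a + T) / 2) (T / 2) ∈ Ioo 0 T :=
        ⟨lt_max_of_lt_right (half_pos h.hL.pos), max_lt (by linarith) (half_lt_self h.hL.pos)⟩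
      filter_upwards [Ioo_mem_nhdsGT (h.X_pos hζ)] with x hx
      have := hanti hx.1 (h.X_pos hζ) hx.2
      rw [htX _ hζ] at this
      exact lt_of_lt_of_le (by linarith) ((le_max_left _ _).trans this.le)
    · filter_upwards [self_mem_nhdsWithin] with x hx using (ht x hx).2.trans ha
  have hfn0 : ∀ ζ, T ≤ ζ → fn θ0 α c κ f b θ u T ζ = 0 := fun ζ hζ =>
    indicator_of_notMem (fun h' => h'.2.not_ge hζ) _
  have hfnt : ∀ x > 0, fn θ0 α c κ f b θ u T (t x) =
      √(t x) * (Cs θ0 (r (t x)) / Sn θ0 (r (t x))) * x := fun x hx => by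
    rw [fn, indicator_of_mem (ht x hx), ← hr]
    simp only [hXt x hx]
  have hJT : Jf α c (fn θ0 α c κ f b θ u T) T = Jf α c (fn θ0 α c κ f b θ u T) (Zb α c) := by
    have := h.next.Jf_sub T (Zb α c)
    rw [clamp_eq h.hL.pos.le h.hL.le, clamp_eq (Zb_pos h.P).le le_rfl,
      intervalIntegral.integral_congr (g := fun _ => 0), intervalIntegral.integral_zero] at this
    · linarith
    · intro ζ hζ
      rw [uIcc_of_le h.hL.le] at hζ
      simp only [hfn0 ζ hζ.1, zero_div]
  refine ⟨⟨t, fun x => yf θ (t x), fun x => zf u (t x) ^ α, fun x => qf θ0 α c κ f b θ u T (t x),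
    fun x => If α c κ f b (yf θ (t x)), fun x => r (t x), p, v,
    fun x => Jf α c (fn θ0 α c κ f b θ u T) (Zb α c) - Jf α c (fn θ0 α c κ f b θ u T) (t x), T⟩,
    ⟨h.P, h.hs, h.hw, h.next, fun x hx => (ht x hx).1, fun x hx => (ht x hx).2, h.hL.le, hyl,
      fun x hx => yf_le h.ho.1.1 (ht x hx).1.le, fun x hx => rpow_pos_of_pos (hzp x hx) _,
      fun x hx => h.qf_nonneg (ht x hx).2.le, hpt, fun x _ => rfl, fun x hx => ?_, fun x hx => ?_,
      fun x _ => rfl, hdt, fun x hx => ?_, fun x hx => ?_, fun x hx => ?_, fun x hx => ?_, htop,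
      hzero, ?_, ?_, ?_, ⟨Jf α c (fn θ0 α c κ f b θ u T) (Zb α c), ?_, rfl⟩, hfnt, hfn0,
      fun ζ hζ => ⟨X ζ, h.X_pos hζ, htX ζ hζ⟩⟩, rfl,
    fun ζ hζ => ⟨X ζ, h.X_pos hζ, htX ζ hζ, congrArg r (htX ζ hζ), rfl,
      congrArg (yf θ) (htX ζ hζ)⟩⟩
  · simp only [hr, rf, hXt x hx]
  · have h1 : (zf u (t x) ^ α) ^ ((1 - α) / α) = (zf u (t x) ^ (α - 1))⁻¹ := by
      rw [← rpow_mul (hzp x hx).le, mul_div_cancel₀ _ hα0.ne', ← rpow_neg (hzp x hx).le, neg_sub]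
    simp only [h1, hp, hR x hx]
    have := rpow_pos_of_pos (hzp x hx) (α - 1)
    field_simp
  · exact ((h.hasDerivAt_y (ht x hx)).comp x (hdt x hx)).congr_deriv (by
      simp only [Path.τ, ← hr]; ring)
  · have h1 := (((h.hasDerivAt_z (ht x hx)).comp x (hdt x hx)).rpow_const (p := α)
      (Or.inl (hzp x hx).ne'))
    refine h1.congr_deriv ?_
    have h2 := hXt x hx
    have h3 := (hv1 x hx).ne'
    have h4 := rpow_pos_of_pos (hzp x hx) (α - 1)
    simp only [h2, ← hr, hp, hR x hx, Function.comp_apply]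
    field_simp
  · refine ((h.hasDerivAt_q hf (ht x hx)).comp x (hdt x hx)).congr_deriv ?_
    have h2 := hXt x hx
    simp only [h2, ← hr, Path.τ]
    ring
  · have h1 := ((h.next.hasDerivAt_Jf h.fn_continuousOn ⟨(ht x hx).1,
      (ht x hx).2.trans_le h.hL.le⟩).comp x (hdt x hx)).const_sub
        (Jf α c (fn θ0 α c κ f b θ u T) (Zb α c))
    refine h1.congr_deriv ?_
    have := sqrt_pos.2 (ht x hx).1
    rw [hfnt x hx, Path.τ]
    field_simp
  · have h1 := ((zf_continuousOn h.ho.1.2.2.2.2) T h.hL.pos.le).tendsto.comp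
      (tendsto_nhdsWithin_iff.2 ⟨hzero, by
        filter_upwards [self_mem_nhdsWithin] with x hx using (ht x hx).1.le⟩)
    have h2 := h1.rpow_const (p := α) (Or.inr hα0.le)
    rwa [h.hL.z_zero T le_rfl, zero_rpow hα0.ne'] at h2
  · have h1 := ((h.qf_continuousOn) T ⟨h.hL.pos.le, le_rfl⟩).tendsto.comp
      (tendsto_nhdsWithin_iff.2 ⟨hzero, by
        filter_upwards [self_mem_nhdsWithin] with x hx using ⟨(ht x hx).1.le, (ht x hx).2.le⟩⟩)
    rwa [qf, intervalIntegral.integral_same] at h1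
  · have h1 := ((h.next.Jf_continuous.tendsto T).comp hzero).const_sub
      (Jf α c (fn θ0 α c κ f b θ u T) (Zb α c))
    rwa [hJT, sub_self] at h1
  · have h1 := ((h.next.Jf_continuous.tendsto 0).comp htop).const_sub
      (Jf α c (fn θ0 α c κ f b θ u T) (Zb α c))
    have h0 : Jf α c (fn θ0 α c κ f b θ u T) 0 = 0 := by
      rw [Jf_eq le_rfl (Zb_pos h.P).le, intervalIntegral.integral_same]
    rwa [h0, sub_zero] at h1

end
end Model2

namespace Model2
open Set Filter Topology

section calculus
variable {F G F' G' : ℝ → ℝ} {δ l : ℝ}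

lemma monotoneOn_of_hasDerivAt (hF : ∀ x > 0, HasDerivAt F (F' x) x) (h0 : ∀ x > 0, 0 ≤ F' x) :
    MonotoneOn F (Ioi 0) := by
  refine monotoneOn_of_deriv_nonneg (convex_Ioi 0)
    (fun x hx => (hF x hx).continuousAt.continuousWithinAt) (fun x hx => ?_) fun x hx => ?_
  · rw [interior_Ioi] at hx
    exact (hF x hx).differentiableAt.differentiableWithinAt
  · rw [interior_Ioi] at hx
    rw [(hF x hx).deriv]; exact h0 x hx

lemma le_of_tendsto_zero (hF : ∀ x > 0, HasDerivAt F (F' x) x) (h0 : ∀ x > 0, 0 ≤ F' x)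
    (hl : Tendsto F (𝓝[>] 0) (𝓝 l)) {x : ℝ} (hx : 0 < x) : l ≤ F x := by
  refine le_of_tendsto hl ?_
  filter_upwards [Ioo_mem_nhdsGT hx] with x' hx'
  exact monotoneOn_of_hasDerivAt hF h0 hx'.1 hx hx'.2.le

lemma le_of_tendsto_top (hF : ∀ x > 0, HasDerivAt F (F' x) x) (h0 : ∀ x > 0, 0 ≤ F' x)
    (hl : Tendsto F atTop (𝓝 l)) {x : ℝ} (hx : 0 < x) : F x ≤ l := by
  refine ge_of_tendsto hl ?_
  filter_upwards [eventually_ge_atTop x] with x' hx'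
  exact monotoneOn_of_hasDerivAt hF h0 hx (hx.trans_le hx') hx'

lemma le_of_deriv_le_zero (hF : ∀ x > 0, HasDerivAt F (F' x) x)
    (hG : ∀ x > 0, HasDerivAt G (G' x) x) (h : ∀ x > 0, F' x ≤ G' x)
    (hF0 : Tendsto F (𝓝[>] 0) (𝓝 0)) (hG0 : Tendsto G (𝓝[>] 0) (𝓝 0)) {x : ℝ} (hx : 0 < x) :
    F x ≤ G x := by
  have h1 := le_of_tendsto_zero (fun x hx => (hG x hx).fun_sub (hF x hx))
    (fun x hx => sub_nonneg.2 (h x hx)) (hG0.sub hF0) hx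
  linarith

lemma le_of_deriv_le_top (hF : ∀ x > 0, HasDerivAt F (-F' x) x)
    (hG : ∀ x > 0, HasDerivAt G (-G' x) x) (h : ∀ x > 0, F' x ≤ G' x)
    (hF0 : Tendsto F atTop (𝓝 0)) (hG0 : Tendsto G atTop (𝓝 0)) {x : ℝ} (hx : 0 < x) :
    F x ≤ G x := by
  have h1 := le_of_tendsto_top (fun x hx => (hF x hx).fun_sub (hG x hx))
    (fun x hx => by linarith [h x hx]) (hF0.sub hG0) hx
  linarith

lemma log_close {a b : ℝ} (ha : 0 < a) (hb : 0 < b) :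
    |log a - log b| ≤ δ ↔ a ≤ exp δ * b ∧ b ≤ exp δ * a := by
  rw [abs_le, ← exp_log ha, ← exp_log hb, ← exp_add, ← exp_add, exp_le_exp, exp_le_exp, log_exp,
    log_exp]
  constructor <;> rintro ⟨h1, h2⟩ <;> constructor <;> linarith

lemma log_close_zero (hF : ∀ x > 0, HasDerivAt F (F' x) x) (hG : ∀ x > 0, HasDerivAt G (G' x) x)
    (hF' : ∀ x > 0, 0 < F' x) (hG' : ∀ x > 0, 0 < G' x) (hFp : ∀ x > 0, 0 < F x)
    (hGp : ∀ x > 0, 0 < G x) (h : ∀ x > 0, |log (F' x) - log (G' x)| ≤ δ)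
    (hF0 : Tendsto F (𝓝[>] 0) (𝓝 0)) (hG0 : Tendsto G (𝓝[>] 0) (𝓝 0)) {x : ℝ} (hx : 0 < x) :
    |log (F x) - log (G x)| ≤ δ := by
  refine (log_close (hFp x hx) (hGp x hx)).2 ⟨?_, ?_⟩
  · refine le_of_deriv_le_zero hF (fun x hx => (hG x hx).const_mul (exp δ))
      (fun x hx => ((log_close (hF' x hx) (hG' x hx)).1 (h x hx)).1) hF0 ?_ hx
    simpa using hG0.const_mul (exp δ)
  · refine le_of_deriv_le_zero hG (fun x hx => (hF x hx).const_mul (exp δ))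
      (fun x hx => ((log_close (hF' x hx) (hG' x hx)).1 (h x hx)).2) hG0 ?_ hx
    simpa using hF0.const_mul (exp δ)

lemma log_close_top (hF : ∀ x > 0, HasDerivAt F (-F' x) x)
    (hG : ∀ x > 0, HasDerivAt G (-G' x) x)
    (hF' : ∀ x > 0, 0 < F' x) (hG' : ∀ x > 0, 0 < G' x) (hFp : ∀ x > 0, 0 < F x)
    (hGp : ∀ x > 0, 0 < G x) (h : ∀ x > 0, |log (F' x) - log (G' x)| ≤ δ)
    (hF0 : Tendsto F atTop (𝓝 0)) (hG0 : Tendsto G atTop (𝓝 0)) {x : ℝ} (hx : 0 < x) :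
    |log (F x) - log (G x)| ≤ δ := by
  refine (log_close (hFp x hx) (hGp x hx)).2 ⟨?_, ?_⟩
  · refine le_of_deriv_le_top hF (fun x hx => ((hG x hx).const_mul (exp δ)).congr_deriv
      (by rw [mul_neg])) (fun x hx => ((log_close (hF' x hx) (hG' x hx)).1 (h x hx)).1) hF0 ?_ hx
    simpa using hG0.const_mul (exp δ)
  · refine le_of_deriv_le_top hG (fun x hx => ((hF x hx).const_mul (exp δ)).congr_deriv
      (by rw [mul_neg])) (fun x hx => ((log_close (hF' x hx) (hG' x hx)).1 (h x hx)).2) hG0 ?_ hx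
    simpa using hF0.const_mul (exp δ)

lemma tendsto_hh_zero (A : ℝ) : Tendsto (fun x => A * hh x) (𝓝[>] 0) (𝓝 0) := by
  have := (continuous_hh.tendsto 0).const_mul A
  rw [hh_zero, mul_zero] at this
  exact this.mono_left nhdsWithin_le_nhds

lemma abs_le_hh {A : ℝ} (hF : ∀ x > 0, HasDerivAt F (F' x) x)
    (h : ∀ x > 0, |F' x| ≤ A * (x * exp (-x))) (hF0 : Tendsto F (𝓝[>] 0) (𝓝 0)) {x : ℝ}
    (hx : 0 < x) : |F x| ≤ A * hh x := by
  have hG := fun x (_ : x > 0) => (hasDerivAt_hh x).const_mul A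
  refine abs_le.2 ⟨?_, le_of_deriv_le_zero hF hG (fun x hx => (abs_le.1 (h x hx)).2) hF0
    (tendsto_hh_zero A) hx⟩
  have h0 := hF0.neg
  rw [neg_zero] at h0
  have := le_of_deriv_le_zero (fun x hx => (hF x hx).fun_neg) hG
    (fun x hx => neg_le.1 (abs_le.1 (h x hx)).1) h0 (tendsto_hh_zero A) hx
  linarith

lemma one_sub_exp_sq_le {x : ℝ} (hx : 0 < x) : (1 - exp (-x)) ^ 2 / 2 ≤ hh x := by
  have hd : ∀ x > (0 : ℝ), HasDerivAt (fun x => (1 - exp (-x)) ^ 2 / 2)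
      ((1 - exp (-x)) * exp (-x)) x := fun x _ => by
    have h1 := (((hasDerivAt_neg x).exp.const_sub 1).fun_pow 2).div_const 2
    exact h1.congr_deriv (by push_cast; ring)
  refine le_of_deriv_le_zero hd (fun x _ => hasDerivAt_hh x) (fun x hx => ?_) ?_ ?_ hx
  · have := one_sub_le_exp_neg x
    have := exp_pos (-x)
    gcongr
    linarith
  · have : Continuous fun x : ℝ => (1 - exp (-x)) ^ 2 / 2 := by fun_prop
    exact (this.tendsto' 0 0 (by simp)).mono_left nhdsWithin_le_nhds
  · simpa using tendsto_hh_zero 1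

lemma abs_le_four_hh {A : ℝ} (hA : 0 ≤ A) (hF : ∀ x > 0, HasDerivAt F (F' x) x)
    (h : ∀ x > 0, |F' x| ≤ A * ((1 - exp (-x)) * exp (-(x / 2))))
    (hF0 : Tendsto F (𝓝[>] 0) (𝓝 0)) {x : ℝ} (hx : 0 < x) : |F x| ≤ 4 * A * hh x := by
  have hd : ∀ x > (0 : ℝ), HasDerivAt (fun x => A * (2 * (1 - exp (-(x / 2))) ^ 2))
      (A * (2 * (1 - exp (-(x / 2))) * exp (-(x / 2)))) x := fun x _ => by
    have h1 := ((((((hasDerivAt_id x).div_const 2).fun_neg.exp).const_sub 1).fun_pow 2).const_mul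
      2).const_mul A
    exact h1.congr_deriv (by push_cast; simp only [id]; ring)
  have hle : ∀ x > 0, |F' x| ≤ A * (2 * (1 - exp (-(x / 2))) * exp (-(x / 2))) := fun x hx => by
    refine (h x hx).trans ?_
    have h1 : exp (-x) = exp (-(x / 2)) ^ 2 := by rw [← exp_nat_mul]; congr 1; push_cast; ring
    gcongr
    nlinarith [sq_nonneg (1 - exp (-(x / 2)))]
  have hlim : Tendsto (fun x => A * (2 * (1 - exp (-(x / 2))) ^ 2)) (𝓝[>] 0) (𝓝 0) := by
    have : Continuous fun x : ℝ => A * (2 * (1 - exp (-(x / 2))) ^ 2) := by fun_prop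
    exact (this.tendsto' 0 0 (by simp)).mono_left nhdsWithin_le_nhds
  have hfin : A * (2 * (1 - exp (-(x / 2))) ^ 2) ≤ 4 * A * hh x := by
    have h1 : exp (-x) ≤ exp (-(x / 2)) := exp_le_exp.2 (by linarith)
    have h2 : exp (-(x / 2)) ≤ 1 := exp_le_one_iff.2 (by linarith)
    have h3 := one_sub_exp_sq_le hx
    have h4 : (1 - exp (-(x / 2))) ^ 2 ≤ (1 - exp (-x)) ^ 2 := by
      have : 0 ≤ 1 - exp (-(x / 2)) := by linarith
      gcongr
    nlinarith
  refine abs_le.2 ⟨?_, (le_of_deriv_le_zero hF hd (fun x hx => (abs_le.1 (hle x hx)).2) hF0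
    hlim hx).trans hfin⟩
  have h0 := hF0.neg
  rw [neg_zero] at h0
  have := le_of_deriv_le_zero (fun x hx => (hF x hx).fun_neg) hd
    (fun x hx => neg_le.1 (abs_le.1 (hle x hx)).1) h0 hlim hx
  linarith

end calculus

section
variable {θ0 α c κ : ℝ} {f g : ℝ → ℝ} {b b' : ℝ} {s : Path}

lemma Sol.y_pos (h : Sol θ0 α c κ f b g b' s) {x : ℝ} (hx : 0 < x) : 0 < s.y x :=
  (mul_pos h.P.sin_pos (h.t_pos x hx)).trans_le (h.le_y x hx)

lemma Sol.t_le (h : Sol θ0 α c κ f b g b' s) {x : ℝ} (hx : 0 < x) : s.t x ≤ Zb α c :=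
  (h.t_lt x hx).le.trans h.T_le

lemma Sol.y_le_Zb (h : Sol θ0 α c κ f b g b' s) {x : ℝ} (hx : 0 < x) : s.y x ≤ Zb α c :=
  (h.y_le x hx).trans (h.t_le hx)

lemma Sol.le_L (h : Sol θ0 α c κ f b g b' s) {x : ℝ} (hx : 0 < x) : 1 / 2 ≤ s.L x := by
  rw [h.L_eq x hx]; exact h.hw.le_If h.hs _

lemma Sol.L_le (h : Sol θ0 α c κ f b g b' s) {x : ℝ} (hx : 0 < x) : s.L x ≤ 2 := by
  rw [h.L_eq x hx]; exact h.hw.If_le h.P h.hs _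

lemma Sol.L_pos (h : Sol θ0 α c κ f b g b' s) {x : ℝ} (hx : 0 < x) : 0 < s.L x := by
  linarith [h.le_L hx]

lemma Sol.ρ_nonneg (h : Sol θ0 α c κ f b g b' s) {x : ℝ} (hx : 0 < x) : 0 ≤ s.ρ x := by
  rw [h.ρ_eq x hx]
  exact div_nonneg (h.q_nonneg x hx) (mul_pos (h.L_pos hx) (hh_pos hx)).le

lemma Sol.Sn_pos (h : Sol θ0 α c κ f b g b' s) {x : ℝ} (hx : 0 < x) : 0 < Sn θ0 (s.ρ x) :=
  Model2.Sn_pos h.P (h.ρ_nonneg hx)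

lemma Sol.Cs_pos (h : Sol θ0 α c κ f b g b' s) {x : ℝ} (hx : 0 < x) : 0 < Cs θ0 (s.ρ x) :=
  Model2.Cs_pos h.P (h.ρ_nonneg hx)

lemma Sol.P_pos (h : Sol θ0 α c κ f b g b' s) {x : ℝ} (hx : 0 < x) : 0 < s.P x := by
  have := h.L_pos hx; have := rpow_pos_of_pos (h.w_pos x hx) ((1 - α) / α)
  have := h.P.c0; have := h.P.α0
  rw [h.P_eq x hx]; positivity

lemma Sol.ν_nonneg (h : Sol θ0 α c κ f b g b' s) {x : ℝ} (hx : 0 < x) : 0 ≤ s.ν x := by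
  have := h.P_pos hx; have := h.Sn_pos hx; have := h.hs.pos; have := h.hw.nonneg (s.y x)
  rw [h.ν_eq x hx]; positivity

lemma Sol.ν_le (h : Sol θ0 α c κ f b g b' s) {x : ℝ} (hx : 0 < x) : s.ν x ≤ 1 / 2 := by
  rw [h.ν_eq x hx]
  exact nu_le h.P h.hs h.hw (h.t_pos x hx) (h.le_y x hx) (h.t_le hx)
    (Sn_le_one h.P (h.ρ_nonneg hx)) (h.P_pos hx).le (h.P_le x hx)

lemma Sol.one_sub_ν_pos (h : Sol θ0 α c κ f b g b' s) {x : ℝ} (hx : 0 < x) : 0 < 1 - s.ν x := by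
  linarith [h.ν_le hx]

lemma Sol.τ_pos (h : Sol θ0 α c κ f b g b' s) {x : ℝ} (hx : 0 < x) : 0 < s.τ x :=
  div_pos (h.P_pos hx) (h.one_sub_ν_pos hx)

lemma Sol.P_le_τ (h : Sol θ0 α c κ f b g b' s) {x : ℝ} (hx : 0 < x) : s.P x ≤ s.τ x :=
  le_div_self (h.P_pos hx).le (h.one_sub_ν_pos hx) (by linarith [h.ν_nonneg hx])

lemma Sol.τ_le (h : Sol θ0 α c κ f b g b' s) {x : ℝ} (hx : 0 < x) : s.τ x ≤ 2 * s.P x := by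
  rw [Path.τ, div_le_iff₀ (h.one_sub_ν_pos hx)]
  nlinarith [h.ν_le hx, h.P_pos hx]

lemma Sol.y_top (h : Sol θ0 α c κ f b g b' s) : Tendsto s.y atTop (𝓝 0) := by
  refine squeeze_zero' ?_ ?_ h.t_top
  · filter_upwards [eventually_gt_atTop 0] with x hx using (h.y_pos hx).le
  · filter_upwards [eventually_gt_atTop 0] with x hx using h.y_le x hx

end
end Model2

namespace Model2
open Set Filter Topology

/-- Bounds along a path. -/
structure Bd (θ0 α κ M : ℝ) (s : Path) : Prop where
  w_le : ∀ x > 0, s.w x ≤ M * hh x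
  le_w : ∀ x > 0, hh x ≤ M * s.w x
  P_le : ∀ x > 0, s.P x ≤ M * exp (-x)
  le_P : ∀ x > 0, exp (-x) * hh x ^ ((1 - α) / α) ≤ M * s.P x
  t_le : ∀ x > 0, s.t x ≤ M * exp (-x)
  le_t : ∀ x > 0, exp (-x) ≤ M * s.t x
  y_inv : ∀ x > 0, 1 / √(s.y x) ≤ M * exp (x / 2)
  q_le : ∀ x > 0, s.q x ≤ κ * M * hh x
  ρ_le : ∀ x > 0, s.ρ x ≤ κ * M

section
variable {θ0 α c κ : ℝ} {f g : ℝ → ℝ} {b b' : ℝ} {s : Path}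

lemma Sol.w_le (h : Sol θ0 α c κ f b g b' s) {x : ℝ} (hx : 0 < x) :
    s.w x ≤ 4 / c * hh x := by
  have hc := h.P.c0
  refine le_of_deriv_le_zero h.w_deriv (fun x _ => (hasDerivAt_hh x).const_mul (4 / c))
    (fun x hx => ?_) h.w_zero (tendsto_hh_zero _) hx
  have h1 := h.one_sub_ν_pos hx
  have h2 := h.ν_le hx
  have h3 : 0 < x * exp (-x) := mul_pos hx (exp_pos _)
  rw [div_le_iff₀ (by positivity)]
  calc s.L x * Cs θ0 (s.ρ x) * (x * exp (-x)) ≤ 2 * 1 * (x * exp (-x)) := by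
        have := h.L_le hx; have := Cs_le_one h.P (h.ρ_nonneg hx); have := (h.Cs_pos hx).le
        gcongr
    _ ≤ 4 * (1 - s.ν x) * (x * exp (-x)) := by nlinarith
    _ = _ := by field_simp

lemma Sol.le_w (h : Sol θ0 α c κ f b g b' s) {x : ℝ} (hx : 0 < x) :
    sin θ0 / (2 * c) * hh x ≤ s.w x := by
  have hc := h.P.c0
  refine le_of_deriv_le_zero (fun x _ => (hasDerivAt_hh x).const_mul (sin θ0 / (2 * c)))
    h.w_deriv (fun x hx => ?_) (tendsto_hh_zero _) h.w_zero hx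
  have h1 := h.one_sub_ν_pos hx
  have h2 := h.ν_nonneg hx
  have h3 : 0 < x * exp (-x) := mul_pos hx (exp_pos _)
  have hσ := h.P.sin_pos
  rw [le_div_iff₀ (by positivity)]
  calc sin θ0 / (2 * c) * (x * exp (-x)) * (c * (1 - s.ν x))
      ≤ sin θ0 / (2 * c) * (x * exp (-x)) * (c * 1) := by gcongr; linarith
    _ = 1 / 2 * sin θ0 * (x * exp (-x)) := by field_simp
    _ ≤ _ := by
      have := h.le_L hx; have := le_Cs h.P (h.ρ_nonneg hx)
      gcongr

lemma gamma_nonneg (P : Params θ0 α c) : 0 ≤ (1 - α) / α :=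
  div_nonneg (by linarith [P.α1]) P.α0.le

lemma tendsto_mul_exp_neg (A : ℝ) : Tendsto (fun x => A * exp (-x)) atTop (𝓝 0) := by
  have := (tendsto_exp_atBot.comp tendsto_neg_atTop_atBot).const_mul A
  rwa [mul_zero] at this

lemma hh_mono {x x' : ℝ} (hx : 0 < x) (h : x ≤ x') : hh x ≤ hh x' :=
  monotoneOn_of_hasDerivAt (fun x0 _ => hasDerivAt_hh x0) (fun _ hx => (mul_pos hx (exp_pos _)).le) hx
    (hx.trans_le h) h

lemma exists_bd (P : Params θ0 α c) : ∃ M ≥ 1, ∀ κ f b g b' s, Sol θ0 α c κ f b g b' s →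
    Bd θ0 α κ M s := by
  set γ := (1 - α) / α with hγ
  have hγ0 : 0 ≤ γ := gamma_nonneg P
  have hc := P.c0
  have hα := P.α0
  have hσ := P.sin_pos
  have hK := Kc_pos P
  set p1 := 2 * (4 / c) ^ γ / (c * α) with hp1
  set p0 := 1 / 2 * (sin θ0 / (2 * c)) ^ γ / (c * α) with hp0
  set p2 := p0 * (hh 1 ^ γ * exp (-1)) with hp2
  have h1p : 0 < hh 1 ^ γ := rpow_pos_of_pos (hh_pos one_pos) _
  have hp1p : 0 < p1 := by have := rpow_pos_of_pos (show 0 < 4 / c by positivity) γ; positivity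
  have hp0p : 0 < p0 := by
    have := rpow_pos_of_pos (show 0 < sin θ0 / (2 * c) by positivity) γ; positivity
  have hp2p : 0 < p2 := by positivity
  set q1 := 4 * Kc θ0 α c * p1 / √(sin θ0 * p2) with hq1
  have hq1p : 0 < q1 := by have := sqrt_pos.2 (mul_pos hσ hp2p); positivity
  set M := 1 + 4 / c + 2 * c / sin θ0 + 2 * p1 + 1 / p0 + 1 / p2 + 1 / √(sin θ0 * p2) + 8 * q1
    with hM
  have hr0 : 0 < 1 / √(sin θ0 * p2) := one_div_pos.2 (sqrt_pos.2 (mul_pos hσ hp2p))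
  have e1 : 0 < 4 / c := by positivity
  have e2 : 0 < 2 * c / sin θ0 := by positivity
  have e3 : 0 < 1 / p0 := by positivity
  have e4 : 0 < 1 / p2 := by positivity
  refine ⟨M, by linarith, fun κ f b g b' s h => ?_⟩
  have hκ := h.hs.pos
  have bP : ∀ x > 0, s.P x ≤ p1 * exp (-x) := fun x hx => by
    have h1 : s.w x ≤ 4 / c := (h.w_le hx).trans
      (mul_le_of_le_one_right (by positivity) (hh_le_one hx.le))
    have h2 := rpow_le_rpow (h.w_pos x hx).le h1 hγ0
    have h3 := h.L_le hx
    have := (h.L_pos hx).le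
    have := rpow_nonneg (h.w_pos x hx).le γ
    rw [h.P_eq x hx]
    calc s.L x * exp (-x) * s.w x ^ γ / (c * α) ≤ 2 * exp (-x) * (4 / c) ^ γ / (c * α) := by gcongr
      _ = p1 * exp (-x) := by rw [hp1]; ring
  have bP' : ∀ x > 0, p0 * (exp (-x) * hh x ^ γ) ≤ s.P x := fun x hx => by
    have h1 := hh_nonneg hx.le
    have h2 := rpow_le_rpow (by positivity) (h.le_w hx) hγ0
    rw [mul_rpow (by positivity) h1] at h2
    have h3 := h.le_L hx
    have h4 := rpow_nonneg h1 γ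
    rw [h.P_eq x hx]
    calc p0 * (exp (-x) * hh x ^ γ)
        = 1 / 2 * exp (-x) * ((sin θ0 / (2 * c)) ^ γ * hh x ^ γ) / (c * α) := by rw [hp0]; ring
      _ ≤ _ := by
        have := (h.L_pos hx).le
        gcongr
  have bt : ∀ x > 0, s.t x ≤ 2 * p1 * exp (-x) := fun x hx =>
    le_of_deriv_le_top h.t_deriv
      (fun x _ => (((hasDerivAt_neg x).exp.const_mul (2 * p1)).congr_deriv (by ring) :
        HasDerivAt _ (-(2 * p1 * exp (-x))) x))
      (fun x hx => (h.τ_le hx).trans (by linarith [bP x hx])) h.t_top (tendsto_mul_exp_neg _) hx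
  have anti : ∀ x > 0, ∀ x', x ≤ x' → s.t x' ≤ s.t x := fun x hx x' hxx => by
    have := monotoneOn_of_hasDerivAt (fun x hx => (h.t_deriv x hx).fun_neg)
      (fun x hx => (neg_neg (s.τ x)).symm ▸ (h.τ_pos hx).le) hx (hx.trans_le hxx) hxx
    linarith
  have bt1 : ∀ x ≥ 1, p0 * (exp (-x) * hh 1 ^ γ) ≤ s.t x := fun x hx => by
    have hx0 : 0 < x := by linarith
    refine le_trans ?_ ((bP' x hx0).trans (h.P_le x hx0))
    have := hh_mono one_pos hx
    have := (hh_pos one_pos).le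
    gcongr
  have bt' : ∀ x > 0, p2 * exp (-x) ≤ s.t x := fun x hx => by
    rcases le_total 1 x with h1 | h1
    · refine le_trans ?_ (bt1 x h1)
      have : exp (-1) ≤ 1 := exp_le_one_iff.2 (by norm_num)
      calc p2 * exp (-x) = p0 * (exp (-x) * hh 1 ^ γ) * exp (-1) := by rw [hp2]; ring
        _ ≤ p0 * (exp (-x) * hh 1 ^ γ) * 1 := by gcongr
        _ = _ := mul_one _
    · refine le_trans ?_ ((bt1 1 le_rfl).trans (anti x hx 1 h1))
      have : exp (-x) ≤ 1 := exp_le_one_iff.2 (by linarith)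
      calc p2 * exp (-x) ≤ p2 * 1 := by gcongr
        _ = _ := by rw [hp2]; ring
  have by1 : ∀ x > 0, 1 / √(s.y x) ≤ 1 / √(sin θ0 * p2) * exp (x / 2) := fun x hx => by
    have h1 : sin θ0 * p2 * exp (-x) ≤ s.y x := by
      have := mul_le_mul_of_nonneg_left (bt' x hx) hσ.le
      linarith [h.le_y x hx]
    have h2 := sqrt_le_sqrt h1
    have h3 : 0 < √(sin θ0 * p2) := sqrt_pos.2 (mul_pos hσ hp2p)
    rw [sqrt_mul (by positivity), ← exp_half] at h2
    have h4 : exp (x / 2) * exp (-x / 2) = 1 := by rw [← exp_add]; simp [neg_div]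
    have h5 := exp_pos (-x / 2)
    calc 1 / √(s.y x) ≤ 1 / (√(sin θ0 * p2) * exp (-x / 2)) := by gcongr
      _ = _ := by
        rw [one_div, one_div, mul_inv, eq_inv_of_mul_eq_one_left h4]
  have bq : ∀ x > 0, s.q x ≤ 4 * (κ * q1) * hh x := fun x hx => by
    refine (le_abs_self _).trans (abs_le_four_hh (by positivity) h.q_deriv (fun x hx => ?_)
      h.q_zero hx)
    have h1 : 0 < 1 - exp (-x) := sub_pos.2 (exp_lt_one_iff.mpr (by linarith))
    have h2 := h.L_pos hx
    have h3 := h.Cs_pos hx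
    have h4 := h.τ_pos hx
    have h5 := h.hw.nonneg (s.y x)
    have h6 := h.L_le hx
    have h7 := h.hw.le (s.y x)
    have h8 := Cs_le_one h.P (h.ρ_nonneg hx)
    have h9 : s.τ x ≤ 2 * (p1 * exp (-x)) := (h.τ_le hx).trans (by linarith [bP x hx])
    have h10 : exp (x / 2) * exp (-x) = exp (-(x / 2)) := by rw [← exp_add]; congr 1; ring
    rw [abs_of_nonneg (by positivity)]
    calc κ * s.L x * (f (s.y x) / √(s.y x)) * (Cs θ0 (s.ρ x) * (1 - exp (-x))) * s.τ x
        = κ * s.L x * (f (s.y x) * (1 / √(s.y x))) * (Cs θ0 (s.ρ x) * (1 - exp (-x))) * s.τ x := by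
          ring
      _ ≤ κ * 2 * (Kc θ0 α c * (1 / √(sin θ0 * p2) * exp (x / 2))) * (1 * (1 - exp (-x))) *
          (2 * (p1 * exp (-x))) := by
        have := by1 x hx
        gcongr
      _ = κ * q1 * ((1 - exp (-x)) * (exp (x / 2) * exp (-x))) := by rw [hq1]; ring
      _ = _ := by rw [h10]
  refine ⟨fun x hx => ?_, fun x hx => ?_, fun x hx => ?_, fun x hx => ?_, fun x hx => ?_,
    fun x hx => ?_, fun x hx => ?_, fun x hx => ?_, fun x hx => ?_⟩
  · refine (h.w_le hx).trans (mul_le_mul_of_nonneg_right ?_ (hh_nonneg hx.le))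
    linarith
  · have h1 := h.le_w hx
    have h2 : hh x ≤ 2 * c / sin θ0 * s.w x := by
      rw [div_mul_eq_mul_div, le_div_iff₀ hσ]
      rw [div_mul_eq_mul_div, div_le_iff₀ (by positivity)] at h1
      linarith
    refine h2.trans (mul_le_mul_of_nonneg_right ?_ (h.w_pos x hx).le)
    linarith
  · exact (bP x hx).trans (mul_le_mul_of_nonneg_right (by linarith) (exp_pos _).le)
  · have h1 := bP' x hx
    have h2 : exp (-x) * hh x ^ γ ≤ 1 / p0 * s.P x := by
      rw [div_mul_eq_mul_div, le_div_iff₀ hp0p]; linarith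
    exact h2.trans (mul_le_mul_of_nonneg_right (by linarith) (h.P_pos hx).le)
  · exact (bt x hx).trans (mul_le_mul_of_nonneg_right (by linarith) (exp_pos _).le)
  · have h1 := bt' x hx
    have h2 : exp (-x) ≤ 1 / p2 * s.t x := by
      rw [div_mul_eq_mul_div, le_div_iff₀ hp2p]; linarith
    exact h2.trans (mul_le_mul_of_nonneg_right (by linarith) (h.t_pos x hx).le)
  · exact (by1 x hx).trans (mul_le_mul_of_nonneg_right (by linarith) (exp_pos _).le)
  · refine (bq x hx).trans ?_
    have := hh_nonneg hx.le
    calc 4 * (κ * q1) * hh x = κ * (4 * q1) * hh x := by ring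
      _ ≤ _ := by gcongr; linarith
  · have h1 := bq x hx
    have h2 := h.le_L hx
    have h3 := hh_pos hx
    rw [h.ρ_eq x hx, div_le_iff₀ (mul_pos (h.L_pos hx) h3)]
    calc s.q x ≤ κ * (8 * q1) * (1 / 2 * hh x) := by linarith
      _ ≤ κ * M * (s.L x * hh x) := by gcongr; linarith

end
end Model2

namespace Model2
open Set Filter Topology

section elementary

lemma abs_sub_le_log {a b B : ℝ} (ha : 0 < a) (hb : 0 < b) (haB : a ≤ B) (hbB : b ≤ B) :
    |a - b| ≤ B * |log a - log b| := by
  wlog h : b ≤ a generalizing a b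
  · rw [abs_sub_comm a, abs_sub_comm (log a)]
    exact this hb ha hbB haB (le_of_not_ge h)
  have h1 := log_le_log hb h
  rw [abs_of_nonneg (sub_nonneg.2 h), abs_of_nonneg (sub_nonneg.2 h1)]
  have h2 := one_sub_inv_le_log_of_pos (div_pos ha hb)
  rw [log_div ha.ne' hb.ne', inv_div] at h2
  calc a - b = a * (1 - b / a) := by field_simp
    _ ≤ B * (log a - log b) := mul_le_mul haB h2
      (sub_nonneg.2 ((div_le_one ha).2 h)) (ha.le.trans haB)

lemma abs_log_sub_le {a b m : ℝ} (hm : 0 < m) (ha : m ≤ a) (hb : m ≤ b) :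
    |log a - log b| ≤ |a - b| / m := by
  wlog h : b ≤ a generalizing a b
  · rw [abs_sub_comm a, abs_sub_comm (log a)]
    exact this hb ha (le_of_not_ge h)
  have hb0 := hm.trans_le hb
  have ha0 := hm.trans_le ha
  have h1 := log_le_log hb0 h
  rw [abs_of_nonneg (sub_nonneg.2 h), abs_of_nonneg (sub_nonneg.2 h1)]
  have h2 := log_le_sub_one_of_pos (div_pos ha0 hb0)
  rw [log_div ha0.ne' hb0.ne'] at h2
  calc log a - log b ≤ a / b - 1 := h2
    _ = (a - b) / b := by field_simp
    _ ≤ (a - b) / m := div_le_div_of_nonneg_left (sub_nonneg.2 h) hm hb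

lemma abs_mul_sub_le_log {p1 p2 D1 D2 K B δ η : ℝ} (h1 : 0 < D1) (h2 : 0 < D2) (hB1 : D1 ≤ B)
    (hB2 : D2 ≤ B) (hD : |log D1 - log D2| ≤ δ) (hp : 0 ≤ p1) (hK : p1 ≤ K)
    (hη : |p1 - p2| ≤ η) : |p1 * D1 - p2 * D2| ≤ B * (K * δ + η) := by
  have hB : 0 ≤ B := h1.le.trans hB1
  have h3 := (abs_sub_le_log h1 h2 hB1 hB2).trans (mul_le_mul_of_nonneg_left hD hB)
  calc |p1 * D1 - p2 * D2| = |p1 * (D1 - D2) + D2 * (p1 - p2)| := by congr 1; ring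
    _ ≤ p1 * |D1 - D2| + D2 * |p1 - p2| := by
      refine (abs_add_le _ _).trans_eq ?_
      rw [abs_mul, abs_mul, abs_of_nonneg hp, abs_of_pos h2]
    _ ≤ K * (B * δ) + B * η := by
      have := abs_nonneg (p1 - p2)
      have := abs_nonneg (D1 - D2)
      have := hp.trans hK
      gcongr
    _ = _ := by ring

lemma abs_log_Sn_Cs_sub_le {θ0 α c : ℝ} (P : Params θ0 α c) {r1 r2 : ℝ} (h1 : 0 ≤ r1)
    (h2 : 0 ≤ r2) : |log (Sn θ0 r1) - log (Sn θ0 r2)| ≤ 1 / sin θ0 * |r1 - r2| ∧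
      |log (Cs θ0 r1) - log (Cs θ0 r2)| ≤ 1 / sin θ0 * |r1 - r2| := by
  have hσ := P.sin_pos
  have hσ1 : 1 ≤ 1 / sin θ0 := (one_le_div hσ).2 P.sin_lt_one.le
  have hQ : ∀ r : ℝ, 0 ≤ r → 0 < 1 + 2 * r * sin θ0 + r ^ 2 := fun r hr => by positivity
  have hQd : ∀ r : ℝ, 0 ≤ r → HasDerivAt (fun r => log (1 + 2 * r * sin θ0 + r ^ 2) / 2)
      ((sin θ0 + r) / (1 + 2 * r * sin θ0 + r ^ 2)) r := fun r hr => by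
    have h3 := ((((((hasDerivAt_id r).const_mul 2).mul_const (sin θ0)).const_add 1).fun_add
      ((hasDerivAt_id r).fun_pow 2)).log (hQ r hr).ne').div_const 2
    refine h3.congr_deriv ?_
    simp only [id]
    push_cast
    ring
  have hQb : ∀ r : ℝ, 0 ≤ r → 0 ≤ (sin θ0 + r) / (1 + 2 * r * sin θ0 + r ^ 2) ∧
      (sin θ0 + r) / (1 + 2 * r * sin θ0 + r ^ 2) ≤ 1 := fun r hr =>
    ⟨div_nonneg (by linarith) (hQ r hr).le, (div_le_one (hQ r hr)).2 (by
      nlinarith [P.sin_lt_one, mul_nonneg hr hσ.le, sq_nonneg (2 * r - 1)])⟩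
  have hlD : ∀ r : ℝ, 0 ≤ r → log (Ds θ0 r) = log (1 + 2 * r * sin θ0 + r ^ 2) / 2 :=
    fun r hr => log_sqrt (hQ r hr).le
  have mv := fun (φ φ' : ℝ → ℝ) (hd : ∀ r ∈ Ici (0 : ℝ), HasDerivWithinAt φ (φ' r) (Ici 0) r)
    (hb : ∀ r ∈ Ici (0 : ℝ), ‖φ' r‖ ≤ 1 / sin θ0) =>
    (convex_Ici (0 : ℝ)).norm_image_sub_le_of_norm_hasDerivWithin_le hd hb h2 h1
  constructor
  · have h3 := mv (fun r => log (sin θ0 + r) - log (1 + 2 * r * sin θ0 + r ^ 2) / 2)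
      (fun r => 1 / (sin θ0 + r) - (sin θ0 + r) / (1 + 2 * r * sin θ0 + r ^ 2))
      (fun r hr => ((((hasDerivAt_id r).const_add (sin θ0)).log
        (by simp only [id]; exact (add_pos_of_pos_of_nonneg hσ hr).ne')).fun_sub
          (hQd r hr)).hasDerivWithinAt) (fun r hr => by
        have hr0 : 0 ≤ r := hr
        have h4 : 1 / (sin θ0 + r) ≤ 1 / sin θ0 := one_div_le_one_div_of_le hσ (by linarith)
        have h5 : 0 ≤ 1 / (sin θ0 + r) := by positivity
        rw [norm_eq_abs, abs_le]
        constructor <;> linarith [hQb r hr])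
    rw [norm_eq_abs, norm_eq_abs] at h3
    rwa [Sn, Sn, log_div (by positivity) (Ds_pos P h1).ne', log_div (by positivity)
      (Ds_pos P h2).ne', hlD r1 h1, hlD r2 h2]
  · have h3 := mv (fun r => log (1 + r * sin θ0) - log (1 + 2 * r * sin θ0 + r ^ 2) / 2)
      (fun r => 1 * sin θ0 / (1 + r * sin θ0) - (sin θ0 + r) / (1 + 2 * r * sin θ0 + r ^ 2))
      (fun r hr => (((((hasDerivAt_id r).mul_const (sin θ0)).const_add 1).log
        (by simp only [id]; exact (add_pos_of_pos_of_nonneg one_pos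
          (mul_nonneg hr hσ.le)).ne')).fun_sub (hQd r hr)).hasDerivWithinAt) (fun r hr => by
        have hr0 : 0 ≤ r := hr
        have h4 : 1 * sin θ0 / (1 + r * sin θ0) ≤ 1 := by
          rw [div_le_one (by positivity)]
          nlinarith [P.sin_lt_one, mul_nonneg hr0 hσ.le]
        have h5 : 0 ≤ 1 * sin θ0 / (1 + r * sin θ0) := by positivity
        rw [norm_eq_abs, abs_le]
        constructor <;> linarith [hQb r hr])
    rw [norm_eq_abs, norm_eq_abs] at h3
    rwa [Cs, Cs, log_div (by positivity) (Ds_pos P h1).ne', log_div (by positivity)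
      (Ds_pos P h2).ne', hlD r1 h1, hlD r2 h2]

end elementary

/-- Two paths for light intensities that differ by at most `e`. -/
structure Cmp (θ0 α c κ M K2 S e : ℝ) (f1 : ℝ → ℝ) (b1 : ℝ) (g1 : ℝ → ℝ) (b1' : ℝ) (s1 : Path)
    (f2 : ℝ → ℝ) (b2 : ℝ) (g2 : ℝ → ℝ) (b2' : ℝ) (s2 : Path) : Prop where
  h1 : Sol θ0 α c κ f1 b1 g1 b1' s1
  h2 : Sol θ0 α c κ f2 b2 g2 b2' s2
  B1 : Bd θ0 α κ M s1
  B2 : Bd θ0 α κ M s2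
  κ_le : κ ≤ 1
  e_nonneg : 0 ≤ e
  lip : ∀ ζ ∈ Ioc 0 S, ∀ ζ' ∈ Ioc 0 S, |f1 ζ - f1 ζ'| ≤ K2 * |log ζ - log ζ'|
  diff : ∀ ζ ∈ Ioc 0 S, |f1 ζ - f2 ζ| ≤ e
  b_diff : |b1 - b2| ≤ κ * e
  y1_le : ∀ x > 0, s1.y x ≤ S
  y2_le : ∀ x > 0, s2.y x ≤ S

/-- Two paths are close up to `m`. -/
structure Near (m : ℝ) (s1 s2 : Path) : Prop where
  y : ∀ x > 0, |log (s1.y x) - log (s2.y x)| ≤ m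
  w : ∀ x > 0, |log (s1.w x) - log (s2.w x)| ≤ m
  ρ : ∀ x > 0, |s1.ρ x - s2.ρ x| ≤ m

section
variable {θ0 α c κ : ℝ} {f g : ℝ → ℝ} {b b' : ℝ} {s : Path}

lemma Sol.log_P (h : Sol θ0 α c κ f b g b' s) {x : ℝ} (hx : 0 < x) :
    log (s.P x) = log (s.L x) - x + (1 - α) / α * log (s.w x) - log (c * α) := by
  have h1 := (h.L_pos hx).ne'
  have h2 := h.w_pos x hx
  rw [h.P_eq x hx, log_div (mul_ne_zero (mul_ne_zero h1 (exp_pos _).ne')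
    (rpow_pos_of_pos h2 _).ne') (mul_pos h.P.c0 h.P.α0).ne', log_mul
    (mul_ne_zero h1 (exp_pos _).ne') (rpow_pos_of_pos h2 _).ne', log_mul h1 (exp_pos _).ne',
    log_exp, log_rpow h2]
  ring

lemma Sol.log_τ (h : Sol θ0 α c κ f b g b' s) {x : ℝ} (hx : 0 < x) :
    log (s.τ x) = log (s.P x) - log (1 - s.ν x) :=
  log_div (h.P_pos hx).ne' (h.one_sub_ν_pos hx).ne'

variable {M K2 S e m : ℝ} {f1 : ℝ → ℝ} {b1 : ℝ} {g1 : ℝ → ℝ} {b1' : ℝ} {s1 : Path}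
    {f2 : ℝ → ℝ} {b2 : ℝ} {g2 : ℝ → ℝ} {b2' : ℝ} {s2 : Path}

lemma Cmp.abs_f_sub_le (h : Cmp θ0 α c κ M K2 S e f1 b1 g1 b1' s1 f2 b2 g2 b2' s2) (hK : 0 ≤ K2)
    (hm : Near m s1 s2) {x : ℝ} (hx : 0 < x) :
    |f1 (s1.y x) - f2 (s2.y x)| ≤ (K2 + 1) * (e + m) := by
  have m1 : s1.y x ∈ Ioc 0 S := ⟨h.h1.y_pos hx, h.y1_le x hx⟩
  have m2 : s2.y x ∈ Ioc 0 S := ⟨h.h2.y_pos hx, h.y2_le x hx⟩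
  have e1 := (h.lip _ m1 _ m2).trans (mul_le_mul_of_nonneg_left (hm.y x hx) hK)
  have e2 := h.diff _ m2
  have e3 : 0 ≤ m := (abs_nonneg _).trans (hm.y x hx)
  have e4 : 0 ≤ K2 * e := mul_nonneg hK h.e_nonneg
  have e5 := abs_sub_le (f1 (s1.y x)) (f1 (s2.y x)) (f2 (s2.y x))
  linarith

lemma Cmp.abs_log_L_sub_le (h : Cmp θ0 α c κ M K2 S e f1 b1 g1 b1' s1 f2 b2 g2 b2' s2)
    (hm : Near m s1 s2) {x : ℝ} (hx : 0 < x) : |log (s1.L x) - log (s2.L x)| ≤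
      (1 + Kc θ0 α c * √(Zb α c) + 2 * √(Zb α c)) * (κ * (e + m)) := by
  have hP := h.h1.P
  have hκ := h.h1.hs.pos
  have hK := Kc_pos hP
  have he := h.e_nonneg
  have hm0 : 0 ≤ m := (abs_nonneg _).trans (hm.y x hx)
  have hy1 := h.h1.y_pos hx
  have hy2 := h.h2.y_pos hx
  have hZ1 := h.h1.y_le_Zb hx
  have hZ2 := h.h2.y_le_Zb hx
  have hmon : ∀ {u v : ℝ}, 0 < u → u ≤ v → v ≤ Zb α c → |Jf α c f1 v - Jf α c f1 u| ≤
      Kc θ0 α c * √(Zb α c) * |log v - log u| := fun {u v} hu huv hv => by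
    rw [abs_of_nonneg (sub_nonneg.2 (h.h1.hw.Jf_mono huv)),
      abs_of_nonneg (sub_nonneg.2 (log_le_log hu huv)), h.h1.hw.Jf_sub,
      clamp_eq hu.le (huv.trans hv), clamp_eq (hu.le.trans huv) hv]
    exact h.h1.hw.integral_le_log hP hu huv hv
  have e1 : |Jf α c f1 (s1.y x) - Jf α c f1 (s2.y x)| ≤ Kc θ0 α c * √(Zb α c) * m := by
    refine le_trans ?_ (mul_le_mul_of_nonneg_left (hm.y x hx) (by positivity))
    rcases le_total (s2.y x) (s1.y x) with hle | hle
    · exact hmon hy2 hle hZ1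
    · rw [abs_sub_comm, abs_sub_comm (log _)]
      exact hmon hy1 hle hZ2
  have e2 : |Jf α c f1 (s2.y x) - Jf α c f2 (s2.y x)| ≤ 2 * √(Zb α c) * e := by
    rw [Jf_eq hy2.le hZ2, Jf_eq hy2.le hZ2, ← intervalIntegral.integral_sub
      (h.h1.hw.intervalIntegrable _ _) (h.h2.hw.intervalIntegrable _ _)]
    have e3 := intervalIntegral.norm_integral_le_of_norm_le (μ := volume) hy2.le
      (f := fun ζ => f1 ζ / √ζ - f2 ζ / √ζ) (g := fun ζ => e * (1 / √ζ)) (by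
        filter_upwards with ζ hζ
        rw [← sub_div, norm_eq_abs, abs_div, abs_of_nonneg (sqrt_nonneg ζ), mul_one_div]
        have := h.diff ζ ⟨hζ.1, hζ.2.trans (h.y2_le x hx)⟩
        gcongr) ((inv_sqrt_intervalIntegrable _ _).const_mul e)
    rw [intervalIntegral.integral_const_mul, integral_inv_sqrt le_rfl hy2.le, sqrt_zero,
      sub_zero, norm_eq_abs] at e3
    refine e3.trans ?_
    have := sqrt_le_sqrt hZ2
    calc e * (2 * √(s2.y x)) ≤ e * (2 * √(Zb α c)) := by gcongr
      _ = _ := by ring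
  have e4 := h.b_diff
  rw [h.h1.L_eq x hx, h.h2.L_eq x hx, log_If, log_If]
  have e5 := abs_sub_le (Jf α c f1 (s1.y x)) (Jf α c f1 (s2.y x)) (Jf α c f2 (s2.y x))
  calc |b1 + κ * Jf α c f1 (s1.y x) - (b2 + κ * Jf α c f2 (s2.y x))|
      = |(b1 - b2) + κ * (Jf α c f1 (s1.y x) - Jf α c f2 (s2.y x))| := by congr 1; ring
    _ ≤ |b1 - b2| + κ * |Jf α c f1 (s1.y x) - Jf α c f2 (s2.y x)| := by
      refine (abs_add_le _ _).trans_eq ?_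
      rw [abs_mul, abs_of_nonneg hκ]
    _ ≤ κ * e + κ * (Kc θ0 α c * √(Zb α c) * m + 2 * √(Zb α c) * e) := by gcongr; linarith
    _ ≤ _ := by
      have n1 : 0 ≤ κ * (Kc θ0 α c * √(Zb α c) * e) := by positivity
      have n2 : 0 ≤ κ * (√(Zb α c) * m) := by positivity
      have n3 : 0 ≤ κ * m := by positivity
      linarith

end
end Model2

namespace Model2
open Set Filter Topology

noncomputable section constants

/-- Sensitivity of the light intensity along a path. -/
def kL (α c θ0 : ℝ) : ℝ := 1 + Kc θ0 α c * √(Zb α c) + 2 * √(Zb α c)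

/-- Sensitivity of the feedback term `ν`. -/
def kν (θ0 α c M K2 : ℝ) : ℝ :=
  M ^ 2 * (Kc θ0 α c * (1 / sin θ0 + 1 / 2 + kL α c θ0 + (1 - α) / α) + (K2 + 1))

/-- Sensitivity of the costate `q`. -/
def kq (θ0 α c M K2 : ℝ) : ℝ :=
  16 * M ^ 2 * (Kc θ0 α c * (2 * kL α c θ0 + 1 / sin θ0 + (1 - α) / α + 2 * kν θ0 α c M K2 + 1 / 2) +
    (K2 + 1))

/-- Sensitivity of the ratio `ρ`. -/
def kρ (θ0 α c M K2 : ℝ) : ℝ := 2 * kq θ0 α c M K2 + 2 * M * kL α c θ0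

/-- Sensitivity of `w`. -/
def kw (θ0 α c M K2 : ℝ) : ℝ :=
  kL α c θ0 + 1 / sin θ0 * kρ θ0 α c M K2 + 2 * kν θ0 α c M K2

/-- Sensitivity of all the path variables. -/
def kC (θ0 α c M K2 : ℝ) : ℝ :=
  kL α c θ0 + (1 - α) / α * kw θ0 α c M K2 + 2 * kν θ0 α c M K2 +
    1 / sin θ0 * kρ θ0 α c M K2 + kρ θ0 α c M K2 + kw θ0 α c M K2

end constants

section
variable {θ0 α c κ M K2 S e m : ℝ} {f1 : ℝ → ℝ} {b1 : ℝ} {g1 : ℝ → ℝ} {b1' : ℝ} {s1 : Path}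
    {f2 : ℝ → ℝ} {b2 : ℝ} {g2 : ℝ → ℝ} {b2' : ℝ} {s2 : Path}

lemma kL_nonneg (P : Params θ0 α c) : 0 ≤ kL α c θ0 := by
  have := Kc_pos P; unfold kL; positivity

lemma kν_nonneg (P : Params θ0 α c) (hK : 0 ≤ K2) : 0 ≤ kν θ0 α c M K2 := by
  have := Kc_pos P; have := kL_nonneg P; have := gamma_nonneg P; have := P.sin_pos
  unfold kν; positivity

lemma kq_nonneg (P : Params θ0 α c) (hK : 0 ≤ K2) : 0 ≤ kq θ0 α c M K2 := by
  have := Kc_pos P; have := kL_nonneg P; have := gamma_nonneg P; have := P.sin_pos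
  have := kν_nonneg (M := M) P hK
  unfold kq; positivity

lemma kρ_nonneg (P : Params θ0 α c) (hM : 0 ≤ M) (hK : 0 ≤ K2) : 0 ≤ kρ θ0 α c M K2 := by
  have := kL_nonneg P; have := kq_nonneg (M := M) P hK
  unfold kρ; positivity

lemma kw_nonneg (P : Params θ0 α c) (hM : 0 ≤ M) (hK : 0 ≤ K2) : 0 ≤ kw θ0 α c M K2 := by
  have := kL_nonneg P; have := kρ_nonneg P hM hK; have := P.sin_pos
  have := kν_nonneg (M := M) P hK
  unfold kw; positivity

lemma kC_nonneg (P : Params θ0 α c) (hM : 0 ≤ M) (hK : 0 ≤ K2) : 0 ≤ kC θ0 α c M K2 := by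
  have := kL_nonneg P; have := kρ_nonneg P hM hK; have := P.sin_pos
  have := kν_nonneg (M := M) P hK; have := gamma_nonneg P; have := kw_nonneg P hM hK
  unfold kC; positivity

/-- Bounds for the derivative of `q`. -/
noncomputable def Path.E (θ0 : ℝ) (s : Path) (x : ℝ) : ℝ :=
  s.L x * Cs θ0 (s.ρ x) * (1 - exp (-x)) * s.τ x / √(s.y x)

variable {f g : ℝ → ℝ} {b b' : ℝ} {s : Path}

lemma one_sub_exp_neg_pos {x : ℝ} (hx : 0 < x) : 0 < 1 - exp (-x) :=
  sub_pos.2 (exp_lt_one_iff.mpr (by linarith))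

lemma Sol.E_pos (h : Sol θ0 α c κ f b g b' s) {x : ℝ} (hx : 0 < x) : 0 < s.E θ0 x := by
  have := h.L_pos hx; have := h.Cs_pos hx; have := h.τ_pos hx; have := h.y_pos hx
  have := one_sub_exp_neg_pos hx
  unfold Path.E; positivity

lemma Sol.log_E (h : Sol θ0 α c κ f b g b' s) {x : ℝ} (hx : 0 < x) :
    log (s.E θ0 x) = log (s.L x) + log (Cs θ0 (s.ρ x)) + log (1 - exp (-x)) + log (s.τ x) -
      log (s.y x) / 2 := by
  have h1 := (h.L_pos hx).ne'
  have h2 := (h.Cs_pos hx).ne'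
  have h3 := (h.τ_pos hx).ne'
  have h4 := h.y_pos hx
  have h5 := (one_sub_exp_neg_pos hx).ne'
  rw [Path.E, log_div (by positivity) (sqrt_pos.2 h4).ne', log_mul (by positivity) h3,
    log_mul (by positivity) h5, log_mul h1 h2, log_sqrt h4.le]

lemma exp_neg_mul_exp_half (x : ℝ) : exp (-x) * exp (x / 2) = exp (-(x / 2)) := by
  rw [← exp_add]; congr 1; ring

lemma Sol.E_le (h : Sol θ0 α c κ f b g b' s) (hB : Bd θ0 α κ M s) (hM : 0 ≤ M) {x : ℝ}
    (hx : 0 < x) : s.E θ0 x ≤ 4 * M ^ 2 * ((1 - exp (-x)) * exp (-(x / 2))) := by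
  have h1 := h.L_le hx
  have h2 := Cs_le_one h.P (h.ρ_nonneg hx)
  have h3 : s.τ x ≤ 2 * (M * exp (-x)) := (h.τ_le hx).trans (by have := hB.P_le x hx; linarith)
  have h4 := hB.y_inv x hx
  have h5 := one_sub_exp_neg_pos hx
  have := h.L_pos hx; have := h.Cs_pos hx; have := h.τ_pos hx; have := h.y_pos hx
  calc s.E θ0 x = s.L x * Cs θ0 (s.ρ x) * (1 - exp (-x)) * s.τ x * (1 / √(s.y x)) := by
        rw [Path.E, mul_one_div]
    _ ≤ 2 * 1 * (1 - exp (-x)) * (2 * (M * exp (-x))) * (M * exp (x / 2)) := by gcongr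
    _ = 4 * M ^ 2 * ((1 - exp (-x)) * (exp (-x) * exp (x / 2))) := by ring
    _ = _ := by rw [exp_neg_mul_exp_half]

/-- The factor of `ν` that does not involve `f`. -/
noncomputable def Path.D (θ0 : ℝ) (s : Path) (x : ℝ) : ℝ :=
  Sn θ0 (s.ρ x) * s.P x / √(s.y x)

lemma Sol.D_pos (h : Sol θ0 α c κ f b g b' s) {x : ℝ} (hx : 0 < x) : 0 < s.D θ0 x := by
  have := h.Sn_pos hx; have := h.P_pos hx; have := h.y_pos hx
  unfold Path.D; positivity

lemma Sol.log_D (h : Sol θ0 α c κ f b g b' s) {x : ℝ} (hx : 0 < x) :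
    log (s.D θ0 x) = log (Sn θ0 (s.ρ x)) + log (s.P x) - log (s.y x) / 2 := by
  have h1 := (h.Sn_pos hx).ne'
  have h2 := (h.P_pos hx).ne'
  have h4 := h.y_pos hx
  rw [Path.D, log_div (by positivity) (sqrt_pos.2 h4).ne', log_mul h1 h2, log_sqrt h4.le]

lemma Sol.D_le (h : Sol θ0 α c κ f b g b' s) (hB : Bd θ0 α κ M s) (hM : 0 ≤ M) {x : ℝ}
    (hx : 0 < x) : s.D θ0 x ≤ M ^ 2 := by
  have h2 := Sn_le_one h.P (h.ρ_nonneg hx)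
  have h3 := hB.P_le x hx
  have h4 := hB.y_inv x hx
  have := h.Sn_pos hx; have := h.P_pos hx; have := h.y_pos hx
  calc s.D θ0 x = Sn θ0 (s.ρ x) * s.P x * (1 / √(s.y x)) := by rw [Path.D, mul_one_div]
    _ ≤ 1 * (M * exp (-x)) * (M * exp (x / 2)) := by gcongr
    _ = M ^ 2 * (exp (-x) * exp (x / 2)) := by ring
    _ ≤ M ^ 2 * 1 := by
      rw [exp_neg_mul_exp_half]
      have : exp (-(x / 2)) ≤ 1 := exp_le_one_iff.2 (by linarith)
      gcongr
    _ = _ := mul_one _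

lemma Cmp.κ_mul_le (h : Cmp θ0 α c κ M K2 S e f1 b1 g1 b1' s1 f2 b2 g2 b2' s2)
    (hm : Near m s1 s2) : 0 ≤ m ∧ 0 ≤ κ * (e + m) ∧ κ * (e + m) ≤ e + m := by
  have h1 := h.e_nonneg
  have h2 : 0 ≤ m := (abs_nonneg _).trans (hm.y 1 one_pos)
  have h3 := h.h1.hs.pos
  exact ⟨h2, by positivity, mul_le_of_le_one_left (by positivity) h.κ_le⟩

lemma Cmp.abs_log_P_sub_le (h : Cmp θ0 α c κ M K2 S e f1 b1 g1 b1' s1 f2 b2 g2 b2' s2)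
    (hm : Near m s1 s2) {m' x : ℝ} (hx : 0 < x) (hw : |log (s1.w x) - log (s2.w x)| ≤ m') :
    |log (s1.P x) - log (s2.P x)| ≤ kL α c θ0 * (κ * (e + m)) + (1 - α) / α * m' := by
  have h1 := h.abs_log_L_sub_le hm hx
  have hγ := gamma_nonneg h.h1.P
  rw [h.h1.log_P hx, h.h2.log_P hx]
  calc _ = |(log (s1.L x) - log (s2.L x)) + (1 - α) / α * (log (s1.w x) - log (s2.w x))| := by
        congr 1; ring
    _ ≤ |log (s1.L x) - log (s2.L x)| + (1 - α) / α * |log (s1.w x) - log (s2.w x)| := by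
      refine (abs_add_le _ _).trans_eq ?_
      rw [abs_mul, abs_of_nonneg hγ]
    _ ≤ _ := by rw [kL]; gcongr

lemma Cmp.abs_log_Sn_Cs_sub_le (h : Cmp θ0 α c κ M K2 S e f1 b1 g1 b1' s1 f2 b2 g2 b2' s2)
    {m' x : ℝ} (hx : 0 < x) (hρ : |s1.ρ x - s2.ρ x| ≤ m') :
    |log (Sn θ0 (s1.ρ x)) - log (Sn θ0 (s2.ρ x))| ≤ 1 / sin θ0 * m' ∧
      |log (Cs θ0 (s1.ρ x)) - log (Cs θ0 (s2.ρ x))| ≤ 1 / sin θ0 * m' := by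
  have hσ := h.h1.P.sin_pos
  have h1 := Model2.abs_log_Sn_Cs_sub_le h.h1.P (h.h1.ρ_nonneg hx) (h.h2.ρ_nonneg hx)
  have h2 := mul_le_mul_of_nonneg_left hρ (by positivity : 0 ≤ 1 / sin θ0)
  exact ⟨h1.1.trans h2, h1.2.trans h2⟩

lemma Cmp.abs_ν_sub_le (h : Cmp θ0 α c κ M K2 S e f1 b1 g1 b1' s1 f2 b2 g2 b2' s2)
    (hM : 0 ≤ M) (hK : 0 ≤ K2) (hm : Near m s1 s2) {x : ℝ} (hx : 0 < x) :
    |s1.ν x - s2.ν x| ≤ kν θ0 α c M K2 * (κ * (e + m)) := by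
  obtain ⟨hm0, hA0, hA⟩ := h.κ_mul_le hm
  have hσ := h.h1.P.sin_pos
  have hc := kL_nonneg h.h1.P
  have hγ := gamma_nonneg h.h1.P
  have hκ := h.h1.hs.pos
  have he := h.e_nonneg
  have e1 : |log (s1.D θ0 x) - log (s2.D θ0 x)| ≤
      (1 / sin θ0 + 1 / 2 + kL α c θ0 + (1 - α) / α) * (e + m) := by
    have h1 := abs_le.1 (h.abs_log_P_sub_le hm hx (hm.w x hx))
    have h2 := abs_le.1 (h.abs_log_Sn_Cs_sub_le hx (hm.ρ x hx)).1
    have h3 := abs_le.1 (hm.y x hx)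
    have h4 := mul_le_mul_of_nonneg_left hA hc
    have h5 : 0 ≤ 1 / sin θ0 * e := by positivity
    have h6 : 0 ≤ (1 - α) / α * e := by positivity
    rw [h.h1.log_D hx, h.h2.log_D hx]
    rw [abs_le]
    constructor <;> linarith
  have e2 := abs_mul_sub_le_log (h.h1.D_pos hx) (h.h2.D_pos hx) (h.h1.D_le h.B1 hM hx)
    (h.h2.D_le h.B2 hM hx) e1 (h.h1.hw.nonneg (s1.y x)) (h.h1.hw.le (s1.y x))
    (h.abs_f_sub_le hK hm hx)
  have e3 : ∀ {f g : ℝ → ℝ} {b b' : ℝ} {s : Path}, Sol θ0 α c κ f b g b' s →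
      s.ν x = κ * (f (s.y x) * s.D θ0 x) := fun h => by
    rw [h.ν_eq x hx, Path.D]; ring
  rw [e3 h.h1, e3 h.h2, ← mul_sub, abs_mul, abs_of_nonneg hκ]
  refine (mul_le_mul_of_nonneg_left e2 hκ).trans_eq ?_
  rw [kν]; ring

lemma Cmp.abs_log_one_sub_ν_sub_le (h : Cmp θ0 α c κ M K2 S e f1 b1 g1 b1' s1 f2 b2 g2 b2' s2)
    (hM : 0 ≤ M) (hK : 0 ≤ K2) (hm : Near m s1 s2) {x : ℝ} (hx : 0 < x) :
    |log (1 - s1.ν x) - log (1 - s2.ν x)| ≤ 2 * kν θ0 α c M K2 * (κ * (e + m)) := by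
  have h1 := abs_log_sub_le (m := 1 / 2) (by norm_num) (by linarith [h.h1.ν_le hx])
    (by linarith [h.h2.ν_le hx] : 1 / 2 ≤ 1 - s2.ν x) (a := 1 - s1.ν x)
  have h2 := h.abs_ν_sub_le hM hK hm hx
  rw [sub_sub_sub_cancel_left, abs_sub_comm (s2.ν x)] at h1
  linarith

lemma Cmp.abs_log_τ_sub_le (h : Cmp θ0 α c κ M K2 S e f1 b1 g1 b1' s1 f2 b2 g2 b2' s2)
    (hM : 0 ≤ M) (hK : 0 ≤ K2) (hm : Near m s1 s2) {m' x : ℝ} (hx : 0 < x)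
    (hw : |log (s1.w x) - log (s2.w x)| ≤ m') :
    |log (s1.τ x) - log (s2.τ x)| ≤
      (kL α c θ0 + 2 * kν θ0 α c M K2) * (κ * (e + m)) + (1 - α) / α * m' := by
  have h1 := abs_le.1 (h.abs_log_P_sub_le hm hx hw)
  have h2 := abs_le.1 (h.abs_log_one_sub_ν_sub_le hM hK hm hx)
  rw [h.h1.log_τ hx, h.h2.log_τ hx, abs_le]
  constructor <;> linarith

lemma Cmp.abs_q_sub_le (h : Cmp θ0 α c κ M K2 S e f1 b1 g1 b1' s1 f2 b2 g2 b2' s2)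
    (hM : 0 ≤ M) (hK : 0 ≤ K2) (hm : Near m s1 s2) {x : ℝ} (hx : 0 < x) :
    |s1.q x - s2.q x| ≤ kq θ0 α c M K2 * (κ * (e + m)) * hh x := by
  obtain ⟨hm0, hA0, hA⟩ := h.κ_mul_le hm
  have hσ := h.h1.P.sin_pos
  have hc := kL_nonneg h.h1.P
  have hν := kν_nonneg (M := M) h.h1.P hK
  have hγ := gamma_nonneg h.h1.P
  have hκ := h.h1.hs.pos
  have he := h.e_nonneg
  set c3 := 2 * kL α c θ0 + 1 / sin θ0 + (1 - α) / α + 2 * kν θ0 α c M K2 + 1 / 2 with hc3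
  have hc30 : 0 ≤ c3 := by positivity
  have e1 : ∀ x > 0, |log (s1.E θ0 x) - log (s2.E θ0 x)| ≤ c3 * (e + m) := fun x hx => by
    have h1 := abs_le.1 (h.abs_log_τ_sub_le hM hK hm hx (hm.w x hx))
    have h0 := abs_le.1 (h.abs_log_L_sub_le hm hx)
    rw [← kL] at h0
    have h2 := abs_le.1 (h.abs_log_Sn_Cs_sub_le hx (hm.ρ x hx)).2
    have h3 := abs_le.1 (hm.y x hx)
    have h4 := mul_le_mul_of_nonneg_left hA hc
    have h7 := mul_le_mul_of_nonneg_left hA hν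
    have h5 : 0 ≤ 1 / sin θ0 * e := by positivity
    have h6 : 0 ≤ (1 - α) / α * e := by positivity
    rw [h.h1.log_E hx, h.h2.log_E hx, abs_le, hc3]
    constructor <;> linarith
  have hd := fun x hx => (h.h1.q_deriv x hx).fun_sub (h.h2.q_deriv x hx)
  have hz := h.h1.q_zero.sub h.h2.q_zero
  rw [sub_zero] at hz
  have hK0 := Kc_pos h.h1.P
  have := abs_le_four_hh (A := 4 * M ^ 2 * (Kc θ0 α c * c3 + (K2 + 1)) * (κ * (e + m)))
    (by positivity) hd (fun x hx => ?_) hz hx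
  · refine this.trans_eq ?_
    rw [kq]; ring
  have e2 := abs_mul_sub_le_log (h.h1.E_pos hx) (h.h2.E_pos hx) (h.h1.E_le h.B1 hM hx)
    (h.h2.E_le h.B2 hM hx) (e1 x hx) (h.h1.hw.nonneg (s1.y x)) (h.h1.hw.le (s1.y x))
    (h.abs_f_sub_le hK hm hx)
  have e3 : ∀ (f : ℝ → ℝ) (s : Path), κ * s.L x * (f (s.y x) / √(s.y x)) *
      (Cs θ0 (s.ρ x) * (1 - exp (-x))) * s.τ x = κ * (f (s.y x) * s.E θ0 x) := fun f s => by
    rw [Path.E]; ring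
  rw [e3 f1, e3 f2, ← mul_sub, abs_mul, abs_of_nonneg hκ]
  refine (mul_le_mul_of_nonneg_left e2 hκ).trans_eq ?_
  ring

lemma Cmp.abs_ρ_sub_le (h : Cmp θ0 α c κ M K2 S e f1 b1 g1 b1' s1 f2 b2 g2 b2' s2)
    (hM : 0 ≤ M) (hK : 0 ≤ K2) (hm : Near m s1 s2) {x : ℝ} (hx : 0 < x) :
    |s1.ρ x - s2.ρ x| ≤ kρ θ0 α c M K2 * (κ * (e + m)) := by
  obtain ⟨hm0, hA0, hA⟩ := h.κ_mul_le hm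
  have hL1 := h.h1.L_pos hx
  have hL2 := h.h2.L_pos hx
  have hh0 := hh_pos hx
  have e1 := h.abs_log_L_sub_le hm hx
  rw [← kL] at e1
  have hL : ∀ {L : ℝ}, 1 / 2 ≤ L → L⁻¹ ≤ 2 := fun {L} hL =>
    (inv_anti₀ (by norm_num) hL).trans_eq (by norm_num)
  have e2 := abs_mul_sub_le_log (p1 := s1.q x / hh x) (p2 := s2.q x / hh x) (K := M)
    (η := kq θ0 α c M K2 * (κ * (e + m))) (inv_pos.2 hL1)
    (inv_pos.2 hL2) (hL (h.h1.le_L hx)) (hL (h.h2.le_L hx)) (δ := kL α c θ0 * (κ * (e + m)))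
    (by rw [log_inv, log_inv, neg_sub_neg, abs_sub_comm]; exact e1)
    (div_nonneg (h.h1.q_nonneg x hx) hh0.le) (by
      rw [div_le_iff₀ hh0]
      refine (h.B1.q_le x hx).trans ?_
      have := h.κ_le
      calc κ * M * hh x ≤ 1 * M * hh x := by gcongr
        _ = _ := by ring) (by
      rw [← sub_div, abs_div, abs_of_pos hh0, div_le_iff₀ hh0]
      exact h.abs_q_sub_le hM hK hm hx)
  rw [h.h1.ρ_eq x hx, h.h2.ρ_eq x hx]
  have e3 : ∀ q L : ℝ, q / (L * hh x) = q / hh x * L⁻¹ := fun q L => by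
    rw [mul_comm L, ← div_div, div_eq_mul_inv _ L]
  rw [e3, e3]
  refine e2.trans_eq ?_
  rw [kρ]; ring

lemma Cmp.abs_log_w_sub_le (h : Cmp θ0 α c κ M K2 S e f1 b1 g1 b1' s1 f2 b2 g2 b2' s2)
    (hM : 0 ≤ M) (hK : 0 ≤ K2) (hm : Near m s1 s2) {x : ℝ} (hx : 0 < x) :
    |log (s1.w x) - log (s2.w x)| ≤ kw θ0 α c M K2 * (κ * (e + m)) := by
  have hc := h.h1.P.c0
  have hpos : ∀ {f g : ℝ → ℝ} {b b' : ℝ} {s : Path}, Sol θ0 α c κ f b g b' s → ∀ x > 0,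
      0 < s.L x * Cs θ0 (s.ρ x) * (x * exp (-x)) / (c * (1 - s.ν x)) := fun h x hx => by
    have := h.L_pos hx; have := h.Cs_pos hx; have := h.one_sub_ν_pos hx
    positivity
  have hlog : ∀ {f g : ℝ → ℝ} {b b' : ℝ} {s : Path}, Sol θ0 α c κ f b g b' s → ∀ x > 0,
      log (s.L x * Cs θ0 (s.ρ x) * (x * exp (-x)) / (c * (1 - s.ν x))) =
        log (s.L x) + log (Cs θ0 (s.ρ x)) + log (x * exp (-x)) - (log c + log (1 - s.ν x)) :=
    fun h x hx => by
    have h1 := (h.L_pos hx).ne'; have h2 := (h.Cs_pos hx).ne'; have h3 := (h.one_sub_ν_pos hx).ne'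
    have h4 := (mul_pos hx (exp_pos (-x))).ne'
    rw [log_div (by positivity) (by positivity), log_mul (by positivity) h4, log_mul h1 h2,
      log_mul hc.ne' h3]
  refine log_close_zero h.h1.w_deriv h.h2.w_deriv (hpos h.h1) (hpos h.h2) h.h1.w_pos h.h2.w_pos
    (fun x hx => ?_) h.h1.w_zero h.h2.w_zero hx
  have h0 := abs_le.1 (h.abs_log_L_sub_le hm hx)
  rw [← kL] at h0
  have h1 := abs_le.1 (h.abs_log_Sn_Cs_sub_le hx (h.abs_ρ_sub_le hM hK hm hx)).2
  have h2 := abs_le.1 (h.abs_log_one_sub_ν_sub_le hM hK hm hx)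
  rw [hlog h.h1 x hx, hlog h.h2 x hx, abs_le, kw]
  constructor <;> linarith

lemma Cmp.near (h : Cmp θ0 α c κ M K2 S e f1 b1 g1 b1' s1 f2 b2 g2 b2' s2)
    (hM : 0 ≤ M) (hK : 0 ≤ K2) (hm : Near m s1 s2) :
    Near (kC θ0 α c M K2 * (κ * (e + m))) s1 s2 ∧
      (∀ x > 0, |log (s1.τ x) - log (s2.τ x)| ≤ kC θ0 α c M K2 * (κ * (e + m))) ∧
      ∀ x > 0, |log (s1.t x) - log (s2.t x)| ≤ kC θ0 α c M K2 * (κ * (e + m)) := by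
  obtain ⟨hm0, hA0, hA⟩ := h.κ_mul_le hm
  have hP := h.h1.P
  have hσ := hP.sin_pos
  have n1 := mul_nonneg (kL_nonneg hP) hA0
  have n2 := mul_nonneg (mul_nonneg (gamma_nonneg hP) (kw_nonneg hP hM hK)) hA0
  have n3 := mul_nonneg (kν_nonneg (M := M) hP hK) hA0
  have n4 := mul_nonneg (mul_nonneg (one_div_pos.2 hσ).le (kρ_nonneg hP hM hK)) hA0
  have n5 := mul_nonneg (kρ_nonneg hP hM hK) hA0
  have n6 := mul_nonneg (kw_nonneg hP hM hK) hA0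
  have hτ : ∀ x > 0, |log (s1.τ x) - log (s2.τ x)| ≤ (kL α c θ0 + 2 * kν θ0 α c M K2) *
      (κ * (e + m)) + (1 - α) / α * (kw θ0 α c M K2 * (κ * (e + m))) := fun x hx =>
    h.abs_log_τ_sub_le hM hK hm hx (h.abs_log_w_sub_le hM hK hm hx)
  refine ⟨⟨fun x hx => ?_, fun x hx => ?_, fun x hx => ?_⟩, fun x hx => ?_, fun x hx => ?_⟩
  · refine log_close_top h.h1.y_deriv h.h2.y_deriv
      (fun x hx => mul_pos (h.h1.τ_pos hx) (h.h1.Sn_pos hx))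
      (fun x hx => mul_pos (h.h2.τ_pos hx) (h.h2.Sn_pos hx)) (fun x hx => h.h1.y_pos hx)
      (fun x hx => h.h2.y_pos hx) (fun x hx => ?_) h.h1.y_top h.h2.y_top hx
    have h1 := abs_le.1 (hτ x hx)
    have h2 := abs_le.1 (h.abs_log_Sn_Cs_sub_le hx (h.abs_ρ_sub_le hM hK hm hx)).1
    rw [log_mul (h.h1.τ_pos hx).ne' (h.h1.Sn_pos hx).ne', log_mul (h.h2.τ_pos hx).ne'
      (h.h2.Sn_pos hx).ne', abs_le, kC]
    constructor <;> linarith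
  · refine (h.abs_log_w_sub_le hM hK hm hx).trans ?_
    rw [kC]; linarith
  · refine (h.abs_ρ_sub_le hM hK hm hx).trans ?_
    rw [kC]; linarith
  · refine (hτ x hx).trans ?_
    rw [kC]; linarith
  · refine log_close_top h.h1.t_deriv h.h2.t_deriv (fun x hx => h.h1.τ_pos hx)
      (fun x hx => h.h2.τ_pos hx) (fun x hx => h.h1.t_pos x hx)
      (fun x hx => h.h2.t_pos x hx) (fun x hx => ?_) h.h1.t_top h.h2.t_top hx
    refine (hτ x hx).trans ?_
    rw [kC]; linarith

end
end Model2

namespace Model2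
open Set Filter Topology

section
variable {θ0 α c κ M K2 S e m : ℝ} {f1 : ℝ → ℝ} {b1 : ℝ} {g1 : ℝ → ℝ} {b1' : ℝ} {s1 : Path}
    {f2 : ℝ → ℝ} {b2 : ℝ} {g2 : ℝ → ℝ} {b2' : ℝ} {s2 : Path}

lemma Cmp.near_apriori (h : Cmp θ0 α c κ M K2 S e f1 b1 g1 b1' s1 f2 b2 g2 b2' s2) (hM : 1 ≤ M) :
    Near (M ^ 2 / sin θ0) s1 s2 := by
  have hσ := h.h1.P.sin_pos
  have hσ1 := h.h1.P.sin_lt_one.le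
  have hM0 : 0 < M := by linarith
  have hM2 : 0 < M ^ 2 / sin θ0 := by positivity
  have hle : M ^ 2 ≤ M ^ 2 / sin θ0 := le_div_self (by positivity) hσ hσ1
  have hlog : log (M ^ 2 / sin θ0) ≤ M ^ 2 / sin θ0 := (log_le_self hM2.le)
  have hw : ∀ {s s' : Path}, Bd θ0 α κ M s → Bd θ0 α κ M s' → (∀ x > 0, 0 < s'.w x) → ∀ x > 0,
      s.w x ≤ M ^ 2 / sin θ0 * s'.w x := fun {s s'} B B' hp x hx => by
    have h1 := B'.le_w x hx
    have h2 := hp x hx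
    calc s.w x ≤ M * (M * s'.w x) :=
          (B.w_le x hx).trans (mul_le_mul_of_nonneg_left h1 (by linarith))
      _ = M ^ 2 * s'.w x := by ring
      _ ≤ _ := mul_le_mul_of_nonneg_right hle h2.le
  have hy : ∀ {f g f' g' : ℝ → ℝ} {b b' b2 b2' : ℝ} {s s' : Path}, Bd θ0 α κ M s →
      Bd θ0 α κ M s' → Sol θ0 α c κ f b g b' s → Sol θ0 α c κ f' b2 g' b2' s' → ∀ x > 0,
      s.y x ≤ M ^ 2 / sin θ0 * s'.y x := fun {f g f' g' b b' b2 b2' s s'} B B' h h' x hx => by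
    calc s.y x ≤ M * exp (-x) := (h.y_le x hx).trans (B.t_le x hx)
      _ ≤ M * (M * s'.t x) := mul_le_mul_of_nonneg_left (B'.le_t x hx) hM0.le
      _ = M ^ 2 / sin θ0 * (sin θ0 * s'.t x) := by field_simp
      _ ≤ _ := mul_le_mul_of_nonneg_left (h'.le_y x hx) hM2.le
  refine ⟨fun x hx => le_trans ?_ hlog, fun x hx => le_trans ?_ hlog, fun x hx => ?_⟩
  · rw [log_close (h.h1.y_pos hx) (h.h2.y_pos hx), exp_log hM2]
    exact ⟨hy h.B1 h.B2 h.h1 h.h2 x hx, hy h.B2 h.B1 h.h2 h.h1 x hx⟩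
  · rw [log_close (h.h1.w_pos x hx) (h.h2.w_pos x hx), exp_log hM2]
    exact ⟨hw h.B1 h.B2 h.h2.w_pos x hx, hw h.B2 h.B1 h.h1.w_pos x hx⟩
  · have h1 := h.B1.ρ_le x hx
    have h2 := h.B2.ρ_le x hx
    have h3 := h.h1.ρ_nonneg hx
    have h4 := h.h2.ρ_nonneg hx
    have h5 : κ * M ≤ M ^ 2 := by
      rw [sq]; exact mul_le_mul_of_nonneg_right (h.κ_le.trans hM) hM0.le
    rw [abs_le]
    constructor <;> linarith

lemma Cmp.close (h : Cmp θ0 α c κ M K2 S e f1 b1 g1 b1' s1 f2 b2 g2 b2' s2)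
    (hM : 1 ≤ M) (hK : 0 ≤ K2) (hκ : kC θ0 α c M K2 * κ ≤ 1 / 2) :
    Near (2 * kC θ0 α c M K2 * κ * e) s1 s2 ∧
      (∀ x > 0, |log (s1.τ x) - log (s2.τ x)| ≤ 2 * kC θ0 α c M K2 * κ * e) ∧
      ∀ x > 0, |log (s1.t x) - log (s2.t x)| ≤ 2 * kC θ0 α c M K2 * κ * e := by
  have hM0 : 0 ≤ M := by linarith
  have he := h.e_nonneg
  have hκ0 := h.h1.hs.pos
  have hk := kC_nonneg (M := M) h.h1.P hM0 hK
  have hstep : ∀ m, 0 ≤ m → kC θ0 α c M K2 * (κ * (e + m)) ≤ kC θ0 α c M K2 * κ * e + m / 2 :=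
    fun m hm => by
      have := mul_le_mul_of_nonneg_right hκ hm
      linarith
  have hn : ∀ n : ℕ, Near (2 * kC θ0 α c M K2 * κ * e + M ^ 2 / sin θ0 * (1 / 2) ^ n) s1 s2 := by
    intro n
    induction n with
    | zero =>
      have h1 := h.near_apriori hM
      have h2 : 0 ≤ 2 * kC θ0 α c M K2 * κ * e := by positivity
      have h3 : M ^ 2 / sin θ0 ≤ 2 * kC θ0 α c M K2 * κ * e + M ^ 2 / sin θ0 * (1 / 2) ^ 0 := by
        rw [pow_zero, mul_one]; linarith
      exact ⟨fun x hx => (h1.y x hx).trans h3, fun x hx => (h1.w x hx).trans h3,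
        fun x hx => (h1.ρ x hx).trans h3⟩
    | succ n ih =>
      have h1 := (h.near hM0 hK ih).1
      have h3 := hstep _ (h.κ_mul_le ih).1
      have h4 : kC θ0 α c M K2 * κ * e + (2 * kC θ0 α c M K2 * κ * e +
          M ^ 2 / sin θ0 * (1 / 2) ^ n) / 2 =
          2 * kC θ0 α c M K2 * κ * e + M ^ 2 / sin θ0 * (1 / 2) ^ (n + 1) := by ring
      rw [h4] at h3
      exact ⟨fun x hx => (h1.y x hx).trans h3, fun x hx => (h1.w x hx).trans h3,
        fun x hx => (h1.ρ x hx).trans h3⟩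
  have hlim : Tendsto (fun n : ℕ => 2 * kC θ0 α c M K2 * κ * e + M ^ 2 / sin θ0 * (1 / 2) ^ n)
      atTop (𝓝 (2 * kC θ0 α c M K2 * κ * e)) := by
    have := ((tendsto_pow_atTop_nhds_zero_of_lt_one (r := (1 : ℝ) / 2) (by norm_num)
      (by norm_num)).const_mul (M ^ 2 / sin θ0)).const_add (2 * kC θ0 α c M K2 * κ * e)
    rwa [mul_zero, add_zero] at this
  have hN : Near (2 * kC θ0 α c M K2 * κ * e) s1 s2 :=
    ⟨fun x hx => ge_of_tendsto' hlim fun n => (hn n).y x hx,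
      fun x hx => ge_of_tendsto' hlim fun n => (hn n).w x hx,
      fun x hx => ge_of_tendsto' hlim fun n => (hn n).ρ x hx⟩
  have h5 := hstep _ (h.κ_mul_le hN).1
  obtain ⟨-, h1, h2⟩ := h.near hM0 hK hN
  exact ⟨hN, fun x hx => (h1 x hx).trans (by linarith), fun x hx => (h2 x hx).trans (by linarith)⟩

/-- The logarithm of the slope `Cs / Sn` is Lipschitz. -/
lemma abs_log_slope_sub_le (P : Params θ0 α c) {r1 r2 : ℝ} (h1 : 0 ≤ r1) (h2 : 0 ≤ r2) :
    |log (Cs θ0 r1 / Sn θ0 r1) - log (Cs θ0 r2 / Sn θ0 r2)| ≤ 2 / sin θ0 * |r1 - r2| := by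
  obtain ⟨h3, h4⟩ := abs_log_Sn_Cs_sub_le P h1 h2
  rw [log_div (Cs_pos P h1).ne' (Sn_pos P h1).ne', log_div (Cs_pos P h2).ne' (Sn_pos P h2).ne']
  rw [show 2 / sin θ0 = 1 / sin θ0 + 1 / sin θ0 by ring, add_mul]
  rw [abs_le] at h3 h4 ⊢
  constructor <;> linarith

/-- Sensitivity of the total leaf area. -/
noncomputable def kb (θ0 M : ℝ) : ℝ := 2 * M / sin θ0 * (2 / sin θ0 + 1)

lemma kb_nonneg (P : Params θ0 α c) (hM : 0 ≤ M) : 0 ≤ kb θ0 M := by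
  have := P.sin_pos; unfold kb; positivity

lemma Cmp.abs_b_sub_le (h : Cmp θ0 α c κ M K2 S e f1 b1 g1 b1' s1 f2 b2 g2 b2' s2)
    (hM : 1 ≤ M) {D : ℝ} (hN : Near D s1 s2)
    (hτ : ∀ x > 0, |log (s1.τ x) - log (s2.τ x)| ≤ D) : |b1' - b2'| ≤ κ * (kb θ0 M * D) := by
  have hP := h.h1.P
  have hσ := hP.sin_pos
  have hM0 : 0 ≤ M := by linarith
  have hκ := h.h1.hs.pos
  have hD : 0 ≤ D := (abs_nonneg _).trans (hN.y 1 one_pos)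
  obtain ⟨β1, hβ1, hb1⟩ := h.h1.B_top
  obtain ⟨β2, hβ2, hb2⟩ := h.h2.B_top
  have hd := fun x hx => (h.h1.B_deriv x hx).fun_sub (h.h2.B_deriv x hx)
  have hz := h.h1.B_zero.sub h.h2.B_zero
  rw [sub_zero] at hz
  have hpos : ∀ {f g : ℝ → ℝ} {b b' : ℝ} {s : Path}, Sol θ0 α c κ f b g b' s → ∀ x > 0,
      0 < Cs θ0 (s.ρ x) / Sn θ0 (s.ρ x) * x * s.τ x := fun h x hx => by
    have := h.Sn_pos hx; have := h.Cs_pos hx; have := h.τ_pos hx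
    positivity
  have hle : ∀ {f g : ℝ → ℝ} {b b' : ℝ} {s : Path}, Sol θ0 α c κ f b g b' s → Bd θ0 α κ M s →
      ∀ x > 0, Cs θ0 (s.ρ x) / Sn θ0 (s.ρ x) * x * s.τ x ≤ 2 * M / sin θ0 * (x * exp (-x)) :=
    fun {f g b b' s} h B x hx => by
    have h1 := h.Sn_pos hx; have h2 := h.Cs_pos hx; have h3 := h.τ_pos hx
    have h4 := Cs_div_Sn_le hP (h.ρ_nonneg hx)
    have h5 : s.τ x ≤ 2 * (M * exp (-x)) := (h.τ_le hx).trans (by have := B.P_le x hx; linarith)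
    calc _ ≤ 1 / sin θ0 * x * (2 * (M * exp (-x))) := by gcongr
      _ = _ := by ring
  have hB : ∀ x > 0, |s1.B x - s2.B x| ≤ kb θ0 M * D * hh x := fun x hx => by
    refine abs_le_hh hd (fun x hx => ?_) hz hx
    have e1 := abs_log_slope_sub_le hP (h.h1.ρ_nonneg hx) (h.h2.ρ_nonneg hx)
    have e3 : |log (Cs θ0 (s1.ρ x) / Sn θ0 (s1.ρ x) * x * s1.τ x) -
        log (Cs θ0 (s2.ρ x) / Sn θ0 (s2.ρ x) * x * s2.τ x)| ≤ (2 / sin θ0 + 1) * D := by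
      have hk : ∀ {f g : ℝ → ℝ} {b b' : ℝ} {s : Path}, Sol θ0 α c κ f b g b' s →
          Cs θ0 (s.ρ x) / Sn θ0 (s.ρ x) ≠ 0 := fun h =>
        (div_pos (h.Cs_pos hx) (h.Sn_pos hx)).ne'
      rw [log_mul (mul_ne_zero (hk h.h1) hx.ne') (h.h1.τ_pos hx).ne', log_mul (hk h.h1) hx.ne',
        log_mul (mul_ne_zero (hk h.h2) hx.ne') (h.h2.τ_pos hx).ne', log_mul (hk h.h2) hx.ne']
      have e4 := abs_le.1 (e1.trans (mul_le_mul_of_nonneg_left (hN.ρ x hx) (by positivity)))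
      have e5 := abs_le.1 (hτ x hx)
      rw [abs_le]
      constructor <;> linarith
    have e2 := abs_sub_le_log (hpos h.h1 x hx) (hpos h.h2 x hx) (hle h.h1 h.B1 x hx)
      (hle h.h2 h.B2 x hx)
    refine e2.trans ((mul_le_mul_of_nonneg_left e3 (by positivity)).trans_eq ?_)
    rw [kb]; ring
  have hkb := kb_nonneg hP hM0
  have hβ : |β1 - β2| ≤ kb θ0 M * D := by
    refine le_of_tendsto (hβ1.sub hβ2).abs ?_
    filter_upwards [eventually_gt_atTop 0] with x hx
    exact (hB x hx).trans (mul_le_of_le_one_right (by positivity) (hh_le_one hx.le))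
  rw [hb1, hb2, neg_sub_neg, ← mul_sub, abs_mul, abs_of_nonneg hκ, abs_sub_comm]
  exact mul_le_mul_of_nonneg_left hβ hκ

lemma Cmp.abs_log_T_sub_le (h : Cmp θ0 α c κ M K2 S e f1 b1 g1 b1' s1 f2 b2 g2 b2' s2) {D : ℝ}
    (ht : ∀ x > 0, |log (s1.t x) - log (s2.t x)| ≤ D) : |log s1.T - log s2.T| ≤ D := by
  have h1 : 0 < s1.T := (h.h1.t_pos 1 one_pos).trans (h.h1.t_lt 1 one_pos)
  have h2 : 0 < s2.T := (h.h2.t_pos 1 one_pos).trans (h.h2.t_lt 1 one_pos)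
  refine le_of_tendsto ((h.h1.t_zero.log h1.ne').sub (h.h2.t_zero.log h2.ne')).abs ?_
  filter_upwards [self_mem_nhdsWithin] with x hx using ht x hx

end
end Model2

namespace Model2
open Set Filter Topology

/-- The height that no optimal configuration exceeds; `T0` is the length of a stem in
constant light. -/
noncomputable def Sh (θ0 T0 : ℝ) : ℝ := T0 * (1 + sin θ0) / 2

/-- Uniform bounds for all optimal configurations, valid for small densities. -/
structure Ctx (θ0 α c M T0 κ : ℝ) : Prop where
  P : Params θ0 α c
  hs : Small θ0 α c κ
  κ_pos : 0 < κ
  κ_le : κ ≤ 1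
  M_ge : 1 ≤ M
  T0_pos : 0 < T0
  bd : ∀ f b g b' s, Sol θ0 α c κ f b g b' s → Bd θ0 α κ M s
  T_ge : ∀ f b g b' s, Sol θ0 α c κ f b g b' s → T0 * (3 + sin θ0) / 4 ≤ s.T
  y_le : ∀ f b g b' s, Sol θ0 α c κ f b g b' s → ∀ x > 0, s.y x ≤ Sh θ0 T0

section
variable {θ0 α c κ M K2 S e m : ℝ} {f g : ℝ → ℝ} {b b' : ℝ} {s : Path}

lemma Sn_le_add (P : Params θ0 α c) {r : ℝ} (hr : 0 ≤ r) : Sn θ0 r ≤ sin θ0 + r :=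
  div_le_self (add_pos_of_pos_of_nonneg P.sin_pos hr).le (one_le_Ds P hr)

lemma Sol.y_le_mul (h : Sol θ0 α c κ f b g b' s) (hB : Bd θ0 α κ M s) {x : ℝ} (hx : 0 < x) :
    s.y x ≤ (sin θ0 + κ * M) * s.t x := by
  have hz := h.t_top.const_mul (sin θ0 + κ * M)
  rw [mul_zero] at hz
  refine le_of_deriv_le_top h.y_deriv (G' := fun x => (sin θ0 + κ * M) * s.τ x)
    (fun x hx => ((h.t_deriv x hx).const_mul (sin θ0 + κ * M)).congr_deriv (by ring))
    (fun x hx => ?_) h.y_top hz hx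
  rw [mul_comm]
  have h1 := Sn_le_add h.P (h.ρ_nonneg hx)
  have h2 := hB.ρ_le x hx
  exact mul_le_mul_of_nonneg_right (by linarith) (h.τ_pos hx).le

lemma light_one : Light fun _ => 1 :=
  ⟨continuous_const, monotone_const, fun _ => one_pos, fun _ => one_le_two⟩

lemma If_zero : If α c κ (fun _ => 0) 0 = fun _ => 1 := by
  funext y; simp [If, Jf]

lemma wk_zero (P : Params θ0 α c) (hs : Small θ0 α c κ) : Wk θ0 α c κ (fun _ => 0) 0 :=
  ⟨measurable_const, fun _ => le_rfl, fun _ => (Kc_pos P).le, by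
    rw [abs_zero]; exact mul_nonneg hs.pos (C2_pos P).le⟩

lemma eventually_lt_of_continuous {F : ℝ → ℝ} (hF : Continuous F) {a : ℝ} (h : F 0 < a) :
    ∀ᶠ κ in 𝓝[>] (0 : ℝ), F κ < a :=
  ((hF.tendsto 0).eventually_lt_const h).filter_mono nhdsWithin_le_nhds

lemma eventually_small (P : Params θ0 α c) : ∀ᶠ κ in 𝓝[>] (0 : ℝ), Small θ0 α c κ := by
  have hσ := P.sin_pos
  filter_upwards [self_mem_nhdsWithin, eventually_lt_of_continuous (F := fun κ => κ * C2 θ0 α c)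
    (a := 1 / 4) (by fun_prop) (by norm_num), eventually_lt_of_continuous
      (F := fun κ => κ * C2 θ0 α c) (a := sin θ0) (by fun_prop) (by simpa using hσ)]
    with κ h0 h1 h2 using ⟨le_of_lt h0, h1.le, h2.le⟩

lemma exists_ctx (P : Params θ0 α c) :
    ∃ M T0, ∀ᶠ κ in 𝓝[>] (0 : ℝ), Ctx θ0 α c M T0 κ := by
  obtain ⟨M, hM, hbd⟩ := exists_bd P
  obtain ⟨θ, u, ho⟩ := exists_opt P light_one
  replace ho : Opt θ0 α c (fun _ => 1) θ u := ho
  obtain ⟨T0, hL⟩ := ho.exists_len P light_one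
  have hσ := P.sin_pos
  have hσ1 := P.sin_lt_one
  have hT0 := hL.pos
  refine ⟨M, T0, ?_⟩
  set e := max (Kc θ0 α c) (C2 θ0 α c) with he
  set C := 2 * kC θ0 α c M 0 with hC
  have hρ3 : (3 + sin θ0) / 4 < 1 := by linarith
  filter_upwards [self_mem_nhdsWithin, eventually_small P,
    eventually_lt_of_continuous (F := fun κ => κ) (a := 1) continuous_id (by norm_num),
    eventually_lt_of_continuous (F := fun κ => kC θ0 α c M 0 * κ) (a := 1 / 2) (by fun_prop)
      (by norm_num),
    eventually_lt_of_continuous (F := fun κ => (sin θ0 + κ * M) * exp (C * κ * e))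
      (a := (1 + sin θ0) / 2) (by fun_prop) (by simp; linarith),
    eventually_lt_of_continuous (F := fun κ => (3 + sin θ0) / 4 * exp (C * κ * e))
      (a := 1) (by fun_prop) (by simpa using hρ3)] with κ h0 hs h1 h2 h3 h4
  have hκ0 : 0 < κ := h0
  have hTr : Tr θ0 α c κ (fun _ => 0) 0 θ u T0 := ⟨P, hs, wk_zero P hs, by rw [If_zero]; exact ho,
    by rw [If_zero]; exact hL⟩
  obtain ⟨s0, hs0, hsT, -⟩ := hTr.exists_sol continuousOn_const
  have hT : ∀ {f b g b' s}, Sol θ0 α c κ f b g b' s → |log T0 - log s.T| ≤ C * κ * e := by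
    intro f b g b' s h
    have hcmp : Cmp θ0 α c κ M 0 (Zb α c) e (fun _ => 0) 0 _ _ s0 f b g b' s :=
      { h1 := hs0
        h2 := h
        B1 := hbd _ _ _ _ _ _ hs0
        B2 := hbd _ _ _ _ _ _ h
        κ_le := h1.le
        e_nonneg := (Kc_pos P).le.trans (le_max_left _ _)
        lip := fun ζ _ ζ' _ => by simp
        diff := fun ζ _ => by
          rw [zero_sub, abs_neg, abs_of_nonneg (h.hw.nonneg ζ)]
          exact (h.hw.le ζ).trans (le_max_left _ _)
        b_diff := by
          rw [zero_sub, abs_neg]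
          exact h.hw.b_le.trans (mul_le_mul_of_nonneg_left (le_max_right _ _) hκ0.le)
        y1_le := fun x hx => hs0.y_le_Zb hx
        y2_le := fun x hx => h.y_le_Zb hx }
    rw [← hsT]
    exact hcmp.abs_log_T_sub_le (hcmp.close hM le_rfl h2.le).2.2
  have hTp : ∀ {f b g b' s}, Sol θ0 α c κ f b g b' s → 0 < s.T := fun h =>
    (h.t_pos 1 one_pos).trans (h.t_lt 1 one_pos)
  refine ⟨P, hs, hκ0, h1.le, hM, hT0, hbd κ, fun f b g b' s h => ?_, fun f b g b' s h x hx => ?_⟩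
  · have h5 := ((log_close hT0 (hTp h)).1 (hT h)).1
    have h6 : 0 < exp (C * κ * e) := exp_pos _
    refine le_of_mul_le_mul_right ?_ h6
    calc T0 * (3 + sin θ0) / 4 * exp (C * κ * e) = T0 * ((3 + sin θ0) / 4 * exp (C * κ * e)) := by
          ring
      _ ≤ T0 * 1 := by gcongr
      _ ≤ s.T * exp (C * κ * e) := by linarith
  · have h5 := ((log_close hT0 (hTp h)).1 (hT h)).2
    have h6 := h.y_le_mul (hbd _ _ _ _ _ _ h) hx
    have h7 := (h.t_lt x hx).le
    calc s.y x ≤ (sin θ0 + κ * M) * s.t x := h6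
      _ ≤ (sin θ0 + κ * M) * (exp (C * κ * e) * T0) := by gcongr; linarith
      _ = (sin θ0 + κ * M) * exp (C * κ * e) * T0 := by ring
      _ ≤ (1 + sin θ0) / 2 * T0 := by gcongr
      _ = _ := by rw [Sh]; ring

end
end Model2

namespace Model2
open Set Filter Topology

noncomputable section constants

/-- A lower bound for the optical depth of leaves below height `Sh`. -/
def xm (θ0 M T0 : ℝ) : ℝ := T0 * (1 - sin θ0) / (8 * M)

/-- A lower bound for the logarithmic speed of paths beyond `xm`. -/
def am (θ0 α M T0 : ℝ) : ℝ := hh (xm θ0 M T0) ^ ((1 - α) / α) / M ^ 2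

/-- A Lipschitz constant of `ρ` beyond `xm`. -/
def kr (θ0 α c M T0 : ℝ) : ℝ :=
  2 * (M * (2 / sin θ0) + (4 * Kc θ0 α c * M ^ 2 + M) / hh (xm θ0 M T0))

/-- A logarithmic Lipschitz constant of the leaf densities below `Sh`. -/
def kg (θ0 α c M T0 : ℝ) : ℝ :=
  Kc θ0 α c * (1 / 2 + (2 / sin θ0 * kr θ0 α c M T0 + 1 / xm θ0 M T0) / am θ0 α M T0)

/-- Sensitivity of the leaf densities below `Sh`. -/
def kd (θ0 α c M T0 : ℝ) : ℝ :=
  Kc θ0 α c * (2 / sin θ0 * (1 + kr θ0 α c M T0 / am θ0 α M T0) +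
    1 / xm θ0 M T0 / am θ0 α M T0)

end constants

section
variable {θ0 α c κ M T0 : ℝ} {f g : ℝ → ℝ} {b b' : ℝ} {s : Path}

lemma abs_sub_le_of_deriv {F F' : ℝ → ℝ} {C : ℝ} (hF : ∀ x > 0, HasDerivAt F (F' x) x)
    (h : ∀ x > 0, |F' x| ≤ C) {x x' : ℝ} (hx : 0 < x) (hx' : 0 < x') :
    |F x - F x'| ≤ C * |x - x'| :=
  (convex_Ioi (0 : ℝ)).norm_image_sub_le_of_norm_hasDerivWithin_le
    (fun x hx => (hF x hx).hasDerivWithinAt) h hx' hx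

lemma Ctx.xm_pos (hC : Ctx θ0 α c M T0 κ) : 0 < xm θ0 M T0 := by
  have h1 := hC.P.sin_lt_one
  have h2 := hC.T0_pos
  have h3 := hC.M_ge
  have h4 : 0 < 1 - sin θ0 := by linarith
  unfold xm; positivity

lemma Ctx.am_pos (hC : Ctx θ0 α c M T0 κ) : 0 < am θ0 α M T0 := by
  have h1 := rpow_pos_of_pos (hh_pos hC.xm_pos) ((1 - α) / α)
  have h3 := hC.M_ge
  unfold am; positivity

lemma Ctx.kr_nonneg (hC : Ctx θ0 α c M T0 κ) : 0 ≤ kr θ0 α c M T0 := by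
  have := hC.P.sin_pos
  have := hh_pos hC.xm_pos
  have := hC.M_ge
  have := Kc_pos hC.P
  unfold kr; positivity

lemma Ctx.kg_nonneg (hC : Ctx θ0 α c M T0 κ) : 0 ≤ kg θ0 α c M T0 := by
  have := hC.P.sin_pos
  have := hC.xm_pos
  have := hC.am_pos
  have := hC.kr_nonneg
  have := Kc_pos hC.P
  unfold kg; positivity

lemma Ctx.le_x (hC : Ctx θ0 α c M T0 κ) (h : Sol θ0 α c κ f b g b' s) {x : ℝ} (hx : 0 < x)
    (ht : s.t x ≤ Sh θ0 T0) : xm θ0 M T0 ≤ x := by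
  have hB := hC.bd _ _ _ _ _ h
  have hM := hC.M_ge
  have hl : Tendsto (fun x => s.t x + 2 * M * x) (𝓝[>] 0) (𝓝 (s.T + 2 * M * 0)) :=
    h.t_zero.add ((tendsto_id.const_mul (2 * M)).mono_left nhdsWithin_le_nhds)
  have h1 := le_of_tendsto_zero (fun x hx => (h.t_deriv x hx).fun_add
    ((hasDerivAt_id x).const_mul (2 * M))) (fun x hx => by
      have h2 := h.τ_le hx
      have h3 := hB.P_le x hx
      have h4 : M * exp (-x) ≤ M * 1 :=
        mul_le_mul_of_nonneg_left (exp_le_one_iff.2 (by linarith)) (by linarith)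
      linarith) hl hx
  have h2 := hC.T_ge _ _ _ _ _ h
  rw [Sh] at ht
  simp only [id] at h1
  rw [xm, div_le_iff₀ (by linarith)]
  linarith

lemma Ctx.am_le (hC : Ctx θ0 α c M T0 κ) (h : Sol θ0 α c κ f b g b' s) {x : ℝ}
    (hx : xm θ0 M T0 ≤ x) : am θ0 α M T0 ≤ s.τ x / s.t x := by
  have hx0 := hC.xm_pos.trans_le hx
  have hB := hC.bd _ _ _ _ _ h
  have hM : 0 < M := by linarith [hC.M_ge]
  rw [le_div_iff₀ (h.t_pos x hx0), am, div_mul_eq_mul_div, div_le_iff₀ (by positivity)]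
  have h1 : hh (xm θ0 M T0) ^ ((1 - α) / α) ≤ hh x ^ ((1 - α) / α) :=
    rpow_le_rpow (hh_pos hC.xm_pos).le (hh_mono hC.xm_pos hx) (gamma_nonneg hC.P)
  have h2 := hB.le_P x hx0
  have h3 := hB.t_le x hx0
  have h4 := h.P_le_τ hx0
  have h5 := rpow_pos_of_pos (hh_pos hx0) ((1 - α) / α)
  have h6 := h.t_pos x hx0
  calc hh (xm θ0 M T0) ^ ((1 - α) / α) * s.t x ≤ hh x ^ ((1 - α) / α) * (M * exp (-x)) := by
        gcongr
    _ = M * (exp (-x) * hh x ^ ((1 - α) / α)) := by ring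
    _ ≤ M * (M * s.P x) := by gcongr
    _ ≤ M * (M * s.τ x) := by gcongr
    _ = _ := by ring

lemma Ctx.abs_x_sub_le (hC : Ctx θ0 α c M T0 κ) (h : Sol θ0 α c κ f b g b' s) {x x' : ℝ}
    (hx : xm θ0 M T0 ≤ x) (hx' : xm θ0 M T0 ≤ x') :
    |x - x'| ≤ |log (s.t x) - log (s.t x')| / am θ0 α M T0 := by
  wlog hlt : x < x' generalizing x x'
  · rcases (not_lt.1 hlt).eq_or_lt with rfl | hlt'
    · simp
    · rw [abs_sub_comm x, abs_sub_comm (log _)]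
      exact this hx' hx hlt'
  have hd : ∀ y, x ≤ y → HasDerivAt (fun x => log (s.t x)) (-s.τ y / s.t y) y := fun y hy => by
    have hy0 := hC.xm_pos.trans_le (hx.trans hy)
    exact (h.t_deriv y hy0).log (h.t_pos y hy0).ne'
  obtain ⟨ξ, hξ, he⟩ := exists_hasDerivAt_eq_slope (fun x => log (s.t x))
    (fun y => -s.τ y / s.t y) hlt
    (fun y hy => (hd y hy.1).continuousAt.continuousWithinAt) (fun y hy => hd y hy.1.le)
  have h1 := hC.am_le h (hx.trans hξ.1.le)
  have ha := hC.am_pos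
  have hp : 0 < x' - x := sub_pos.2 hlt
  rw [eq_div_iff hp.ne', neg_div] at he
  rw [le_div_iff₀ ha, abs_sub_comm, abs_of_pos hp]
  have h2 := mul_le_mul_of_nonneg_right h1 hp.le
  refine le_trans ?_ (le_abs_self _)
  linarith

lemma Sol.abs_log_y_sub_le (h : Sol θ0 α c κ f b g b' s) {x x' : ℝ} (hx : 0 < x) (hx' : 0 < x') :
    |log (s.y x) - log (s.y x')| ≤ 2 / sin θ0 * |x - x'| := by
  have hσ := h.P.sin_pos
  refine abs_sub_le_of_deriv (fun x hx => (h.y_deriv x hx).log (h.y_pos hx).ne') (fun x hx => ?_)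
    hx hx'
  have h1 := h.τ_pos hx; have h2 := h.Sn_pos hx; have h3 := h.y_pos hx
  rw [abs_div, abs_neg, abs_of_pos (mul_pos h1 h2), abs_of_pos h3, div_le_div_iff₀ h3 hσ]
  have h4 : s.τ x ≤ 2 * s.t x := (h.τ_le hx).trans (by linarith [h.P_le x hx])
  have h5 := Sn_le_one h.P (h.ρ_nonneg hx)
  have h6 := h.t_pos x hx
  calc s.τ x * Sn θ0 (s.ρ x) * sin θ0 ≤ 2 * s.t x * 1 * sin θ0 := by gcongr
    _ = 2 * (sin θ0 * s.t x) := by ring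
    _ ≤ _ := by linarith [h.le_y x hx]

lemma Sol.abs_log_L_sub_le (h : Sol θ0 α c κ f b g b' s) {x x' : ℝ} (hx : 0 < x) (hx' : 0 < x') :
    |log (s.L x) - log (s.L x')| ≤ 2 / sin θ0 * |x - x'| := by
  refine le_trans ?_ (h.abs_log_y_sub_le hx hx')
  rw [h.L_eq x hx, h.L_eq x' hx', log_If, log_If, add_sub_add_left_eq_sub, ← mul_sub, abs_mul,
    abs_of_nonneg h.hs.pos]
  have hK := Kc_pos h.P
  have hκ : κ * (Kc θ0 α c * √(Zb α c)) ≤ 1 := by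
    have := h.hs.le_quarter
    rw [C2] at this
    linarith
  have key : ∀ {u v : ℝ}, 0 < u → u ≤ v → v ≤ Zb α c →
      κ * |Jf α c f v - Jf α c f u| ≤ |log v - log u| := fun {u v} hu huv hv => by
    rw [abs_of_nonneg (sub_nonneg.2 (h.hw.Jf_mono huv)),
      abs_of_nonneg (sub_nonneg.2 (log_le_log hu huv)), h.hw.Jf_sub,
      clamp_eq hu.le (huv.trans hv), clamp_eq (hu.le.trans huv) hv]
    have h1 := mul_le_mul_of_nonneg_left (h.hw.integral_le_log h.P hu huv hv) h.hs.pos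
    have h2 := mul_le_mul_of_nonneg_right hκ (sub_nonneg.2 (log_le_log hu huv))
    linarith
  rcases le_total (s.y x') (s.y x) with hle | hle
  · exact key (h.y_pos hx') hle (h.y_le_Zb hx)
  · rw [abs_sub_comm, abs_sub_comm (log _)]
    exact key (h.y_pos hx) hle (h.y_le_Zb hx')

lemma Ctx.abs_q_sub_le (hC : Ctx θ0 α c M T0 κ) (h : Sol θ0 α c κ f b g b' s) {x x' : ℝ}
    (hx : 0 < x) (hx' : 0 < x') : |s.q x - s.q x'| ≤ 4 * Kc θ0 α c * M ^ 2 * |x - x'| := by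
  have hB := hC.bd _ _ _ _ _ h
  have hM : 0 < M := by linarith [hC.M_ge]
  have hK := Kc_pos hC.P
  refine abs_sub_le_of_deriv h.q_deriv (fun x hx => ?_) hx hx'
  have h1 := h.E_pos hx
  have h2 := h.E_le hB hM.le hx
  have h3 := h.hw.nonneg (s.y x)
  have h4 := h.hw.le (s.y x)
  have h5 := hC.κ_pos
  have h6 := hC.κ_le
  rw [show κ * s.L x * (f (s.y x) / √(s.y x)) * (Cs θ0 (s.ρ x) * (1 - exp (-x))) * s.τ x =
    κ * f (s.y x) * s.E θ0 x by rw [Path.E]; ring, abs_of_nonneg (by positivity)]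
  have h7 : (1 - exp (-x)) * exp (-(x / 2)) ≤ 1 * 1 :=
    mul_le_mul (by linarith [exp_pos (-x)]) (exp_le_one_iff.2 (by linarith)) (exp_pos _).le
      zero_le_one
  calc κ * f (s.y x) * s.E θ0 x ≤ 1 * Kc θ0 α c * (4 * M ^ 2 * (1 * 1)) := by
        gcongr
        exact h2.trans (mul_le_mul_of_nonneg_left h7 (by positivity))
    _ = _ := by ring

lemma abs_hh_sub_le {x x' : ℝ} (hx : 0 < x) (hx' : 0 < x') : |hh x - hh x'| ≤ 1 * |x - x'| := by
  refine abs_sub_le_of_deriv (fun x _ => hasDerivAt_hh x) (fun x hx => ?_) hx hx'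
  rw [abs_of_pos (mul_pos hx (exp_pos _))]
  have h1 := add_one_le_exp x
  calc x * exp (-x) ≤ exp x * exp (-x) := by gcongr; linarith
    _ = 1 := by rw [← exp_add, add_neg_cancel, exp_zero]

lemma Ctx.abs_ρ_sub_le (hC : Ctx θ0 α c M T0 κ) (h : Sol θ0 α c κ f b g b' s) {x x' : ℝ}
    (hx : xm θ0 M T0 ≤ x) (hx' : xm θ0 M T0 ≤ x') :
    |s.ρ x - s.ρ x'| ≤ kr θ0 α c M T0 * |x - x'| := by
  have hB := hC.bd _ _ _ _ _ h
  have hM : 0 < M := by linarith [hC.M_ge]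
  have hK := Kc_pos hC.P
  have hm := hC.xm_pos
  have hx0 := hm.trans_le hx
  have hx0' := hm.trans_le hx'
  have hL1 := h.L_pos hx0
  have hL2 := h.L_pos hx0'
  have hh0 := hh_pos hm
  have hh1 := hh_pos hx0
  have hh2 := hh_pos hx0'
  have hq : ∀ x > 0, s.q x / hh x ≤ M := fun x hx => by
    rw [div_le_iff₀ (hh_pos hx)]
    have := hh_pos hx
    have := hC.κ_le
    calc s.q x ≤ κ * M * hh x := hB.q_le x hx
      _ ≤ 1 * M * hh x := by gcongr
      _ = _ := by ring
  have hL : ∀ {L : ℝ}, 1 / 2 ≤ L → L⁻¹ ≤ 2 := fun {L} hL =>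
    (inv_anti₀ (by norm_num) hL).trans_eq (by norm_num)
  have e1 : |s.q x / hh x - s.q x' / hh x'| ≤
      (4 * Kc θ0 α c * M ^ 2 + M) / hh (xm θ0 M T0) * |x - x'| := by
    have e2 : s.q x / hh x - s.q x' / hh x' =
        ((s.q x - s.q x') + s.q x' / hh x' * (hh x' - hh x)) / hh x := by
      field_simp; ring
    have e5 : (4 * Kc θ0 α c * M ^ 2 + M) / hh (xm θ0 M T0) * |x - x'| =
        (4 * Kc θ0 α c * M ^ 2 + M) * |x - x'| / hh (xm θ0 M T0) := by ring
    rw [e2, abs_div, abs_of_pos hh1, e5]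
    have e3 := div_nonneg (h.q_nonneg x' hx0') hh2.le
    have e4 := abs_hh_sub_le hx0' hx0
    rw [abs_sub_comm x'] at e4
    refine div_le_div₀ (by positivity) ?_ hh0 (hh_mono hm hx)
    calc _ ≤ |s.q x - s.q x'| + s.q x' / hh x' * |hh x' - hh x| := by
          refine (abs_add_le _ _).trans_eq ?_
          rw [abs_mul, abs_of_nonneg e3]
      _ ≤ 4 * Kc θ0 α c * M ^ 2 * |x - x'| + M * (1 * |x - x'|) := by
          have := hC.abs_q_sub_le h hx0 hx0'
          have := hq x' hx0'
          gcongr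
      _ = _ := by ring
  have e2 := abs_mul_sub_le_log (inv_pos.2 hL1) (inv_pos.2 hL2) (hL (h.le_L hx0))
    (hL (h.le_L hx0')) (δ := 2 / sin θ0 * |x - x'|)
    (by rw [log_inv, log_inv, neg_sub_neg, abs_sub_comm]; exact h.abs_log_L_sub_le hx0 hx0')
    (div_nonneg (h.q_nonneg x hx0) hh1.le) (hq x hx0) e1
  have e3 : ∀ q L k : ℝ, q / (L * k) = q / k * L⁻¹ := fun q L k => by
    rw [mul_comm L, ← div_div, div_eq_mul_inv _ L]
  rw [h.ρ_eq x hx0, h.ρ_eq x' hx0', e3, e3]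
  refine e2.trans_eq ?_
  rw [kr]; ring

lemma Ctx.abs_g_sub_le (hC : Ctx θ0 α c M T0 κ) (h : Sol θ0 α c κ f b g b' s)
    {f2 g2 : ℝ → ℝ} {b2 b2' : ℝ} {s2 : Path} (h2 : Sol θ0 α c κ f2 b2 g2 b2' s2) {x x' : ℝ}
    (hx : xm θ0 M T0 ≤ x) (hx' : xm θ0 M T0 ≤ x') : |g (s.t x) - g2 (s2.t x')| ≤
      Kc θ0 α c * (1 / 2 * |log (s.t x) - log (s2.t x')| + 2 / sin θ0 * |s.ρ x - s2.ρ x'| +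
        |x - x'| / xm θ0 M T0) := by
  have hm := hC.xm_pos
  have hx0 := hm.trans_le hx
  have hx0' := hm.trans_le hx'
  have hK := Kc_pos hC.P
  have hpos : ∀ {f g : ℝ → ℝ} {b b' : ℝ} {s : Path}, Sol θ0 α c κ f b g b' s → ∀ x > 0,
      0 < g (s.t x) ∧ log (g (s.t x)) = log (s.t x) / 2 +
        log (Cs θ0 (s.ρ x) / Sn θ0 (s.ρ x)) + log x := fun h x hx => by
    have h3 := sqrt_pos.2 (h.t_pos x hx)
    have h4 := div_pos (h.Cs_pos hx) (h.Sn_pos hx)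
    rw [h.g_eq x hx]
    refine ⟨by positivity, ?_⟩
    rw [log_mul (by positivity) hx.ne', log_mul h3.ne' h4.ne', log_sqrt (h.t_pos x hx).le]
  obtain ⟨p1, l1⟩ := hpos h x hx0
  obtain ⟨p2, l2⟩ := hpos h2 x' hx0'
  refine (abs_sub_le_log p1 p2 (h.hg.le _) (h2.hg.le _)).trans ?_
  refine mul_le_mul_of_nonneg_left ?_ hK.le
  have e1 := abs_log_slope_sub_le hC.P (h.ρ_nonneg hx0) (h2.ρ_nonneg hx0')
  have e2 := abs_log_sub_le hm hx hx'
  have e3 := abs_le.1 (le_refl |log (s.t x) - log (s2.t x')|)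
  rw [l1, l2]
  rw [abs_le] at e1 e2 ⊢
  constructor <;> linarith

lemma Ctx.Sh_lt (hC : Ctx θ0 α c M T0 κ) (h : Sol θ0 α c κ f b g b' s) : Sh θ0 T0 < s.T := by
  refine lt_of_lt_of_le ?_ (hC.T_ge _ _ _ _ _ h)
  rw [Sh]
  nlinarith [hC.T0_pos, hC.P.sin_lt_one]

lemma Ctx.exists_x (hC : Ctx θ0 α c M T0 κ) (h : Sol θ0 α c κ f b g b' s) {ζ : ℝ}
    (hζ : ζ ∈ Ioc 0 (Sh θ0 T0)) : ∃ x, xm θ0 M T0 ≤ x ∧ s.t x = ζ := by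
  obtain ⟨x, hx, he⟩ := h.surj ζ ⟨hζ.1, hζ.2.trans_lt (hC.Sh_lt h)⟩
  exact ⟨x, hC.le_x h hx (he.trans_le hζ.2), he⟩

lemma Ctx.lip (hC : Ctx θ0 α c M T0 κ) (h : Sol θ0 α c κ f b g b' s) :
    ∀ ζ ∈ Ioc 0 (Sh θ0 T0), ∀ ζ' ∈ Ioc 0 (Sh θ0 T0),
      |g ζ - g ζ'| ≤ kg θ0 α c M T0 * |log ζ - log ζ'| := by
  intro ζ hζ ζ' hζ'
  obtain ⟨x, hx, rfl⟩ := hC.exists_x h hζ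
  obtain ⟨x', hx', rfl⟩ := hC.exists_x h hζ'
  have h1 := hC.abs_x_sub_le h hx hx'
  have hm := hC.xm_pos
  have hσ := hC.P.sin_pos
  have hK := Kc_pos hC.P
  have hr := hC.kr_nonneg
  have hρ := (hC.abs_ρ_sub_le h hx hx').trans (mul_le_mul_of_nonneg_left h1 hr)
  calc _ ≤ _ := hC.abs_g_sub_le h h hx hx'
    _ ≤ Kc θ0 α c * (1 / 2 * |log (s.t x) - log (s.t x')| +
        2 / sin θ0 * (kr θ0 α c M T0 * (|log (s.t x) - log (s.t x')| / am θ0 α M T0)) +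
        |log (s.t x) - log (s.t x')| / am θ0 α M T0 / xm θ0 M T0) := by gcongr
    _ = _ := by rw [kg]; ring

lemma Ctx.diff_le (hC : Ctx θ0 α c M T0 κ) (h : Sol θ0 α c κ f b g b' s)
    {f2 g2 : ℝ → ℝ} {b2 b2' : ℝ} {s2 : Path} (h2 : Sol θ0 α c κ f2 b2 g2 b2' s2) {D : ℝ}
    (hρ : ∀ x > 0, |s.ρ x - s2.ρ x| ≤ D) (ht : ∀ x > 0, |log (s.t x) - log (s2.t x)| ≤ D) :
    ∀ ζ ∈ Ioc 0 (Sh θ0 T0), |g ζ - g2 ζ| ≤ kd θ0 α c M T0 * D := by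
  intro ζ hζ
  obtain ⟨x, hx, he⟩ := hC.exists_x h hζ
  obtain ⟨x', hx', he'⟩ := hC.exists_x h2 hζ
  have hm := hC.xm_pos
  have hσ := hC.P.sin_pos
  have hK := Kc_pos hC.P
  have hr := hC.kr_nonneg
  have ha := hC.am_pos
  have h1 : |x - x'| ≤ D / am θ0 α M T0 := by
    refine (hC.abs_x_sub_le h2 hx hx').trans ?_
    have := ht x (hm.trans_le hx)
    rw [he, abs_sub_comm] at this
    rw [he']
    gcongr
  have h3 : |s.ρ x - s2.ρ x'| ≤ D + kr θ0 α c M T0 * (D / am θ0 α M T0) := by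
    have e1 := abs_sub_le (s.ρ x) (s2.ρ x) (s2.ρ x')
    have e2 := (hC.abs_ρ_sub_le h2 hx hx').trans (mul_le_mul_of_nonneg_left h1 hr)
    linarith [hρ x (hm.trans_le hx)]
  have h4 := hC.abs_g_sub_le h h2 hx hx'
  rw [he, he', sub_self, abs_zero, mul_zero, zero_add] at h4
  calc _ ≤ _ := h4
    _ ≤ Kc θ0 α c * (2 / sin θ0 * (D + kr θ0 α c M T0 * (D / am θ0 α M T0)) +
        D / am θ0 α M T0 / xm θ0 M T0) := by gcongr
    _ = _ := by rw [kd]; ring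

end
end Model2

namespace Model2
open Set Filter Topology

/-- A leaf density with the regularity of generated leaf densities. -/
structure Gd (θ0 α c M T0 κ : ℝ) (f : ℝ → ℝ) (b : ℝ) : Prop where
  wk : Wk θ0 α c κ f b
  cont : ContinuousOn f (Ioi 0)
  lip : ∀ ζ ∈ Ioc 0 (Sh θ0 T0), ∀ ζ' ∈ Ioc 0 (Sh θ0 T0),
    |f ζ - f ζ'| ≤ kg θ0 α c M T0 * |log ζ - log ζ'|

/-- The optimal stem `(θ, u)` for the leaf density `(f, b)` generates `(g, b')`. -/
structure Step (θ0 α c κ : ℝ) (f : ℝ → ℝ) (b : ℝ) (g : ℝ → ℝ) (b' : ℝ) (θ u : ℝ → ℝ) (T : ℝ)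
    (s : Path) : Prop where
  tr : Tr θ0 α c κ f b θ u T
  g_eq : g = fn θ0 α c κ f b θ u T
  b_eq : b' = bn θ0 α c κ f b θ u T
  sol : Sol θ0 α c κ f b g b' s
  T_eq : s.T = T
  link : ∀ ζ ∈ Ioo 0 T, ∃ x > 0, s.t x = ζ ∧ s.ρ x = rf θ0 α c κ f b θ u T ζ ∧
    x = Xf α c (If α c κ f b) θ u ζ ∧ s.y x = yf θ ζ

/-- Densities for which the equilibrium map is a contraction. -/
structure Good (θ0 α c M T0 κ : ℝ) : Prop where
  ctx : Ctx θ0 α c M T0 κ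
  small : kC θ0 α c M (kg θ0 α c M T0) * κ ≤ 1 / 2
  contr : (kd θ0 α c M T0 + kb θ0 M) * (2 * kC θ0 α c M (kg θ0 α c M T0) * κ) ≤ 1 / 2

/-- Closeness of leaf densities up to `e`. -/
def Cl (θ0 T0 κ e : ℝ) (f1 : ℝ → ℝ) (b1 : ℝ) (f2 : ℝ → ℝ) (b2 : ℝ) : Prop :=
  (∀ ζ ∈ Ioc 0 (Sh θ0 T0), |f1 ζ - f2 ζ| ≤ e) ∧ |b1 - b2| ≤ κ * e

section
variable {θ0 α c κ M T0 : ℝ} {f g : ℝ → ℝ} {b b' : ℝ} {θ u : ℝ → ℝ} {T : ℝ} {s : Path}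

lemma exists_good (P : Params θ0 α c) : ∃ M T0, ∀ᶠ κ in 𝓝[>] (0 : ℝ), Good θ0 α c M T0 κ := by
  obtain ⟨M, T0, h⟩ := exists_ctx P
  refine ⟨M, T0, ?_⟩
  filter_upwards [h, eventually_lt_of_continuous (a := 1 / 2)
      (F := fun κ => kC θ0 α c M (kg θ0 α c M T0) * κ) (by fun_prop) (by norm_num),
    eventually_lt_of_continuous (a := 1 / 2) (F := fun κ => (kd θ0 α c M T0 + kb θ0 M) *
      (2 * kC θ0 α c M (kg θ0 α c M T0) * κ)) (by fun_prop) (by norm_num)] with κ h1 h2 h3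
  exact ⟨h1, h2.le, h3.le⟩

lemma Ctx.kd_nonneg (hC : Ctx θ0 α c M T0 κ) : 0 ≤ kd θ0 α c M T0 := by
  have := hC.P.sin_pos
  have := hC.xm_pos
  have := hC.am_pos
  have := hC.kr_nonneg
  have := Kc_pos hC.P
  unfold kd; positivity

lemma Ctx.Sh_pos (hC : Ctx θ0 α c M T0 κ) : 0 < Sh θ0 T0 := by
  have := hC.P.sin_pos
  have := hC.T0_pos
  unfold Sh; positivity

lemma Tr.exists_step (h : Tr θ0 α c κ f b θ u T) (hf : ContinuousOn f (Ioi 0)) : ∃ s,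
    Step θ0 α c κ f b (fn θ0 α c κ f b θ u T) (bn θ0 α c κ f b θ u T) θ u T s := by
  obtain ⟨s, h1, h2, h3⟩ := h.exists_sol hf
  exact ⟨s, h, rfl, rfl, h1, h2, h3⟩

lemma Ctx.exists_step (hC : Ctx θ0 α c M T0 κ) (h : Gd θ0 α c M T0 κ f b) :
    ∃ g b' θ u T s, Step θ0 α c κ f b g b' θ u T s := by
  have hl := h.wk.light hC.P hC.hs
  obtain ⟨θ, u, ho⟩ := exists_opt hC.P hl
  obtain ⟨T, hT⟩ := Opt.exists_len hC.P hl ho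
  obtain ⟨s, hs⟩ := Tr.exists_step ⟨hC.P, hC.hs, h.wk, ho, hT⟩ h.cont
  exact ⟨_, _, θ, u, T, s, hs⟩

lemma Step.gd (h : Step θ0 α c κ f b g b' θ u T s) (hC : Ctx θ0 α c M T0 κ) :
    Gd θ0 α c M T0 κ g b' :=
  ⟨h.sol.hg, h.g_eq ▸ h.tr.fn_continuousOn, hC.lip h.sol⟩

lemma If_congr {f1 f2 : ℝ → ℝ} (h : ∀ ζ > 0, f1 ζ = f2 ζ) (b : ℝ) :
    If α c κ f1 b = If α c κ f2 b := by
  have : Jf α c f1 = Jf α c f2 := by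
    ext y
    unfold Jf
    refine intervalIntegral.integral_congr_ae (ae_of_all _ fun ζ hζ => ?_)
    rw [uIoc_of_le (le_max_left _ _)] at hζ
    rw [h ζ hζ.1]
  ext y
  rw [If, If, this]

section pair
variable {f1 g1 f2 g2 : ℝ → ℝ} {b1 b1' b2 b2' e : ℝ} {θ1 u1 θ2 u2 : ℝ → ℝ} {T1 T2 : ℝ}
  {s1 s2 : Path}

lemma Cl.of_forall {C : ℝ} (h : ∀ n : ℕ, Cl θ0 T0 κ (C / 2 ^ n) f1 b1 f2 b2) :
    Cl θ0 T0 κ 0 f1 b1 f2 b2 := by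
  have hl : Tendsto (fun n : ℕ => C / 2 ^ n) atTop (𝓝 0) := by
    have := (tendsto_pow_atTop_nhds_zero_of_lt_one (r := (1 / 2 : ℝ)) (by norm_num)
      (by norm_num)).const_mul C
    rw [mul_zero] at this
    refine this.congr fun n => ?_
    rw [div_pow, one_pow]; ring
  exact ⟨fun ζ hζ => ge_of_tendsto' hl fun n => (h n).1 ζ hζ,
    ge_of_tendsto' (hl.const_mul κ) fun n => (h n).2⟩

lemma Cl.trans {f3 : ℝ → ℝ} {b3 e' : ℝ} (h : Cl θ0 T0 κ e f1 b1 f2 b2)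
    (h' : Cl θ0 T0 κ e' f2 b2 f3 b3) : Cl θ0 T0 κ (e + e') f1 b1 f3 b3 :=
  ⟨fun ζ hζ => (abs_sub_le _ (f2 ζ) _).trans (add_le_add (h.1 ζ hζ) (h'.1 ζ hζ)),
    (abs_sub_le _ b2 _).trans ((add_le_add h.2 h'.2).trans_eq (mul_add _ _ _).symm)⟩

lemma Cl.symm (h : Cl θ0 T0 κ e f1 b1 f2 b2) : Cl θ0 T0 κ e f2 b2 f1 b1 :=
  ⟨fun ζ hζ => by rw [abs_sub_comm]; exact h.1 ζ hζ, by rw [abs_sub_comm]; exact h.2⟩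

lemma Wk.cl (P : Params θ0 α c) (hκ : 0 ≤ κ) (h1 : Wk θ0 α c κ f1 b1) (h2 : Wk θ0 α c κ f2 b2) :
    Cl θ0 T0 κ (Kc θ0 α c + 2 * C2 θ0 α c) f1 b1 f2 b2 := by
  have hK := Kc_pos P
  have hC := C2_pos P
  refine ⟨fun ζ _ => ?_, ?_⟩
  · have := h1.nonneg ζ; have := h1.le ζ; have := h2.nonneg ζ; have := h2.le ζ
    rw [abs_le]; constructor <;> linarith
  · have e1 := abs_le.1 h1.b_le
    have e2 := abs_le.1 h2.b_le
    have e3 := mul_nonneg hκ hK.le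
    rw [mul_add, abs_le]; constructor <;> linarith

lemma Good.cmp (hG : Good θ0 α c M T0 κ) (hf : Gd θ0 α c M T0 κ f1 b1)
    (h1 : Sol θ0 α c κ f1 b1 g1 b1' s1) (h2 : Sol θ0 α c κ f2 b2 g2 b2' s2) (he : 0 ≤ e)
    (h : Cl θ0 T0 κ e f1 b1 f2 b2) :
    Cmp θ0 α c κ M (kg θ0 α c M T0) (Sh θ0 T0) e f1 b1 g1 b1' s1 f2 b2 g2 b2' s2 :=
  ⟨h1, h2, hG.ctx.bd _ _ _ _ _ h1, hG.ctx.bd _ _ _ _ _ h2, hG.ctx.κ_le, he, hf.lip, h.1, h.2,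
    hG.ctx.y_le _ _ _ _ _ h1, hG.ctx.y_le _ _ _ _ _ h2⟩

lemma Good.cl (hG : Good θ0 α c M T0 κ) (hf : Gd θ0 α c M T0 κ f1 b1)
    (h1 : Sol θ0 α c κ f1 b1 g1 b1' s1) (h2 : Sol θ0 α c κ f2 b2 g2 b2' s2) (he : 0 ≤ e)
    (h : Cl θ0 T0 κ e f1 b1 f2 b2) : Cl θ0 T0 κ (e / 2) g1 b1' g2 b2' := by
  have hm := hG.cmp hf h1 h2 he h
  have hM := hG.ctx.M_ge
  have hκ := hG.ctx.κ_pos.le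
  have hg := hG.ctx.kg_nonneg
  obtain ⟨hN, hτ, ht⟩ := hm.close hM hg hG.small
  have hd := hG.ctx.kd_nonneg
  have hb := kb_nonneg hG.ctx.P (M := M) (by linarith)
  have hc := kC_nonneg hG.ctx.P (M := M) (by linarith) hg
  have hD : 0 ≤ 2 * kC θ0 α c M (kg θ0 α c M T0) * κ * e := by positivity
  have key := mul_le_mul_of_nonneg_right hG.contr he
  refine ⟨fun ζ hζ => (hG.ctx.diff_le h1 h2 hN.ρ ht ζ hζ).trans ?_,
    (hm.abs_b_sub_le hM hN hτ).trans ?_⟩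
  · have := mul_nonneg hb hD
    linarith
  · refine mul_le_mul_of_nonneg_left ?_ hκ
    have := mul_nonneg hd hD
    linarith

lemma Good.eq_of_cl_zero (hG : Good θ0 α c M T0 κ) (hf : Gd θ0 α c M T0 κ f1 b1)
    (h1 : Sol θ0 α c κ f1 b1 g1 b1' s1) (h2 : Sol θ0 α c κ f2 b2 g2 b2' s2)
    (h : Cl θ0 T0 κ 0 f1 b1 f2 b2) :
    s1.T = s2.T ∧ (∀ x > 0, s1.t x = s2.t x ∧ s1.y x = s2.y x ∧ s1.ρ x = s2.ρ x) ∧ b1 = b2 ∧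
      b1' = b2' ∧ ∀ ζ > 0, g1 ζ = g2 ζ := by
  have hm := hG.cmp hf h1 h2 le_rfl h
  obtain ⟨hN, -, ht⟩ := hm.close hG.ctx.M_ge hG.ctx.kg_nonneg hG.small
  have hT := hm.abs_log_T_sub_le ht
  have hc := hG.cl hf h1 h2 le_rfl h
  have heq : ∀ {a b : ℝ}, |a - b| ≤ 0 → a = b := fun h =>
    sub_eq_zero.1 (abs_eq_zero.1 (le_antisymm h (abs_nonneg _)))
  have hlog : ∀ {a b : ℝ}, 0 < a → 0 < b → |log a - log b| ≤ 0 → a = b := fun ha hb h =>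
    log_injOn_pos ha hb (heq h)
  rw [mul_zero] at hT hN ht
  have hT1 := (h1.t_pos 1 one_pos).trans (h1.t_lt 1 one_pos)
  have hT2 := (h2.t_pos 1 one_pos).trans (h2.t_lt 1 one_pos)
  have hTe := hlog hT1 hT2 hT
  have hx : ∀ x > 0, s1.t x = s2.t x ∧ s1.y x = s2.y x ∧ s1.ρ x = s2.ρ x := fun x hx =>
    ⟨hlog (h1.t_pos x hx) (h2.t_pos x hx) (ht x hx), hlog (h1.y_pos hx) (h2.y_pos hx) (hN.y x hx),
      heq (hN.ρ x hx)⟩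
  refine ⟨hTe, hx, heq (h.2.trans_eq (mul_zero _)), heq (hc.2.trans_eq (by ring)), fun ζ hζ => ?_⟩
  rcases lt_or_ge ζ s1.T with hlt | hge
  · obtain ⟨x, hx0, rfl⟩ := h1.surj ζ ⟨hζ, hlt⟩
    rw [h1.g_eq x hx0]
    rw [(hx x hx0).1, (hx x hx0).2.2, h2.g_eq x hx0]
  · rw [h1.g_zero ζ hge, h2.g_zero ζ (hTe ▸ hge)]

/-- Self-generating leaf densities coincide. -/
lemma Good.unique (hG : Good θ0 α c M T0 κ) (hf : Gd θ0 α c M T0 κ f1 b1)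
    (h1 : Sol θ0 α c κ f1 b1 g1 b1 s1) (h2 : Sol θ0 α c κ f2 b2 g2 b2 s2)
    (e1 : ∀ ζ > 0, g1 ζ = f1 ζ) (e2 : ∀ ζ > 0, g2 ζ = f2 ζ) : Cl θ0 T0 κ 0 f1 b1 f2 b2 := by
  have hκ := hG.ctx.κ_pos.le
  have hK := Kc_pos hG.ctx.P
  have hC := C2_pos hG.ctx.P
  refine Cl.of_forall (C := Kc θ0 α c + 2 * C2 θ0 α c) fun n => ?_
  induction n with
  | zero => rw [pow_zero, div_one]; exact h1.hw.cl hG.ctx.P hκ h2.hw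
  | succ n ih =>
    have := hG.cl hf h1 h2 (by positivity) ih
    rw [pow_succ, ← div_div]
    exact ⟨fun ζ hζ => by rw [← e1 ζ hζ.1, ← e2 ζ hζ.1]; exact this.1 ζ hζ, this.2⟩

end pair

lemma Ctx.gd_zero (hC : Ctx θ0 α c M T0 κ) : Gd θ0 α c M T0 κ (fun _ => 0) 0 :=
  ⟨wk_zero hC.P hC.hs, continuousOn_const, fun ζ _ ζ' _ => by
    rw [sub_zero, abs_zero]; exact mul_nonneg hC.kg_nonneg (abs_nonneg _)⟩

lemma Ctx.gd_limit (hC : Ctx θ0 α c M T0 κ) {F : ℕ → ℝ → ℝ} {B : ℕ → ℝ}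
    (h : ∀ n, Gd θ0 α c M T0 κ (F n) (B n)) {C : ℝ}
    (hcl : ∀ n, Cl θ0 T0 κ (C / 2 / 2 ^ n) (F n) (B n) (F (n + 1)) (B (n + 1))) :
    ∃ f b, Gd θ0 α c M T0 κ f b ∧ ∀ n, Cl θ0 T0 κ (C / 2 ^ n) (F n) (B n) f b := by
  have hS := hC.Sh_pos
  have hmin : ∀ {ζ : ℝ}, 0 < ζ → min ζ (Sh θ0 T0) ∈ Ioc 0 (Sh θ0 T0) := fun h =>
    ⟨lt_min h hS, min_le_right _ _⟩
  have hF : ∀ ζ : ℝ, 0 < ζ → ∀ n,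
      dist (F n (min ζ (Sh θ0 T0))) (F (n + 1) (min ζ (Sh θ0 T0))) ≤ C / 2 / 2 ^ n :=
    fun ζ hζ n => (hcl n).1 _ (hmin hζ)
  have hB : ∀ n, dist (B n) (B (n + 1)) ≤ κ * C / 2 / 2 ^ n := fun n =>
    (hcl n).2.trans_eq (by ring)
  obtain ⟨b, hb⟩ := cauchySeq_tendsto_of_complete (cauchySeq_of_le_geometric_two hB)
  have hex : ∀ ζ : ℝ, ∃ v, 0 < ζ → Tendsto (fun n => F n (min ζ (Sh θ0 T0))) atTop (𝓝 v) :=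
    fun ζ => by
      by_cases hζ : 0 < ζ
      · obtain ⟨v, hv⟩ := cauchySeq_tendsto_of_complete (cauchySeq_of_le_geometric_two (hF ζ hζ))
        exact ⟨v, fun _ => hv⟩
      · exact ⟨0, fun h => absurd h hζ⟩
  choose f hf using hex
  have hlip : ∀ ζ > 0, ∀ ζ' > 0, |f ζ - f ζ'| ≤
      kg θ0 α c M T0 * |log (min ζ (Sh θ0 T0)) - log (min ζ' (Sh θ0 T0))| := fun ζ hζ ζ' hζ' =>
    le_of_tendsto' ((hf ζ hζ).sub (hf ζ' hζ')).abs fun n =>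
      (h n).lip _ (hmin hζ) _ (hmin hζ')
  have hcont : ContinuousOn f (Ioi 0) := by
    intro ζ hζ
    rw [ContinuousWithinAt, tendsto_iff_dist_tendsto_zero]
    have hc : ContinuousWithinAt (fun x => kg θ0 α c M T0 *
        |log (min x (Sh θ0 T0)) - log (min ζ (Sh θ0 T0))|) (Ioi 0) ζ := by
      have h0 : min ζ (Sh θ0 T0) ≠ 0 := (hmin hζ).1.ne'
      have h1 : ContinuousAt (fun x => min x (Sh θ0 T0)) ζ := by fun_prop
      exact (((h1.log h0).sub continuousAt_const).abs.const_mul _).continuousWithinAt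
    have hc' := hc.tendsto
    simp only [sub_self, abs_zero, mul_zero] at hc'
    refine squeeze_zero' (Eventually.of_forall fun _ => dist_nonneg) ?_ hc'
    filter_upwards [self_mem_nhdsWithin] with x hx using hlip x hx ζ hζ
  have hind : ∀ ζ > 0, (Ioi (0 : ℝ)).indicator f ζ = f ζ := fun ζ hζ => indicator_of_mem hζ f
  refine ⟨(Ioi 0).indicator f, b, ⟨⟨measurable_indicator_of_continuousOn measurableSet_Ioi hcont,
    fun ζ => ?_, fun ζ => ?_, ?_⟩, hcont.congr fun ζ hζ => hind ζ hζ, fun ζ hζ ζ' hζ' => ?_⟩,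
    fun n => ⟨fun ζ hζ => ?_, ?_⟩⟩
  · exact indicator_nonneg (fun ζ hζ => ge_of_tendsto' (hf ζ hζ) fun n => (h n).wk.nonneg _) ζ
  · by_cases hζ : 0 < ζ
    · rw [hind ζ hζ]
      exact le_of_tendsto' (hf ζ hζ) fun n => (h n).wk.le _
    · rw [indicator_of_notMem (show ζ ∉ Ioi 0 from hζ)]
      exact (Kc_pos hC.P).le
  · exact le_of_tendsto' hb.abs fun n => (h n).wk.b_le
  · rw [hind ζ hζ.1, hind ζ' hζ'.1]
    have := hlip ζ hζ.1 ζ' hζ'.1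
    rwa [min_eq_left hζ.2, min_eq_left hζ'.2] at this
  · rw [hind ζ hζ.1]
    have := dist_le_of_le_geometric_two_of_tendsto (hF ζ hζ.1) (hf ζ hζ.1) n
    rwa [min_eq_left hζ.2] at this
  · exact (dist_le_of_le_geometric_two_of_tendsto hB hb n).trans_eq (by ring)

/-- There is a self-generating leaf density. -/
lemma Good.exists_fixed (hG : Good θ0 α c M T0 κ) : ∃ f b g θ u T s, Gd θ0 α c M T0 κ f b ∧
    Step θ0 α c κ f b g b θ u T s ∧ ∀ ζ > 0, g ζ = f ζ := by
  have hC := hG.ctx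
  have hκ := hC.κ_pos.le
  have hK := Kc_pos hC.P
  have hC2 := C2_pos hC.P
  have hnext : ∀ p : {p : (ℝ → ℝ) × ℝ // Gd θ0 α c M T0 κ p.1 p.2},
      ∃ q : {q : (ℝ → ℝ) × ℝ // Gd θ0 α c M T0 κ q.1 q.2}, ∃ s,
        Sol θ0 α c κ p.1.1 p.1.2 q.1.1 q.1.2 s := fun p => by
    obtain ⟨g, b', θ, u, T, s, h⟩ := hC.exists_step p.2
    exact ⟨⟨(g, b'), h.gd hC⟩, s, h.sol⟩
  choose Φ S hΦ using hnext
  set p : ℕ → {p : (ℝ → ℝ) × ℝ // Gd θ0 α c M T0 κ p.1 p.2} :=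
    fun n => Φ^[n] ⟨(fun _ => 0, 0), hC.gd_zero⟩ with hp
  have hps : ∀ n, p (n + 1) = Φ (p n) := fun n => Function.iterate_succ_apply' Φ n _
  have hsol : ∀ n, Sol θ0 α c κ (p n).1.1 (p n).1.2 (p (n + 1)).1.1 (p (n + 1)).1.2 (S (p n)) :=
    fun n => by rw [hps]; exact hΦ (p n)
  clear_value p
  set C := 2 * (Kc θ0 α c + 2 * C2 θ0 α c) with hCd
  have hC0 : 0 ≤ C := by positivity
  have hcl : ∀ n, Cl θ0 T0 κ (C / 2 / 2 ^ n) (p n).1.1 (p n).1.2 (p (n + 1)).1.1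
      (p (n + 1)).1.2 := fun n => by
    induction n with
    | zero =>
      rw [pow_zero, div_one, hCd, mul_div_cancel_left₀ _ two_ne_zero]
      exact (p 0).2.wk.cl hC.P hκ (p 1).2.wk
    | succ n ih =>
      rw [pow_succ, ← div_div]
      exact hG.cl (p n).2 (hsol n) (hsol (n + 1)) (by positivity) ih
  obtain ⟨f, b, hf, hlim⟩ := hC.gd_limit (fun n => (p n).2) hcl
  obtain ⟨g, b', θ, u, T, s, h1⟩ := hC.exists_step hf
  obtain ⟨g', b'', θ', u', T', s', h2⟩ := hC.exists_step (h1.gd hC)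
  have h0 : Cl θ0 T0 κ 0 f b g b' := Cl.of_forall (C := C) fun n => by
    have e1 := hlim (n + 1)
    have e2 := hG.cl (p n).2 (hsol n) h1.sol (by positivity) (hlim n)
    convert e1.symm.trans e2 using 1
    rw [pow_succ]; ring
  obtain ⟨-, -, -, he, hg⟩ := hG.eq_of_cl_zero hf h1.sol h2.sol h0
  subst he
  exact ⟨g, b', g', θ', u', T', s', h1.gd hC, h2, fun ζ hζ => (hg ζ hζ).symm⟩

end
end Model2

namespace Model2
open Set Filter Topology

section
variable {θ0 α c κ M T0 : ℝ} {f g N : ℝ → ℝ} {b : ℝ} {θ u : ℝ → ℝ} {T : ℝ} {s : Path}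

lemma payoff_congr (P : Params θ0 α c) {I I' : ℝ → ℝ} (hI : ∀ y ≥ 0, I y = I' y)
    (ha : Adm2 θ0 θ u) : Payoff θ0 α c I θ u = Payoff θ0 α c I' θ u := by
  rw [payoff_eq, payoff_eq]
  refine setIntegral_congr_fun measurableSet_Ioi fun t ht => ?_
  have ht0 : 0 < t := ht
  have h := (mul_pos P.sin_pos ht0).le.trans (le_yf P ha.1 ha.2.2.1 ht0.le)
  simp only [lt, hI _ h]

lemma Opt.congr (P : Params θ0 α c) {I I' : ℝ → ℝ} (hI : ∀ y ≥ 0, I y = I' y)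
    (ho : Opt θ0 α c I θ u) : Opt θ0 α c I' θ u :=
  ⟨ho.1, fun θ' u' ha => by
    rw [← payoff_congr P hI ha, ← payoff_congr P hI ho.1]; exact ho.2 θ' u' ha⟩

lemma Jf_congr_ae {f1 f2 : ℝ → ℝ}
    (h : ∀ᵐ ζ ∂(volume.restrict (Ioi 0)), f1 ζ / √ζ = f2 ζ / √ζ) : Jf α c f1 = Jf α c f2 := by
  ext y
  unfold Jf
  refine intervalIntegral.integral_congr_ae ?_
  rw [ae_restrict_iff' measurableSet_Ioi] at h
  filter_upwards [h] with ζ hζ hm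
  rw [uIoc_of_le (le_max_left _ _)] at hm
  exact hζ hm.1

lemma zf_eq_Jf (hw : Wk θ0 α c κ f b) (hi : IntegrableOn N (Ioi 0))
    (hN : ∀ᵐ ζ ∂(volume.restrict (Ioi 0)), N ζ = f ζ / √ζ) (hT0 : 0 ≤ T) (hT : T ≤ Zb α c)
    (h0 : ∀ᵐ ζ ∂(volume.restrict (Ioi T)), N ζ = 0) {y : ℝ} (hy : 0 ≤ y) :
    zf N y = Jf α c f (Zb α c) - Jf α c f y := by
  have hz : ∀ y, Zb α c ≤ y → zf N y = 0 := fun y hy => by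
    refine integral_eq_zero_of_ae ?_
    exact ae_restrict_of_ae_restrict_of_subset (Ioi_subset_Ioi (hT.trans hy)) h0
  have hZ := hT0.trans hT
  rw [hw.Jf_sub, clamp_eq hZ le_rfl]
  rcases le_total y (Zb α c) with h | h
  · rw [clamp_eq hy h, zf_add hi hy h, hz _ le_rfl, add_zero]
    refine intervalIntegral.integral_congr_ae ?_
    rw [ae_restrict_iff' measurableSet_Ioi] at hN
    filter_upwards [hN] with ζ hζ hm
    rw [uIoc_of_le h] at hm
    exact hζ (hy.trans_lt hm.1)
  · rw [hz _ h, min_eq_right h, max_eq_right hZ, intervalIntegral.integral_same]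

lemma If_eq_exp (hw : Wk θ0 α c κ f b) (hi : IntegrableOn N (Ioi 0))
    (hN : ∀ᵐ ζ ∂(volume.restrict (Ioi 0)), N ζ = f ζ / √ζ) (hT0 : 0 ≤ T) (hT : T ≤ Zb α c)
    (h0 : ∀ᵐ ζ ∂(volume.restrict (Ioi T)), N ζ = 0) {y : ℝ} (hy : 0 ≤ y) :
    If α c κ f (-(κ * Jf α c f (Zb α c))) y = exp (-κ * zf N y) := by
  rw [zf_eq_Jf hw hi hN hT0 hT h0 hy, If]
  ring_nf

lemma density_integrable (P : Params θ0 α c) (ha : Adm2 θ0 θ u) :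
    IntegrableOn (fun ζ => u ζ / sin (θ ζ)) (Ioi 0) := by
  have hσ := P.sin_pos
  refine (ha.2.2.2.2.div_const (sin θ0)).mono'
    (ha.2.1.div ha.1.sin).aestronglyMeasurable (ae_of_all _ fun ζ => ?_)
  have h1 := ha.2.2.2.1 ζ
  have h2 := P.sin_le (ha.2.2.1 ζ)
  rw [norm_of_nonneg (div_nonneg h1 (hσ.trans_le h2).le)]
  gcongr

/-- A self-generating leaf density. -/
structure Fixed (θ0 α c M T0 κ : ℝ) (f : ℝ → ℝ) (b : ℝ) (g θ u : ℝ → ℝ) (T : ℝ) (s : Path) :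
    Prop where
  gd : Gd θ0 α c M T0 κ f b
  step : Step θ0 α c κ f b g b θ u T s
  eq : ∀ ζ > 0, g ζ = f ζ

lemma Fixed.intensity (h : Fixed θ0 α c M T0 κ f b g θ u T s) {y : ℝ} (hy : 0 ≤ y) :
    If α c κ f b y = exp (-κ * zf (fun ζ => u ζ / sin (θ ζ)) y) := by
  have htr := h.step.tr
  have hg := htr.fn_eq
  rw [← h.step.g_eq] at hg
  have hb : b = -(κ * Jf α c g (Zb α c)) := by
    have := h.step.b_eq
    rwa [bn, ← h.step.g_eq] at this
  rw [← If_congr h.eq b]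
  have h0 : ∀ᵐ ζ ∂(volume.restrict (Ioi T)), u ζ / sin (θ ζ) = 0 := by
    filter_upwards [htr.hL.u_zero] with ζ hζ
    rw [hζ, zero_div]
  have := If_eq_exp (N := fun ζ => u ζ / sin (θ ζ)) h.step.sol.hg
    (density_integrable htr.P htr.ho.1) hg htr.hL.pos.le htr.hL.le h0 hy
  rwa [← hb] at this

lemma Fixed.equilibrium {ρ0 : ℝ} (h : Fixed θ0 α c M T0 (ρ0 / cos θ0) f b g θ u T s) :
    Equilibrium θ0 α c ρ0 (If α c (ρ0 / cos θ0) f b) θ u :=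
  ⟨h.step.tr.ho.1, h.step.tr.ho.2, fun _ hy => h.intensity hy⟩

lemma light_of_density (hκ : 0 ≤ κ) (hi : IntegrableOn N (Ioi 0)) (h0 : ∀ ζ, 0 ≤ N ζ) :
    Light fun y => exp (-κ * zf N (max 0 y)) where
  cont := by
    have : Continuous fun y => zf N (max 0 y) :=
      (zf_continuousOn hi).comp_continuous (by fun_prop) fun y => mem_Ici.2 (le_max_left _ _)
    fun_prop
  mono y y' h := by
    have := zf_antitone hi h0 (le_max_left 0 y) (max_le_max le_rfl h)
    have := mul_le_mul_of_nonneg_left this hκ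
    refine exp_le_exp.2 ?_
    linarith
  pos y := exp_pos _
  le_two y := by
    have := mul_nonneg hκ (zf_nonneg h0 (max 0 y))
    have : exp (-κ * zf N (max 0 y)) ≤ 1 := exp_le_one_iff.2 (by linarith)
    linarith

/-- The leaf density of a competitive equilibrium. -/
lemma exists_density (P : Params θ0 α c) (hs : Small θ0 α c κ) {I : ℝ → ℝ}
    (ho : Opt θ0 α c I θ u)
    (hI : ∀ y ≥ 0, I y = exp (-κ * zf (fun ζ => u ζ / sin (θ ζ)) y)) :
    ∃ f T, Tr θ0 α c κ f (-(κ * Jf α c f (Zb α c))) θ u T ∧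
      (∀ᵐ ζ ∂(volume.restrict (Ioi 0)), u ζ / sin (θ ζ) = f ζ / √ζ) ∧
      ∀ y ≥ 0, I y = If α c κ f (-(κ * Jf α c f (Zb α c))) y := by
  set N := fun ζ => u ζ / sin (θ ζ) with hN
  have hσ := P.sin_pos
  have hK := Kc_pos P
  have ha := ho.1
  have hs0 : ∀ ζ, 0 < sin (θ ζ) := fun ζ => hσ.trans_le (P.sin_le (ha.2.2.1 ζ))
  have hN0 : ∀ ζ, 0 ≤ N ζ := fun ζ => div_nonneg (ha.2.2.2.1 ζ) (hs0 ζ).le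
  have hNi := density_integrable P ha
  have hl := light_of_density hs.pos hNi hN0
  have ho1 := ho.congr P (I' := fun y => exp (-κ * zf N (max 0 y))) fun y hy => by
    rw [hI y hy, max_eq_right hy]
  obtain ⟨T, hL⟩ := ho1.exists_len P hl
  have hbd : ∀ᵐ ζ ∂(volume.restrict (Ioo 0 T)), N ζ ≤ Kc θ0 α c / √ζ := by
    filter_upwards [hL.u_eq, ae_restrict_mem measurableSet_Ioo] with ζ hu hζ
    have h1 := hL.log_le_sqrt P hl ho1 hζ
    have h2 : 0 ≤ 2 * √(Zb α c) / √ζ := by positivity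
    have h3 : u ζ ≤ 1 * (2 * √(Zb α c) / √ζ) := by
      rw [hu]
      exact mul_le_mul (cos_le_one _) (max_le h2 h1) (le_max_left _ _) zero_le_one
    calc N ζ ≤ 1 * (2 * √(Zb α c) / √ζ) / sin θ0 :=
          div_le_div₀ (by positivity) h3 hσ (P.sin_le (ha.2.2.1 ζ))
      _ = _ := by rw [Kc]; ring
  have hz : ∀ᵐ ζ ∂(volume.restrict (Ioi T)), N ζ = 0 := by
    filter_upwards [hL.u_zero] with ζ hζ
    simp only [hN, hζ, zero_div]
  have hbd' : ∀ᵐ ζ ∂(volume.restrict (Ioi 0)), N ζ ≤ Kc θ0 α c / √ζ := by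
    rw [← Ioc_union_Ioi_eq_Ioi hL.pos.le, ae_restrict_union_iff, ← restrict_Ioo_eq_restrict_Ioc]
    refine ⟨hbd, ?_⟩
    filter_upwards [hz] with ζ hζ
    rw [hζ]; positivity
  set f : ℝ → ℝ := fun ζ => min (√ζ * N ζ) (Kc θ0 α c) with hf
  have hfN : ∀ᵐ ζ ∂(volume.restrict (Ioi 0)), N ζ = f ζ / √ζ := by
    filter_upwards [hbd', ae_restrict_mem measurableSet_Ioi] with ζ h1 h2
    have h3 : 0 < √ζ := sqrt_pos.2 h2
    rw [le_div_iff₀ h3, mul_comm] at h1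
    simp only [hf]
    rw [min_eq_left h1, mul_div_cancel_left₀ _ h3.ne']
  have hw : Wk θ0 α c κ f (-(κ * Jf α c f (Zb α c))) := by
    refine wk_of_le P hs.pos ?_ (fun ζ => le_min (mul_nonneg (sqrt_nonneg _) (hN0 ζ)) hK.le)
      fun ζ => min_le_right _ _
    exact (measurable_id.sqrt.mul (ha.2.1.div ha.1.sin)).min measurable_const
  have hIf : ∀ y ≥ 0, I y = If α c κ f (-(κ * Jf α c f (Zb α c))) y := fun y hy => by
    rw [hI y hy, If_eq_exp hw hNi hfN hL.pos.le hL.le hz hy]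
  have ho2 := ho.congr P hIf
  obtain ⟨T', hL'⟩ := ho2.exists_len P (hw.light P hs)
  exact ⟨f, T', ⟨P, hs, hw, ho2, hL'⟩, hfN, hIf⟩

lemma exists_fixed_of_opt (hC : Ctx θ0 α c M T0 κ) {I : ℝ → ℝ} (ho : Opt θ0 α c I θ u)
    (hI : ∀ y ≥ 0, I y = exp (-κ * zf (fun ζ => u ζ / sin (θ ζ)) y)) :
    ∃ f b g T s, Fixed θ0 α c M T0 κ f b g θ u T s ∧ ∀ y ≥ 0, I y = If α c κ f b y := by
  obtain ⟨f, T, h, hN, hIf⟩ := exists_density hC.P hC.hs ho hI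
  set b := -(κ * Jf α c f (Zb α c)) with hb
  have hn := h.next
  have hc := h.fn_continuousOn
  have h1 := h.fn_eq
  have hbn : bn θ0 α c κ f b θ u T = -(κ * Jf α c (fn θ0 α c κ f b θ u T) (Zb α c)) := rfl
  set f1 := fn θ0 α c κ f b θ u T
  have hJ : Jf α c f = Jf α c f1 := Jf_congr_ae (by
    filter_upwards [hN, h1] with ζ e1 e2
    rw [← e1, e2])
  rw [hbn, ← hJ, ← hb] at hn
  have hE : If α c κ f b = If α c κ f1 b := by
    ext y; rw [If, If, hJ]
  have h' : Tr θ0 α c κ f1 b θ u T := ⟨h.P, h.hs, hn, hE ▸ h.ho, hE ▸ h.hL⟩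
  obtain ⟨s, hst⟩ := h'.exists_step hc
  have h2 := h'.fn_eq
  have hc2 := h'.fn_continuousOn
  have hbn2 : bn θ0 α c κ f1 b θ u T = -(κ * Jf α c (fn θ0 α c κ f1 b θ u T) (Zb α c)) := rfl
  set f2 := fn θ0 α c κ f1 b θ u T
  have h12 : ∀ᵐ ζ ∂(volume.restrict (Ioi 0)), f2 ζ / √ζ = f1 ζ / √ζ := by
    filter_upwards [h1, h2] with ζ e1 e2
    rw [← e1, e2]
  rw [hbn2, Jf_congr_ae h12, ← hJ, ← hb] at hst
  have heq : ∀ ζ > 0, f2 ζ = f1 ζ := by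
    refine Measure.eqOn_open_of_ae_eq (μ := volume) ?_ isOpen_Ioi hc2 hc
    filter_upwards [h12, ae_restrict_mem measurableSet_Ioi] with ζ e hζ
    exact (div_left_inj' (sqrt_pos.2 hζ).ne').1 e
  refine ⟨f1, b, f2, T, s, ⟨⟨hn, hc, fun ζ hζ ζ' hζ' => ?_⟩, hst, heq⟩, fun y hy => ?_⟩
  · rw [← heq ζ hζ.1, ← heq ζ' hζ'.1]
    exact (hst.gd hC).lip ζ hζ ζ' hζ'
  · rw [← hE]; exact hIf y hy

lemma Sol.t_injOn {b' : ℝ} (h : Sol θ0 α c κ f b g b' s) : InjOn s.t (Ioi 0) := by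
  refine (strictAntiOn_of_deriv_neg (convex_Ioi 0)
    (fun x hx => (h.t_deriv x hx).continuousAt.continuousWithinAt) fun x hx => ?_).injOn
  rw [interior_Ioi] at hx
  rw [(h.t_deriv x hx).deriv, neg_lt_zero]
  exact h.τ_pos hx

/-- Competitive equilibria coincide. -/
lemma Fixed.unique (hG : Good θ0 α c M T0 κ) {f1 g1 θ1 u1 f2 g2 θ2 u2 : ℝ → ℝ}
    {b1 T1 b2 T2 : ℝ} {s1 s2 : Path} (h1 : Fixed θ0 α c M T0 κ f1 b1 g1 θ1 u1 T1 s1)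
    (h2 : Fixed θ0 α c M T0 κ f2 b2 g2 θ2 u2 T2 s2) :
    If α c κ f1 b1 = If α c κ f2 b2 ∧
      (∀ᵐ t ∂(volume.restrict (Ioi (0 : ℝ))), u1 t = u2 t) ∧
      ∀ᵐ t ∂(volume.restrict (Ioi (0 : ℝ))), 0 < u2 t → θ1 t = θ2 t := by
  obtain ⟨hT, hx, hb, -, hg⟩ := hG.eq_of_cl_zero h1.gd h1.step.sol h2.step.sol
    (hG.unique h1.gd h1.step.sol h2.step.sol h1.eq h2.eq)
  have hTT : T1 = T2 := h1.step.T_eq.symm.trans (hT.trans h2.step.T_eq)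
  subst hTT hb
  have hIf : If α c κ f1 b1 = If α c κ f2 b1 :=
    If_congr (fun ζ hζ => by rw [← h1.eq ζ hζ, hg ζ hζ, h2.eq ζ hζ]) b1
  have hin : ∀ᵐ t ∂(volume.restrict (Ioo 0 T1)), u1 t = u2 t ∧ θ1 t = θ2 t := by
    filter_upwards [h1.step.tr.u_eq, h2.step.tr.u_eq, h1.step.tr.angle, h2.step.tr.angle,
      ae_restrict_mem measurableSet_Ioo] with t e1 e2 a1 a2 ht
    obtain ⟨x1, p1, t1, r1, X1, -⟩ := h1.step.link t ht
    obtain ⟨x2, p2, t2, r2, X2, -⟩ := h2.step.link t ht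
    have hxx : x1 = x2 := h1.step.sol.t_injOn p1 p2 (by rw [t1, (hx x2 p2).1, t2])
    subst hxx
    have hr := r1.symm.trans ((hx x1 p1).2.2.trans r2)
    constructor
    · rw [e1, e2, a1.2, a2.2, ← X1, ← X2, hr]
    · have m : ∀ {θ}, θ ∈ Icc θ0 (π / 2) → θ ∈ Icc (-(π / 2)) (π / 2) := fun h =>
        ⟨by linarith [h.1, hG.ctx.P.pos, pi_pos], h.2⟩
      exact injOn_sin (m (h1.step.tr.ho.1.2.2.1 t)) (m (h2.step.tr.ho.1.2.2.1 t))
        (by rw [a1.1, a2.1, hr])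
  rw [← Ioc_union_Ioi_eq_Ioi h1.step.tr.hL.pos.le]
  simp only [ae_restrict_union_iff]
  rw [← restrict_Ioo_eq_restrict_Ioc]
  refine ⟨hIf, ⟨hin.mono fun t h => h.1, ?_⟩, hin.mono fun t h _ => h.2, ?_⟩
  · filter_upwards [h1.step.tr.hL.u_zero, h2.step.tr.hL.u_zero] with t e1 e2
    rw [e1, e2]
  · filter_upwards [h2.step.tr.hL.u_zero] with t e2 h
    exact absurd e2 h.ne'

lemma Good.exists_unique_equilibrium {ρ0 : ℝ} (hG : Good θ0 α c M T0 (ρ0 / cos θ0)) :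
    ∃ Istar θs us : ℝ → ℝ, Equilibrium θ0 α c ρ0 Istar θs us ∧
      ∀ Istar' θs' us' : ℝ → ℝ, Equilibrium θ0 α c ρ0 Istar' θs' us' →
        (∀ y ≥ (0 : ℝ), Istar' y = Istar y) ∧
        (∀ᵐ t ∂(volume.restrict (Ioi (0 : ℝ))), us' t = us t) ∧
        (∀ᵐ t ∂(volume.restrict (Ioi (0 : ℝ))), 0 < us t → θs' t = θs t) := by
  obtain ⟨f, b, g, θ, u, T, s, h1, h2, h3⟩ := hG.exists_fixed
  have hF : Fixed θ0 α c M T0 (ρ0 / cos θ0) f b g θ u T s := ⟨h1, h2, h3⟩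
  refine ⟨_, θ, u, hF.equilibrium, fun I' θ' u' h' => ?_⟩
  obtain ⟨f', b', g', T', s', hF', hI'⟩ :=
    exists_fixed_of_opt hG.ctx ⟨h'.1, h'.2.1⟩ h'.2.2
  obtain ⟨e1, e2, e3⟩ := Fixed.unique hG hF' hF
  exact ⟨fun y hy => by rw [hI' y hy, e1], e2, e3⟩

end
end Model2

/-- For all sufficiently small stem densities `ρ0 > 0` there exists a unique competitive
equilibrium `(I*, θ*, u*)` (the intensity is unique on `[0,∞)`, the leaf density is
a.e. unique, and the angle is a.e. unique where the leaf density is positive). -/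
theorem model2_equilibrium_exists_unique (θ0 α c : ℝ) (hθ0 : θ0 ∈ Set.Ioo 0 (π / 2))
    (hα : α ∈ Set.Ioo (0 : ℝ) 1) (hc : 0 < c) :
    ∃ ρbar > (0 : ℝ), ∀ ρ0 : ℝ, 0 < ρ0 → ρ0 ≤ ρbar →
      ∃ Istar θs us : ℝ → ℝ,
        Equilibrium θ0 α c ρ0 Istar θs us ∧
        ∀ Istar' θs' us' : ℝ → ℝ, Equilibrium θ0 α c ρ0 Istar' θs' us' →
          (∀ y ≥ (0 : ℝ), Istar' y = Istar y) ∧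
          (∀ᵐ t ∂(volume.restrict (Set.Ioi (0 : ℝ))), us' t = us t) ∧
          (∀ᵐ t ∂(volume.restrict (Set.Ioi (0 : ℝ))), 0 < us t → θs' t = θs t) := by
  have P : Model2.Params θ0 α c := ⟨hθ0.1, hθ0.2, hα.1, hα.2, hc⟩
  have hcos := P.cos_pos
  obtain ⟨M, T0, h⟩ := Model2.exists_good P
  obtain ⟨κ, hκ, hG⟩ := (mem_nhdsGT_iff_exists_Ioc_subset).1 h
  refine ⟨κ * Real.cos θ0, mul_pos hκ hcos, fun ρ0 hρ hle => ?_⟩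
  exact Model2.Good.exists_unique_equilibrium (hG ⟨div_pos hρ hcos, (div_le_iff₀ hcos).2 hle⟩)
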